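/- Let p₁, …, p_n be distinct rational primes and for each i let F_i be a quadratic étale ℚ_{p_i}-algebra (i.e. F_i is isomorphic either to ℚ_{p_i} × ℚ_{p_i} or to a quadratic field extension of ℚ_{p_i}), with F₁ = ℚ_{p₁} × ℚ_{p₁}. Let S⁺ be the set of imaginary quadratic subfields K of ℂ (degree 2 over ℚ with K ⊄ ℝ) such that K ⊗_ℚ ℚ_{p_i} ≅ F_i as ℚ_{p_i}-algebras for all i. For K ∈ S⁺, the prime p₁ splits into two distinct primes w₁ ≠ w₂ of O_K; let c_K ∈ Cl(O_K) be the class of w₁ · w₂^{-1} (for either labeling—the count below is independent of it). Fix a ∈ ℤ/3ℤ. Then lim_{X→∞} [∑_{K ∈ S⁺, |Disc(K)| < X} #{φ ∈ Sur(Cl(O_K), ℤ/3ℤ) : φ(c_K) = a}] / [#{K ∈ S⁺ : |Disc(K)| < X}] = 1/3. -/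

import Mathlib

/-!
Theorem `T:iDH2` (imaginary case): among imaginary quadratic fields with prescribed
completions at finitely many primes, the first of which is split, the average number of
surjections `Cl(O_K) → ℤ/3ℤ` sending the class of `w₁ w₂⁻¹` (for `w₁, w₂` the primes above
the split prime `p₁`) to a fixed `a ∈ ℤ/3ℤ` is `1/3`.
-/

open scoped Classical TensorProduct nonZeroDivisors

/-- The absolute discriminant of a quadratic (more generally, finite-dimensional) subfield
of `ℂ`. -/
noncomputable def absDisc (K : IntermediateField ℚ ℂ) : ℤ :=
  if h : FiniteDimensional ℚ K then
    haveI := h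
    haveI : NumberField K := ⟨⟩
    NumberField.discr K
  else 0

/-- The class in the class group of a nonzero ideal of a Dedekind domain. -/
noncomputable def idealClass (R : Type*) [CommRing R] [IsDomain R] (I : (Ideal R)⁰) :
    ClassGroup R :=
  if h : IsDedekindDomain R then
    haveI := h
    ClassGroup.mk0 I
  else 1

/-- `#{φ ∈ Sur(Cl(O_K), ℤ/3ℤ) : φ([w₁ w₂⁻¹]) = a}`, where `w₁ ≠ w₂` are the primes of `O_K`
above the split prime `v`.  It is counted via ordered pairs `(w₁, w₂)` of distinct primes
above `v` and divided by `2`; since negation is an automorphism of `ℤ/3ℤ`, this count does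
not depend on the ordering of `w₁, w₂`. -/
noncomputable def pointedSurCount (K : IntermediateField ℚ ℂ) (v : ℕ) (a : ZMod 3) : ℝ :=
  (Nat.card {x : (Ideal (NumberField.RingOfIntegers K))⁰ ×
        (Ideal (NumberField.RingOfIntegers K))⁰ ×
        (ClassGroup (NumberField.RingOfIntegers K) →* Multiplicative (ZMod 3)) //
      (x.1 : Ideal (NumberField.RingOfIntegers K)).IsPrime ∧
      (x.2.1 : Ideal (NumberField.RingOfIntegers K)).IsPrime ∧
      (x.1 : Ideal (NumberField.RingOfIntegers K)) ≠ (x.2.1 : Ideal _) ∧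
      Ideal.comap (algebraMap ℤ (NumberField.RingOfIntegers K)) x.1
        = Ideal.span {(v : ℤ)} ∧
      Ideal.comap (algebraMap ℤ (NumberField.RingOfIntegers K)) x.2.1
        = Ideal.span {(v : ℤ)} ∧
      Function.Surjective x.2.2 ∧
      x.2.2 (idealClass _ x.1 * (idealClass _ x.2.1)⁻¹) = Multiplicative.ofAdd a} : ℝ) / 2

/-- Membership in `S⁺`: `K` is an imaginary quadratic subfield of `ℂ` with
`K ⊗_ℚ ℚ_{p_i} ≅ F_i` for all `i`. -/
def InSPlus (n : ℕ) (p : Fin (n + 1) → ℕ) [∀ i, Fact (p i).Prime]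
    (F : Fin (n + 1) → Type) [∀ i, CommRing (F i)] [∀ i, Algebra ℚ_[p i] (F i)]
    (K : IntermediateField ℚ ℂ) : Prop :=
  Module.finrank ℚ K = 2 ∧ (∃ z : ℂ, z ∈ K ∧ z.im ≠ 0) ∧
    ∀ i, Nonempty ((ℚ_[p i] ⊗[ℚ] K) ≃ₐ[ℚ_[p i]] F i)


/-! ### Binary cubic forms with triplicate middle coefficients and their Hessians -/
namespace PTM

/-- The cubic form `a X³ + 3 b X² Y + 3 c X Y² + d Y³` is encoded as `![a, b, c, d]`. -/
abbrev V (R : Type*) := Fin 4 → R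

section
variable {R S : Type*} [CommRing R] [CommRing S]

def hA (f : V R) : R := f 1 ^ 2 - f 0 * f 2
def hB (f : V R) : R := f 1 * f 2 - f 0 * f 3
def hC (f : V R) : R := f 2 ^ 2 - f 1 * f 3
def hD (f : V R) : R := hB f ^ 2 - 4 * hA f * hC f

/-- base change of forms -/
def fmap (φ : R →+* S) (f : V R) : V S := fun i => φ (f i)

@[simp] lemma fmap_apply (φ : R →+* S) (f : V R) (i : Fin 4) : fmap φ f i = φ (f i) := rfl
@[simp] lemma hA_fmap (φ : R →+* S) (f : V R) : hA (fmap φ f) = φ (hA f) := by simp [hA]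
@[simp] lemma hB_fmap (φ : R →+* S) (f : V R) : hB (fmap φ f) = φ (hB f) := by simp [hB]
@[simp] lemma hC_fmap (φ : R →+* S) (f : V R) : hC (fmap φ f) = φ (hC f) := by simp [hC]
@[simp] lemma hD_fmap (φ : R →+* S) (f : V R) : hD (fmap φ f) = φ (hD f) := by simp [hD, map_ofNat φ 4]

lemma syz1 (f : V R) : f 0 * hC f - f 1 * hB f + f 2 * hA f = 0 := by simp [hA, hB, hC]; ring
lemma syz2 (f : V R) : f 1 * hC f - f 2 * hB f + f 3 * hA f = 0 := by simp [hA, hB, hC]; ring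

/-- Substitution `X ↦ x X + s Y`, `Y ↦ y X + w Y`. -/
def act (x s y w : R) (f : V R) : V R :=
  ![f 0 * x ^ 3 + 3 * f 1 * x ^ 2 * y + 3 * f 2 * x * y ^ 2 + f 3 * y ^ 3,
    f 0 * x ^ 2 * s + f 1 * (x ^ 2 * w + 2 * x * y * s) + f 2 * (2 * x * y * w + y ^ 2 * s)
      + f 3 * y ^ 2 * w,
    f 0 * x * s ^ 2 + f 1 * (2 * x * s * w + y * s ^ 2) + f 2 * (x * w ^ 2 + 2 * y * s * w)
      + f 3 * y * w ^ 2,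
    f 0 * s ^ 3 + 3 * f 1 * s ^ 2 * w + 3 * f 2 * s * w ^ 2 + f 3 * w ^ 3]

lemma hA_act (x s y w : R) (f : V R) : hA (act x s y w f) =
    (x * w - s * y) ^ 2 * (hA f * x ^ 2 + hB f * x * y + hC f * y ^ 2) := by
  simp [hA, hB, hC, act]; ring
lemma hB_act (x s y w : R) (f : V R) : hB (act x s y w f) =
    (x * w - s * y) ^ 2 * (2 * hA f * x * s + hB f * (x * w + s * y) + 2 * hC f * y * w) := by
  simp [hA, hB, hC, act]; ring
lemma hC_act (x s y w : R) (f : V R) : hC (act x s y w f) =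
    (x * w - s * y) ^ 2 * (hA f * s ^ 2 + hB f * s * w + hC f * w ^ 2) := by
  simp [hA, hB, hC, act]; ring
lemma hD_act (x s y w : R) (f : V R) : hD (act x s y w f) = (x * w - s * y) ^ 6 * hD f := by
  simp only [hD, hA_act, hB_act, hC_act]; ring

lemma act_act (x s y w x' s' y' w' : R) (f : V R) :
    act x' s' y' w' (act x s y w f) =
      act (x * x' + s * y') (x * s' + s * w') (y * x' + w * y') (y * s' + w * w') f := by
  funext i; fin_cases i <;> simp [act] <;> ring

lemma act_one (f : V R) : act 1 0 0 1 f = f := by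
  funext i; fin_cases i <;> simp [act]

lemma hD_expand (f : V R) : hD f = f 0 ^ 2 * f 3 ^ 2 - 6 * f 0 * f 1 * f 2 * f 3 + 4 * f 0 * f 2 ^ 3
    + 4 * f 1 ^ 3 * f 3 - 3 * f 1 ^ 2 * f 2 ^ 2 := by
  simp [hD, hA, hB, hC]; ring
end

section
variable {R : Type*} [CommRing R] [LinearOrder R]
/-- Closed reducedness of the Hessian. -/
def redC (f : V R) : Prop := 0 < hA f ∧ |hB f| ≤ hA f ∧ hA f ≤ hC f
/-- Strict reducedness of the Hessian. -/
def redO (f : V R) : Prop := 0 < hA f ∧ |hB f| < hA f ∧ hA f < hC f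
lemma redO.redC {f : V R} (h : redO f) : redC f := ⟨h.1, h.2.1.le, h.2.2.le⟩
end

end PTM


/-! ### The real parametrization and the volume of the reduced region -/
namespace PTM
open MeasureTheory Set ENNReal

/-- `(x,y,u,v) ↦ Re ((u+iv)(X+(x+iy)Y)³)` -/
def Phi (w : V ℝ) : V ℝ :=
  ![w 2, w 2 * w 0 - w 3 * w 1, w 2 * (w 0 ^ 2 - w 1 ^ 2) - 2 * w 0 * w 1 * w 3,
    w 2 * (w 0 ^ 3 - 3 * w 0 * w 1 ^ 2) - w 3 * (3 * w 0 ^ 2 * w 1 - w 1 ^ 3)]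

lemma hA_Phi (w : V ℝ) : hA (Phi w) = (w 2 ^ 2 + w 3 ^ 2) * w 1 ^ 2 := by
  simp [hA, Phi]; ring
lemma hB_Phi (w : V ℝ) : hB (Phi w) = 2 * w 0 * ((w 2 ^ 2 + w 3 ^ 2) * w 1 ^ 2) := by
  simp [hB, Phi]; ring
lemma hC_Phi (w : V ℝ) : hC (Phi w) = (w 0 ^ 2 + w 1 ^ 2) * ((w 2 ^ 2 + w 3 ^ 2) * w 1 ^ 2) := by
  simp [hC, Phi]; ring
lemma hD_Phi (w : V ℝ) : hD (Phi w) = - (4 * (w 2 ^ 2 + w 3 ^ 2) ^ 2 * w 1 ^ 6) := by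
  simp only [hD, hA_Phi, hB_Phi, hC_Phi]; ring

/-- the Jacobian matrix -/
def PhiJ (w : V ℝ) : Matrix (Fin 4) (Fin 4) ℝ :=
  !![0, 0, 1, 0;
     w 2, -w 3, w 0, -w 1;
     2 * w 0 * w 2 - 2 * w 1 * w 3, -2 * w 1 * w 2 - 2 * w 0 * w 3, w 0 ^ 2 - w 1 ^ 2, -2 * w 0 * w 1;
     w 2 * (3 * w 0 ^ 2 - 3 * w 1 ^ 2) - 6 * w 0 * w 1 * w 3,
       -6 * w 0 * w 1 * w 2 - w 3 * (3 * w 0 ^ 2 - 3 * w 1 ^ 2),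
       w 0 ^ 3 - 3 * w 0 * w 1 ^ 2, -(3 * w 0 ^ 2 * w 1 - w 1 ^ 3)]

lemma PhiJ_det (w : V ℝ) : (PhiJ w).det = 4 * (w 2 ^ 2 + w 3 ^ 2) * w 1 ^ 4 := by
  simp [PhiJ, Matrix.det_succ_row_zero, Fin.sum_univ_succ, Fin.succAbove]
  ring

noncomputable def PhiD (w : V ℝ) : V ℝ →L[ℝ] V ℝ := LinearMap.toContinuousLinearMap (Matrix.toLin' (PhiJ w))

lemma PhiD_det (w : V ℝ) : (PhiD w).det = 4 * (w 2 ^ 2 + w 3 ^ 2) * w 1 ^ 4 := by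
  rw [← PhiJ_det, ContinuousLinearMap.det, PhiD, LinearMap.coe_toContinuousLinearMap,
    LinearMap.det_toLin']

lemma hasFDerivAt_coord (w : V ℝ) (i : Fin 4) :
    HasFDerivAt (fun w : V ℝ => w i) (ContinuousLinearMap.proj i : V ℝ →L[ℝ] ℝ) w :=
  (ContinuousLinearMap.proj i : V ℝ →L[ℝ] ℝ).hasFDerivAt

lemma Phi_hasFDerivAt (w : V ℝ) : HasFDerivAt Phi (PhiD w) w := by
  have h := hasFDerivAt_coord w
  rw [hasFDerivAt_pi']
  intro i
  fin_cases i
  · refine (h 2).congr_fderiv ?_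
    ext j; simp [PhiD, PhiJ, Matrix.toLin'_apply, dotProduct, Fin.sum_univ_succ]
  · refine (((h 2).mul (h 0)).sub ((h 3).mul (h 1))).congr_fderiv ?_
    ext j; simp [PhiD, PhiJ, Matrix.toLin'_apply, dotProduct, Fin.sum_univ_succ]
    ring
  · refine (((h 2).mul (((h 0).pow 2).sub ((h 1).pow 2))).sub
      ((((h 0).const_mul 2).mul (h 1)).mul (h 3))).congr_fderiv ?_
    ext j; simp [PhiD, PhiJ, Matrix.toLin'_apply, dotProduct, Fin.sum_univ_succ]
    ring
  · refine (((h 2).mul (((h 0).pow 3).sub (((h 0).const_mul 3).mul ((h 1).pow 2)))).sub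
      ((h 3).mul (((((h 0).pow 2).const_mul 3).mul (h 1)).sub ((h 1).pow 3)))).congr_fderiv ?_
    ext j; simp [PhiD, PhiJ, Matrix.toLin'_apply, dotProduct, Fin.sum_univ_succ]
    ring

lemma Phi_injOn : InjOn Phi {w | 0 < w 1 ∧ 0 < w 2 ^ 2 + w 3 ^ 2} := by
  intro w hw w' hw' h
  have hA' := congrArg hA h
  have hB' := congrArg hB h
  have hC' := congrArg hC h
  simp only [hA_Phi, hB_Phi, hC_Phi] at hA' hB' hC'
  have hpos : 0 < (w 2 ^ 2 + w 3 ^ 2) * w 1 ^ 2 := mul_pos hw.2 (pow_pos hw.1 2)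
  have hx : w 0 = w' 0 := by
    rw [← hA'] at hB'
    have := mul_right_cancel₀ hpos.ne' hB'
    linarith
  have hy : w 1 = w' 1 := by
    rw [← hA'] at hC'
    have := mul_right_cancel₀ hpos.ne' hC'
    rw [hx] at this
    have h2 : w 1 ^ 2 = w' 1 ^ 2 := by linarith
    exact (pow_left_inj₀ hw.1.le hw'.1.le (by norm_num)).1 h2
  have h0 := congrFun h 0
  have h1 := congrFun h 1
  simp [Phi] at h0 h1
  have hv : w 3 = w' 3 := by
    rw [h0, hx, ← hy] at h1
    have : w 3 * w 1 = w' 3 * w 1 := by linarith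
    exact mul_right_cancel₀ hw.1.ne' this
  funext i; fin_cases i <;> assumption

/-- Real forms with positive definite Hessian come from the parametrization. -/
lemma exists_Phi (f : V ℝ) (hAf : 0 < hA f) (hDf : hD f < 0) :
    ∃ w : V ℝ, 0 < w 1 ∧ Phi w = f := by
  set y := Real.sqrt (- hD f) / (2 * hA f) with hy
  set x := hB f / (2 * hA f) with hx
  have hypos : 0 < y := by
    have : 0 < Real.sqrt (- hD f) := Real.sqrt_pos.2 (by linarith)
    positivity
  have hsq : y ^ 2 * (4 * hA f ^ 2) = - hD f := by
    rw [hy, div_pow, Real.sq_sqrt (by linarith)]; field_simp; ring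
  have hxA : 2 * x * hA f = hB f := by rw [hx]; field_simp
  have hn : (x ^ 2 + y ^ 2) * hA f = hC f := by
    have h4 : (4 * hA f) ≠ 0 := by positivity
    apply mul_left_cancel₀ h4
    have : hD f = hB f ^ 2 - 4 * hA f * hC f := rfl
    linear_combination hsq + (-1:ℝ) * this + (2 * x * hA f + hB f) * hxA
  refine ⟨![x, y, f 0, (f 0 * x - f 1) / y], by simpa using hypos, ?_⟩
  have e1 := syz1 f
  have e2 := syz2 f
  have hc : f 2 = 2 * x * f 1 - (x ^ 2 + y ^ 2) * f 0 := by
    apply mul_right_cancel₀ hAf.ne'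
    linear_combination e1 - f 1 * hxA + f 0 * hn
  have hd : f 3 = 2 * x * f 2 - (x ^ 2 + y ^ 2) * f 1 := by
    apply mul_right_cancel₀ hAf.ne'
    linear_combination e2 - f 2 * hxA + f 1 * hn
  have hy0 := hypos.ne'
  funext i; fin_cases i
  · simp [Phi]
  · simp [Phi]; field_simp; ring
  · simp [Phi]; rw [hc]; field_simp; ring
  · simp [Phi]; rw [hd, hc]; field_simp; ring

end PTM


/-! ### The integral computing the volume of the reduced region -/
namespace PTM
open MeasureTheory Set ENNReal

lemma lintegral_fin_four (g : V ℝ → ℝ≥0∞) (hg : Measurable g) :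
    ∫⁻ w, g w = ∫⁻ x, ∫⁻ y, ∫⁻ p : ℝ × ℝ, g ![x, y, p.1, p.2] := by
  have e1 := (volume_preserving_piFinSuccAbove (fun _ : Fin 4 => ℝ) 0).symm
  rw [← e1.lintegral_comp_emb (MeasurableEquiv.measurableEmbedding _) g, Measure.volume_eq_prod,
    lintegral_prod _ (by fun_prop)]
  congr 1; funext x
  have e2 := (volume_preserving_piFinSuccAbove (fun _ : Fin 3 => ℝ) 0).symm
  rw [← e2.lintegral_comp_emb (MeasurableEquiv.measurableEmbedding _), Measure.volume_eq_prod,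
    lintegral_prod _ (by fun_prop)]
  congr 1; funext y
  have e3 := (volume_preserving_finTwoArrow ℝ).symm
  rw [← e3.lintegral_comp_emb (MeasurableEquiv.measurableEmbedding _)]
  congr 1; funext p
  congr 1; funext i; fin_cases i <;> rfl

lemma lintegral_Ioo_pow (ρ K : ℝ) (hρ : 0 ≤ ρ) (hK : 0 ≤ K) :
    ∫⁻ r in Ioo 0 ρ, ENNReal.ofReal (K * r ^ 3) = ENNReal.ofReal (K * ρ ^ 4 / 4) := by
  rw [← ofReal_integral_eq_lintegral_ofReal]
  · congr 1
    rw [← integral_Ioc_eq_integral_Ioo, ← intervalIntegral.integral_of_le hρ,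
      intervalIntegral.integral_const_mul, integral_pow]
    norm_num; ring
  · refine (Continuous.integrableOn_Icc (a := 0) (b := ρ) (by fun_prop)).mono_set Ioo_subset_Icc_self
  · filter_upwards [ae_restrict_mem measurableSet_Ioo] with r hr
    have := hr.1.le
    positivity

/-- inner integral -/
lemma disc_integral (P : ℝ → Prop) (y : ℝ) (hy : 0 < y)
    (h1 : ∀ r, 0 < r → 4 * (r ^ 2) ^ 2 * y ^ 6 < 1 → P (r ^ 2))
    (h2 : ∀ r, 0 < r → P (r ^ 2) → 4 * (r ^ 2) ^ 2 * y ^ 6 ≤ 1) :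
    ∫⁻ p : ℝ × ℝ, (if P (p.1 ^ 2 + p.2 ^ 2) then
      ENNReal.ofReal (4 * (p.1 ^ 2 + p.2 ^ 2) * y ^ 4) else 0)
      = ENNReal.ofReal (Real.pi / 2 * y ^ (-2 : ℝ)) := by
  set ρ : ℝ := (1 / (4 * y ^ 6)) ^ (1 / 4 : ℝ) with hρ
  have hρ0 : 0 < ρ := by positivity
  have hρ4 : ρ ^ 4 = 1 / (4 * y ^ 6) := by
    rw [hρ, ← Real.rpow_natCast, ← Real.rpow_mul (by positivity)]; norm_num
  have key : ∀ r : ℝ, 4 * (r ^ 2) ^ 2 * y ^ 6 = (r ^ 4) / ρ ^ 4 := by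
    intro r; rw [hρ4]; field_simp
  have hlt : ∀ r : ℝ, 0 < r → r < ρ → P (r ^ 2) := by
    intro r hr h
    apply h1 r hr
    rw [key, div_lt_one (by positivity)]
    exact pow_lt_pow_left₀ h hr.le (by norm_num)
  have hgt : ∀ r : ℝ, 0 < r → P (r ^ 2) → r ≤ ρ := by
    intro r hr h
    have := h2 r hr h
    rw [key, div_le_one (by positivity)] at this
    exact (pow_le_pow_iff_left₀ hr.le hρ0.le (by norm_num)).1 this
  rw [← lintegral_comp_polarCoord_symm]
  have : ∀ p : ℝ × ℝ, (polarCoord.symm p).1 ^ 2 + (polarCoord.symm p).2 ^ 2 = p.1 ^ 2 := by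
    intro p
    simp only [polarCoord_symm_apply]
    linear_combination (p.1 ^ 2) * Real.sin_sq_add_cos_sq p.2
  simp only [this, polarCoord_target]
  have step : ∫⁻ p in Ioi (0:ℝ) ×ˢ Ioo (-Real.pi) Real.pi, ENNReal.ofReal p.1 •
      (if P (p.1 ^ 2) then ENNReal.ofReal (4 * p.1 ^ 2 * y ^ 4) else 0)
      = ∫⁻ p in (Ioo (0:ℝ) ρ) ×ˢ Ioo (-Real.pi) Real.pi, ENNReal.ofReal (4 * y ^ 4 * p.1 ^ 3) := by
    rw [← lintegral_indicator (measurableSet_Ioi.prod measurableSet_Ioo),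
      ← lintegral_indicator (measurableSet_Ioo.prod measurableSet_Ioo)]
    apply lintegral_congr_ae
    have hne : ∀ᵐ p : ℝ × ℝ, p.1 ≠ ρ := by
      have : ∀ᵐ x : ℝ, x ≠ ρ := by
        simp [ae_iff]
      exact (Measure.quasiMeasurePreserving_fst).ae this
    filter_upwards [hne] with p hp
    by_cases hp2 : p.2 ∈ Ioo (-Real.pi) Real.pi
    swap
    · simp only [indicator, mem_prod, hp2, and_false, if_false]
    by_cases hp1 : 0 < p.1
    swap
    · simp only [indicator, mem_prod, mem_Ioi, mem_Ioo, hp1, false_and, if_false]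
    rcases lt_or_gt_of_ne hp with h | h
    · simp only [indicator, mem_prod, mem_Ioi, hp1, hp2, true_and, and_true, if_true, mem_Ioo, h,
        hlt _ hp1 h, smul_eq_mul]
      rw [← ENNReal.ofReal_mul hp1.le]; congr 1; ring
    · have : ¬ P (p.1 ^ 2) := fun hh => absurd (hgt _ hp1 hh) (not_le.2 h)
      simp [indicator, this, h.le]
  rw [step, Measure.volume_eq_prod, ← Measure.prod_restrict, lintegral_prod _ (by fun_prop)]
  simp only [lintegral_const, Measure.restrict_apply MeasurableSet.univ, univ_inter, Real.volume_Ioo]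
  rw [lintegral_mul_const _ (by fun_prop), lintegral_Ioo_pow _ _ hρ0.le (by positivity),
    ← ENNReal.ofReal_mul (by positivity), hρ4]
  congr 1
  rw [Real.rpow_neg hy.le]
  norm_num
  field_simp
  ring

lemma mid_integral (x : ℝ) (hx : |x| ≤ 1 / 2) (s : Set ℝ) (hs : s =ᵐ[volume] Ioi (Real.sqrt (1 - x ^ 2))) :
    ∫⁻ y in s, ENNReal.ofReal (Real.pi / 2 * y ^ (-2 : ℝ)) =
      ENNReal.ofReal (Real.pi / 2 * (1 / Real.sqrt (1 - x ^ 2))) := by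
  have hx2 : x ^ 2 ≤ 1 / 4 := by
    have := sq_le_sq' (by linarith [abs_nonneg x]) hx
    rw [sq_abs] at this; linarith
  have hc : 0 < Real.sqrt (1 - x ^ 2) := Real.sqrt_pos.2 (by linarith)
  rw [Measure.restrict_congr_set hs, ← ofReal_integral_eq_lintegral_ofReal]
  · rw [integral_const_mul, integral_Ioi_rpow_of_lt (by norm_num) hc]
    norm_num [Real.rpow_neg hc.le]
  · exact (integrableOn_Ioi_rpow_of_lt (by norm_num) hc).const_mul _
  · filter_upwards [ae_restrict_mem measurableSet_Ioi] with y hy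
    have : 0 < y := hc.trans hy
    positivity

lemma outer_integral (s : Set ℝ) (hs : s =ᵐ[volume] Ioc (-(1/2) : ℝ) (1/2)) :
    ∫⁻ x in s, ENNReal.ofReal (Real.pi / 2 * (1 / Real.sqrt (1 - x ^ 2))) =
      ENNReal.ofReal (Real.pi ^ 2 / 6) := by
  have hpos : ∀ x ∈ uIcc (-(1/2) : ℝ) (1/2), 0 < 1 - x ^ 2 := by
    intro x hx
    rw [uIcc_of_le (by norm_num)] at hx
    nlinarith [hx.1, hx.2]
  have hcont : ContinuousOn (fun x : ℝ => 1 / Real.sqrt (1 - x ^ 2)) (uIcc (-(1/2) : ℝ) (1/2)) := by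
    apply ContinuousOn.div continuousOn_const (by fun_prop)
    intro x hx; exact (Real.sqrt_pos.2 (hpos x hx)).ne'
  have hi : IntervalIntegrable (fun x : ℝ => 1 / Real.sqrt (1 - x ^ 2)) volume (-(1/2)) (1/2) :=
    hcont.intervalIntegrable
  rw [Measure.restrict_congr_set hs, ← ofReal_integral_eq_lintegral_ofReal]
  · congr 1
    rw [← intervalIntegral.integral_of_le (by norm_num), intervalIntegral.integral_const_mul,
      intervalIntegral.integral_eq_sub_of_hasDerivAt (f := Real.arcsin) _ hi]
    · have : Real.arcsin (1/2) = Real.pi / 6 := by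
        rw [← Real.sin_pi_div_six, Real.arcsin_sin] <;> linarith [Real.pi_pos]
      rw [Real.arcsin_neg, this]; ring
    · intro x hx
      have := hpos x hx
      apply Real.hasDerivAt_arcsin <;> intro h <;> rw [h] at this <;> norm_num at this
  · exact (hi.const_mul (Real.pi / 2)).1
  · filter_upwards with y
    positivity

def WC : Set (V ℝ) := {w | |w 0| ≤ 1 / 2 ∧ 1 ≤ w 0 ^ 2 + w 1 ^ 2 ∧ 0 < w 1 ∧
  4 * (w 2 ^ 2 + w 3 ^ 2) ^ 2 * w 1 ^ 6 ≤ 1}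
def WO : Set (V ℝ) := {w | |w 0| < 1 / 2 ∧ 1 < w 0 ^ 2 + w 1 ^ 2 ∧ 0 < w 1 ∧
  0 < w 2 ^ 2 + w 3 ^ 2 ∧ 4 * (w 2 ^ 2 + w 3 ^ 2) ^ 2 * w 1 ^ 6 < 1}

lemma measurableSet_WC : MeasurableSet WC := by
  refine MeasurableSet.congr ((measurableSet_le (f := fun w : V ℝ => |w 0|) (g := fun w : V ℝ => 1 / 2) (by fun_prop) (by fun_prop)).inter (
    (measurableSet_le (f := fun w : V ℝ => 1) (g := fun w : V ℝ => w 0 ^ 2 + w 1 ^ 2) (by fun_prop) (by fun_prop)).inter (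
    (measurableSet_lt (f := fun w : V ℝ => 0) (g := fun w : V ℝ => w 1) (by fun_prop) (by fun_prop)).inter
    (measurableSet_le (f := fun w : V ℝ => 4 * (w 2 ^ 2 + w 3 ^ 2) ^ 2 * w 1 ^ 6) (g := fun w : V ℝ => 1) (by fun_prop) (by fun_prop)))))
    (by ext w; rfl)
lemma measurableSet_WO : MeasurableSet WO := by
  refine MeasurableSet.congr ((measurableSet_lt (f := fun w : V ℝ => |w 0|) (g := fun w : V ℝ => 1 / 2) (by fun_prop) (by fun_prop)).inter (
    (measurableSet_lt (f := fun w : V ℝ => 1) (g := fun w : V ℝ => w 0 ^ 2 + w 1 ^ 2) (by fun_prop) (by fun_prop)).inter (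
    (measurableSet_lt (f := fun w : V ℝ => 0) (g := fun w : V ℝ => w 1) (by fun_prop) (by fun_prop)).inter (
    (measurableSet_lt (f := fun w : V ℝ => 0) (g := fun w : V ℝ => w 2 ^ 2 + w 3 ^ 2) (by fun_prop) (by fun_prop)).inter
    (measurableSet_lt (f := fun w : V ℝ => 4 * (w 2 ^ 2 + w 3 ^ 2) ^ 2 * w 1 ^ 6) (g := fun w : V ℝ => 1) (by fun_prop) (by fun_prop))))))
    (by ext w; rfl)

/-- the Jacobian density -/
noncomputable def Jd (w : V ℝ) : ℝ≥0∞ := ENNReal.ofReal (4 * (w 2 ^ 2 + w 3 ^ 2) * w 1 ^ 4)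

lemma measurable_Jd : Measurable Jd := by unfold Jd; fun_prop

lemma integral_general (W : Set (V ℝ)) (hW : MeasurableSet W) (P : ℝ → ℝ → Prop) (S : Set ℝ) (M : ℝ → Set ℝ)
    (hmem : ∀ w, w ∈ W ↔ w 0 ∈ S ∧ w 1 ∈ M (w 0) ∧ P (w 1) (w 2 ^ 2 + w 3 ^ 2))
    (hS : S =ᵐ[volume] Ioc (-(1/2) : ℝ) (1/2)) (hSm : MeasurableSet S) (hS2 : ∀ x ∈ S, |x| ≤ 1 / 2)
    (hM : ∀ x ∈ S, M x =ᵐ[volume] Ioi (Real.sqrt (1 - x ^ 2))) (hMm : ∀ x, MeasurableSet (M x))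
    (hMp : ∀ x y, y ∈ M x → 0 < y)
    (h1 : ∀ y r, 0 < y → 0 < r → 4 * (r ^ 2) ^ 2 * y ^ 6 < 1 → P y (r ^ 2))
    (h2 : ∀ y r, 0 < y → 0 < r → P y (r ^ 2) → 4 * (r ^ 2) ^ 2 * y ^ 6 ≤ 1) :
    ∫⁻ w in W, Jd w = ENNReal.ofReal (Real.pi ^ 2 / 6) := by
  rw [← lintegral_indicator hW, lintegral_fin_four _ (measurable_Jd.indicator hW),
    ← outer_integral S hS, ← lintegral_indicator hSm]
  congr 1; funext x
  by_cases hx : x ∈ S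
  swap
  · have : ∀ (y : ℝ) (p : ℝ × ℝ), (![x, y, p.1, p.2] : V ℝ) ∉ W := by
      intro y p h; exact hx ((hmem _).1 h).1
    simp [this, hx]
  rw [indicator_of_mem hx, ← mid_integral x (hS2 x hx) (M x) (hM x hx), ← lintegral_indicator (hMm x)]
  congr 1; funext y
  by_cases hy : y ∈ M x
  swap
  · have : ∀ (p : ℝ × ℝ), (![x, y, p.1, p.2] : V ℝ) ∉ W := by
      intro p h; exact hy ((hmem _).1 h).2.1
    simp [this, hy]
  have hyp := hMp _ _ hy
  rw [indicator_of_mem hy, ← disc_integral (P y) y hyp (fun r hr => h1 y r hyp hr) (fun r hr => h2 y r hyp hr)]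
  congr 1; funext p
  have : (![x, y, p.1, p.2] : V ℝ) ∈ W ↔ P y (p.1 ^ 2 + p.2 ^ 2) := by
    rw [hmem]; simp [hx, hy]
  simp [indicator, this, Jd]

lemma integral_WC : ∫⁻ w in WC, Jd w = ENNReal.ofReal (Real.pi ^ 2 / 6) := by
  have hset : ∀ x : ℝ, {y : ℝ | 1 ≤ x ^ 2 + y ^ 2 ∧ 0 < y} = if x ^ 2 < 1 then Ici (Real.sqrt (1 - x ^ 2)) else Ioi 0 := by
    intro x; ext y
    split_ifs with h
    · simp only [mem_ofPred_eq, mem_Ici]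
      constructor
      · rintro ⟨h1, h2⟩; rw [Real.sqrt_le_left h2.le]; linarith
      · intro h1
        have h3 : 0 < Real.sqrt (1 - x ^ 2) := Real.sqrt_pos.2 (by linarith)
        have h4 := h3.trans_le h1
        rw [Real.sqrt_le_left h4.le] at h1
        exact ⟨by linarith, h4⟩
    · simp only [mem_ofPred_eq, mem_Ioi, and_iff_right_iff_imp]; intro _; nlinarith
  refine integral_general WC measurableSet_WC (fun y t => 4 * t ^ 2 * y ^ 6 ≤ 1) (Icc (-(1/2)) (1/2))
    (fun x => {y | 1 ≤ x ^ 2 + y ^ 2 ∧ 0 < y}) ?_ Ioc_ae_eq_Icc.symm measurableSet_Icc ?_ ?_ ?_ ?_ ?_ ?_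
  · intro w; simp only [WC, mem_ofPred_eq, mem_Icc, abs_le]; tauto
  · intro x hx; exact abs_le.2 hx
  · intro x hx; simp only [hset]; rw [if_pos (by nlinarith [hx.1, hx.2])]; exact Ioi_ae_eq_Ici.symm
  · intro x; simp only [hset]; split_ifs <;> measurability
  · intro x y h; exact h.2
  · intro y r _ _ h; exact h.le
  · intro y r _ _ h; exact h

lemma integral_WO : ∫⁻ w in WO, Jd w = ENNReal.ofReal (Real.pi ^ 2 / 6) := by
  have hset : ∀ x : ℝ, {y : ℝ | 1 < x ^ 2 + y ^ 2 ∧ 0 < y} = Ioi 0 ∩ {y | 1 < x ^ 2 + y ^ 2} := by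
    intro x; ext y; simp [and_comm]
  refine integral_general WO measurableSet_WO (fun y t => 0 < t ∧ 4 * t ^ 2 * y ^ 6 < 1) (Ioo (-(1/2)) (1/2))
    (fun x => {y | 1 < x ^ 2 + y ^ 2 ∧ 0 < y}) ?_ Ioo_ae_eq_Ioc measurableSet_Ioo ?_ ?_ ?_ ?_ ?_ ?_
  · intro w; simp only [WO, mem_ofPred_eq, mem_Ioo, abs_lt]; tauto
  · intro x hx; exact (abs_lt.2 hx).le
  · intro x hx
    apply Filter.EventuallyEq.of_eq
    have h : x ^ 2 < 1 := by nlinarith [hx.1, hx.2]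
    ext y
    show (1 < x ^ 2 + y ^ 2 ∧ 0 < y) ↔ Real.sqrt (1 - x ^ 2) < y
    constructor
    · rintro ⟨h1, h2⟩; rw [Real.sqrt_lt' h2]; linarith
    · intro h1
      have h3 : 0 < Real.sqrt (1 - x ^ 2) := Real.sqrt_pos.2 (by linarith)
      have h4 := h3.trans h1
      rw [Real.sqrt_lt' h4] at h1
      exact ⟨by linarith, h4⟩
  · intro x; simp only [hset]
    exact measurableSet_Ioi.inter (measurableSet_lt (by fun_prop) (by fun_prop))
  · intro x y h; exact h.2
  · intro y r _ hr h; exact ⟨by positivity, h⟩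
  · intro y r _ _ h; exact h.2.le

end PTM


/-! ### Counting points of a shifted lattice in dilated regions -/
namespace PTM
open MeasureTheory Set ENNReal Filter

/-- Points of the coset `f0 + N ℤ⁴` lying in `t • S`. -/
def latPts (N : ℕ) (f0 : V ℤ) (S : Set (V ℝ)) (t : ℝ) : Set (V ℤ) :=
  {f | (∀ i, (N : ℤ) ∣ f i - f0 i) ∧ (fun i => (f i : ℝ) / t) ∈ S}

def cube (N : ℕ) (t : ℝ) (f : V ℤ) : Set (V ℝ) :=
  Set.pi univ (fun i => Ico ((f i : ℝ) / t) ((f i : ℝ) / t + N / t))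

lemma cube_volume (N : ℕ) (t : ℝ) (ht : 0 < t) (f : V ℤ) : volume (cube N t f) = ENNReal.ofReal ((N / t) ^ 4) := by
  rw [cube, Real.volume_pi_Ico]
  simp only [add_sub_cancel_left, Finset.prod_const, Finset.card_univ, Fintype.card_fin]
  rw [ENNReal.ofReal_pow (by positivity)]

lemma cube_disj (N : ℕ) (hN : 0 < N) (t : ℝ) (ht : 0 < t) (f0 f g : V ℤ) (hf : ∀ i, (N : ℤ) ∣ f i - f0 i)
    (hg : ∀ i, (N : ℤ) ∣ g i - f0 i) (x : V ℝ) (hxf : x ∈ cube N t f) (hxg : x ∈ cube N t g) : f = g := by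
  funext i
  have h1 := hxf i (mem_univ i)
  have h2 := hxg i (mem_univ i)
  simp only [mem_Ico, ← add_div] at h1 h2
  rw [div_le_iff₀ ht, lt_div_iff₀ ht] at h1 h2
  have h3 : (f i : ℝ) < g i + N := by linarith
  have h4 : (g i : ℝ) < f i + N := by linarith
  have h3' : f i < g i + N := by exact_mod_cast h3
  have h4' : g i < f i + N := by exact_mod_cast h4
  have hd : (N : ℤ) ∣ f i - g i := by
    have := dvd_sub (hf i) (hg i)
    simpa using this
  have := Int.eq_zero_of_abs_lt_dvd hd (by rw [abs_lt]; constructor <;> linarith)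
  linarith

lemma latPts_card_le (N : ℕ) (hN : 0 < N) (f0 : V ℤ) (S : Set (V ℝ)) (t : ℝ) (ht : 0 < t)
    (F : Finset (V ℤ)) (hF : (F : Set (V ℤ)) ⊆ latPts N f0 S t) :
    (F.card : ℝ≥0∞) * ENNReal.ofReal ((N / t) ^ 4) ≤ volume (Metric.cthickening (N / t) S) := by
  have hd : (F : Set (V ℤ)).PairwiseDisjoint (cube N t) := by
    intro f hf g hg hne
    refine Set.disjoint_left.2 fun x hxf hxg => hne ?_
    exact cube_disj N hN t ht f0 f g (hF hf).1 (hF hg).1 x hxf hxg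
  have hm : ∀ f ∈ F, MeasurableSet (cube N t f) := fun f _ =>
    MeasurableSet.univ_pi fun i => measurableSet_Ico
  have h1 := measure_biUnion_finset (μ := volume) hd hm
  simp only [cube_volume N t ht, Finset.sum_const, nsmul_eq_mul] at h1
  rw [← h1]
  apply measure_mono
  intro x hx
  simp only [mem_iUnion] at hx
  obtain ⟨f, hf, hx⟩ := hx
  refine Metric.mem_cthickening_of_dist_le x _ _ _ (hF hf).2 ?_
  rw [dist_pi_le_iff (by positivity)]
  intro i
  have h2 := hx i (mem_univ i)
  simp only [mem_Ico] at h2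
  rw [Real.dist_eq, abs_le]
  constructor <;> linarith [h2.1, h2.2, show (0:ℝ) ≤ N / t by positivity]

lemma latPts_finite (N : ℕ) (hN : 0 < N) (f0 : V ℤ) (S : Set (V ℝ)) (hS : Bornology.IsBounded S)
    (t : ℝ) (ht : 0 < t) : (latPts N f0 S t).Finite := by
  have hfin : volume (Metric.cthickening (N / t) S) < ⊤ := (hS.cthickening).measure_lt_top
  by_contra hinf
  obtain ⟨k, hk⟩ : ∃ k : ℕ, volume (Metric.cthickening (N / t) S) < k * ENNReal.ofReal ((N / t) ^ 4) := by
    have h0 : ENNReal.ofReal ((N / t) ^ 4) ≠ 0 := by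
      simp only [ne_eq, ENNReal.ofReal_eq_zero, not_le]; positivity
    obtain ⟨k, hk⟩ := ENNReal.exists_nat_gt (ENNReal.div_lt_top hfin.ne h0).ne
    refine ⟨k, ?_⟩
    rwa [ENNReal.div_lt_iff (Or.inl h0) (Or.inl ofReal_ne_top)] at hk
  obtain ⟨F, hF, hc⟩ := Set.Infinite.exists_subset_card_eq hinf k
  have := latPts_card_le N hN f0 S t ht F hF
  rw [hc] at this
  exact absurd this (not_le.2 hk)

lemma lattice_upper (N : ℕ) (hN : 0 < N) (f0 : V ℤ) (C : Set (V ℝ)) (hC : IsCompact C) (v : ℝ) (hv0 : 0 ≤ v)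
    (hv : volume C ≤ ENNReal.ofReal v) (ε : ℝ) (hε : 0 < ε) :
    ∀ᶠ t : ℝ in atTop, ((latPts N f0 C t).ncard : ℝ) ≤ (v / N ^ 4 + ε) * t ^ 4 := by
  have hNR : (0:ℝ) < N := by exact_mod_cast hN
  have h1 : Tendsto (fun t : ℝ => (N : ℝ) / t) atTop (nhds 0) := tendsto_const_nhds.div_atTop tendsto_id
  have h2 := (tendsto_measure_cthickening_of_isCompact (μ := volume) hC).comp h1
  have h3 : volume C < ENNReal.ofReal (v + ε * N ^ 4) := by
    refine hv.trans_lt ?_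
    rw [ENNReal.ofReal_lt_ofReal_iff (by positivity)]
    have : 0 < ε * (N:ℝ) ^ 4 := by positivity
    linarith
  filter_upwards [h2.eventually_lt_const h3, eventually_gt_atTop 0] with t ht ht0
  have hfin := latPts_finite N hN f0 C hC.isBounded t ht0
  have h4 := latPts_card_le N hN f0 C t ht0 hfin.toFinset (by simp)
  rw [← Set.ncard_eq_toFinset_card _ hfin] at h4
  have h5 := h4.trans ht.le
  rw [← ENNReal.ofReal_natCast, ← ENNReal.ofReal_mul (by positivity),
    ENNReal.ofReal_le_ofReal_iff (by positivity)] at h5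
  have h6 : ((latPts N f0 C t).ncard : ℝ) * (N / t) ^ 4 * (t ^ 4 / N ^ 4) ≤ (v + ε * N ^ 4) * (t ^ 4 / N ^ 4) :=
    mul_le_mul_of_nonneg_right h5 (by positivity)
  calc ((latPts N f0 C t).ncard : ℝ) = ((latPts N f0 C t).ncard : ℝ) * (N / t) ^ 4 * (t ^ 4 / N ^ 4) := by
        field_simp
    _ ≤ _ := h6
    _ = _ := by field_simp

/-- erosion -/
def erode (O : Set (V ℝ)) (ε : ℝ) : Set (V ℝ) := {x | Metric.closedBall x ε ⊆ O}

lemma erode_cover (N : ℕ) (hN : 0 < N) (f0 : V ℤ) (O : Set (V ℝ)) (t : ℝ) (ht : 0 < t) :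
    erode O (N / t) ⊆ ⋃ f ∈ latPts N f0 O t, cube N t f := by
  intro x hx
  have hNR : (0:ℝ) < N := by exact_mod_cast hN
  set f : V ℤ := fun i => f0 i + N * ⌊(x i * t - f0 i) / N⌋ with hf
  have hfx : x ∈ cube N t f := by
    intro i _
    simp only [mem_Ico, ← add_div]
    rw [div_le_iff₀ ht, lt_div_iff₀ ht]
    have h1 := Int.floor_le ((x i * t - f0 i) / N)
    have h2 := Int.lt_floor_add_one ((x i * t - f0 i) / N)
    rw [le_div_iff₀ hNR] at h1
    rw [div_lt_iff₀ hNR] at h2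
    simp only [hf]; push_cast
    constructor <;> linarith
  simp only [mem_iUnion]
  refine ⟨f, ⟨fun i => ⟨⌊(x i * t - f0 i) / N⌋, by simp [hf]⟩, hx ?_⟩, hfx⟩
  rw [Metric.mem_closedBall, dist_pi_le_iff (by positivity)]
  intro i
  have h2 := hfx i (mem_univ i)
  simp only [mem_Ico] at h2
  rw [Real.dist_eq, abs_le]
  constructor <;> linarith [h2.1, h2.2, show (0:ℝ) ≤ N / t by positivity]

lemma lattice_lower (N : ℕ) (hN : 0 < N) (f0 : V ℤ) (O : Set (V ℝ)) (hO : IsOpen O)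
    (hOb : Bornology.IsBounded O) (v : ℝ) (hv0 : 0 ≤ v)
    (hv : ENNReal.ofReal v ≤ volume O) (ε : ℝ) (hε : 0 < ε) :
    ∀ᶠ t : ℝ in atTop, (v / N ^ 4 - ε) * t ^ 4 ≤ ((latPts N f0 O t).ncard : ℝ) := by
  have hNR : (0:ℝ) < N := by exact_mod_cast hN
  rcases le_or_gt (v - ε * N ^ 4) 0 with hneg | hpos
  · filter_upwards [eventually_gt_atTop 0] with t ht
    have : v / N ^ 4 - ε ≤ 0 := by
      rw [sub_nonpos, div_le_iff₀ (by positivity)]; linarith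
    exact (mul_nonpos_of_nonpos_of_nonneg this (by positivity)).trans (by positivity)
  have hmono : Monotone (fun n : ℕ => erode O (1 / ((n : ℝ) + 1))) := by
    intro m n hmn x hx
    refine (Metric.closedBall_subset_closedBall ?_).trans hx
    apply one_div_le_one_div_of_le (by positivity)
    have : (m : ℝ) ≤ n := by exact_mod_cast hmn
    linarith
  have hU : (⋃ n : ℕ, erode O (1 / ((n : ℝ) + 1))) = O := by
    ext x
    simp only [mem_iUnion]
    constructor
    · rintro ⟨n, hn⟩; exact hn (Metric.mem_closedBall_self (by positivity))
    · intro hx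
      obtain ⟨δ, hδ, hb⟩ := Metric.nhds_basis_closedBall.mem_iff.1 (hO.mem_nhds hx)
      obtain ⟨n, hn⟩ := exists_nat_one_div_lt hδ
      exact ⟨n, (Metric.closedBall_subset_closedBall hn.le).trans hb⟩
  have h1 := tendsto_measure_iUnion_atTop (μ := volume) hmono
  rw [hU] at h1
  have h3 : ENNReal.ofReal (v - ε * N ^ 4) < volume O := by
    refine lt_of_lt_of_le ?_ hv
    have h0 : 0 < ε * (N:ℝ) ^ 4 := by positivity
    rw [ENNReal.ofReal_lt_ofReal_iff (by linarith)]
    linarith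
  obtain ⟨n, hn⟩ := (h1.eventually_const_lt h3).exists
  have h4 : Tendsto (fun t : ℝ => (N : ℝ) / t) atTop (nhds 0) := tendsto_const_nhds.div_atTop tendsto_id
  filter_upwards [h4.eventually_le_const (show (0:ℝ) < 1 / ((n : ℝ) + 1) by positivity),
    eventually_gt_atTop 0] with t ht ht0
  have hfin := latPts_finite N hN f0 O hOb t ht0
  have h5 : volume (erode O (1 / ((n : ℝ) + 1))) ≤ (hfin.toFinset.card : ℝ≥0∞) * ENNReal.ofReal ((N / t) ^ 4) := by
    calc _ ≤ volume (erode O (N / t)) := measure_mono fun x hx => (Metric.closedBall_subset_closedBall ht).trans hx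
      _ ≤ volume (⋃ f ∈ hfin.toFinset, cube N t f) := by
          apply measure_mono
          refine (erode_cover N hN f0 O t ht0).trans ?_
          intro x hx; simpa using hx
      _ ≤ _ := by
          refine (measure_biUnion_finset_le _ _).trans ?_
          simp [cube_volume N t ht0]
  rw [← Set.ncard_eq_toFinset_card _ hfin] at h5
  have h6 := (hn.le).trans h5
  rw [← ENNReal.ofReal_natCast, ← ENNReal.ofReal_mul (by positivity),
    ENNReal.ofReal_le_ofReal_iff (by positivity)] at h6
  have h7 : (v - ε * N ^ 4) * (t ^ 4 / N ^ 4) ≤ ((latPts N f0 O t).ncard : ℝ) * (N / t) ^ 4 * (t ^ 4 / N ^ 4) :=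
    mul_le_mul_of_nonneg_right h6 (by positivity)
  calc _ = (v - ε * N ^ 4) * (t ^ 4 / N ^ 4) := by field_simp
    _ ≤ _ := h7
    _ = _ := by field_simp

end PTM


/-! ### The truncated regions -/
namespace PTM
open MeasureTheory Set ENNReal Filter

def WCT (T : ℝ) : Set (V ℝ) := {w | w ∈ WC ∧ w 1 ≤ T}
def CT (T : ℝ) : Set (V ℝ) := Phi '' WCT T
def OT (T : ℝ) : Set (V ℝ) :=
  {f | (0 < hA f ∧ hB f < hA f ∧ -hA f < hB f ∧ hA f < hC f ∧ -1 < hD f ∧ -hD f < 4 * T ^ 2 * hA f ^ 2) ∧ f 0 ≠ 0}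

lemma continuous_Phi : Continuous Phi := by
  unfold Phi
  refine continuous_pi fun i => ?_
  fin_cases i <;> simp <;> fun_prop

lemma continuous_hA : Continuous (hA : V ℝ → ℝ) := by unfold hA; fun_prop
lemma continuous_hB : Continuous (hB : V ℝ → ℝ) := by unfold hB; fun_prop
lemma continuous_hC : Continuous (hC : V ℝ → ℝ) := by unfold hC; fun_prop
lemma continuous_hD : Continuous (hD : V ℝ → ℝ) := by
  unfold hD; have := continuous_hA; have := continuous_hB; have := continuous_hC; fun_prop

lemma y_sq_ge {x y : ℝ} (hx : |x| ≤ 1 / 2) (h : 1 ≤ x ^ 2 + y ^ 2) : 3 / 4 ≤ y ^ 2 := by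
  have := sq_le_sq' (by linarith [abs_nonneg x]) hx
  rw [sq_abs] at this; linarith

lemma isCompact_WCT (T : ℝ) : IsCompact (WCT T) := by
  have heq : WCT T = {w : V ℝ | |w 0| ≤ 1 / 2} ∩ ({w | 1 ≤ w 0 ^ 2 + w 1 ^ 2} ∩ ({w | 0 ≤ w 1} ∩
      ({w | 4 * (w 2 ^ 2 + w 3 ^ 2) ^ 2 * w 1 ^ 6 ≤ 1} ∩ {w | w 1 ≤ T}))) := by
    ext w
    constructor
    · rintro ⟨⟨h1, h2, h3, h4⟩, h5⟩; exact ⟨h1, h2, h3.le, h4, h5⟩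
    · rintro ⟨h1, h2, h3, h4, h5⟩
      refine ⟨⟨h1, h2, lt_of_le_of_ne h3 ?_, h4⟩, h5⟩
      intro h
      have := y_sq_ge h1 h2
      rw [← h] at this; norm_num at this
  have hcl : IsClosed (WCT T) := by
    rw [heq]
    exact (isClosed_le (by fun_prop) (by fun_prop)).inter ((isClosed_le (by fun_prop) (by fun_prop)).inter
      ((isClosed_le (by fun_prop) (by fun_prop)).inter ((isClosed_le (by fun_prop) (by fun_prop)).inter
      (isClosed_le (by fun_prop) (by fun_prop)))))
  refine Metric.isCompact_of_isClosed_isBounded hcl ?_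
  refine (Metric.isBounded_closedBall (x := (0 : V ℝ)) (r := 1 + |T|)).subset ?_
  rintro w ⟨⟨h1, h2, h3, h4⟩, h5⟩
  rw [mem_closedBall_zero_iff, pi_norm_le_iff_of_nonneg (by positivity)]
  have hy := y_sq_ge h1 h2
  have hT := le_abs_self T
  have hT0 := abs_nonneg T
  have hy6 : (27 / 64 : ℝ) ≤ w 1 ^ 6 := by
    have : (3/4 : ℝ) ^ 3 ≤ (w 1 ^ 2) ^ 3 := pow_le_pow_left₀ (by norm_num) hy 3
    rw [← pow_mul] at this; norm_num at this ⊢; exact this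
  have hn : w 2 ^ 2 + w 3 ^ 2 ≤ 1 := by
    by_contra hcon
    push Not at hcon
    have : 1 < (w 2 ^ 2 + w 3 ^ 2) ^ 2 := by nlinarith
    nlinarith
  intro i
  rw [Real.norm_eq_abs]
  fin_cases i
  · simp only [Fin.zero_eta]; linarith
  · simp only [Fin.mk_one]; rw [abs_of_pos h3]; linarith
  · have : |w 2| ≤ 1 := by rw [← sq_le_one_iff_abs_le_one]; nlinarith [sq_nonneg (w 3)]
    simp only [Fin.reduceFinMk]; linarith
  · have : |w 3| ≤ 1 := by rw [← sq_le_one_iff_abs_le_one]; nlinarith [sq_nonneg (w 2)]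
    simp only [Fin.reduceFinMk]; linarith

lemma isCompact_CT (T : ℝ) : IsCompact (CT T) := (isCompact_WCT T).image continuous_Phi

lemma Jd_eq (w : V ℝ) : ENNReal.ofReal |(PhiD w).det| = Jd w := by
  rw [PhiD_det, abs_of_nonneg (by positivity)]; rfl

lemma volume_CT (T : ℝ) : volume (CT T) ≤ ENNReal.ofReal (Real.pi ^ 2 / 6) := by
  have h := addHaar_image_le_lintegral_abs_det_fderiv (volume : Measure (V ℝ)) (s := WCT T) (f := Phi) (f' := PhiD)
    (isCompact_WCT T).measurableSet (fun x _ => (Phi_hasFDerivAt x).hasFDerivWithinAt)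
  refine h.trans ?_
  simp only [Jd_eq]
  rw [← integral_WC]
  exact lintegral_mono_set (fun w hw => hw.1)

lemma isOpen_OT (T : ℝ) : IsOpen (OT T) := by
  have h1 := continuous_hA; have h2 := continuous_hB; have h3 := continuous_hC; have h4 := continuous_hD
  have heq : OT T = {f : V ℝ | 0 < hA f} ∩ ({f | hB f < hA f} ∩ ({f | -hA f < hB f} ∩ ({f | hA f < hC f} ∩
    ({f | -1 < hD f} ∩ ({f | -hD f < 4 * T ^ 2 * hA f ^ 2} ∩ {f | f 0 ≠ 0}))))) := by
    ext f
    constructor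
    · rintro ⟨⟨h1, h2, h3, h4, h5, h6⟩, h7⟩; exact ⟨h1, h2, h3, h4, h5, h6, h7⟩
    · rintro ⟨h1, h2, h3, h4, h5, h6, h7⟩; exact ⟨⟨h1, h2, h3, h4, h5, h6⟩, h7⟩
  rw [heq]
  exact (isOpen_lt (by fun_prop) (by fun_prop)).inter ((isOpen_lt (by fun_prop) (by fun_prop)).inter
    ((isOpen_lt (by fun_prop) (by fun_prop)).inter ((isOpen_lt (by fun_prop) (by fun_prop)).inter
    ((isOpen_lt (by fun_prop) (by fun_prop)).inter ((isOpen_lt (by fun_prop) (by fun_prop)).inter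
    (isOpen_ne_fun (by fun_prop) (by fun_prop)))))))

lemma mem_CT_of (f : V ℝ) (T : ℝ) (hT : 0 < T) (h1 : 0 < hA f) (h2 : |hB f| ≤ hA f) (h3 : hA f ≤ hC f)
    (h4 : -1 ≤ hD f) (h5 : -hD f ≤ 4 * T ^ 2 * hA f ^ 2) : f ∈ CT T := by
  have hD0 : hD f < 0 := by
    have : hB f ^ 2 ≤ hA f ^ 2 := by rw [← sq_abs (hB f)]; exact pow_le_pow_left₀ (abs_nonneg _) h2 2
    simp only [hD]; nlinarith
  obtain ⟨w, hw, rfl⟩ := exists_Phi f h1 hD0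
  refine ⟨w, ⟨⟨?_, ?_, hw, ?_⟩, ?_⟩, rfl⟩
  · rw [hB_Phi, ← hA_Phi, abs_mul, abs_of_pos h1, abs_mul, abs_two] at h2
    have := le_of_mul_le_mul_right (show 2 * |w 0| * hA (Phi w) ≤ 1 * hA (Phi w) by linarith) h1
    linarith
  · rw [hC_Phi, ← hA_Phi] at h3
    exact le_of_mul_le_mul_right (show 1 * hA (Phi w) ≤ _ by linarith) h1
  · rw [hD_Phi] at h4; linarith
  · have e : hD (Phi w) = -(4 * (w 1) ^ 2 * hA (Phi w) ^ 2) := by rw [hD_Phi, hA_Phi]; ring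
    rw [e, neg_neg] at h5
    have := le_of_mul_le_mul_right h5 (by positivity)
    have h6 : w 1 ^ 2 ≤ T ^ 2 := by linarith
    exact (pow_le_pow_iff_left₀ hw.le hT.le (by norm_num)).1 h6

lemma OT_subset_CT (T : ℝ) (hT : 0 < T) : OT T ⊆ CT T := by
  rintro f ⟨⟨h1, h2, h3, h4, h5, h6⟩, h7⟩
  exact mem_CT_of f T hT h1 (abs_le.2 ⟨h3.le, h2.le⟩) h4.le h5.le h6.le

lemma volume_OT (v : ℝ) (hv : v < Real.pi ^ 2 / 6) : ∃ T : ℝ, 0 < T ∧ ENNReal.ofReal v ≤ volume (OT T) := by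
  set s : ℕ → Set (V ℝ) := fun n => WO ∩ {w | w 1 < (n : ℝ) + 1} with hs
  have hsm : ∀ n, MeasurableSet (s n) := fun n =>
    measurableSet_WO.inter (measurableSet_lt (by fun_prop) (by fun_prop))
  have hmono : Monotone s := by
    intro m n hmn w hw
    refine ⟨hw.1, ?_⟩
    have h1 : w 1 < (m:ℝ) + 1 := hw.2
    have h2 : (m:ℝ) ≤ n := by exact_mod_cast hmn
    show w 1 < (n : ℝ) + 1
    linarith
  have hU : ⋃ n, s n = WO := by
    ext w
    simp only [mem_iUnion]
    constructor
    · rintro ⟨n, hn⟩; exact hn.1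
    · intro hw
      obtain ⟨n, hn⟩ := exists_nat_gt (w 1)
      refine ⟨n, hw, ?_⟩
      show w 1 < (n:ℝ) + 1
      linarith
  have h1 := tendsto_measure_iUnion_atTop (μ := volume.withDensity Jd) hmono
  rw [hU, withDensity_apply _ measurableSet_WO, integral_WO] at h1
  have h2 : ENNReal.ofReal v < ENNReal.ofReal (Real.pi ^ 2 / 6) := by
    rw [ENNReal.ofReal_lt_ofReal_iff (by positivity)]; exact hv
  obtain ⟨n, hn⟩ := (h1.eventually_const_lt h2).exists
  refine ⟨n + 1, by positivity, hn.le.trans ?_⟩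
  simp only [Function.comp]
  rw [withDensity_apply _ (hsm n)]
  have h3 := lintegral_abs_det_fderiv_eq_addHaar_image (volume : Measure (V ℝ)) (s := s n) (f := Phi) (f' := PhiD)
    (hsm n) (fun x _ => (Phi_hasFDerivAt x).hasFDerivWithinAt)
    (Phi_injOn.mono (by intro w hw; exact ⟨hw.1.2.2.1, hw.1.2.2.2.1⟩))
  simp only [Jd_eq] at h3
  rw [h3]
  have hnull : volume {f : V ℝ | f 0 = 0} = 0 := by
    have := Measure.pi_hyperplane (fun _ : Fin 4 => (volume : Measure ℝ)) 0 0
    exact this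
  have hsub : Phi '' s n ⊆ OT (n + 1) ∪ {f : V ℝ | f 0 = 0} := by
    rintro _ ⟨w, ⟨⟨g1, g2, g3, g4, g5⟩, g6⟩, rfl⟩
    by_cases h0 : Phi w 0 = 0
    · right; exact h0
    left
    have g6' : w 1 < (n:ℝ) + 1 := g6
    have hAp : 0 < hA (Phi w) := by rw [hA_Phi]; positivity
    have g1' := abs_lt.1 g1
    refine ⟨⟨hAp, ?_, ?_, ?_, ?_, ?_⟩, h0⟩
    · rw [hB_Phi, ← hA_Phi]; nlinarith [g1'.2]
    · rw [hB_Phi, ← hA_Phi]; nlinarith [g1'.1]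
    · rw [hC_Phi, ← hA_Phi]; nlinarith
    · rw [hD_Phi]; linarith
    · have e : hD (Phi w) = -(4 * (w 1) ^ 2 * hA (Phi w) ^ 2) := by rw [hD_Phi, hA_Phi]; ring
      rw [e, neg_neg]
      have : w 1 ^ 2 < ((n:ℝ) + 1) ^ 2 := pow_lt_pow_left₀ g6' g3.le (by norm_num)
      have h2 : 0 < hA (Phi w) ^ 2 := by positivity
      nlinarith
  calc volume (Phi '' s n) ≤ volume (OT (n + 1) ∪ {f : V ℝ | f 0 = 0}) := measure_mono hsub
    _ ≤ volume (OT (n + 1)) + volume {f : V ℝ | f 0 = 0} := measure_union_le _ _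
    _ = _ := by rw [hnull, add_zero]

end PTM


/-! ### Bounds in the cusp -/
namespace PTM
open Set Filter

/-- integers within `L` of `c` congruent to `r` modulo `q` -/
noncomputable def ivl (c L : ℝ) (r : ℤ) (q : ℕ) : Finset ℤ :=
  (Finset.Icc ⌈(c - L - r) / q⌉ ⌊(c + L - r) / q⌋).image (fun m => r + q * m)

lemma mem_ivl {c L : ℝ} {r : ℤ} {q : ℕ} (hq : 0 < q) {z : ℤ} (h1 : |(z:ℝ) - c| ≤ L) (h2 : (q:ℤ) ∣ z - r) :
    z ∈ ivl c L r q := by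
  obtain ⟨m, hm⟩ := h2
  have hqR : (0:ℝ) < q := by exact_mod_cast hq
  have hz : z = r + q * m := by linarith
  have hzR : (z:ℝ) = r + q * m := by rw [hz]; push_cast; ring
  rw [abs_le] at h1
  refine Finset.mem_image.2 ⟨m, Finset.mem_Icc.2 ⟨?_, ?_⟩, hz.symm⟩
  · rw [Int.ceil_le, div_le_iff₀ hqR]; linarith
  · rw [Int.le_floor, le_div_iff₀ hqR]; linarith

lemma card_ivl (c L : ℝ) (hL : 0 ≤ L) (r : ℤ) (q : ℕ) (hq : 0 < q) : ((ivl c L r q).card : ℝ) ≤ 2 * L / q + 1 := by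
  have hqR : (0:ℝ) < q := by exact_mod_cast hq
  have h1 : ((ivl c L r q).card : ℝ) ≤ ((Finset.Icc ⌈(c - L - r) / q⌉ ⌊(c + L - r) / q⌋).card : ℝ) := by
    exact_mod_cast Finset.card_image_le
  refine h1.trans ?_
  rw [Int.card_Icc]
  have h2 := Int.floor_le ((c + L - r) / q)
  have h3 := Int.le_ceil ((c - L - r) / q)
  have h4 : (c + L - r) / q = (c - L - r) / q + 2 * L / q := by rw [← add_div]; ring
  have h5 : 0 ≤ 2 * L / q := by positivity
  rcases le_or_gt 0 (⌊(c + L - r) / q⌋ + 1 - ⌈(c - L - r) / q⌉) with h | h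
  · have : (((⌊(c + L - r) / q⌋ + 1 - ⌈(c - L - r) / q⌉).toNat : ℤ) : ℝ) =
        ((⌊(c + L - r) / q⌋ + 1 - ⌈(c - L - r) / q⌉ : ℤ) : ℝ) := by rw [Int.toNat_of_nonneg h]
    rw [Int.cast_natCast] at this
    rw [this]; push_cast; linarith
  · rw [Int.toNat_of_nonpos h.le]; push_cast; linarith

lemma fiber_count (S : Set (V ℤ)) (I : Finset ℤ) (I1 : ℤ → Finset ℤ) (J : ℤ → ℤ → Finset ℤ) (K : ℤ → ℤ → ℤ → Finset ℤ)
    (n0 n1 n2 n3 : ℝ) (h0 : (I.card : ℝ) ≤ n0) (h1 : ∀ a, ((I1 a).card : ℝ) ≤ n1) (h2 : ∀ a b, ((J a b).card : ℝ) ≤ n2)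
    (h3 : ∀ a b c, ((K a b c).card : ℝ) ≤ n3)
    (hS : ∀ f ∈ S, f 0 ∈ I ∧ f 1 ∈ I1 (f 0) ∧ f 2 ∈ J (f 0) (f 1) ∧ f 3 ∈ K (f 0) (f 1) (f 2)) :
    S.Finite ∧ (S.ncard : ℝ) ≤ n0 * n1 * n2 * n3 := by
  set B : Finset (Σ _ : ℤ, Σ _ : ℤ, Σ _ : ℤ, ℤ) :=
    I.sigma fun a => (I1 a).sigma fun b => (J a b).sigma fun c => K a b c with hB
  set F : Finset (V ℤ) := B.image (fun z => ![z.1, z.2.1, z.2.2.1, z.2.2.2]) with hF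
  have hsub : S ⊆ F := by
    intro f hf
    obtain ⟨g0, g1, g2, g3⟩ := hS f hf
    simp only [hF, Finset.coe_image, mem_image, Finset.mem_coe]
    refine ⟨⟨f 0, f 1, f 2, f 3⟩, ?_, ?_⟩
    · simp [hB, g0, g1, g2, g3]
    · funext i; fin_cases i <;> rfl
  have m0 : 0 ≤ n0 := (Nat.cast_nonneg _).trans h0
  have m1 : 0 ≤ n1 := (Nat.cast_nonneg _).trans (h1 0)
  have m2 : 0 ≤ n2 := (Nat.cast_nonneg _).trans (h2 0 0)
  have m3 : 0 ≤ n3 := (Nat.cast_nonneg _).trans (h3 0 0 0)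
  refine ⟨F.finite_toSet.subset hsub, ?_⟩
  have e1 : S.ncard ≤ F.card := by
    rw [← Set.ncard_coe_finset]; exact Set.ncard_le_ncard hsub F.finite_toSet
  have e2 : F.card ≤ B.card := Finset.card_image_le
  have e3 : (B.card : ℝ) ≤ n0 * n1 * n2 * n3 := by
    simp only [hB, Finset.card_sigma]
    push_cast
    have k3 : ∀ a b, (∑ c ∈ J a b, ((K a b c).card : ℝ)) ≤ n2 * n3 := fun a b =>
      (Finset.sum_le_card_nsmul _ _ n3 fun c _ => h3 a b c).trans (by
        rw [nsmul_eq_mul]; exact mul_le_mul_of_nonneg_right (h2 a b) m3)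
    have k2 : ∀ a, (∑ b ∈ I1 a, ∑ c ∈ J a b, ((K a b c).card : ℝ)) ≤ n1 * (n2 * n3) := fun a =>
      (Finset.sum_le_card_nsmul _ _ (n2 * n3) fun b _ => k3 a b).trans (by
        rw [nsmul_eq_mul]; exact mul_le_mul_of_nonneg_right (h1 a) (by positivity))
    refine (Finset.sum_le_card_nsmul _ _ (n1 * (n2 * n3)) fun a _ => k2 a).trans ?_
    rw [nsmul_eq_mul]
    calc _ ≤ n0 * (n1 * (n2 * n3)) := mul_le_mul_of_nonneg_right h0 (by positivity)
      _ = _ := by ring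
  calc (S.ncard : ℝ) ≤ B.card := by exact_mod_cast e1.trans e2
    _ ≤ _ := e3

/-- closed reduced integral forms with `a ≠ 0` and `|D| < X` -/
def FC (X : ℝ) : Set (V ℤ) := {f | redC f ∧ f 0 ≠ 0 ∧ -X < ((hD f : ℤ) : ℝ)}
/-- strictly reduced integral forms with `a ≠ 0` and `|D| < X` -/
def FO (X : ℝ) : Set (V ℤ) := {f | redO f ∧ f 0 ≠ 0 ∧ -X < ((hD f : ℤ) : ℝ)}

noncomputable def rho (X : ℝ) (m : ℕ) : ℝ := (16 * X / (m:ℝ) ^ 6) ^ (1 / 4 : ℝ)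
lemma rho_nonneg {X : ℝ} (hX : 0 ≤ X) (m : ℕ) : 0 ≤ rho X m := by unfold rho; positivity
lemma rho_pow {X : ℝ} (hX : 0 ≤ X) (m : ℕ) : rho X m ^ 4 = 16 * X / (m:ℝ) ^ 6 := by
  rw [rho, ← Real.rpow_natCast, ← Real.rpow_mul (by positivity)]; norm_num

/-- the slice of forms with `m - 1 < Im τ ≤ m` -/
def Slice (X : ℝ) (m : ℕ) : Set (V ℤ) := {f | |(f 0 : ℝ)| ≤ rho X m ∧ |(f 1 : ℝ)| ≤ 2 * m * rho X m ∧
  |(f 2 : ℝ) + m ^ 2 * f 0| ≤ 4 * m * rho X m ∧ |(f 3 : ℝ) + m ^ 2 * f 1| ≤ 8 * m ^ 2 * rho X m}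

def toR (f : V ℤ) : V ℝ := fmap (Int.castRingHom ℝ) f
@[simp] lemma toR_apply (f : V ℤ) (i : Fin 4) : toR f i = (f i : ℝ) := rfl
@[simp] lemma hA_toR (f : V ℤ) : hA (toR f) = ((hA f : ℤ) : ℝ) := by simp [toR]
@[simp] lemma hB_toR (f : V ℤ) : hB (toR f) = ((hB f : ℤ) : ℝ) := by simp [toR]
@[simp] lemma hC_toR (f : V ℤ) : hC (toR f) = ((hC f : ℤ) : ℝ) := by simp [toR]
@[simp] lemma hD_toR (f : V ℤ) : hD (toR f) = ((hD f : ℤ) : ℝ) := by simp [toR]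

lemma redC.hD_neg {f : V ℤ} (h : redC f) : hD f < 0 := by
  obtain ⟨h1, h2, h3⟩ := h
  have : hB f ^ 2 ≤ hA f ^ 2 := by rw [← sq_abs (hB f)]; exact pow_le_pow_left₀ (abs_nonneg _) h2 2
  simp only [hD]; nlinarith

set_option maxHeartbeats 2000000 in
lemma exists_slice (X : ℝ) (f : V ℤ) (h : redC f) (hX : -X < ((hD f : ℤ) : ℝ)) :
    ∃ m : ℕ, 1 ≤ m ∧ f ∈ Slice X m ∧ -((hD f : ℤ) : ℝ) ≤ 4 * (m:ℝ) ^ 2 * ((hA f : ℤ) : ℝ) ^ 2 := by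
  have hD0 := h.hD_neg
  obtain ⟨h1, h2, h3⟩ := h
  have hD0R : ((hD f : ℤ) : ℝ) < 0 := by exact_mod_cast hD0
  have hX0 : 0 ≤ X := by linarith
  have h1R : (0:ℝ) < ((hA f : ℤ) : ℝ) := by exact_mod_cast h1
  have h2R : |((hB f : ℤ) : ℝ)| ≤ ((hA f : ℤ) : ℝ) := by exact_mod_cast h2
  have h3R : ((hA f : ℤ) : ℝ) ≤ ((hC f : ℤ) : ℝ) := by exact_mod_cast h3
  obtain ⟨w, hw, hwf⟩ := exists_Phi (toR f) (by simpa using h1R) (by simpa using hD0R)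
  have eA : ((hA f : ℤ) : ℝ) = (w 2 ^ 2 + w 3 ^ 2) * w 1 ^ 2 := by rw [← hA_Phi, hwf, hA_toR]
  have eB : ((hB f : ℤ) : ℝ) = 2 * w 0 * ((hA f : ℤ) : ℝ) := by rw [eA, ← hB_Phi, hwf, hB_toR]
  have eC : ((hC f : ℤ) : ℝ) = (w 0 ^ 2 + w 1 ^ 2) * ((hA f : ℤ) : ℝ) := by rw [eA, ← hC_Phi, hwf, hC_toR]
  have eD : ((hD f : ℤ) : ℝ) = - (4 * (w 2 ^ 2 + w 3 ^ 2) ^ 2 * w 1 ^ 6) := by rw [← hD_Phi, hwf, hD_toR]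
  have f0 : (f 0 : ℝ) = w 2 := by rw [← toR_apply, ← hwf]; simp [Phi]
  have f1 : (f 1 : ℝ) = w 2 * w 0 - w 3 * w 1 := by rw [← toR_apply, ← hwf]; simp [Phi]
  have f2 : (f 2 : ℝ) = 2 * w 0 * f 1 - (w 0 ^ 2 + w 1 ^ 2) * f 0 := by
    rw [f0, f1, ← toR_apply, ← hwf]; simp [Phi]; ring
  have f3 : (f 3 : ℝ) = 2 * w 0 * f 2 - (w 0 ^ 2 + w 1 ^ 2) * f 1 := by
    rw [f2, f0, f1, ← toR_apply, ← hwf]; simp [Phi]; ring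
  have hx : |w 0| ≤ 1 / 2 := by
    rw [eB, abs_mul, abs_of_pos h1R, abs_mul, abs_two] at h2R
    have := le_of_mul_le_mul_right (show 2 * |w 0| * ((hA f : ℤ) : ℝ) ≤ 1 * ((hA f : ℤ) : ℝ) by linarith) h1R
    linarith
  have hxy : 1 ≤ w 0 ^ 2 + w 1 ^ 2 := by
    rw [eC] at h3R
    exact le_of_mul_le_mul_right (show 1 * ((hA f : ℤ) : ℝ) ≤ _ by linarith) h1R
  have hy2 := y_sq_ge hx hxy
  have hx2 : w 0 ^ 2 ≤ 1 / 4 := by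
    have := sq_le_sq' (by linarith [abs_nonneg (w 0)]) hx
    rw [sq_abs] at this; linarith
  set m := ⌈w 1⌉₊ with hm
  have hm1 : w 1 ≤ m := Nat.le_ceil _
  have hm2 : (m:ℝ) < w 1 + 1 := Nat.ceil_lt_add_one hw.le
  have hmpos : 1 ≤ m := Nat.one_le_iff_ne_zero.2 (Nat.ceil_pos.2 hw).ne'
  have hmR : (1:ℝ) ≤ m := by exact_mod_cast hmpos
  have hym : (m:ℝ) / 2 ≤ w 1 := by
    rcases eq_or_lt_of_le hmpos with h | h
    · rw [← h]; nlinarith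
    · have : (2:ℝ) ≤ m := by exact_mod_cast h
      linarith
  set ρ := rho X m with hρ
  have hρ0 : 0 ≤ ρ := rho_nonneg hX0 m
  have hρ4 : ρ ^ 4 = 16 * X / (m:ℝ) ^ 6 := rho_pow hX0 m
  have hr : w 2 ^ 2 + w 3 ^ 2 ≤ ρ ^ 2 := by
    have hy6 : (m:ℝ) ^ 6 / 64 ≤ w 1 ^ 6 := by
      have := pow_le_pow_left₀ (by positivity) hym 6
      rw [div_pow] at this; norm_num at this; linarith
    have : (w 2 ^ 2 + w 3 ^ 2) ^ 2 ≤ (ρ ^ 2) ^ 2 := by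
      rw [← pow_mul, hρ4, le_div_iff₀ (by positivity)]
      have : (w 2 ^ 2 + w 3 ^ 2) ^ 2 * (m ^ 6 / 64) ≤ (w 2 ^ 2 + w 3 ^ 2) ^ 2 * w 1 ^ 6 :=
        mul_le_mul_of_nonneg_left hy6 (by positivity)
      linarith
    exact (pow_le_pow_iff_left₀ (by positivity) (by positivity) (by norm_num)).1 this
  have hnt : w 0 ^ 2 + w 1 ^ 2 ≤ 2 * m ^ 2 := by nlinarith
  have hnt2 : |(m:ℝ) ^ 2 - (w 0 ^ 2 + w 1 ^ 2)| ≤ 2 * m := by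
    rw [abs_le]; constructor <;> nlinarith [sq_nonneg (w 0)]
  have ha : |(f 0 : ℝ)| ≤ ρ := by
    apply abs_le_of_sq_le_sq _ hρ0
    rw [f0]; nlinarith [sq_nonneg (w 3)]
  have hb : |(f 1 : ℝ)| ≤ 2 * m * ρ := by
    apply abs_le_of_sq_le_sq _ (by positivity)
    rw [f1]
    have c1 : (w 2 * w 0 - w 3 * w 1) ^ 2 ≤ (w 2 ^ 2 + w 3 ^ 2) * (w 0 ^ 2 + w 1 ^ 2) := by
      nlinarith [sq_nonneg (w 2 * w 1 + w 3 * w 0)]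
    have c2 : (w 2 ^ 2 + w 3 ^ 2) * (w 0 ^ 2 + w 1 ^ 2) ≤ ρ ^ 2 * (2 * m ^ 2) :=
      mul_le_mul hr hnt (by positivity) (by positivity)
    nlinarith [sq_nonneg (m * ρ)]
  have h2x : |2 * w 0| ≤ 1 := by rw [abs_mul, abs_two]; linarith
  have hc0 : |(f 2 : ℝ)| ≤ 4 * m ^ 2 * ρ := by
    rw [f2]
    calc |2 * w 0 * f 1 - (w 0 ^ 2 + w 1 ^ 2) * f 0| ≤ |2 * w 0| * |(f 1:ℝ)| + |w 0 ^ 2 + w 1 ^ 2| * |(f 0:ℝ)| := by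
          rw [← abs_mul, ← abs_mul]; exact abs_sub _ _
      _ ≤ 1 * (2 * m * ρ) + 2 * m ^ 2 * ρ := by
          rw [abs_of_nonneg (show 0 ≤ w 0 ^ 2 + w 1 ^ 2 by positivity)]
          gcongr
      _ ≤ _ := by nlinarith [mul_nonneg (sub_nonneg.2 hmR) (mul_nonneg (by positivity : (0:ℝ) ≤ m) hρ0)]
  refine ⟨m, hmpos, ⟨ha, hb, ?_, ?_⟩, ?_⟩
  · have : (f 2 : ℝ) + m ^ 2 * f 0 = 2 * w 0 * f 1 + (m ^ 2 - (w 0 ^ 2 + w 1 ^ 2)) * f 0 := by rw [f2]; ring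
    rw [this]
    calc _ ≤ |2 * w 0| * |(f 1:ℝ)| + |(m:ℝ) ^ 2 - (w 0 ^ 2 + w 1 ^ 2)| * |(f 0:ℝ)| := by
          rw [← abs_mul, ← abs_mul]; exact abs_add_le _ _
      _ ≤ 1 * (2 * m * ρ) + 2 * m * ρ := by gcongr
      _ = _ := by ring
  · have : (f 3 : ℝ) + m ^ 2 * f 1 = 2 * w 0 * f 2 + (m ^ 2 - (w 0 ^ 2 + w 1 ^ 2)) * f 1 := by rw [f3]; ring
    rw [this]
    calc _ ≤ |2 * w 0| * |(f 2:ℝ)| + |(m:ℝ) ^ 2 - (w 0 ^ 2 + w 1 ^ 2)| * |(f 1:ℝ)| := by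
          rw [← abs_mul, ← abs_mul]; exact abs_add_le _ _
      _ ≤ 1 * (4 * m ^ 2 * ρ) + 2 * m * (2 * m * ρ) := by gcongr
      _ = _ := by ring
  · have : -((hD f : ℤ) : ℝ) = 4 * w 1 ^ 2 * ((hA f : ℤ) : ℝ) ^ 2 := by rw [eD, eA]; ring
    rw [this]; gcongr

/-- If a slice contains a form with `a ≠ 0`, then `m ^ 6 ≤ 16 X`. -/
lemma slice_rho {X : ℝ} {m : ℕ} {f : V ℤ} (hf : f ∈ Slice X m) (h0 : f 0 ≠ 0) : 1 ≤ rho X m := by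
  refine le_trans ?_ hf.1
  have : (1:ℤ) ≤ |f 0| := Int.one_le_abs h0
  exact_mod_cast this

lemma rho_bound {X : ℝ} (hX : 0 ≤ X) {m : ℕ} (hm : 1 ≤ m) (h : 1 ≤ rho X m) : (m:ℝ) ≤ 16 * X := by
  have h1 : 1 ≤ rho X m ^ 4 := one_le_pow₀ h
  have hmR : (1:ℝ) ≤ m := by exact_mod_cast hm
  rw [rho_pow hX, le_div_iff₀ (by positivity), one_mul] at h1
  exact (le_self_pow₀ hmR (by norm_num)).trans h1

lemma slice_count (X : ℝ) (hX : 0 ≤ X) (m : ℕ) (hm : 1 ≤ m) :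
    {f ∈ Slice X m | f 0 ≠ 0}.Finite ∧ ({f ∈ Slice X m | f 0 ≠ 0}.ncard : ℝ) ≤ 36720 * X * ((m:ℝ) ^ 2)⁻¹ := by
  have hmR : (1:ℝ) ≤ m := by exact_mod_cast hm
  by_cases hρ : 1 ≤ rho X m
  swap
  · have : {f ∈ Slice X m | f 0 ≠ 0} = ∅ := by
      rw [Set.eq_empty_iff_forall_notMem]
      rintro f ⟨h1, h2⟩
      exact hρ (slice_rho h1 h2)
    rw [this]; simp; positivity
  set ρ := rho X m with hρd
  have hmρ : 1 ≤ m * ρ := by nlinarith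
  have hm2ρ : 1 ≤ m ^ 2 * ρ := by nlinarith
  have := fiber_count {f ∈ Slice X m | f 0 ≠ 0} (ivl 0 ρ 0 1) (fun _ => ivl 0 (2 * m * ρ) 0 1)
    (fun a _ => ivl (-(m ^ 2 * a)) (4 * m * ρ) 0 1) (fun _ b _ => ivl (-(m ^ 2 * b)) (8 * m ^ 2 * ρ) 0 1)
    (3 * ρ) (5 * m * ρ) (9 * m * ρ) (17 * m ^ 2 * ρ) ?_ ?_ ?_ ?_ ?_
  · refine ⟨this.1, this.2.trans ?_⟩
    have e : 3 * ρ * (5 * m * ρ) * (9 * m * ρ) * (17 * m ^ 2 * ρ) = 2295 * ρ ^ 4 * m ^ 4 := by ring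
    rw [e, rho_pow hX]
    apply le_of_eq; field_simp; ring
  · refine (card_ivl _ _ (by positivity) _ _ one_pos).trans ?_
    push_cast; linarith
  · intro a; refine (card_ivl _ _ (by positivity) _ _ one_pos).trans ?_
    push_cast; linarith
  · intro a b; refine (card_ivl _ _ (by positivity) _ _ one_pos).trans ?_
    push_cast; linarith
  · intro a b c; refine (card_ivl _ _ (by positivity) _ _ one_pos).trans ?_
    push_cast; linarith
  · rintro f ⟨⟨h1, h2, h3, h4⟩, -⟩
    refine ⟨mem_ivl one_pos (by simpa using h1) (by simp), mem_ivl one_pos (by simpa using h2) (by simp),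
      mem_ivl one_pos (by simpa using h3) (by simp), mem_ivl one_pos (by simpa using h4) (by simp)⟩

/-- union bound over slices -/
lemma union_slices (X : ℝ) (hX : 0 ≤ X) (k : ℕ) (S : Set (V ℤ)) (c : ℕ → ℝ)
    (hS : ∀ f ∈ S, ∃ m : ℕ, k < m ∧ f ∈ Slice X m ∧ f 0 ≠ 0)
    (hc : ∀ m : ℕ, 1 ≤ m → 1 ≤ rho X m → ({f ∈ Slice X m | f 0 ≠ 0 ∧ f ∈ S}.ncard : ℝ) ≤ c m) (hc0 : ∀ m, 0 ≤ c m) :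
    S.Finite ∧ (S.ncard : ℝ) ≤ ∑ m ∈ Finset.Ioc k ⌊16 * X⌋₊, c m := by
  set F : ℕ → Set (V ℤ) := fun m => {f ∈ Slice X m | f 0 ≠ 0 ∧ f ∈ S} with hF
  have hfin : ∀ m, 1 ≤ m → (F m).Finite := fun m hm => (slice_count X hX m hm).1.subset (by intro f hf; exact ⟨hf.1, hf.2.1⟩)
  have hsub : S ⊆ ⋃ m ∈ Finset.Ioc k ⌊16 * X⌋₊, F m := by
    intro f hf
    obtain ⟨m, hkm, h1, h2⟩ := hS f hf
    simp only [mem_iUnion]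
    refine ⟨m, Finset.mem_Ioc.2 ⟨hkm, Nat.le_floor (rho_bound hX (by omega) (slice_rho h1 h2))⟩, h1, h2, hf⟩
  have hUf : (⋃ m ∈ Finset.Ioc k ⌊16 * X⌋₊, F m).Finite :=
    Set.Finite.biUnion (Finset.finite_toSet _) fun m hm => hfin m (by have := (Finset.mem_Ioc.1 hm).1; omega)
  refine ⟨hUf.subset hsub, ?_⟩
  calc (S.ncard : ℝ) ≤ ((⋃ m ∈ Finset.Ioc k ⌊16 * X⌋₊, F m).ncard : ℝ) := by
        exact_mod_cast Set.ncard_le_ncard hsub hUf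
    _ ≤ ∑ m ∈ Finset.Ioc k ⌊16 * X⌋₊, ((F m).ncard : ℝ) := by
        exact_mod_cast Finset.set_ncard_biUnion_le _ _
    _ ≤ _ := by
        apply Finset.sum_le_sum
        intro m hm
        have hm1 : 1 ≤ m := by have := (Finset.mem_Ioc.1 hm).1; omega
        by_cases hρ : 1 ≤ rho X m
        · exact hc m hm1 hρ
        · have : F m = ∅ := by
            rw [Set.eq_empty_iff_forall_notMem]
            rintro f ⟨h1, h2, _⟩
            exact hρ (slice_rho h1 h2)
          rw [this]; simpa using hc0 m

lemma sum_inv_sq_le (k n : ℕ) (hk : 0 < k) : ∑ m ∈ Finset.Ioc k n, ((m:ℝ) ^ 2)⁻¹ ≤ (k:ℝ)⁻¹ := by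
  rcases le_or_gt k n with h | h
  · refine (sum_Ioc_inv_sq_le_sub hk.ne' h).trans ?_
    have : (0:ℝ) ≤ (n:ℝ)⁻¹ := by positivity
    linarith
  · rw [Finset.Ioc_eq_empty (by omega)]; simp

lemma sum_inv_sq_le' (n : ℕ) : ∑ m ∈ Finset.Ioc 0 n, ((m:ℝ) ^ 2)⁻¹ ≤ 2 := by
  rcases Nat.eq_zero_or_pos n with rfl | hn
  · simp
  rw [← Finset.sum_Ioc_consecutive _ (Nat.zero_le 1) hn]
  have := sum_inv_sq_le 1 n one_pos
  simp at this ⊢; linarith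

lemma FC_cusp (X : ℝ) (hX : 0 ≤ X) (k : ℕ) (hk : 0 < k) :
    {f ∈ FC X | 4 * (k:ℝ) ^ 2 * ((hA f : ℤ) : ℝ) ^ 2 < -((hD f : ℤ) : ℝ)}.Finite ∧
    ({f ∈ FC X | 4 * (k:ℝ) ^ 2 * ((hA f : ℤ) : ℝ) ^ 2 < -((hD f : ℤ) : ℝ)}.ncard : ℝ) ≤ 36720 * X * (k:ℝ)⁻¹ := by
  have := union_slices X hX k {f ∈ FC X | 4 * (k:ℝ) ^ 2 * ((hA f : ℤ) : ℝ) ^ 2 < -((hD f : ℤ) : ℝ)}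
    (fun m => 36720 * X * ((m:ℝ) ^ 2)⁻¹) ?_ ?_ (fun m => by positivity)
  · refine ⟨this.1, this.2.trans ?_⟩
    rw [← Finset.mul_sum]
    exact mul_le_mul_of_nonneg_left (sum_inv_sq_le _ _ hk) (by positivity)
  · rintro f ⟨⟨h1, h2, h3⟩, h4⟩
    obtain ⟨m, hm, hs, hd⟩ := exists_slice X f h1 h3
    refine ⟨m, ?_, hs, h2⟩
    by_contra hcon
    push Not at hcon
    have hcR : (m:ℝ) ≤ k := by exact_mod_cast hcon
    have : 4 * (m:ℝ) ^ 2 * ((hA f : ℤ) : ℝ) ^ 2 ≤ 4 * (k:ℝ) ^ 2 * ((hA f : ℤ) : ℝ) ^ 2 := by gcongr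
    linarith
  · intro m hm _
    refine le_trans ?_ (slice_count X hX m hm).2
    exact_mod_cast Set.ncard_le_ncard (by intro f hf; exact ⟨hf.1, hf.2.1⟩) (slice_count X hX m hm).1

lemma FC_bound (X : ℝ) (hX : 0 ≤ X) : (FC X).Finite ∧ ((FC X).ncard : ℝ) ≤ 73440 * X := by
  have := union_slices X hX 0 (FC X) (fun m => 36720 * X * ((m:ℝ) ^ 2)⁻¹) ?_ ?_ (fun m => by positivity)
  · refine ⟨this.1, this.2.trans ?_⟩
    rw [← Finset.mul_sum]
    have := mul_le_mul_of_nonneg_left (sum_inv_sq_le' ⌊16 * X⌋₊) (show 0 ≤ 36720 * X by positivity)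
    linarith
  · rintro f ⟨h1, h2, h3⟩
    obtain ⟨m, hm, hs, hd⟩ := exists_slice X f h1 h3
    exact ⟨m, by omega, hs, h2⟩
  · intro m hm _
    refine le_trans ?_ (slice_count X hX m hm).2
    exact_mod_cast Set.ncard_le_ncard (by intro f hf; exact ⟨hf.1, hf.2.1⟩) (slice_count X hX m hm).1

end PTM


/-! ### Equidistribution of reduced forms in residue classes -/
namespace PTM
open Set Filter

lemma FO_sub_FC (X : ℝ) : FO X ⊆ FC X := by
  rintro f ⟨h1, h2, h3⟩; exact ⟨h1.redC, h2, h3⟩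

lemma scale_hA (f : V ℤ) (t : ℝ) : hA (fun i => (f i : ℝ) / t : V ℝ) = ((hA f : ℤ) : ℝ) / t ^ 2 := by
  simp [hA]; ring
lemma scale_hB (f : V ℤ) (t : ℝ) : hB (fun i => (f i : ℝ) / t : V ℝ) = ((hB f : ℤ) : ℝ) / t ^ 2 := by
  simp [hB]; ring
lemma scale_hC (f : V ℤ) (t : ℝ) : hC (fun i => (f i : ℝ) / t : V ℝ) = ((hC f : ℤ) : ℝ) / t ^ 2 := by
  simp [hC]; ring
lemma scale_hD (f : V ℤ) (t : ℝ) : hD (fun i => (f i : ℝ) / t : V ℝ) = ((hD f : ℤ) : ℝ) / t ^ 4 := by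
  simp only [hD, scale_hA, scale_hB, scale_hC]; push_cast; ring

lemma tendsto_fourth : Tendsto (fun X : ℝ => X ^ (1 / 4 : ℝ)) atTop atTop :=
  tendsto_rpow_atTop (by norm_num)

lemma fourth_pow {X : ℝ} (hX : 0 ≤ X) : (X ^ (1 / 4 : ℝ)) ^ 4 = X := by
  rw [← Real.rpow_natCast, ← Real.rpow_mul hX]; norm_num

lemma FC_upper (N : ℕ) (hN : 0 < N) (f0 : V ℤ) (ε : ℝ) (hε : 0 < ε) :
    ∀ᶠ X : ℝ in atTop, ({f ∈ FC X | ∀ i, (N : ℤ) ∣ f i - f0 i}.ncard : ℝ) ≤ (Real.pi ^ 2 / 6 / N ^ 4 + ε) * X := by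
  obtain ⟨k, hk⟩ := exists_nat_gt (36720 / (ε / 2))
  have hk0 : (0:ℝ) < k := lt_of_le_of_lt (by positivity) hk
  have hkN : 0 < k := by exact_mod_cast hk0
  have h := tendsto_fourth.eventually (lattice_upper N hN f0 (CT k) (isCompact_CT k) (Real.pi ^ 2 / 6) (by positivity)
    (volume_CT k) (ε / 2) (by positivity))
  filter_upwards [h, eventually_gt_atTop 0] with X hX hX0
  set t := X ^ (1 / 4 : ℝ) with ht
  have ht0 : 0 < t := by positivity
  have ht4 : t ^ 4 = X := fourth_pow hX0.le
  rw [ht4] at hX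
  obtain ⟨c1, c2⟩ := FC_cusp X hX0.le k hkN
  have hfin := latPts_finite N hN f0 (CT k) (isCompact_CT k).isBounded t ht0
  have hsub : {f ∈ FC X | ∀ i, (N : ℤ) ∣ f i - f0 i} ⊆ latPts N f0 (CT k) t ∪
      {f ∈ FC X | 4 * (k:ℝ) ^ 2 * ((hA f : ℤ) : ℝ) ^ 2 < -((hD f : ℤ) : ℝ)} := by
    rintro f ⟨hf, hd⟩
    by_cases hc : 4 * (k:ℝ) ^ 2 * ((hA f : ℤ) : ℝ) ^ 2 < -((hD f : ℤ) : ℝ)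
    · right; exact ⟨hf, hc⟩
    · left
      push Not at hc
      obtain ⟨⟨h1, h2, h3⟩, h4, h5⟩ := hf
      have h1R : (0:ℝ) < ((hA f : ℤ) : ℝ) := by exact_mod_cast h1
      have h2R : |((hB f : ℤ) : ℝ)| ≤ ((hA f : ℤ) : ℝ) := by exact_mod_cast h2
      have h3R : ((hA f : ℤ) : ℝ) ≤ ((hC f : ℤ) : ℝ) := by exact_mod_cast h3
      refine ⟨hd, mem_CT_of _ _ hk0 ?_ ?_ ?_ ?_ ?_⟩
      · rw [scale_hA]; positivity
      · rw [scale_hA, scale_hB, abs_div, abs_of_pos (show 0 < t ^ 2 by positivity)]; gcongr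
      · rw [scale_hA, scale_hC]; gcongr
      · rw [scale_hD, le_div_iff₀ (by positivity), ht4]; linarith
      · rw [scale_hD, scale_hA, div_pow, ← mul_div_assoc, ← neg_div, ← pow_mul]; gcongr
  have hle : ({f ∈ FC X | ∀ i, (N : ℤ) ∣ f i - f0 i}.ncard : ℝ) ≤ (latPts N f0 (CT k) t).ncard +
      ({f ∈ FC X | 4 * (k:ℝ) ^ 2 * ((hA f : ℤ) : ℝ) ^ 2 < -((hD f : ℤ) : ℝ)}.ncard : ℝ) := by
    exact_mod_cast (Set.ncard_le_ncard hsub (hfin.union c1)).trans (Set.ncard_union_le _ _)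
  have hkε : 36720 * X * (k:ℝ)⁻¹ ≤ ε / 2 * X := by
    rw [div_lt_iff₀ (by positivity)] at hk
    rw [mul_inv_le_iff₀ hk0]; nlinarith
  calc _ ≤ _ := hle
    _ ≤ (Real.pi ^ 2 / 6 / N ^ 4 + ε / 2) * X + ε / 2 * X := add_le_add hX (c2.trans hkε)
    _ = _ := by ring

lemma FO_lower (N : ℕ) (hN : 0 < N) (f0 : V ℤ) (ε : ℝ) (hε : 0 < ε) :
    ∀ᶠ X : ℝ in atTop, (Real.pi ^ 2 / 6 / N ^ 4 - ε) * X ≤ ({f ∈ FO X | ∀ i, (N : ℤ) ∣ f i - f0 i}.ncard : ℝ) := by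
  have hNR : (1:ℝ) ≤ N := by exact_mod_cast hN
  set v := max 0 (Real.pi ^ 2 / 6 - ε / 2) with hv
  have hvlt : v < Real.pi ^ 2 / 6 := max_lt (by positivity) (by linarith)
  have hvge : Real.pi ^ 2 / 6 - ε / 2 ≤ v := le_max_right _ _
  obtain ⟨T, hT0, hT⟩ := volume_OT v hvlt
  have hb : Bornology.IsBounded (OT T) := (isCompact_CT T).isBounded.subset (OT_subset_CT T hT0)
  have h := tendsto_fourth.eventually (lattice_lower N hN f0 (OT T) (isOpen_OT T) hb v (le_max_left _ _) hT
    (ε / 2) (by positivity))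
  filter_upwards [h, eventually_gt_atTop 0] with X hX hX0
  set t := X ^ (1 / 4 : ℝ) with ht
  have ht0 : 0 < t := by positivity
  have ht4 : t ^ 4 = X := fourth_pow hX0.le
  rw [ht4] at hX
  have hsub : latPts N f0 (OT T) t ⊆ {f ∈ FO X | ∀ i, (N : ℤ) ∣ f i - f0 i} := by
    rintro f ⟨hd, ⟨h1, h2, h3, h4, h5, h6⟩, h7⟩
    rw [scale_hA] at h1 h2 h3 h4
    rw [scale_hB, div_lt_div_iff_of_pos_right (by positivity)] at h2
    rw [scale_hB, ← neg_div, div_lt_div_iff_of_pos_right (by positivity)] at h3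
    rw [scale_hC, div_lt_div_iff_of_pos_right (by positivity)] at h4
    rw [scale_hD, lt_div_iff₀ (by positivity), ht4] at h5
    have h1' : (0:ℝ) < ((hA f : ℤ) : ℝ) := by
      by_contra hc; push Not at hc
      exact absurd h1 (not_lt.2 (div_nonpos_of_nonpos_of_nonneg hc (by positivity)))
    refine ⟨⟨⟨by exact_mod_cast h1', ?_, by exact_mod_cast h4⟩, ?_, by linarith⟩, hd⟩
    · rw [abs_lt]; exact ⟨by exact_mod_cast h3, by exact_mod_cast h2⟩
    · intro h0; apply h7; simp [h0]
  have hfin : {f ∈ FO X | ∀ i, (N : ℤ) ∣ f i - f0 i}.Finite :=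
    (FC_bound X hX0.le).1.subset (by intro f hf; exact FO_sub_FC X hf.1)
  refine le_trans (le_trans ?_ hX) (by exact_mod_cast Set.ncard_le_ncard hsub hfin)
  gcongr ?_ * X
  have : (Real.pi ^ 2 / 6 - ε / 2) / N ^ 4 ≤ v / N ^ 4 := by gcongr
  have h2 : ε / 2 / (N:ℝ) ^ 4 ≤ ε / 2 := div_le_self (by positivity) (one_le_pow₀ hNR)
  rw [sub_div] at this; linarith

/-- reduction of an integral form modulo `N` -/
def red (N : ℕ) (f : V ℤ) : V (ZMod N) := fmap (Int.castRingHom (ZMod N)) f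
lemma red_apply (N : ℕ) (f : V ℤ) (i : Fin 4) : red N f i = (f i : ZMod N) := rfl

lemma red_surj (N : ℕ) (g : V (ZMod N)) : ∃ f : V ℤ, red N f = g := by
  choose f hf using fun i => ZMod.intCast_surjective (g i)
  exact ⟨f, funext hf⟩

lemma red_eq_iff (N : ℕ) (f f0 : V ℤ) : red N f = red N f0 ↔ ∀ i, (N : ℤ) ∣ f i - f0 i := by
  rw [funext_iff]
  refine forall_congr' fun i => ?_
  rw [red_apply, red_apply, eq_comm, ZMod.intCast_eq_intCast_iff_dvd_sub]

lemma ncard_red_sum (N : ℕ) [NeZero N] (S : Set (V ℤ)) (hS : S.Finite) (T : Finset (V (ZMod N))) :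
    ({f ∈ S | red N f ∈ T}.ncard : ℝ) = ∑ g ∈ T, ({f ∈ S | red N f = g}.ncard : ℝ) := by
  have hsub : {f ∈ S | red N f ∈ T}.Finite := hS.subset (by intro f hf; exact hf.1)
  rw [Set.ncard_eq_toFinset_card _ hsub]
  rw [Finset.card_eq_sum_card_fiberwise (f := red N) (t := T)]
  · push_cast
    refine Finset.sum_congr rfl fun g hg => ?_
    have hs2 : {f ∈ S | red N f = g}.Finite := hS.subset (by intro f hf; exact hf.1)
    rw [Set.ncard_eq_toFinset_card _ hs2]
    congr 2
    ext f
    simp only [Finset.mem_filter, Set.Finite.mem_toFinset]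
    constructor
    · rintro ⟨⟨h1, h2⟩, h3⟩; exact ⟨h1, h3⟩
    · rintro ⟨h1, h3⟩; exact ⟨⟨h1, by rw [h3]; exact hg⟩, h3⟩
  · intro f hf
    have := (Set.Finite.mem_toFinset hsub).1 hf
    exact this.2

/-- sandwich giving limits from eventual ε bounds -/
lemma tendsto_div_of_eps (u : ℝ → ℝ) (l : ℝ) (h1 : ∀ ε > 0, ∀ᶠ X in atTop, u X ≤ (l + ε) * X)
    (h2 : ∀ ε > 0, ∀ᶠ X in atTop, (l - ε) * X ≤ u X) : Tendsto (fun X => u X / X) atTop (nhds l) := by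
  rw [Metric.tendsto_atTop']
  intro ε hε
  obtain ⟨N, hN⟩ := ((h1 (ε / 2) (by positivity)).and ((h2 (ε / 2) (by positivity)).and (eventually_gt_atTop 0))).exists_forall_of_atTop
  refine ⟨N, fun X hX => ?_⟩
  obtain ⟨a, b, c⟩ := hN X hX.le
  rw [Real.dist_eq, abs_lt]
  rw [← div_le_iff₀ c] at a
  rw [← le_div_iff₀ c] at b
  constructor <;> linarith

theorem tendsto_class (N : ℕ) [NeZero N] (g : V (ZMod N)) :
    Tendsto (fun X : ℝ => ({f ∈ FC X | red N f = g}.ncard : ℝ) / X) atTop (nhds (Real.pi ^ 2 / 6 / N ^ 4)) ∧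
    Tendsto (fun X : ℝ => ({f ∈ FO X | red N f = g}.ncard : ℝ) / X) atTop (nhds (Real.pi ^ 2 / 6 / N ^ 4)) := by
  obtain ⟨f0, rfl⟩ := red_surj N g
  have hN : 0 < N := NeZero.pos N
  simp only [red_eq_iff]
  have hmono : ∀ X : ℝ, 0 < X → ({f ∈ FO X | ∀ i, (N : ℤ) ∣ f i - f0 i}.ncard : ℝ) ≤ ({f ∈ FC X | ∀ i, (N : ℤ) ∣ f i - f0 i}.ncard : ℝ) := by
    intro X hX
    exact_mod_cast Set.ncard_le_ncard (by intro f hf; exact ⟨FO_sub_FC X hf.1, hf.2⟩)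
      ((FC_bound X hX.le).1.subset (by intro f hf; exact hf.1))
  refine ⟨tendsto_div_of_eps _ _ (FC_upper N hN f0) fun ε hε => ?_, tendsto_div_of_eps _ _ (fun ε hε => ?_) (FO_lower N hN f0)⟩
  · filter_upwards [FO_lower N hN f0 ε hε, eventually_gt_atTop 0] with X h1 h2
    exact h1.trans (hmono X h2)
  · filter_upwards [FC_upper N hN f0 ε hε, eventually_gt_atTop 0] with X h1 h2
    exact (hmono X h2).trans h1

theorem tendsto_FC (N : ℕ) [NeZero N] (T : Finset (V (ZMod N))) :
    Tendsto (fun X : ℝ => ({f ∈ FC X | red N f ∈ T}.ncard : ℝ) / X) atTop (nhds (T.card * (Real.pi ^ 2 / 6 / N ^ 4))) := by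
  have := tendsto_finset_sum T fun g _ => (tendsto_class N g).1
  rw [Finset.sum_const, nsmul_eq_mul] at this
  refine this.congr' ?_
  filter_upwards [eventually_gt_atTop 0] with X hX
  rw [ncard_red_sum N _ (FC_bound X hX.le).1, Finset.sum_div]

theorem tendsto_FO (N : ℕ) [NeZero N] (T : Finset (V (ZMod N))) :
    Tendsto (fun X : ℝ => ({f ∈ FO X | red N f ∈ T}.ncard : ℝ) / X) atTop (nhds (T.card * (Real.pi ^ 2 / 6 / N ^ 4))) := by
  have := tendsto_finset_sum T fun g _ => (tendsto_class N g).2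
  rw [Finset.sum_const, nsmul_eq_mul] at this
  refine this.congr' ?_
  filter_upwards [eventually_gt_atTop 0] with X hX
  rw [ncard_red_sum N _ ((FC_bound X hX.le).1.subset (FO_sub_FC X)), Finset.sum_div]

end PTM


/-! ### Equidistribution and the Chinese remainder theorem -/
namespace PTM
open Set Filter

section
variable {ι : Type} [Fintype ι]

/-- reduction of an integral vector modulo `N` -/
def rd (N : ℕ) (f : ι → ℤ) : ι → ZMod N := fun i => (f i : ZMod N)

lemma rd_eq_red (N : ℕ) (f : V ℤ) : rd N f = red N f := rfl

/-- The sets `S X` have about `c X` elements, equidistributed modulo all integers. -/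
def Equi (S : ℝ → Set (ι → ℤ)) (c : ℝ) : Prop :=
  (∀ X > 0, (S X).Finite) ∧ ∀ (N : ℕ) (_ : N ≠ 0) (g : ι → ZMod N),
    Tendsto (fun X : ℝ => ({f ∈ S X | rd N f = g}.ncard : ℝ) / X) atTop (nhds (c / (N:ℝ) ^ Fintype.card ι))

lemma equi_FC : Equi FC (Real.pi ^ 2 / 6) := by
  refine ⟨fun X hX => (FC_bound X hX.le).1, fun N hN g => ?_⟩
  have : NeZero N := ⟨hN⟩
  have := (tendsto_class N g).1
  simpa [← rd_eq_red] using this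

lemma equi_FO : Equi FO (Real.pi ^ 2 / 6) := by
  refine ⟨fun X hX => (FC_bound X hX.le).1.subset (FO_sub_FC X), fun N hN g => ?_⟩
  have : NeZero N := ⟨hN⟩
  have := (tendsto_class N g).2
  simpa [← rd_eq_red] using this

lemma ncard_fiber {α β : Type*} (S : Set α) (hS : S.Finite) (r : α → β) (T : Finset β) :
    ({f ∈ S | r f ∈ T}.ncard : ℝ) = ∑ g ∈ T, ({f ∈ S | r f = g}.ncard : ℝ) := by
  have hsub : {f ∈ S | r f ∈ T}.Finite := hS.subset (by intro f hf; exact hf.1)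
  rw [Set.ncard_eq_toFinset_card _ hsub]
  rw [Finset.card_eq_sum_card_fiberwise (f := r) (t := T)]
  · push_cast
    refine Finset.sum_congr rfl fun g hg => ?_
    have hs2 : {f ∈ S | r f = g}.Finite := hS.subset (by intro f hf; exact hf.1)
    rw [Set.ncard_eq_toFinset_card _ hs2]
    congr 2
    ext f
    simp only [Finset.mem_filter, Set.Finite.mem_toFinset]
    constructor
    · rintro ⟨⟨h1, h2⟩, h3⟩; exact ⟨h1, h3⟩
    · rintro ⟨h1, h3⟩; exact ⟨⟨h1, by rw [h3]; exact hg⟩, h3⟩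
  · intro f hf
    have := (Set.Finite.mem_toFinset hsub).1 hf
    exact this.2

lemma crt_pair (M N : ℕ) (h : M.Coprime N) (g : ι → ZMod M) (t : ι → ZMod N) :
    ∃ u : ι → ZMod (M * N), ∀ f : ι → ℤ, rd (M * N) f = u ↔ (rd M f = g ∧ rd N f = t) := by
  let e := ZMod.chineseRemainder h
  refine ⟨fun i => e.symm (g i, t i), fun f => ?_⟩
  have key : ∀ z : ℤ, e (z : ZMod (M * N)) = ((z : ZMod M), (z : ZMod N)) := by
    intro z
    have : e (z : ZMod (M * N)) = ((z : ℤ) : ZMod M × ZMod N) := map_intCast e z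
    rw [this]; rfl
  simp only [funext_iff, rd]
  rw [← forall_and]
  refine forall_congr' fun i => ?_
  rw [← e.injective.eq_iff, key, e.apply_symm_apply, Prod.mk.injEq]

theorem Equi.prod {S : ℝ → Set (ι → ℤ)} {c : ℝ} (h : Equi S c) (m : ℕ → ℕ) (hm : ∀ q, m q ≠ 0)
    (T : ∀ q, Finset (ι → ZMod (m q))) (s : Finset ℕ) :
    (s : Set ℕ).Pairwise (fun q q' => (m q).Coprime (m q')) → ∀ (N : ℕ) (_ : N ≠ 0) (g : ι → ZMod N)
    (_ : ∀ q ∈ s, N.Coprime (m q)),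
    Tendsto (fun X : ℝ => ({f ∈ S X | rd N f = g ∧ ∀ q ∈ s, rd (m q) f ∈ T q}.ncard : ℝ) / X) atTop
      (nhds (c / (N:ℝ) ^ Fintype.card ι * ∏ q ∈ s, ((T q).card : ℝ) / (m q : ℝ) ^ Fintype.card ι)) := by
  induction s using Finset.induction_on with
  | empty =>
    intro _ N hN g _
    simpa using h.2 N hN g
  | insert q s hq ih =>
    intro hpw N hN g hco
    have hpw' : (s : Set ℕ).Pairwise (fun q q' => (m q).Coprime (m q')) :=
      hpw.mono (by intro x hx; simp at hx ⊢; exact Or.inr hx)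
    have hco' : ∀ q' ∈ s, (N * m q).Coprime (m q') := by
      intro q' hq'
      refine Nat.Coprime.mul_left (hco q' (Finset.mem_insert_of_mem hq')) ?_
      exact hpw (by simp) (by simp [hq']) (by rintro rfl; exact hq hq')
    choose u hu using fun t => crt_pair N (m q) (hco q (Finset.mem_insert_self _ _)) g t
    have key := tendsto_finsetSum (T q) fun t _ => ih hpw' (N * m q) (mul_ne_zero hN (hm q)) (u t) hco'
    rw [Finset.sum_const, nsmul_eq_mul] at key
    rw [Finset.prod_insert hq]
    have e : ((T q).card : ℝ) * (c / ((N * m q : ℕ):ℝ) ^ Fintype.card ι * ∏ q ∈ s, ((T q).card : ℝ) / (m q : ℝ) ^ Fintype.card ι)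
      = c / (N:ℝ) ^ Fintype.card ι * (((T q).card : ℝ) / (m q : ℝ) ^ Fintype.card ι * ∏ q ∈ s, ((T q).card : ℝ) / (m q : ℝ) ^ Fintype.card ι) := by
      push_cast
      generalize (∏ q ∈ s, ((T q).card : ℝ) / (m q : ℝ) ^ Fintype.card ι) = P
      rw [mul_pow]
      have : (N:ℝ) ≠ 0 := by exact_mod_cast hN
      have : (m q:ℝ) ≠ 0 := by exact_mod_cast hm q
      field_simp
    rw [e] at key
    refine key.congr' ?_
    filter_upwards [eventually_gt_atTop 0] with X hX
    rw [← Finset.sum_div]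
    congr 1
    have hf := ncard_fiber {f ∈ S X | rd N f = g ∧ ∀ q ∈ s, rd (m q) f ∈ T q}
      ((h.1 X hX).subset (by intro f hf; exact hf.1)) (rd (m q)) (T q)
    have e1 : {f ∈ S X | rd N f = g ∧ ∀ q' ∈ insert q s, rd (m q') f ∈ T q'} =
        {f ∈ {f ∈ S X | rd N f = g ∧ ∀ q ∈ s, rd (m q) f ∈ T q} | rd (m q) f ∈ T q} := by
      ext f
      simp only [Finset.forall_mem_insert, mem_ofPred_eq]
      tauto
    rw [e1, hf]
    refine Finset.sum_congr rfl fun t _ => ?_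
    congr 2
    ext f
    simp only [mem_ofPred_eq, hu]
    tauto

theorem Equi.prod' {S : ℝ → Set (ι → ℤ)} {c : ℝ} (h : Equi S c) (m : ℕ → ℕ) (hm : ∀ q, m q ≠ 0)
    (T : ∀ q, Finset (ι → ZMod (m q))) (s : Finset ℕ)
    (hco : (s : Set ℕ).Pairwise (fun q q' => (m q).Coprime (m q'))) :
    Tendsto (fun X : ℝ => ({f ∈ S X | ∀ q ∈ s, rd (m q) f ∈ T q}.ncard : ℝ) / X) atTop
      (nhds (c * ∏ q ∈ s, ((T q).card : ℝ) / (m q : ℝ) ^ Fintype.card ι)) := by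
  have := h.prod m hm T s hco 1 one_ne_zero (fun _ => 0) (fun q _ => Nat.coprime_one_left _)
  simp only [Nat.cast_one, one_pow, div_one] at this
  refine this.congr fun X => ?_
  congr 3
  ext f
  simp only [mem_ofPred_eq, and_congr_right_iff]
  intro _
  refine ⟨fun h => h.2, fun h => ⟨?_, h⟩⟩
  funext i; exact Subsingleton.elim _ _

end

/-- negative integers of absolute value below `X`, as vectors of length one -/
def SD (X : ℝ) : Set (Unit → ℤ) := {D | D () < 0 ∧ -X < (D () : ℝ)}

lemma equi_SD : Equi SD 1 := by
  have hfinI : ∀ X : ℝ, SD X ⊆ (fun z : ℤ => fun _ : Unit => z) '' (Finset.Icc (-⌈X⌉) 0 : Finset ℤ) := by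
    rintro X D ⟨h1, h2⟩
    refine ⟨D (), ?_, by funext i; rfl⟩
    simp only [Finset.coe_Icc, Set.mem_Icc]
    refine ⟨?_, h1.le⟩
    have h3 := Int.le_ceil X
    have : (-⌈X⌉ : ℝ) ≤ (D () : ℝ) := by linarith
    exact_mod_cast this
  have hfin : ∀ X > 0, (SD X).Finite := fun X _ => ((Finset.finite_toSet _).image _).subset (hfinI X)
  refine ⟨hfin, fun N hN g => ?_⟩
  have hN0 : (0:ℝ) < N := by exact_mod_cast Nat.pos_of_ne_zero hN
  obtain ⟨r, hr⟩ := ZMod.intCast_surjective (g ())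
  have hcond : ∀ D : Unit → ℤ, rd N D = g ↔ (D () ≡ r [ZMOD N]) := by
    intro D
    rw [← ZMod.intCast_eq_intCast_iff, hr]
    constructor
    · intro h; rw [← h]; rfl
    · intro h; funext i; exact h
  simp only [Fintype.card_unit, pow_one]
  have hcount : ∀ X : ℝ, 0 < X → ({f ∈ SD X | rd N f = g}.ncard : ℤ) =
      max (⌈((0:ℤ) - r : ℝ) / N⌉ - ⌈((-⌈X⌉ + 1 : ℤ) - r : ℝ) / N⌉) 0 := by
    intro X hX
    have h0 := Int.Ico_filter_modEq_card (-⌈X⌉ + 1) 0 (r := (N:ℤ)) (by exact_mod_cast Nat.pos_of_ne_zero hN) r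
    have e : {f ∈ SD X | rd N f = g} = (fun z : ℤ => fun _ : Unit => z) '' ((Finset.Ico (-⌈X⌉ + 1) 0).filter (· ≡ r [ZMOD N]) : Finset ℤ) := by
      ext D
      simp only [mem_image, Finset.coe_filter, mem_ofPred_eq, Finset.mem_Ico, hcond]
      constructor
      · rintro ⟨⟨h1, h2⟩, h3⟩
        refine ⟨D (), ⟨⟨?_, h1⟩, h3⟩, by funext i; rfl⟩
        have h4 := Int.lt_ceil (z := -D ()) (a := X)
        have : -D () < ⌈X⌉ := h4.2 (by push_cast; linarith)
        omega
      · rintro ⟨z, ⟨⟨h1, h2⟩, h3⟩, rfl⟩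
        refine ⟨⟨h2, ?_⟩, h3⟩
        have h4 := (Int.lt_ceil (z := -z) (a := X)).1 (by omega)
        push_cast at h4; linarith
    rw [e, Set.ncard_image_of_injective _ (by intro a b hab; exact congrFun hab ()), Set.ncard_coe_finset, h0]
    rw [← Rat.ceil_cast (α := ℝ), ← Rat.ceil_cast (α := ℝ)]
    push_cast
    rfl
  have hb : ∀ X : ℝ, 0 < X → |({f ∈ SD X | rd N f = g}.ncard : ℝ) - X / N| ≤ 3 := by
    intro X hX
    have h1 : (({f ∈ SD X | rd N f = g}.ncard : ℤ) : ℝ) = _ := congrArg (Int.cast (R := ℝ)) (hcount X hX)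
    rw [Int.cast_natCast] at h1
    rw [h1]
    have a1 := Int.le_ceil (((0:ℤ) - r : ℝ) / N)
    have a2 := Int.ceil_lt_add_one (((0:ℤ) - r : ℝ) / N)
    have b1 := Int.le_ceil (((-⌈X⌉ + 1 : ℤ) - r : ℝ) / N)
    have b2 := Int.ceil_lt_add_one (((-⌈X⌉ + 1 : ℤ) - r : ℝ) / N)
    have c1 := Int.le_ceil X
    have c2 := Int.ceil_lt_add_one X
    have hN1 : (1:ℝ) ≤ N := by exact_mod_cast Nat.pos_of_ne_zero hN
    have d1 : ((0:ℤ) - r : ℝ) / N - ((-⌈X⌉ + 1 : ℤ) - r : ℝ) / N = X / N + (⌈X⌉ - X - 1) / N := by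
      push_cast; ring
    have d2 : (⌈X⌉ - X - 1) / (N:ℝ) ≤ 0 := div_nonpos_of_nonpos_of_nonneg (by linarith) hN0.le
    have d3 : -1 ≤ (⌈X⌉ - X - 1) / (N:ℝ) := by rw [le_div_iff₀ hN0]; linarith
    have hXN : 0 ≤ X / N := by positivity
    rw [Int.cast_max]
    set u : ℤ := ⌈((0:ℤ) - r : ℝ) / N⌉ - ⌈((-⌈X⌉ + 1 : ℤ) - r : ℝ) / N⌉ with hu
    have hu' : (u:ℝ) = ⌈((0:ℤ) - r : ℝ) / N⌉ - ⌈((-⌈X⌉ + 1 : ℤ) - r : ℝ) / N⌉ := by rw [hu]; push_cast; ring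
    rw [abs_le]
    rcases max_cases (u:ℝ) ((0:ℤ):ℝ) with ⟨h, h'⟩ | ⟨h, h'⟩ <;> rw [h] <;> push_cast at * <;> constructor <;> linarith
  apply tendsto_div_of_eps
  · intro ε hε
    filter_upwards [eventually_ge_atTop (3 / ε), eventually_gt_atTop 0] with X h1 h2
    have := (abs_le.1 (hb X h2)).2
    rw [div_le_iff₀ hε] at h1
    have e : (1 / (N:ℝ) + ε) * X = X / N + X * ε := by ring
    rw [e]; linarith
  · intro ε hε
    filter_upwards [eventually_ge_atTop (3 / ε), eventually_gt_atTop 0] with X h1 h2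
    have := (abs_le.1 (hb X h2)).1
    rw [div_le_iff₀ hε] at h1
    have e : (1 / (N:ℝ) - ε) * X = X / N - X * ε := by ring
    rw [e]; linarith

end PTM


/-! ### Local densities: forms with given Hessian invariants -/
namespace PTM
open Set Filter

section
lemma card_of_orbit {G T Y : Type*} [Group G] [Finite G] [MulAction G T] [MulAction G Y] (π : T → Y)
    (hπ : ∀ (g : G) t, π (g • t) = g • π t) (y0 : Y) (h : ∀ t, ∃ g : G, g • π t = y0)
    (hc : Nat.card {t // π t = y0} = Nat.card (MulAction.stabilizer G y0)) : Nat.card T = Nat.card G := by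
  choose γ hγ using h
  let e : T × MulAction.stabilizer G y0 ≃ G × {t // π t = y0} :=
  { toFun := fun z => (z.2.1 * γ z.1, ⟨(z.2.1 * γ z.1) • z.1, by
      rw [hπ, mul_smul, hγ]; exact z.2.2⟩)
    invFun := fun z => (z.1⁻¹ • z.2.1, ⟨z.1 * (γ (z.1⁻¹ • z.2.1))⁻¹, by
      rw [MulAction.mem_stabilizer_iff, mul_smul]
      have h1 := hγ (z.1⁻¹ • z.2.1)
      have h2 : (γ (z.1⁻¹ • z.2.1))⁻¹ • y0 = π (z.1⁻¹ • z.2.1) := by rw [inv_smul_eq_iff, h1]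
      rw [h2, ← hπ, smul_inv_smul]; exact z.2.2⟩)
    left_inv := by
      rintro ⟨t, σ⟩
      have : (σ.1 * γ t)⁻¹ • (σ.1 * γ t) • t = t := inv_smul_smul _ _
      simp only [this]
      ext
      · rfl
      · simp
    right_inv := by
      rintro ⟨g, x⟩
      ext
      · simp
      · simp }
  have := Nat.card_congr e
  rw [Nat.card_prod, Nat.card_prod, hc] at this
  have : Finite (MulAction.stabilizer G y0) := inferInstance
  exact Nat.eq_of_mul_eq_mul_right (Nat.card_pos (α := MulAction.stabilizer G y0)) ‹_›

variable {R : Type*} [CommRing R]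

abbrev SL (R : Type*) [CommRing R] := Matrix.SpecialLinearGroup (Fin 2) R

lemma SL_det (g : SL R) : g 0 0 * g 1 1 - g 0 1 * g 1 0 = 1 := by
  have := g.det_coe; rw [Matrix.det_fin_two] at this; exact this

def mkSL (x s y w : R) (h : x * w - s * y = 1) : SL R := ⟨!![x, y; s, w], by
  rw [Matrix.det_fin_two]; simp; linear_combination h⟩

/-- quadratic forms `A x² + (2 β + ε) x y + C y²` -/
def Qf (_ : R) := R × R × R

instance (ε : R) : MulAction (SL R) (Qf ε) where
  smul g q := (q.1 * g 0 0 ^ 2 + (2 * q.2.1 + ε) * g 0 0 * g 0 1 + q.2.2 * g 0 1 ^ 2,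
    q.1 * g 0 0 * g 1 0 + q.2.1 * (g 0 0 * g 1 1 + g 1 0 * g 0 1) + ε * g 1 0 * g 0 1 + q.2.2 * g 0 1 * g 1 1,
    q.1 * g 1 0 ^ 2 + (2 * q.2.1 + ε) * g 1 0 * g 1 1 + q.2.2 * g 1 1 ^ 2)
  one_smul q := by
    rcases q with ⟨A, β, C⟩
    refine Prod.ext ?_ (Prod.ext ?_ ?_)
    · show A * (1 : SL R) 0 0 ^ 2 + (2 * β + ε) * (1 : SL R) 0 0 * (1 : SL R) 0 1 + C * (1 : SL R) 0 1 ^ 2 = A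
      simp
    · show A * (1 : SL R) 0 0 * (1 : SL R) 1 0 + β * ((1 : SL R) 0 0 * (1 : SL R) 1 1 + (1 : SL R) 1 0 * (1 : SL R) 0 1)
        + ε * (1 : SL R) 1 0 * (1 : SL R) 0 1 + C * (1 : SL R) 0 1 * (1 : SL R) 1 1 = β
      simp
    · show A * (1 : SL R) 1 0 ^ 2 + (2 * β + ε) * (1 : SL R) 1 0 * (1 : SL R) 1 1 + C * (1 : SL R) 1 1 ^ 2 = C
      simp
  mul_smul g h q := by
    rcases q with ⟨A, β, C⟩
    have hd := SL_det h
    have e00 : (g * h) 0 0 = g 0 0 * h 0 0 + g 0 1 * h 1 0 := by simp [Matrix.mul_apply, Fin.sum_univ_two]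
    have e01 : (g * h) 0 1 = g 0 0 * h 0 1 + g 0 1 * h 1 1 := by simp [Matrix.mul_apply, Fin.sum_univ_two]
    have e10 : (g * h) 1 0 = g 1 0 * h 0 0 + g 1 1 * h 1 0 := by simp [Matrix.mul_apply, Fin.sum_univ_two]
    have e11 : (g * h) 1 1 = g 1 0 * h 0 1 + g 1 1 * h 1 1 := by simp [Matrix.mul_apply, Fin.sum_univ_two]
    refine Prod.ext ?_ (Prod.ext ?_ ?_)
    · show A * (g * h) 0 0 ^ 2 + (2 * β + ε) * (g * h) 0 0 * (g * h) 0 1 + C * (g * h) 0 1 ^ 2 =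
        (A * h 0 0 ^ 2 + (2 * β + ε) * h 0 0 * h 0 1 + C * h 0 1 ^ 2) * g 0 0 ^ 2 +
        (2 * (A * h 0 0 * h 1 0 + β * (h 0 0 * h 1 1 + h 1 0 * h 0 1) + ε * h 1 0 * h 0 1 + C * h 0 1 * h 1 1) + ε)
          * g 0 0 * g 0 1 + (A * h 1 0 ^ 2 + (2 * β + ε) * h 1 0 * h 1 1 + C * h 1 1 ^ 2) * g 0 1 ^ 2
      rw [e00, e01]
      linear_combination ε * g 0 0 * g 0 1 * hd
    · show A * (g * h) 0 0 * (g * h) 1 0 + β * ((g * h) 0 0 * (g * h) 1 1 + (g * h) 1 0 * (g * h) 0 1)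
        + ε * (g * h) 1 0 * (g * h) 0 1 + C * (g * h) 0 1 * (g * h) 1 1 =
        (A * h 0 0 ^ 2 + (2 * β + ε) * h 0 0 * h 0 1 + C * h 0 1 ^ 2) * g 0 0 * g 1 0 +
        (A * h 0 0 * h 1 0 + β * (h 0 0 * h 1 1 + h 1 0 * h 0 1) + ε * h 1 0 * h 0 1 + C * h 0 1 * h 1 1)
          * (g 0 0 * g 1 1 + g 1 0 * g 0 1) + ε * g 1 0 * g 0 1
          + (A * h 1 0 ^ 2 + (2 * β + ε) * h 1 0 * h 1 1 + C * h 1 1 ^ 2) * g 0 1 * g 1 1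
      rw [e00, e01, e10, e11]
      linear_combination ε * g 1 0 * g 0 1 * hd
    · show A * (g * h) 1 0 ^ 2 + (2 * β + ε) * (g * h) 1 0 * (g * h) 1 1 + C * (g * h) 1 1 ^ 2 =
        (A * h 0 0 ^ 2 + (2 * β + ε) * h 0 0 * h 0 1 + C * h 0 1 ^ 2) * g 1 0 ^ 2 +
        (2 * (A * h 0 0 * h 1 0 + β * (h 0 0 * h 1 1 + h 1 0 * h 0 1) + ε * h 1 0 * h 0 1 + C * h 0 1 * h 1 1) + ε)
          * g 1 0 * g 1 1 + (A * h 1 0 ^ 2 + (2 * β + ε) * h 1 0 * h 1 1 + C * h 1 1 ^ 2) * g 1 1 ^ 2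
      rw [e10, e11]
      linear_combination ε * g 1 0 * g 1 1 * hd

lemma Qf_smul (ε : R) (g : SL R) (q : Qf ε) : g • q =
   (q.1 * g 0 0 ^ 2 + (2 * q.2.1 + ε) * g 0 0 * g 0 1 + q.2.2 * g 0 1 ^ 2,
    q.1 * g 0 0 * g 1 0 + q.2.1 * (g 0 0 * g 1 1 + g 1 0 * g 0 1) + ε * g 1 0 * g 0 1 + q.2.2 * g 0 1 * g 1 1,
    q.1 * g 1 0 ^ 2 + (2 * q.2.1 + ε) * g 1 0 * g 1 1 + q.2.2 * g 1 1 ^ 2) := rfl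

instance : MulAction (SL R) (V R) where
  smul g f := act (g 0 0) (g 1 0) (g 0 1) (g 1 1) f
  one_smul f := by
    show act ((1 : SL R) 0 0) ((1 : SL R) 1 0) ((1 : SL R) 0 1) ((1 : SL R) 1 1) f = f
    simpa using act_one f
  mul_smul g h f := by
    show act ((g * h) 0 0) ((g * h) 1 0) ((g * h) 0 1) ((g * h) 1 1) f =
      act (g 0 0) (g 1 0) (g 0 1) (g 1 1) (act (h 0 0) (h 1 0) (h 0 1) (h 1 1) f)
    rw [act_act]
    simp only [Matrix.SpecialLinearGroup.coe_mul, Matrix.mul_apply, Fin.sum_univ_two]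
    congr 1 <;> ring

lemma V_smul (g : SL R) (f : V R) : g • f = act (g 0 0) (g 1 0) (g 0 1) (g 1 1) f := rfl

/-- forms together with a half of the middle coefficient of the Hessian -/
def TTc (ε n : R) (p : V R × Qf ε) : Prop := p.2.1 = hA p.1 ∧ p.2.2.2 = hC p.1 ∧ 2 * p.2.2.1 + ε = hB p.1 ∧
    hA p.1 * hC p.1 - p.2.2.1 ^ 2 - ε * p.2.2.1 = n ∧ ∃ x y, IsUnit (hA p.1 * x ^ 2 + hB p.1 * x * y + hC p.1 * y ^ 2)
def TT (ε n : R) := {p : V R × Qf ε // TTc ε n p}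

lemma TTc_smul (ε n : R) (p : V R × Qf ε) (h : TTc ε n p) (g : SL R) : TTc ε n (g • p) := by
  rcases p with ⟨f, A, β, C⟩
  obtain ⟨h1, h2, h3, h4, u, v, hu⟩ := h
  have hd := SL_det g
  simp only at h1 h2 h3 h4 hu
  have hd' : g 0 0 * g 1 1 - g 1 0 * g 0 1 = 1 := by linear_combination hd
  have eA : hA (g • f) = hA f * g 0 0 ^ 2 + hB f * g 0 0 * g 0 1 + hC f * g 0 1 ^ 2 := by
    rw [V_smul, hA_act, hd']; ring
  have eB : hB (g • f) = 2 * hA f * g 0 0 * g 1 0 + hB f * (g 0 0 * g 1 1 + g 1 0 * g 0 1) + 2 * hC f * g 0 1 * g 1 1 := by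
    rw [V_smul, hB_act, hd']; ring
  have eC : hC (g • f) = hA f * g 1 0 ^ 2 + hB f * g 1 0 * g 1 1 + hC f * g 1 1 ^ 2 := by
    rw [V_smul, hC_act, hd']; ring
  refine ⟨?_, ?_, ?_, ?_, u * g 1 1 - v * g 1 0, v * g 0 0 - u * g 0 1, ?_⟩
  · show A * g 0 0 ^ 2 + (2 * β + ε) * g 0 0 * g 0 1 + C * g 0 1 ^ 2 = hA (g • f)
    rw [eA, ← h3, h1, h2]
  · show A * g 1 0 ^ 2 + (2 * β + ε) * g 1 0 * g 1 1 + C * g 1 1 ^ 2 = hC (g • f)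
    rw [eC, ← h3, h1, h2]
  · show 2 * (A * g 0 0 * g 1 0 + β * (g 0 0 * g 1 1 + g 1 0 * g 0 1) + ε * g 1 0 * g 0 1 + C * g 0 1 * g 1 1) + ε = hB (g • f)
    rw [eB, ← h3, ← h1, ← h2]
    linear_combination -ε * hd
  · show hA (g • f) * hC (g • f) - (A * g 0 0 * g 1 0 + β * (g 0 0 * g 1 1 + g 1 0 * g 0 1) + ε * g 1 0 * g 0 1 + C * g 0 1 * g 1 1) ^ 2
      - ε * (A * g 0 0 * g 1 0 + β * (g 0 0 * g 1 1 + g 1 0 * g 0 1) + ε * g 1 0 * g 0 1 + C * g 0 1 * g 1 1) = n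
    rw [eA, eC, ← h3, ← h1, ← h2]
    rw [← h1, ← h2] at h4
    set d := g 0 0 * g 1 1 - g 0 1 * g 1 0 with hdd
    have key : (A * g 0 0 ^ 2 + (2 * β + ε) * g 0 0 * g 0 1 + C * g 0 1 ^ 2) * (A * g 1 0 ^ 2 + (2 * β + ε) * g 1 0 * g 1 1 + C * g 1 1 ^ 2)
      - (A * g 0 0 * g 1 0 + β * (g 0 0 * g 1 1 + g 1 0 * g 0 1) + ε * g 1 0 * g 0 1 + C * g 0 1 * g 1 1) ^ 2
      - ε * d * (A * g 0 0 * g 1 0 + β * (g 0 0 * g 1 1 + g 1 0 * g 0 1) + ε * g 1 0 * g 0 1 + C * g 0 1 * g 1 1)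
      = (A * C - β ^ 2 - ε * β) * d ^ 2 := by rw [hdd]; ring
    rw [hd] at key
    linear_combination key + h4
  · show IsUnit (hA (g • f) * (u * g 1 1 - v * g 1 0) ^ 2 + hB (g • f) * (u * g 1 1 - v * g 1 0) * (v * g 0 0 - u * g 0 1) + hC (g • f) * (v * g 0 0 - u * g 0 1) ^ 2)
    convert hu using 1
    rw [eA, eB, eC]
    have key : (hA f * g 0 0 ^ 2 + hB f * g 0 0 * g 0 1 + hC f * g 0 1 ^ 2) * (u * g 1 1 - v * g 1 0) ^ 2 + (2 * hA f * g 0 0 * g 1 0 + hB f * (g 0 0 * g 1 1 + g 1 0 * g 0 1) + 2 * hC f * g 0 1 * g 1 1) * (u * g 1 1 - v * g 1 0) * (v * g 0 0 - u * g 0 1) + (hA f * g 1 0 ^ 2 + hB f * g 1 0 * g 1 1 + hC f * g 1 1 ^ 2) * (v * g 0 0 - u * g 0 1) ^ 2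
      = (hA f * u ^ 2 + hB f * u * v + hC f * v ^ 2) * (g 0 0 * g 1 1 - g 0 1 * g 1 0) ^ 2 := by ring
    rw [key, hd]; ring

instance (ε n : R) : MulAction (SL R) (TT ε n) where
  smul g p := ⟨g • p.1, TTc_smul ε n p.1 p.2 g⟩
  one_smul p := Subtype.ext (one_smul _ _)
  mul_smul g h p := Subtype.ext (mul_smul _ _ _)

lemma TT_smul (ε n : R) (g : SL R) (p : TT ε n) : (g • p).1 = g • p.1 := rfl

/-- completing a vector on which the form takes a unit value -/
lemma complete (ε : R) (q : Qf ε) (x y : R) (h : IsUnit (q.1 * x ^ 2 + (2 * q.2.1 + ε) * x * y + q.2.2 * y ^ 2)) :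
    ∃ g : SL R, (g • q).1 = q.1 * x ^ 2 + (2 * q.2.1 + ε) * x * y + q.2.2 * y ^ 2 ∧ (g • q).2.1 = 0 := by
  obtain ⟨u, hu⟩ := h
  have hui : (↑u⁻¹ : R) * (q.1 * x ^ 2 + (2 * q.2.1 + ε) * x * y + q.2.2 * y ^ 2) = 1 := by rw [← hu]; simp
  refine ⟨mkSL x (-(q.2.1 * x + q.2.2 * y) * ↑u⁻¹) y ((q.1 * x + (q.2.1 + ε) * y) * ↑u⁻¹) ?_, ?_, ?_⟩
  · linear_combination hui
  · rfl
  · rw [Qf_smul]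
    simp [mkSL]
    ring

lemma exists_to_base (ε n : R) (t : TT ε n) : ∃ g : SL R, g • t.1.2 = ((1, 0, n) : Qf ε) := by
  obtain ⟨x, y, hxy⟩ := t.2.2.2.2.2
  obtain ⟨g, hg1, hg2⟩ := complete ε t.1.2 x y (by
    rw [t.2.1, t.2.2.1, t.2.2.2.1]; exact hxy)
  have hu : IsUnit (hA (g • t).1.1) := by
    rw [← (g • t).2.1]
    show IsUnit (g • t.1.2).1
    rw [hg1, t.2.1, t.2.2.1, t.2.2.2.1]; exact hxy
  obtain ⟨u, hu⟩ := hu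
  set f := (g • t).1.1 with hf
  have hui : (↑u⁻¹ : R) * hA f = 1 := by rw [← hu]; simp
  set v : R := ↑u⁻¹ with hv
  have hrep : hA f * (v * f 1 - v ^ 2 * f 0 * hB f) ^ 2 + hB f * (v * f 1 - v ^ 2 * f 0 * hB f) * (v * f 0) +
      hC f * (v * f 0) ^ 2 = 1 := by
    have e1 : hA f * f 1 ^ 2 - hB f * f 0 * f 1 + hC f * f 0 ^ 2 = hA f ^ 2 := by simp [hA, hB, hC]; ring
    have hv2 : v ^ 2 * hA f ^ 2 = 1 := by rw [← mul_pow, hui, one_pow]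
    linear_combination v ^ 2 * e1 + hv2 + (v ^ 3 * f 0 ^ 2 * hB f ^ 2 - 2 * v ^ 2 * f 0 * f 1 * hB f) * hui
  obtain ⟨g', hg1', hg2'⟩ := complete ε (g • t).1.2 (v * f 1 - v ^ 2 * f 0 * hB f) (v * f 0) (by
    rw [(g • t).2.1, (g • t).2.2.1, (g • t).2.2.2.1, ← hf, hrep]; exact isUnit_one)
  rw [(g • t).2.1, (g • t).2.2.1, (g • t).2.2.2.1, ← hf, hrep] at hg1'
  refine ⟨g' * g, ?_⟩
  rw [mul_smul]
  have hT := (g' • g • t).2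
  have e2 : (g' • g • t).1.2 = g' • g • t.1.2 := rfl
  have e3 : (g • t).1.2 = g • t.1.2 := rfl
  rw [e3] at hg1' hg2'
  refine Prod.ext hg1' (Prod.ext hg2' ?_)
  have h4 := hT.2.2.2.1
  rw [← hT.1, ← hT.2.1, e2, hg1', hg2'] at h4
  show (g' • g • t.1.2).2.2 = n
  linear_combination h4

def q0 (ε n : R) : Qf ε := (1, 0, n)

set_option maxHeartbeats 1000000 in
theorem card_TT (ε n : R) [Finite R] : Nat.card (TT ε n) = Nat.card (SL R) := by
  refine card_of_orbit (fun t : TT ε n => t.1.2) (fun g t => rfl) (q0 ε n) (exists_to_base ε n) ?_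
  refine Nat.card_congr (Equiv.ofBijective (fun t => ⟨mkSL (t.1.1.1 1) (n * t.1.1.1 0) (-t.1.1.1 0) (t.1.1.1 1 - ε * t.1.1.1 0) ?_, ?_⟩) ⟨?_, ?_⟩)
  · obtain ⟨⟨⟨f, q⟩, ht⟩, hq⟩ := t
    dsimp only at hq ⊢
    subst hq
    obtain ⟨h1, h2, h3, h4, -⟩ := ht
    simp only [q0] at h1 h2 h3 h4
    have e1 : hA f * f 1 ^ 2 - hB f * f 0 * f 1 + hC f * f 0 ^ 2 = hA f ^ 2 := by simp [hA, hB, hC]; ring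
    rw [← h1, ← h2, ← h3] at e1
    linear_combination e1
  · obtain ⟨⟨⟨f, q⟩, ht⟩, hq⟩ := t
    dsimp only at hq ⊢
    subst hq
    obtain ⟨h1, h2, h3, h4, -⟩ := ht
    simp only [q0] at h1 h2 h3 h4
    have e1 : hA f * f 1 ^ 2 - hB f * f 0 * f 1 + hC f * f 0 ^ 2 = hA f ^ 2 := by simp [hA, hB, hC]; ring
    rw [← h1, ← h2, ← h3] at e1
    rw [MulAction.mem_stabilizer_iff, Qf_smul]
    simp only [mkSL, q0]
    refine Prod.ext ?_ (Prod.ext ?_ ?_)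
    · simp; linear_combination e1
    · simp; ring
    · simp; linear_combination n * e1
  · rintro ⟨⟨⟨f, q⟩, ht⟩, hq⟩ ⟨⟨⟨f', q'⟩, ht'⟩, hq'⟩ h
    dsimp only at hq hq'
    subst hq; subst hq'
    have hm : !![f 1, -f 0; n * f 0, f 1 - ε * f 0] = !![f' 1, -f' 0; n * f' 0, f' 1 - ε * f' 0] :=
      congrArg (fun z => (z.1.1 : Matrix (Fin 2) (Fin 2) R)) h
    have h1 : f 1 = f' 1 := by simpa using congrFun (congrFun hm 0) 0
    have h0 : f 0 = f' 0 := by simpa using congrFun (congrFun hm 0) 1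
    obtain ⟨a1, a2, a3, -⟩ := ht
    obtain ⟨b1, b2, b3, -⟩ := ht'
    simp only [q0] at a1 a2 a3 b1 b2 b3
    have s1 := syz1 f; have s2 := syz2 f
    have s1' := syz1 f'; have s2' := syz2 f'
    rw [← a1, ← a2, ← a3] at s1 s2
    rw [← b1, ← b2, ← b3] at s1' s2'
    have h2 : f 2 = f' 2 := by
      linear_combination s1 - s1' - n * h0 + ε * h1
    have h3 : f 3 = f' 3 := by
      linear_combination s2 - s2' - n * h1 + ε * h2
    have : f = f' := by funext i; fin_cases i <;> assumption
    subst this; rfl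
  · rintro ⟨g, hg⟩
    rw [MulAction.mem_stabilizer_iff, Qf_smul] at hg
    have g1 : 1 * g 0 0 ^ 2 + (2 * 0 + ε) * g 0 0 * g 0 1 + n * g 0 1 ^ 2 = 1 := congrArg Prod.fst hg
    have g2 : 1 * g 0 0 * g 1 0 + 0 * (g 0 0 * g 1 1 + g 1 0 * g 0 1) + ε * g 1 0 * g 0 1 + n * g 0 1 * g 1 1 = 0 := congrArg (fun z : R × R × R => z.2.1) hg
    have hd := SL_det g
    have e10 : g 1 0 = -n * g 0 1 := by linear_combination (-g 1 0) * g1 + g 0 0 * g2 - n * g 0 1 * hd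
    have e11 : g 1 1 = g 0 0 + ε * g 0 1 := by linear_combination (-g 1 1) * g1 + g 0 1 * g2 + (g 0 0 + ε * g 0 1) * hd
    set x := g 0 0 with hx
    set y := g 0 1 with hy
    have k1 : hA (![-y, x, x * ε + y * n, (x * ε + y * n) * ε - x * n] : V R) = 1 := by
      simp [hA]; linear_combination g1
    have k2 : hB (![-y, x, x * ε + y * n, (x * ε + y * n) * ε - x * n] : V R) = ε := by
      simp [hB]; linear_combination ε * g1
    have k3 : hC (![-y, x, x * ε + y * n, (x * ε + y * n) * ε - x * n] : V R) = n := by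
      simp [hC]; linear_combination n * g1
    refine ⟨⟨⟨(![-y, x, x * ε + y * n, (x * ε + y * n) * ε - x * n], q0 ε n), k1.symm, k3.symm, ?_, ?_, 1, 0, ?_⟩, rfl⟩, ?_⟩
    · rw [k2]; simp [q0]
    · rw [k1, k3]; simp [q0]
    · rw [k1]; simp
    · apply Subtype.ext
      apply Subtype.ext
      funext i j
      fin_cases i <;> fin_cases j
      · rfl
      · show - -y = y
        ring
      · show n * -y = g 1 0
        rw [e10]; ring
      · show x - ε * -y = g 1 1
        rw [e11]; ring

end
end PTM


/-! ### Local densities -/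
namespace PTM
open Set Filter

section
variable {R : Type*} [CommRing R]

lemma card_SL_local [IsLocalRing R] [Finite R] : Nat.card (SL R) =
    Nat.card Rˣ * Nat.card R * (Nat.card R + Nat.card {x : R // ¬ IsUnit x}) := by
  have key : Nat.card ((Rˣ × R × R) ⊕ ({x : R // ¬ IsUnit x} × R × Rˣ)) = Nat.card (SL R) := by
    refine Nat.card_congr (Equiv.ofBijective (Sum.elim
      (fun t => mkSL t.1 t.2.1 t.2.2 (↑t.1⁻¹ * (1 + t.2.1 * t.2.2)) (by
        rw [← mul_assoc, Units.mul_inv]; ring))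
      (fun t => mkSL t.1.1 t.2.2 ((t.1.1 * t.2.1 - 1) * ↑t.2.2⁻¹) t.2.1 (by
        have := Units.mul_inv t.2.2
        linear_combination (-(t.1.1 * t.2.1 - 1)) * this))) ⟨?_, ?_⟩)
    · have hx : ∀ g g' : SL R, g = g' →
          g.1 0 0 = g'.1 0 0 ∧ g.1 1 0 = g'.1 1 0 ∧ g.1 0 1 = g'.1 0 1 ∧ g.1 1 1 = g'.1 1 1 := by
        rintro g g' rfl
        exact ⟨rfl, rfl, rfl, rfl⟩
      rintro (⟨u, s, y⟩ | ⟨⟨x, hx'⟩, w, s⟩) (⟨u', s', y'⟩ | ⟨⟨x', hx''⟩, w', s'⟩) h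
      · obtain ⟨h1, h2, h3, h4⟩ := hx _ _ h
        change (u : R) = u' at h1
        change s = s' at h2
        change y = y' at h3
        rw [Units.ext h1, h2, h3]
      · obtain ⟨h1, h2, h3, h4⟩ := hx _ _ h
        change (u : R) = x' at h1
        exact absurd (h1 ▸ u.isUnit) hx''
      · obtain ⟨h1, h2, h3, h4⟩ := hx _ _ h
        change x = u' at h1
        exact absurd (h1 ▸ u'.isUnit) hx'
      · obtain ⟨h1, h2, h3, h4⟩ := hx _ _ h
        change x = x' at h1
        change (s : R) = s' at h2
        change w = w' at h4
        subst h1; subst h4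
        rw [Units.ext h2]
    · intro g
      have hd := SL_det g
      by_cases hu : IsUnit (g 0 0)
      · obtain ⟨u, hu⟩ := hu
        refine ⟨Sum.inl (u, g 1 0, g 0 1), ?_⟩
        apply Subtype.ext
        funext i j
        fin_cases i <;> fin_cases j
        · exact hu
        · rfl
        · rfl
        · show ↑u⁻¹ * (1 + g 1 0 * g 0 1) = g 1 1
          have := Units.inv_mul u
          rw [hu] at this
          linear_combination g 1 1 * this - ↑u⁻¹ * hd
      · have h1 : IsUnit (g 1 0) := by
          by_contra h
          have h2 : ¬ IsUnit (g 0 0 * g 1 1) := fun h => hu (isUnit_of_mul_isUnit_left h)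
          have h3 : ¬ IsUnit (-(g 0 1 * g 1 0)) := fun h' => h (isUnit_of_mul_isUnit_right ((IsUnit.neg_iff _).1 h'))
          have := IsLocalRing.nonunits_add h2 h3
          apply this
          rw [← sub_eq_add_neg, hd]; exact isUnit_one
        obtain ⟨u, hu'⟩ := h1
        refine ⟨Sum.inr (⟨g 0 0, hu⟩, g 1 1, u), ?_⟩
        apply Subtype.ext
        funext i j
        fin_cases i <;> fin_cases j
        · rfl
        · show (g 0 0 * g 1 1 - 1) * ↑u⁻¹ = g 0 1
          have := Units.mul_inv u
          rw [hu'] at this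
          linear_combination g 0 1 * this + ↑u⁻¹ * hd
        · exact hu'
        · rfl
  rw [← key, Nat.card_sum, Nat.card_prod, Nat.card_prod, Nat.card_prod, Nat.card_prod]
  ring

lemma card_nonunits [Finite R] : Nat.card Rˣ + Nat.card {x : R // ¬ IsUnit x} = Nat.card R := by
  have e : Nat.card Rˣ = Nat.card {x : R // IsUnit x} := by
    refine Nat.card_congr (Equiv.ofBijective (fun u => ⟨u, u.isUnit⟩) ⟨?_, ?_⟩)
    · intro u v h; exact Units.ext (congrArg Subtype.val h)
    · rintro ⟨x, u, rfl⟩; exact ⟨u, rfl⟩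
  rw [e, ← Nat.card_sum]
  exact Nat.card_congr (Equiv.sumCompl _)

lemma local_zmod (q k : ℕ) [hq : Fact q.Prime] (hk : k ≠ 0) : IsLocalRing (ZMod (q ^ k)) := by
  have : Fact (1 < q ^ k) := ⟨Nat.one_lt_pow hk hq.1.one_lt⟩
  exact IsLocalRing.of_surjective' (PadicInt.toZModPow (p := q) k) (ZMod.ringHom_surjective _)

lemma card_units_pow (q k : ℕ) [hq : Fact q.Prime] (hk : k ≠ 0) :
    (Nat.card (ZMod (q ^ k))ˣ : ℝ) = q ^ k * (1 - 1 / q) := by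
  have : NeZero (q ^ k) := ⟨pow_ne_zero _ hq.1.ne_zero⟩
  have hq0 : (q : ℝ) ≠ 0 := by exact_mod_cast hq.1.ne_zero
  rw [Nat.card_eq_fintype_card, ZMod.card_units_eq_totient, Nat.totient_prime_pow hq.1 (Nat.pos_of_ne_zero hk)]
  obtain ⟨j, rfl⟩ := Nat.exists_eq_succ_of_ne_zero hk
  push_cast [Nat.cast_sub hq.1.one_le]
  simp only [Nat.succ_eq_add_one, Nat.add_sub_cancel]
  field_simp
  try ring

lemma card_SL_pow (q k : ℕ) [hq : Fact q.Prime] (hk : k ≠ 0) :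
    (Nat.card (SL (ZMod (q ^ k))) : ℝ) = (q ^ k) ^ 3 * (1 - 1 / q ^ 2) := by
  have : NeZero (q ^ k) := ⟨pow_ne_zero _ hq.1.ne_zero⟩
  have hq0 : (q : ℝ) ≠ 0 := by exact_mod_cast hq.1.ne_zero
  have := local_zmod q k hk
  have h1 := card_nonunits (R := ZMod (q ^ k))
  have h2 := card_units_pow q k hk
  have h3 : (Nat.card (ZMod (q ^ k)) : ℝ) = q ^ k := by simp
  have h1' : (Nat.card (ZMod (q ^ k))ˣ : ℝ) + Nat.card {x : ZMod (q ^ k) // ¬ IsUnit x} = Nat.card (ZMod (q ^ k)) := by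
    exact_mod_cast h1
  rw [card_SL_local]
  push_cast
  rw [show (Nat.card {x : ZMod (q ^ k) // ¬ IsUnit x} : ℝ) = q ^ k - q ^ k * (1 - 1 / q) by linarith]
  rw [h3, h2]
  field_simp
  try ring

/-- number of solutions of `m x = w` -/
lemma card_ker_fiber [Finite R] (m w : R) (h : ∃ x, m * x = w) :
    Nat.card {x : R // m * x = w} = Nat.card {x : R // m * x = 0} := by
  obtain ⟨x0, rfl⟩ := h
  refine Nat.card_congr ⟨fun x => ⟨x.1 - x0, by rw [mul_sub, x.2, sub_self]⟩,
    fun x => ⟨x.1 + x0, by rw [mul_add, x.2, zero_add]⟩, fun x => by simp, fun x => by simp⟩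

lemma card_hD [Finite R] (ε z : R) (hε : ε ^ 2 = ε) (hn : ∃ n, 4 * n = ε - z)
    (h : ∀ f : V R, hD f = z → (∃ β, 2 * β + ε = hB f) ∧
      ∃ x y, IsUnit (hA f * x ^ 2 + hB f * x * y + hC f * y ^ 2)) :
    Nat.card {f : V R // hD f = z} * Nat.card {x : R // 2 * x = 0} =
      Nat.card {x : R // 4 * x = 0} * Nat.card (SL R) := by
  have e1 : Nat.card (Σ n : {n : R // 4 * n = ε - z}, TT ε n.1) =
      Nat.card (Σ f : {f : V R // hD f = z}, {β : R // 2 * β = hB f.1 - ε}) := by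
    refine Nat.card_congr (Equiv.ofBijective (fun t => ⟨⟨t.2.1.1, ?_⟩, ⟨t.2.1.2.2.1, ?_⟩⟩) ⟨?_, ?_⟩)
    · obtain ⟨⟨n, hn⟩, ⟨⟨f, q⟩, h1, h2, h3, h4, -⟩⟩ := t
      dsimp only at h1 h2 h3 h4 ⊢
      rw [hD, ← h3]
      linear_combination -4 * h4 - hn + hε
    · obtain ⟨⟨n, hn⟩, ⟨⟨f, q⟩, h1, h2, h3, h4, -⟩⟩ := t
      dsimp only at h1 h2 h3 h4 ⊢
      linear_combination h3
    · rintro ⟨⟨n, hn⟩, ⟨⟨f, A, β, C⟩, ht⟩⟩ ⟨⟨n', hn'⟩, ⟨⟨f', A', β', C'⟩, ht'⟩⟩ he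
      have hf : f = f' := congrArg (fun z => z.1.1) he
      have hb : β = β' := congrArg (fun z => z.2.1) he
      have ht2 := ht; have ht2' := ht'
      obtain ⟨h1, h2, h3, h4, -⟩ := ht2
      obtain ⟨h1', h2', h3', h4', -⟩ := ht2'
      dsimp only at h1 h2 h3 h4 h1' h2' h3' h4'
      subst hf hb
      have hA' : A = A' := by rw [h1, h1']
      have hC' : C = C' := by rw [h2, h2']
      have hnn : n = n' := by rw [← h4, ← h4']
      subst hA' hC' hnn
      rfl
    · rintro ⟨⟨f, hf⟩, ⟨β, hβ⟩⟩
      dsimp only at hβ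
      refine ⟨⟨⟨hA f * hC f - β ^ 2 - ε * β, ?_⟩, ⟨⟨f, (hA f, β, hC f)⟩, rfl, rfl, ?_, rfl, (h f hf).2⟩⟩, rfl⟩
      · rw [hD, show hB f = 2 * β + ε by rw [hβ]; ring] at hf
        linear_combination -hf + hε
      · show 2 * β + ε = hB f
        rw [hβ]; ring
  have f1 : Finite {n : R // 4 * n = ε - z} := inferInstance
  have : ∀ n : R, Finite (TT ε n) := fun n => by
    have : Finite (Qf ε) := inferInstanceAs (Finite (R × R × R))
    unfold TT; infer_instance
  have := Fintype.ofFinite {n : R // 4 * n = ε - z}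
  have := Fintype.ofFinite {f : V R // hD f = z}
  rw [Nat.card_sigma, Nat.card_sigma] at e1
  rw [Finset.sum_congr rfl (fun n _ => card_TT ε n.1)] at e1
  have : ∀ f : {f : V R // hD f = z}, Nat.card {β : R // 2 * β = hB f.1 - ε} = Nat.card {x : R // 2 * x = 0} := by
    intro f
    apply card_ker_fiber
    obtain ⟨β, hβ⟩ := (h f.1 f.2).1
    exact ⟨β, by rw [← hβ]; ring⟩
  rw [Finset.sum_congr rfl (fun f _ => this f)] at e1
  simp only [Finset.sum_const, Finset.card_univ, smul_eq_mul, ← Nat.card_eq_fintype_card] at e1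
  rw [card_ker_fiber 4 _ hn] at e1
  exact e1.symm
end

lemma card_ker_zmod (N d : ℕ) [NeZero N] : Nat.card {x : ZMod N // (d : ZMod N) * x = 0} = Nat.gcd N d := by
  have := IsAddCyclic.card_nsmulAddMonoidHom_ker (G := ZMod N) d
  rw [Nat.card_zmod] at this
  rw [← this]
  refine Nat.card_congr (Equiv.subtypeEquivRight fun x => ?_)
  simp [AddMonoidHom.mem_ker]

/-- The `κ`-factor numerators. -/
def cq (q : ℕ) : ℕ := if q = 2 then 2 else 1

/-- integers with good discriminant residue at `q` -/
def good (q : ℕ) (z : ℤ) : Prop := if q = 2 then z % 4 = 1 ∨ z % 16 = 8 ∨ z % 16 = 12 else ¬ ((q : ℤ) ^ 2 ∣ z)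

lemma good_prim (q : ℕ) [hq : Fact q.Prime] (A B C : ℤ) (h : good q (B ^ 2 - 4 * A * C)) :
    ¬ (q : ℤ) ∣ A ∨ ¬ (q : ℤ) ∣ B ∨ ¬ (q : ℤ) ∣ C := by
  by_contra hc
  push Not at hc
  obtain ⟨⟨a, rfl⟩, ⟨b, rfl⟩, ⟨c, rfl⟩⟩ := hc
  unfold good at h
  split_ifs at h with h2
  · subst h2
    have e : ((2:ℕ) * b : ℤ) ^ 2 - 4 * ((2:ℕ) * a) * ((2:ℕ) * c) = 4 * (b ^ 2 - 4 * (a * c)) := by push_cast; ring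
    rw [e] at h
    have hb : b ^ 2 % 4 = 0 ∨ b ^ 2 % 4 = 1 := by
      rcases Int.even_or_odd' b with ⟨t, rfl | rfl⟩
      · left; ring_nf; omega
      · right; ring_nf; omega
    generalize b ^ 2 = x at *
    generalize a * c = y at *
    omega
  · apply h
    exact ⟨b ^ 2 - 4 * a * c, by ring⟩

lemma isUnit_zmod (q k : ℕ) [hq : Fact q.Prime] (hk : k ≠ 0) (a : ℤ) :
    IsUnit (a : ZMod (q ^ k)) ↔ ¬ (q : ℤ) ∣ a := by
  rw [ZMod.coe_int_isUnit_iff_isCoprime]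
  push_cast
  rw [IsCoprime.pow_left_iff (Nat.pos_of_ne_zero hk), Int.isCoprime_iff_gcd_eq_one]
  have hp : Prime (q : ℤ) := Nat.prime_iff_prime_int.1 hq.1
  rw [← Int.isCoprime_iff_gcd_eq_one]
  exact Irreducible.coprime_iff_not_dvd hp.irreducible

lemma prim_unit (q k : ℕ) [hq : Fact q.Prime] (hk : k ≠ 0) (A B C : ℤ)
    (h : ¬ (q : ℤ) ∣ A ∨ ¬ (q : ℤ) ∣ B ∨ ¬ (q : ℤ) ∣ C) :
    ∃ x y : ZMod (q ^ k), IsUnit ((A : ZMod (q ^ k)) * x ^ 2 + B * x * y + C * y ^ 2) := by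
  by_cases hA : (q : ℤ) ∣ A
  · by_cases hC : (q : ℤ) ∣ C
    · have hB : ¬ (q : ℤ) ∣ B := by tauto
      refine ⟨1, 1, ?_⟩
      have : ¬ (q : ℤ) ∣ A + B + C := by
        intro h; apply hB
        have := Int.dvd_sub (Int.dvd_sub h hA) hC
        ring_nf at this; exact this
      have := (isUnit_zmod q k hk _).2 this
      push_cast at this; simpa using this
    · exact ⟨0, 1, by simpa using (isUnit_zmod q k hk _).2 hC⟩
  · exact ⟨1, 0, by simpa using (isUnit_zmod q k hk _).2 hA⟩

theorem card_good (q k : ℕ) [hq : Fact q.Prime] (hk : 2 ≤ k) (hk2 : q = 2 → 4 ≤ k) (z : ℤ) (hz : good q z) :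
    Nat.card {f : V (ZMod (q ^ k)) // hD f = (z : ZMod (q ^ k))} = cq q * Nat.card (SL (ZMod (q ^ k))) := by
  have : NeZero (q ^ k) := ⟨pow_ne_zero _ hq.1.ne_zero⟩
  have hk0 : k ≠ 0 := by omega
  have lift : ∀ f : V (ZMod (q ^ k)), hD f = (z : ZMod (q ^ k)) → ∃ g : V ℤ, red (q ^ k) g = f ∧
      ((q : ℤ) ^ k) ∣ hD g - z := by
    intro f hf
    obtain ⟨g, rfl⟩ := red_surj (q ^ k) f
    refine ⟨g, rfl, ?_⟩
    rw [red, hD_fmap] at hf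
    have : ((hD g - z : ℤ) : ZMod (q ^ k)) = 0 := by push_cast; exact sub_eq_zero.2 hf
    rw [ZMod.intCast_zmod_eq_zero_iff_dvd] at this
    exact_mod_cast this
  have prim : ∀ f : V (ZMod (q ^ k)), hD f = (z : ZMod (q ^ k)) →
      ∃ x y, IsUnit (hA f * x ^ 2 + hB f * x * y + hC f * y ^ 2) := by
    intro f hf
    obtain ⟨g, rfl, hg⟩ := lift f hf
    rw [red, hA_fmap, hB_fmap, hC_fmap]
    apply prim_unit q k hk0
    apply good_prim
    change good q (hD g)
    unfold good at hz ⊢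
    split_ifs at hz ⊢ with h2
    · have : (16 : ℤ) ∣ hD g - z := by
        refine dvd_trans ?_ hg
        rw [h2]
        exact pow_dvd_pow (2:ℤ) (hk2 h2)
      omega
    · intro h
      apply hz
      have h3 : (q : ℤ) ^ 2 ∣ hD g - z := dvd_trans (pow_dvd_pow _ hk) hg
      have := Int.dvd_sub h h3
      simpa using this
  have k2 := card_ker_zmod (q ^ k) 2
  have k4 := card_ker_zmod (q ^ k) 4
  push_cast at k2 k4
  by_cases h2 : q = 2
  · subst h2
    have hk4 := hk2 rfl
    have hz' : z % 4 = 1 ∨ z % 16 = 8 ∨ z % 16 = 12 := by simpa [good] using hz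
    set e : ℤ := z % 2 with he
    have hze : (4 : ℤ) ∣ e - z := by omega
    have he01 : e = 0 ∨ e = 1 := by omega
    have := card_hD (R := ZMod (2 ^ k)) (e : ZMod (2 ^ k)) (z : ZMod (2 ^ k))
      (by rcases he01 with h | h <;> simp [h]) (by
        obtain ⟨n, hn⟩ := hze
        exact ⟨n, by
          have := congrArg (Int.cast (R := ZMod (2 ^ k))) hn
          push_cast at this; exact this.symm⟩) (by
        intro f hf
        refine ⟨?_, prim f hf⟩
        obtain ⟨g, rfl, hg⟩ := lift f hf
        have h4 : (4 : ℤ) ∣ hD g - z := dvd_trans (by exact_mod_cast pow_dvd_pow 2 (show 2 ≤ k by omega)) hg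
        have hB2 : (2 : ℤ) ∣ hB g - e := by
          rw [hD, mul_assoc] at h4
          generalize hA g * hC g = w at h4
          rcases Int.even_or_odd' (hB g) with ⟨t, ht | ht⟩
          · rw [ht] at h4 ⊢
            ring_nf at h4
            omega
          · rw [ht] at h4 ⊢
            ring_nf at h4
            omega
        obtain ⟨n, hn⟩ := hB2
        refine ⟨n, ?_⟩
        rw [red, hB_fmap]
        have := congrArg (Int.cast (R := ZMod (2 ^ k))) hn
        push_cast at this
        rw [← this]; simp)
    rw [k2, k4, Nat.gcd_eq_right (by exact dvd_pow_self 2 hk0),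
      Nat.gcd_eq_right (by exact pow_dvd_pow 2 (show 2 ≤ k by omega))] at this
    simp only [cq, if_true]
    omega
  · have hodd : Nat.Coprime (q ^ k) 2 := by
      apply Nat.Coprime.pow_left
      exact (Nat.coprime_primes hq.1 Nat.prime_two).2 h2
    have hodd4 : Nat.Coprime (q ^ k) 4 := by
      have := Nat.Coprime.pow_right 2 hodd
      simpa using this
    have u2 : IsUnit ((2 : ℕ) : ZMod (q ^ k)) := (ZMod.isUnit_iff_coprime 2 _).2 hodd.symm
    have u4 : IsUnit ((4 : ℕ) : ZMod (q ^ k)) := (ZMod.isUnit_iff_coprime 4 _).2 hodd4.symm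
    have := card_hD (R := ZMod (q ^ k)) 0 (z : ZMod (q ^ k)) (by simp) (by
        obtain ⟨u, hu⟩ := u4
        refine ⟨↑u⁻¹ * (0 - z), ?_⟩
        push_cast at hu
        rw [← hu, ← mul_assoc, Units.mul_inv, one_mul]) (by
        intro f hf
        refine ⟨?_, prim f hf⟩
        obtain ⟨u, hu⟩ := u2
        refine ⟨↑u⁻¹ * hB f, ?_⟩
        push_cast at hu
        rw [← hu, ← mul_assoc, Units.mul_inv, one_mul, add_zero])
    rw [k2, k4, hodd, hodd4] at this
    simp only [cq, if_neg h2]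
    omega

end PTM


/-! ### Local density of forms whose Hessian has content `p` -/
namespace PTM
open Set Filter

section
variable (p : ℕ) [hp : Fact p.Prime]

/-- local condition for Hessians of content exactly `p` -/
def condP (f : V (ZMod (p ^ 3))) : Prop :=
  (p : ZMod (p ^ 3)) ∣ hA f ∧ (p : ZMod (p ^ 3)) ∣ hB f ∧ (p : ZMod (p ^ 3)) ∣ hC f ∧ hD f ≠ 0

lemma dvd_zmod (j : ℕ) (hj : j ≤ 3) (x : ℤ) : (p : ZMod (p ^ 3)) ^ j ∣ (x : ZMod (p ^ 3)) ↔ (p : ℤ) ^ j ∣ x := by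
  constructor
  · rintro ⟨y, hy⟩
    obtain ⟨y, rfl⟩ := ZMod.intCast_surjective y
    have : ((x - p ^ j * y : ℤ) : ZMod (p ^ 3)) = 0 := by push_cast; exact sub_eq_zero.2 hy
    rw [ZMod.intCast_zmod_eq_zero_iff_dvd] at this
    have h2 : (p : ℤ) ^ j ∣ x - p ^ j * y := dvd_trans (pow_dvd_pow _ hj) (by exact_mod_cast this)
    have := dvd_add h2 (dvd_mul_right ((p : ℤ) ^ j) y)
    simpa using this
  · rintro ⟨y, rfl⟩
    exact ⟨y, by push_cast; ring⟩

lemma nonunit_zmod (x : ZMod (p ^ 3)) : ¬ IsUnit x ↔ (p : ZMod (p ^ 3)) ∣ x := by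
  obtain ⟨x, rfl⟩ := ZMod.intCast_surjective x
  have := dvd_zmod p 1 (by norm_num) x
  rw [pow_one, pow_one] at this
  rw [this, isUnit_zmod p 3 (by norm_num), not_not]

lemma cube_zmod : (p : ZMod (p ^ 3)) ^ 3 = 0 := by
  have := ZMod.natCast_self (p ^ 3)
  push_cast at this
  exact this

lemma sq_ne (x y : ZMod (p ^ 3)) (hx : (p : ZMod (p ^ 3)) ∣ x) : (x * y) ^ 2 ≠ 0 ↔
    (¬ (p : ZMod (p ^ 3)) ^ 2 ∣ x) ∧ IsUnit y := by
  have hpp : Prime (p : ℤ) := Nat.prime_iff_prime_int.1 hp.1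
  have hp0 : (p : ℤ) ≠ 0 := hpp.ne_zero
  obtain ⟨x, rfl⟩ := ZMod.intCast_surjective x
  obtain ⟨y, rfl⟩ := ZMod.intCast_surjective y
  have h1 := dvd_zmod p 1 (by norm_num) x
  rw [pow_one, pow_one] at h1
  rw [h1] at hx
  obtain ⟨t, rfl⟩ := hx
  rw [dvd_zmod p 2 (by norm_num), isUnit_zmod p 3 (by norm_num)]
  have : (((((p : ℤ) * t : ℤ) : ZMod (p ^ 3)) * (y : ZMod (p ^ 3))) ^ 2) = (((p : ℤ) ^ 2 * ((t * y) ^ 2) : ℤ) : ZMod (p ^ 3)) := by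
    push_cast; ring
  rw [this, Ne, ZMod.intCast_zmod_eq_zero_iff_dvd]
  push_cast
  rw [show (p : ℤ) ^ 3 = p ^ 2 * p by ring, mul_dvd_mul_iff_left (pow_ne_zero 2 hp0), hpp.dvd_pow_iff_dvd (by norm_num),
    hpp.dvd_mul, pow_two, mul_dvd_mul_iff_left hp0]
  tauto

lemma card_mult (j : ℕ) (hj : j ≤ 3) : Nat.card {x : ZMod (p ^ 3) // (p : ZMod (p ^ 3)) ^ j ∣ x} = p ^ (3 - j) := by
  have : NeZero (p ^ 3) := ⟨pow_ne_zero _ hp.1.ne_zero⟩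
  have := IsAddCyclic.card_nsmulAddMonoidHom_range (G := ZMod (p ^ 3)) (p ^ j)
  rw [Nat.card_zmod, Nat.gcd_eq_right (pow_dvd_pow p hj), Nat.pow_div hj hp.1.pos] at this
  rw [← this]
  refine Nat.card_congr (Equiv.subtypeEquivRight fun x => ?_)
  rw [AddMonoidHom.mem_range]
  constructor
  · rintro ⟨y, rfl⟩; exact ⟨y, by simp⟩
  · rintro ⟨y, rfl⟩; exact ⟨y, by simp⟩

abbrev TU := {x : ZMod (p ^ 3) // IsUnit x}
abbrev TP := {x : ZMod (p ^ 3) // (p : ZMod (p ^ 3)) ∣ x}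
abbrev TQ := {x : ZMod (p ^ 3) // (p : ZMod (p ^ 3)) ∣ x ∧ ¬ (p : ZMod (p ^ 3)) ^ 2 ∣ x}

lemma card_TP : Nat.card (TP p) = p ^ 2 := by
  have := card_mult p 1 (by norm_num)
  simpa using this

lemma card_split {α : Type*} [Finite α] (P Q : α → Prop) :
    Nat.card {x // P x} = Nat.card {x // P x ∧ Q x} + Nat.card {x // P x ∧ ¬ Q x} := by
  rw [← Nat.card_sum]
  refine Nat.card_congr ((Equiv.sumCompl (fun x : {x // P x} => Q x.1)).symm.trans (Equiv.sumCongr ?_ ?_))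
  · exact Equiv.subtypeSubtypeEquivSubtypeInter _ _
  · exact Equiv.subtypeSubtypeEquivSubtypeInter _ (fun x => ¬ Q x)

lemma card_TQ : Nat.card (TQ p) + p = p ^ 2 := by
  have : NeZero (p ^ 3) := ⟨pow_ne_zero _ hp.1.ne_zero⟩
  have h := card_split (α := ZMod (p ^ 3)) (fun x => (p : ZMod (p ^ 3)) ∣ x) (fun x => (p : ZMod (p ^ 3)) ^ 2 ∣ x)
  have h2 := card_mult p 2 (by norm_num)
  have e : Nat.card {x : ZMod (p ^ 3) // (p : ZMod (p ^ 3)) ∣ x ∧ (p : ZMod (p ^ 3)) ^ 2 ∣ x} = p := by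
    rw [show (3 - 2) = 1 by norm_num, pow_one] at h2
    conv_rhs => rw [← h2]
    refine Nat.card_congr (Equiv.subtypeEquivRight fun x => ?_)
    exact and_iff_right_of_imp (fun h => dvd_trans (dvd_pow_self _ (by norm_num)) h)
  have h1 := card_TP p
  rw [e] at h
  unfold TP at h1
  rw [← h1, h, add_comm]

lemma card_TU : Nat.card (TU p) + p ^ 2 = p ^ 3 := by
  have : NeZero (p ^ 3) := ⟨pow_ne_zero _ hp.1.ne_zero⟩
  have h := card_split (α := ZMod (p ^ 3)) (fun x => True) (fun x => IsUnit x)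
  have h1 := card_TP p
  have e1 : Nat.card {x : ZMod (p ^ 3) // True ∧ IsUnit x} = Nat.card (TU p) := by simp [TU]
  have e2 : Nat.card {x : ZMod (p ^ 3) // True ∧ ¬ IsUnit x} = Nat.card (TP p) := by
    refine Nat.card_congr (Equiv.subtypeEquivRight fun x => ?_)
    rw [nonunit_zmod]; simp
  rw [e1, e2, h1] at h
  rw [← h]
  simp

lemma condP_nonunit (f : V (ZMod (p ^ 3))) (h0 : ¬ IsUnit (f 0)) : condP p f ↔
    ((p : ZMod (p ^ 3)) ∣ f 0 ∧ ¬ (p : ZMod (p ^ 3)) ^ 2 ∣ f 0) ∧ (p : ZMod (p ^ 3)) ∣ f 1 ∧ (p : ZMod (p ^ 3)) ∣ f 2 ∧ IsUnit (f 3) := by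
  have := local_zmod p 3 (by norm_num)
  have hsq : ∀ x : ZMod (p ^ 3), (p : ZMod (p ^ 3)) ∣ x ^ 2 → (p : ZMod (p ^ 3)) ∣ x := by
    intro x hx
    rw [← nonunit_zmod] at hx ⊢
    intro h; exact hx (h.pow 2)
  rw [nonunit_zmod] at h0
  have c3 := cube_zmod p
  have key : (p : ZMod (p ^ 3)) ∣ f 1 → (p : ZMod (p ^ 3)) ∣ f 2 → hD f = (f 0 * f 3) ^ 2 := by
    rintro ⟨b, hb⟩ ⟨c, hc⟩
    obtain ⟨a, ha⟩ := h0
    rw [hD_expand, ha, hb, hc]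
    linear_combination (-6 * a * b * c * f 3 + 4 * p * a * c ^ 3 + 4 * b ^ 3 * f 3 - 3 * p * b ^ 2 * c ^ 2) * c3
  constructor
  · rintro ⟨h1, h2, h3, h4⟩
    have k1 : (p : ZMod (p ^ 3)) ∣ f 1 := hsq _ (by
      have := dvd_add h1 (dvd_mul_of_dvd_left h0 (f 2))
      simpa [hA] using this)
    have k2 : (p : ZMod (p ^ 3)) ∣ f 2 := hsq _ (by
      have := dvd_add h3 (dvd_mul_of_dvd_left k1 (f 3))
      simpa [hC] using this)
    rw [key k1 k2, sq_ne p _ _ h0] at h4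
    exact ⟨⟨h0, h4.1⟩, k1, k2, h4.2⟩
  · rintro ⟨⟨-, h1⟩, k1, k2, h3⟩
    refine ⟨?_, ?_, ?_, ?_⟩
    · exact dvd_sub (dvd_pow k1 (by norm_num)) (dvd_mul_of_dvd_left h0 _)
    · exact dvd_sub (dvd_mul_of_dvd_left k1 _) (dvd_mul_of_dvd_left h0 _)
    · exact dvd_sub (dvd_pow k2 (by norm_num)) (dvd_mul_of_dvd_left k1 _)
    · rw [key k1 k2, sq_ne p _ _ h0]; exact ⟨h1, h3⟩

lemma condP_shear (f : V (ZMod (p ^ 3))) (h : condP p f) (e : ZMod (p ^ 3)) : condP p (act 1 e 0 1 f) := by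
  obtain ⟨h1, h2, h3, h4⟩ := h
  refine ⟨?_, ?_, ?_, ?_⟩
  · rw [hA_act]; simpa using h1
  · rw [hB_act]
    have := dvd_add h2 (dvd_mul_of_dvd_left h1 (2 * e))
    convert this using 1; ring
  · rw [hC_act]
    have := dvd_add (dvd_add h3 (dvd_mul_of_dvd_left h1 (e ^ 2))) (dvd_mul_of_dvd_left h2 e)
    convert this using 1; ring
  · rw [hD_act]; simpa using h4

lemma condP_unit (a c d : ZMod (p ^ 3)) (h0 : IsUnit a) : condP p ![a, 0, c, d] ↔
    (p : ZMod (p ^ 3)) ∣ c ∧ ((p : ZMod (p ^ 3)) ∣ d ∧ ¬ (p : ZMod (p ^ 3)) ^ 2 ∣ d) := by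
  have := local_zmod p 3 (by norm_num)
  have c3 := cube_zmod p
  have eA : hA ![a, 0, c, d] = -(a * c) := by simp [hA]
  have eB : hB ![a, 0, c, d] = -(a * d) := by simp [hB]
  have eC : hC ![a, 0, c, d] = c ^ 2 := by simp [hC]
  have hD' : (p : ZMod (p ^ 3)) ∣ c → hD ![a, 0, c, d] = (d * a) ^ 2 := by
    rintro ⟨c, rfl⟩
    rw [hD, eA, eB, eC]
    linear_combination 4 * a * c ^ 3 * c3
  unfold condP
  rw [eA, eB, eC, dvd_neg, dvd_neg, h0.dvd_mul_left, h0.dvd_mul_left]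
  constructor
  · rintro ⟨h1, h2, -, h4⟩
    rw [hD' h1, sq_ne p _ _ h2] at h4
    exact ⟨h1, h2, h4.1⟩
  · rintro ⟨h1, h2, h3⟩
    refine ⟨h1, h2, dvd_pow h1 (by norm_num), ?_⟩
    rw [hD' h1, sq_ne p _ _ h2]
    exact ⟨h3, h0⟩

lemma card_condP_nonunit : Nat.card {f : V (ZMod (p ^ 3)) // condP p f ∧ ¬ IsUnit (f 0)} =
    Nat.card (TQ p × TP p × TP p × TU p) := by
  symm
  have hun : ∀ a : ZMod (p ^ 3), (p : ZMod (p ^ 3)) ∣ a → ¬ IsUnit a := fun a h => (nonunit_zmod p a).2 h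
  refine Nat.card_congr (Equiv.ofBijective (fun t => ⟨![t.1.1, t.2.1.1, t.2.2.1.1, t.2.2.2.1], ?_⟩) ⟨?_, ?_⟩)
  · obtain ⟨⟨a, ha⟩, ⟨b, hb⟩, ⟨c, hc⟩, ⟨d, hd⟩⟩ := t
    refine ⟨(condP_nonunit p _ ?_).2 ⟨ha, hb, hc, hd⟩, ?_⟩ <;> exact hun a ha.1
  · rintro ⟨⟨a, ha⟩, ⟨b, hb⟩, ⟨c, hc⟩, ⟨d, hd⟩⟩ ⟨⟨a', ha'⟩, ⟨b', hb'⟩, ⟨c', hc'⟩, ⟨d', hd'⟩⟩ h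
    have h := congrArg Subtype.val h
    have e0 : a = a' := congrFun h 0
    have e1 : b = b' := congrFun h 1
    have e2 : c = c' := congrFun h 2
    have e3 : d = d' := congrFun h 3
    subst e0 e1 e2 e3; rfl
  · rintro ⟨f, hf, h0⟩
    obtain ⟨k0, k1, k2, k3⟩ := (condP_nonunit p f h0).1 hf
    refine ⟨(⟨f 0, k0⟩, ⟨f 1, k1⟩, ⟨f 2, k2⟩, ⟨f 3, k3⟩), ?_⟩
    apply Subtype.ext
    funext i; fin_cases i <;> rfl

lemma card_condP_unit : Nat.card {f : V (ZMod (p ^ 3)) // condP p f ∧ IsUnit (f 0)} =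
    Nat.card (TU p × ZMod (p ^ 3) × TP p × TQ p) := by
  symm
  refine Nat.card_congr (Equiv.ofBijective (fun t => ⟨act 1 (t.2.1 * Ring.inverse t.1.1) 0 1 ![t.1.1, 0, t.2.2.1.1, t.2.2.2.1], ?_⟩) ⟨?_, ?_⟩)
  · obtain ⟨⟨a, ha⟩, b, ⟨c, hc⟩, ⟨d, hd⟩⟩ := t
    refine ⟨condP_shear p _ ((condP_unit p _ _ _ ha).2 ⟨hc, hd⟩) _, ?_⟩
    simpa [act] using ha
  · rintro ⟨⟨a, ha⟩, b, ⟨c, hc⟩, ⟨d, hd⟩⟩ ⟨⟨a', ha'⟩, b', ⟨c', hc'⟩, ⟨d', hd'⟩⟩ h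
    have h := congrArg Subtype.val h
    have e0 : a = a' := by simpa [act] using congrFun h 0
    subst e0
    have e1 : b = b' := by
      have := congrFun h 1
      simp [act] at this
      rw [mul_left_comm, Ring.mul_inverse_cancel a ha, mul_left_comm, Ring.mul_inverse_cancel a ha] at this
      simpa using this
    subst e1
    have e2 : c = c' := by simpa [act] using congrFun h 2
    subst e2
    have e3 : d = d' := by simpa [act] using congrFun h 3
    subst e3; rfl
  · rintro ⟨f, hf, h0⟩
    set v := Ring.inverse (f 0) with hv
    have hiv : f 0 * v = 1 := Ring.mul_inverse_cancel _ h0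
    have g := condP_shear p f hf (-(f 1 * v))
    have eg : act 1 (-(f 1 * v)) 0 1 f = ![f 0, 0, act 1 (-(f 1 * v)) 0 1 f 2, act 1 (-(f 1 * v)) 0 1 f 3] := by
      funext i; fin_cases i
      · simp [act]
      · simp [act]; linear_combination (-f 1) * hiv
      · rfl
      · rfl
    rw [eg, condP_unit p _ _ _ h0] at g
    refine ⟨(⟨f 0, h0⟩, f 1, ⟨_, g.1⟩, ⟨_, g.2⟩), ?_⟩
    apply Subtype.ext
    show act 1 (f 1 * v) 0 1 ![f 0, 0, act 1 (-(f 1 * v)) 0 1 f 2, act 1 (-(f 1 * v)) 0 1 f 3] = f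
    rw [← eg, act_act]
    simp [act_one]

theorem card_condP : (Nat.card {f : V (ZMod (p ^ 3)) // condP p f} : ℝ) = (p ^ 3) ^ 4 * ((p ^ 2 - 1) * (p - 1) / p ^ 5) := by
  have : NeZero (p ^ 3) := ⟨pow_ne_zero _ hp.1.ne_zero⟩
  have hp0 : (p : ℝ) ≠ 0 := by exact_mod_cast hp.1.ne_zero
  rw [card_split _ (fun f => IsUnit (f 0)), card_condP_unit, card_condP_nonunit]
  simp only [Nat.card_prod, card_TP, Nat.card_zmod]
  have h1 : (Nat.card (TQ p) : ℝ) + p = p ^ 2 := by exact_mod_cast card_TQ p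
  have h2 : (Nat.card (TU p) : ℝ) + p ^ 2 = p ^ 3 := by exact_mod_cast card_TU p
  push_cast
  rw [eq_sub_of_add_eq h1, eq_sub_of_add_eq h2]
  field_simp
  ring
end

end PTM


/-! ### Tail estimate: forms whose Hessian is divisible by a large prime -/
namespace PTM
open Set Filter

/-- forms whose Hessian is divisible by `q` -/
def EH (X : ℝ) (q : ℕ) : Set (V ℤ) := {f ∈ FC X | (q : ℤ) ∣ hA f ∧ (q : ℤ) ∣ hB f ∧ (q : ℤ) ∣ hC f}

lemma rho_eq {X : ℝ} (hX : 0 ≤ X) (m : ℕ) (hm : 1 ≤ m) : ∃ s r : ℝ, 0 ≤ s ∧ 0 < r ∧ s ^ 4 = X ∧ s ^ 2 = √X ∧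
    r = (m : ℝ) ^ (-(3/2) : ℝ) ∧ (m : ℝ) ^ 3 * r ^ 2 = 1 ∧ m * r ≤ 1 ∧ rho X m = 2 * s * r := by
  have hmR : (1:ℝ) ≤ m := by exact_mod_cast hm
  have hm0 : (0:ℝ) < m := by linarith
  refine ⟨X ^ (1/4 : ℝ), (m : ℝ) ^ (-(3/2) : ℝ), by positivity, by positivity, ?_, ?_, rfl, ?_, ?_, ?_⟩
  · rw [← Real.rpow_natCast, ← Real.rpow_mul hX]; norm_num
  · rw [← Real.rpow_natCast, ← Real.rpow_mul hX, Real.sqrt_eq_rpow]; norm_num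
  · rw [← Real.rpow_natCast, ← Real.rpow_natCast, ← Real.rpow_mul hm0.le, ← Real.rpow_add hm0]; norm_num
  · nth_rewrite 1 [← Real.rpow_one (m : ℝ)]
    rw [← Real.rpow_add hm0]
    exact Real.rpow_le_one_of_one_le_of_nonpos hmR (by norm_num)
  · rw [rho, Real.div_rpow (by positivity) (by positivity), Real.mul_rpow (by norm_num) hX, ← Real.rpow_natCast (m : ℝ) 6,
      ← Real.rpow_mul hm0.le, Real.rpow_neg hm0.le]
    rw [show (16:ℝ) = 2 ^ (4:ℝ) by norm_num, ← Real.rpow_mul (by norm_num)]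
    norm_num
    rfl

lemma EH_slice (X : ℝ) (hX : 0 ≤ X) (q : ℕ) [hq : Fact q.Prime] (m : ℕ) (hm : 1 ≤ m) (hρ : 1 ≤ rho X m) :
    ({f ∈ Slice X m | f 0 ≠ 0 ∧ f ∈ EH X q}.ncard : ℝ) ≤ 80000 * (X / (q:ℝ) ^ 2 + √X) * (m : ℝ) ^ (-(3/2) : ℝ) := by
  have hmR : (1:ℝ) ≤ m := by exact_mod_cast hm
  have hq0 : 0 < q := hq.1.pos
  have hq1 : (1:ℝ) ≤ q := by exact_mod_cast hq0
  obtain ⟨s, r, hs, hr, hs4, hs2, hrd, hmr, hmr1, hρe⟩ := rho_eq hX m hm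
  rw [← hrd, ← hs2]
  set ρ := rho X m with hρd
  have hmρ : 1 ≤ m * ρ := by nlinarith
  have hm2ρ : 1 ≤ m ^ 2 * ρ := by nlinarith
  have hρ0 : 0 ≤ ρ := by linarith
  have hqp : Prime (q : ℤ) := Nat.prime_iff_prime_int.1 hq.1
  set S1 : Set (V ℤ) := {f ∈ Slice X m | f 0 ≠ 0 ∧ f ∈ EH X q ∧ ¬ (q : ℤ) ∣ f 0} with hS1
  set S2 : Set (V ℤ) := {f ∈ Slice X m | f 0 ≠ 0 ∧ f ∈ EH X q ∧ (q : ℤ) ∣ f 0} with hS2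
  have c1 : S1.Finite ∧ (S1.ncard : ℝ) ≤ (3 * ρ) * (5 * m * ρ) * (8 * m * ρ / q + 1) * (16 * m ^ 2 * ρ / q + 1) := by
    refine fiber_count S1 (ivl 0 ρ 0 1) (fun _ => ivl 0 (2 * m * ρ) 0 1)
      (fun a b => ivl (-(m ^ 2 * a)) (4 * m * ρ) (((b : ZMod q) ^ 2 * (a : ZMod q)⁻¹).val) q)
      (fun a b c => ivl (-(m ^ 2 * b)) (8 * m ^ 2 * ρ) (((b : ZMod q) * c * (a : ZMod q)⁻¹).val) q)
      (3 * ρ) (5 * m * ρ) (8 * m * ρ / q + 1) (16 * m ^ 2 * ρ / q + 1) ?_ ?_ ?_ ?_ ?_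
    · refine (card_ivl _ _ (by positivity) _ _ one_pos).trans ?_
      push_cast; linarith
    · intro a; refine (card_ivl _ _ (by positivity) _ _ one_pos).trans ?_
      push_cast; linarith
    · intro a b; refine (card_ivl _ _ (by positivity) _ _ hq0).trans (le_of_eq ?_)
      ring
    · intro a b c; refine (card_ivl _ _ (by positivity) _ _ hq0).trans (le_of_eq ?_)
      ring
    · rintro f ⟨⟨h1, h2, h3, h4⟩, h5, ⟨-, h6, h7, h8⟩, h9⟩
      have ha : (f 0 : ZMod q) ≠ 0 := by
        rw [Ne, ZMod.intCast_zmod_eq_zero_iff_dvd]; exact h9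
      refine ⟨mem_ivl one_pos (by simpa using h1) (by simp), mem_ivl one_pos (by simpa using h2) (by simp),
        mem_ivl hq0 (by simpa using h3) ?_, mem_ivl hq0 (by simpa using h4) ?_⟩
      · rw [← ZMod.intCast_zmod_eq_zero_iff_dvd] at h6 ⊢
        simp only [hA] at h6
        push_cast at h6 ⊢
        rw [ZMod.natCast_zmod_val]
        field_simp
        linear_combination -h6
      · rw [← ZMod.intCast_zmod_eq_zero_iff_dvd] at h7 ⊢
        simp only [hB] at h7
        push_cast at h7 ⊢
        rw [ZMod.natCast_zmod_val]
        field_simp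
        linear_combination -h7
  have c2 : S2.Finite ∧ (S2.ncard : ℝ) ≤ 2295 * ρ ^ 4 * m ^ 4 / q ^ 2 := by
    by_cases hρq : (q : ℝ) ≤ ρ
    · have hmq : (q : ℝ) ≤ m * ρ := by nlinarith
      have := fiber_count S2 (ivl 0 ρ 0 q) (fun _ => ivl 0 (2 * m * ρ) 0 q)
        (fun a b => ivl (-(m ^ 2 * a)) (4 * m * ρ) 0 q) (fun _ b _ => ivl (-(m ^ 2 * b)) (8 * m ^ 2 * ρ) 0 1)
        (3 * ρ / q) (5 * m * ρ / q) (9 * m * ρ / q) (17 * m ^ 2 * ρ) ?_ ?_ ?_ ?_ ?_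
      · refine ⟨this.1, this.2.trans ?_⟩
        have e : 3 * ρ / q * (5 * m * ρ / q) * (9 * m * ρ / q) * (17 * m ^ 2 * ρ) = 2295 * ρ ^ 4 * m ^ 4 / q ^ 2 / q := by
          field_simp; ring
        rw [e]
        exact div_le_self (by positivity) hq1
      · refine (card_ivl _ _ (by positivity) _ _ hq0).trans ?_
        rw [div_add_one (by positivity)]; gcongr; linarith
      · intro a; refine (card_ivl _ _ (by positivity) _ _ hq0).trans ?_
        rw [div_add_one (by positivity)]; gcongr; linarith
      · intro a b; refine (card_ivl _ _ (by positivity) _ _ hq0).trans ?_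
        rw [div_add_one (by positivity)]; gcongr; linarith
      · intro a b c; refine (card_ivl _ _ (by positivity) _ _ one_pos).trans ?_
        push_cast; linarith
      · rintro f ⟨⟨h1, h2, h3, h4⟩, h5, ⟨-, h6, h7, h8⟩, h9⟩
        have k1 : (q : ℤ) ∣ f 1 := by
          apply hqp.dvd_of_dvd_pow (n := 2)
          have := dvd_add h6 (dvd_mul_of_dvd_left h9 (f 2))
          simpa [hA] using this
        have k2 : (q : ℤ) ∣ f 2 := by
          apply hqp.dvd_of_dvd_pow (n := 2)
          have := dvd_add h8 (dvd_mul_of_dvd_left k1 (f 3))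
          simpa [hC] using this
        exact ⟨mem_ivl hq0 (by simpa using h1) (by simpa using h9), mem_ivl hq0 (by simpa using h2) (by simpa using k1),
          mem_ivl hq0 (by simpa using h3) (by simpa using k2), mem_ivl one_pos (by simpa using h4) (by simp)⟩
    · have : S2 = ∅ := by
        rw [Set.eq_empty_iff_forall_notMem]
        rintro f ⟨⟨h1, -⟩, h5, -, h9⟩
        apply hρq
        refine le_trans ?_ h1
        have : (q : ℤ) ≤ |f 0| := Int.le_of_dvd (by positivity) ((dvd_abs _ _).2 h9)
        exact_mod_cast this
      rw [this]; simp; positivity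
  have hsub : {f ∈ Slice X m | f 0 ≠ 0 ∧ f ∈ EH X q} ⊆ S1 ∪ S2 := by
    rintro f ⟨h1, h2, h3⟩
    by_cases h : (q : ℤ) ∣ f 0
    · right; exact ⟨h1, h2, h3, h⟩
    · left; exact ⟨h1, h2, h3, h⟩
  have hcard : ({f ∈ Slice X m | f 0 ≠ 0 ∧ f ∈ EH X q}.ncard : ℝ) ≤ S1.ncard + S2.ncard := by
    exact_mod_cast (Set.ncard_le_ncard hsub (c1.1.union c2.1)).trans (Set.ncard_union_le _ _)
  refine hcard.trans ((add_le_add c1.2 c2.2).trans ?_)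
  rw [← hs4]
  clear_value ρ
  -- numerical estimate
  have hi : (0:ℝ) < (q:ℝ)⁻¹ := by positivity
  have hi1 : (q:ℝ)⁻¹ ≤ 1 := inv_le_one_of_one_le₀ hq1
  simp only [div_eq_mul_inv]
  rw [← inv_pow]
  generalize (q:ℝ)⁻¹ = i at hi hi1
  rw [hρe]
  have e4 : (m:ℝ) ^ 4 * r ^ 4 ≤ r := by
    have : (m:ℝ) ^ 4 * r ^ 4 = (m ^ 3 * r ^ 2) * ((m * r) * r) := by ring
    rw [this, hmr]; nlinarith
  have e3 : (m:ℝ) ^ 3 * r ^ 3 = r := by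
    have : (m:ℝ) ^ 3 * r ^ 3 = (m ^ 3 * r ^ 2) * r := by ring
    rw [this, hmr]; ring
  have e2 : (m:ℝ) * r ^ 2 ≤ r := by
    have : (m:ℝ) * r ^ 2 = (m * r) * r := by ring
    rw [this]; nlinarith
  have e3' : (m:ℝ) ^ 2 * r ^ 3 ≤ r := by
    calc (m:ℝ) ^ 2 * r ^ 3 = 1 * ((m:ℝ) ^ 2 * r ^ 3) := by ring
      _ ≤ m * ((m:ℝ) ^ 2 * r ^ 3) := by gcongr
      _ = r := by linear_combination e3
  have amgm : s ^ 3 * i ≤ (s ^ 4 * i ^ 2 + s ^ 2) / 2 := by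
    nlinarith [mul_nonneg (sq_nonneg s) (sq_nonneg (s * i - 1))]
  calc _ = 15 * (128 * 16 * (m ^ 4 * r ^ 4) * (s ^ 4 * i ^ 2) + 64 * (m ^ 2 * r ^ 3) * (s ^ 3 * i) + 128 * (m ^ 3 * r ^ 3) * (s ^ 3 * i)
        + 4 * (m * r ^ 2) * s ^ 2) + 2295 * 16 * (m ^ 4 * r ^ 4) * (s ^ 4 * i ^ 2) := by ring
    _ ≤ 15 * (128 * 16 * r * (s ^ 4 * i ^ 2) + 64 * r * (s ^ 3 * i) + 128 * r * (s ^ 3 * i)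
        + 4 * r * s ^ 2) + 2295 * 16 * r * (s ^ 4 * i ^ 2) := by
          rw [e3]; gcongr
    _ = r * (67440 * (s ^ 4 * i ^ 2) + 2880 * (s ^ 3 * i) + 60 * s ^ 2) := by ring
    _ ≤ r * (67440 * (s ^ 4 * i ^ 2) + 2880 * ((s ^ 4 * i ^ 2 + s ^ 2) / 2) + 60 * s ^ 2) := by gcongr
    _ ≤ 80000 * (s ^ 4 * i ^ 2 + s ^ 2) * r := by
        have h1 : 0 ≤ s ^ 4 * i ^ 2 := by positivity
        have h2 : 0 ≤ s ^ 2 := by positivity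
        rw [mul_comm r]
        gcongr
        linarith

lemma EH_bound : ∃ C : ℝ, 0 < C ∧ ∀ (X : ℝ) (_ : 0 ≤ X) (q : ℕ) (_ : q.Prime),
    (EH X q).Finite ∧ ((EH X q).ncard : ℝ) ≤ C * (X / (q:ℝ) ^ 2 + √X) := by
  have hsum : Summable (fun m : ℕ => (m : ℝ) ^ (-(3/2) : ℝ)) := Real.summable_nat_rpow.2 (by norm_num)
  set T := ∑' m : ℕ, (m : ℝ) ^ (-(3/2) : ℝ) with hT
  have hT0 : 0 ≤ T := tsum_nonneg fun m => by positivity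
  refine ⟨80000 * (T + 1), by positivity, fun X hX q hq => ?_⟩
  have : Fact q.Prime := ⟨hq⟩
  have := union_slices X hX 0 (EH X q) (fun m => 80000 * (X / (q:ℝ) ^ 2 + √X) * (m : ℝ) ^ (-(3/2) : ℝ)) ?_
    (fun m hm hρ => EH_slice X hX q m hm hρ) (fun m => by positivity)
  · refine ⟨this.1, this.2.trans ?_⟩
    rw [← Finset.mul_sum]
    have h1 : ∑ m ∈ Finset.Ioc 0 ⌊16 * X⌋₊, (m : ℝ) ^ (-(3/2) : ℝ) ≤ T :=
      hsum.sum_le_tsum _ fun m _ => by positivity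
    calc 80000 * (X / (q:ℝ) ^ 2 + √X) * ∑ m ∈ Finset.Ioc 0 ⌊16 * X⌋₊, (m : ℝ) ^ (-(3/2) : ℝ)
        ≤ 80000 * (X / (q:ℝ) ^ 2 + √X) * (T + 1) := by gcongr; linarith
      _ = _ := by ring
  · rintro f ⟨⟨h1, h2, h3⟩, -⟩
    obtain ⟨m, hm, hs, hd⟩ := exists_slice X f h1 h3
    exact ⟨m, by omega, hs, h2⟩

lemma EH_range {X : ℝ} {q : ℕ} {f : V ℤ} (hf : f ∈ EH X q) : (q : ℝ) ≤ √X := by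
  obtain ⟨⟨h1, -, h3⟩, h4, h5, h6⟩ := hf
  have hq : (q : ℤ) ≤ hA f := Int.le_of_dvd h1.1 h4
  have hC : hA f ≤ hC f := h1.2.2
  have hB : hB f ^ 2 ≤ hA f ^ 2 := by rw [← sq_abs (hB f)]; exact pow_le_pow_left₀ (abs_nonneg _) h1.2.1 2
  have hA0 := h1.1
  apply Real.le_sqrt_of_sq_le
  have : (q : ℤ) ^ 2 ≤ - hD f := by
    simp only [hD]
    nlinarith [mul_le_mul_of_nonneg_left hC hA0.le, pow_le_pow_left₀ (by positivity : (0:ℤ) ≤ q) hq 2]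
  have h7 : ((q : ℤ) : ℝ) ^ 2 ≤ - ((hD f : ℤ) : ℝ) := by exact_mod_cast this
  push_cast at h7
  linarith

lemma tail2 : ∃ C : ℝ, 0 < C ∧ ∀ Z : ℕ, 0 < Z → ∀ᶠ X : ℝ in atTop,
    ({f ∈ FC X | ∃ q : ℕ, q.Prime ∧ Z < q ∧ (q : ℤ) ∣ hA f ∧ (q : ℤ) ∣ hB f ∧ (q : ℤ) ∣ hC f}.ncard : ℝ) ≤ C * X / Z := by
  obtain ⟨C, hC, h⟩ := EH_bound
  refine ⟨2 * C, by positivity, fun Z hZ => ?_⟩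
  have hZR : (0:ℝ) < Z := by exact_mod_cast hZ
  have hpi : ∀ᶠ x : ℝ in atTop, (Nat.primeCounting ⌊x⌋₊ : ℝ) ≤ x / Z := by
    have h1 := Chebyshev.eventually_primeCounting_le (ε := 1) one_pos
    have h2 : ∀ᶠ x : ℝ in atTop, (Real.log 4 + 1) * Z ≤ Real.log x :=
      Real.tendsto_log_atTop.eventually_ge_atTop _
    filter_upwards [h1, h2, eventually_gt_atTop 1] with x h1 h2 h3
    refine h1.trans ?_
    have : 0 < Real.log x := Real.log_pos h3
    rw [div_le_div_iff₀ this hZR]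
    nlinarith
  filter_upwards [Real.tendsto_sqrt_atTop.eventually hpi, eventually_gt_atTop 0] with X hX hX0
  set P := (Finset.Ioc Z ⌊√X⌋₊).filter Nat.Prime with hP
  have hsub : {f ∈ FC X | ∃ q : ℕ, q.Prime ∧ Z < q ∧ (q : ℤ) ∣ hA f ∧ (q : ℤ) ∣ hB f ∧ (q : ℤ) ∣ PTM.hC f} ⊆ ⋃ q ∈ P, EH X q := by
    rintro f ⟨h1, q, hq, hZq, h2⟩
    have hf : f ∈ EH X q := ⟨h1, h2⟩
    simp only [mem_iUnion]
    exact ⟨q, Finset.mem_filter.2 ⟨Finset.mem_Ioc.2 ⟨hZq, Nat.le_floor (EH_range hf)⟩, hq⟩, hf⟩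
  have hfin : (⋃ q ∈ P, EH X q).Finite := Set.Finite.biUnion (Finset.finite_toSet _) fun q hq =>
    (h X hX0.le q (Finset.mem_filter.1 hq).2).1
  calc _ ≤ ((⋃ q ∈ P, EH X q).ncard : ℝ) := by exact_mod_cast Set.ncard_le_ncard hsub hfin
    _ ≤ ∑ q ∈ P, ((EH X q).ncard : ℝ) := by exact_mod_cast Finset.set_ncard_biUnion_le _ _
    _ ≤ ∑ q ∈ P, C * (X / (q:ℝ) ^ 2 + √X) := Finset.sum_le_sum fun q hq => (h X hX0.le q (Finset.mem_filter.1 hq).2).2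
    _ = C * (X * ∑ q ∈ P, ((q:ℝ) ^ 2)⁻¹ + P.card * √X) := by
        rw [← Finset.mul_sum, Finset.sum_add_distrib, Finset.sum_const, nsmul_eq_mul, Finset.mul_sum]
        simp only [div_eq_mul_inv]
    _ ≤ C * (X * (Z:ℝ)⁻¹ + (√X / Z) * √X) := by
        gcongr
        · refine le_trans ?_ (sum_inv_sq_le Z ⌊√X⌋₊ hZ)
          exact Finset.sum_le_sum_of_subset_of_nonneg (Finset.filter_subset _ _) fun _ _ _ => by positivity
        · refine le_trans ?_ hX
          rw [← Nat.primesLE_card_eq_primeCounting]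
          exact_mod_cast Finset.card_le_card (by
            intro q hq
            rw [Finset.mem_filter, Finset.mem_Ioc] at hq
            exact Nat.mem_primesLE.2 ⟨hq.1.2, hq.2⟩)
    _ = 2 * C * X / Z := by
        rw [div_mul_eq_mul_div, Real.mul_self_sqrt hX0.le]; field_simp; ring

end PTM


/-! ### Tail estimate: forms with discriminant divisible by the square of a large prime -/
namespace PTM
open Set Filter

/-- all reduced forms of bounded discriminant -/
def RC (X : ℝ) : Set (V ℤ) := {f | redC f ∧ -X < ((hD f : ℤ) : ℝ)}

lemma RC0_slice (X : ℝ) (hX : 0 ≤ X) (m : ℕ) (hm : 1 ≤ m) :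
    {f ∈ RC X | f 0 = 0 ∧ |f 1| = m}.Finite ∧
    ({f ∈ RC X | f 0 = 0 ∧ |f 1| = m}.ncard : ℝ) ≤ 12 * X * ((m:ℝ) ^ 2)⁻¹ := by
  have hmR : (1:ℝ) ≤ m := by exact_mod_cast hm
  have key : ∀ f ∈ {f ∈ RC X | f 0 = 0 ∧ |f 1| = m}, |(f 2 : ℝ)| ≤ m ∧ |(f 3 : ℝ)| ≤ X / (2 * m ^ 3) ∧ 3 * (m:ℝ) ^ 4 ≤ X := by
    rintro f ⟨⟨⟨h1, h2, h3⟩, h4⟩, h5, h6⟩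
    have e1 : ((hD f : ℤ) : ℝ) = (f 1 : ℝ) ^ 2 * (4 * f 1 * f 3 - 3 * f 2 ^ 2) := by
      rw [hD_expand, h5]; push_cast; ring
    simp only [hA, hB, hC, h5] at h1 h2 h3
    have h6R : |(f 1 : ℝ)| = m := by exact_mod_cast h6
    have h2' : |f 1| * |f 2| ≤ |f 1| * |f 1| := by
      have : f 1 * f 2 - 0 * f 3 = f 1 * f 2 := by ring
      rw [this, abs_mul] at h2
      rw [abs_mul_abs_self]; linarith
    have h7 : |f 2| ≤ |f 1| := le_of_mul_le_mul_left h2' (by rw [h6]; exact_mod_cast hm)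
    have h7R : |(f 2 : ℝ)| ≤ m := by rw [← h6R]; exact_mod_cast h7
    have h8 : (f 2 : ℝ) ^ 2 ≤ m ^ 2 := by rw [← sq_abs]; exact pow_le_pow_left₀ (abs_nonneg _) h7R 2
    have h9 : (f 1 : ℝ) ^ 2 = m ^ 2 := by rw [← sq_abs, h6R]
    have h3R : (f 1 : ℝ) ^ 2 ≤ f 2 ^ 2 - f 1 * f 3 := by
      have : f 1 ^ 2 ≤ f 2 ^ 2 - f 1 * f 3 := by linarith
      exact_mod_cast this
    rw [e1, h9] at h4
    rw [h9] at h3R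
    have hm2 : (0:ℝ) < (m:ℝ) ^ 2 := by positivity
    have h10 : 3 * (m:ℝ) ^ 4 ≤ X := by nlinarith
    refine ⟨h7R, ?_, h10⟩
    rw [le_div_iff₀ (by positivity)]
    have h11 : |(f 3:ℝ)| * m = |(f 1 : ℝ) * f 3| := by rw [abs_mul, h6R]; ring
    have h12 : |(f 1 : ℝ) * f 3| * (2 * m ^ 2) ≤ X := by
      have : |(f 1 : ℝ) * f 3| = -(f 1 * f 3 : ℝ) ∨ |(f 1 : ℝ) * f 3| = (f 1 * f 3 : ℝ) := by
        rcases abs_choice ((f 1 : ℝ) * f 3) with h | h <;> simp [h]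
      rcases this with h | h <;> rw [h]
      · nlinarith
      · nlinarith
    calc |(f 3:ℝ)| * (2 * m ^ 3) = (|(f 3:ℝ)| * m) * (2 * m ^ 2) := by ring
      _ ≤ X := by rw [h11]; exact h12
  by_cases h4 : 3 * (m:ℝ) ^ 4 ≤ X
  · have hm3 : (m:ℝ) ^ 3 ≤ X := by
      have : (m:ℝ) ^ 3 ≤ m ^ 4 := pow_le_pow_right₀ hmR (by norm_num)
      nlinarith [pow_pos (lt_of_lt_of_le one_pos hmR) 4]
    have := fiber_count {f ∈ RC X | f 0 = 0 ∧ |f 1| = m} {0} (fun _ => {(m:ℤ), -(m:ℤ)}) (fun _ _ => ivl 0 m 0 1)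
      (fun _ _ _ => ivl 0 (X / (2 * m ^ 3)) 0 1) 1 2 (3 * m) (2 * X / m ^ 3) (by simp) (fun _ => by
        have := Finset.card_le_two (a := (m:ℤ)) (b := -(m:ℤ))
        exact_mod_cast this) ?_ ?_ ?_
    · refine ⟨this.1, this.2.trans (le_of_eq ?_)⟩
      field_simp; ring
    · intro a b; refine (card_ivl _ _ (by positivity) _ _ one_pos).trans ?_
      push_cast; linarith
    · intro a b c; refine (card_ivl _ _ (by positivity) _ _ one_pos).trans ?_
      have : 1 ≤ X / (m:ℝ) ^ 3 := by rw [le_div_iff₀ (by positivity)]; linarith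
      have e : 2 * (X / (2 * (m:ℝ) ^ 3)) / ((1:ℕ):ℝ) = X / m ^ 3 := by push_cast; field_simp
      rw [e, mul_div_assoc]; linarith
    · intro f hf
      obtain ⟨k1, k2, -⟩ := key f hf
      refine ⟨by simp [hf.2.1], ?_, mem_ivl one_pos (by simpa using k1) (by simp), mem_ivl one_pos (by simpa using k2) (by simp)⟩
      have := hf.2.2
      rcases abs_choice (f 1) with h | h <;> rw [h] at this <;> simp <;> omega
  · have : {f ∈ RC X | f 0 = 0 ∧ |f 1| = m} = ∅ := by
      rw [Set.eq_empty_iff_forall_notMem]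
      intro f hf
      exact h4 (key f hf).2.2
    rw [this]; simp; positivity

lemma RC_bound : ∃ C : ℝ, 0 < C ∧ ∀ X : ℝ, 0 ≤ X → (RC X).Finite ∧ ((RC X).ncard : ℝ) ≤ C * X := by
  refine ⟨73464, by norm_num, fun X hX => ?_⟩
  obtain ⟨hF, hb⟩ := FC_bound X hX
  have hsub : RC X ⊆ FC X ∪ ⋃ m ∈ Finset.Ioc 0 ⌊X⌋₊, {f ∈ RC X | f 0 = 0 ∧ |f 1| = m} := by
    intro f hf
    by_cases h0 : f 0 = 0
    · right
      simp only [mem_iUnion]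
      have hA0 := hf.1.1
      refine ⟨(f 1).natAbs, Finset.mem_Ioc.2 ⟨?_, Nat.le_floor ?_⟩, hf, h0, by simp⟩
      · rw [Int.natAbs_pos]; rintro h; simp [hA, h0, h] at hA0
      · have h1 : hB f ^ 2 ≤ hA f ^ 2 := by rw [← sq_abs (hB f)]; exact pow_le_pow_left₀ (abs_nonneg _) hf.1.2.1 2
        have h2 := hf.1.2.2
        have h3 : hA f ≤ - hD f := by simp only [hD]; nlinarith
        have h4 : |f 1| ≤ hA f := by
          simp only [hA, h0]; rw [← sq_abs]; nlinarith [abs_nonneg (f 1)]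
        have h5 : ((f 1).natAbs : ℤ) ≤ - hD f := by simpa using h4.trans h3
        have h6 : (((f 1).natAbs : ℤ) : ℝ) ≤ - ((hD f : ℤ) : ℝ) := by exact_mod_cast h5
        have := hf.2
        rw [Int.cast_natCast] at h6; linarith
    · left; exact ⟨hf.1, h0, hf.2⟩
  have hfin : (⋃ m ∈ Finset.Ioc 0 ⌊X⌋₊, {f ∈ RC X | f 0 = 0 ∧ |f 1| = m}).Finite :=
    Set.Finite.biUnion (Finset.finite_toSet _) fun m hm => (RC0_slice X hX m (by have := (Finset.mem_Ioc.1 hm).1; omega)).1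
  refine ⟨(hF.union hfin).subset hsub, ?_⟩
  have h1 : ((RC X).ncard : ℝ) ≤ (FC X).ncard + (⋃ m ∈ Finset.Ioc 0 ⌊X⌋₊, {f ∈ RC X | f 0 = 0 ∧ |f 1| = m}).ncard := by
    exact_mod_cast (Set.ncard_le_ncard hsub (hF.union hfin)).trans (Set.ncard_union_le _ _)
  have h2 : ((⋃ m ∈ Finset.Ioc 0 ⌊X⌋₊, {f ∈ RC X | f 0 = 0 ∧ |f 1| = m}).ncard : ℝ) ≤ 24 * X :=
    calc _ ≤ ∑ m ∈ Finset.Ioc 0 ⌊X⌋₊, ({f ∈ RC X | f 0 = 0 ∧ |f 1| = m}.ncard : ℝ) := by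
          exact_mod_cast Finset.set_ncard_biUnion_le _ _
      _ ≤ ∑ m ∈ Finset.Ioc 0 ⌊X⌋₊, 12 * X * ((m:ℝ) ^ 2)⁻¹ :=
          Finset.sum_le_sum fun m hm => (RC0_slice X hX m (by have := (Finset.mem_Ioc.1 hm).1; omega)).2
      _ ≤ 12 * X * 2 := by
          rw [← Finset.mul_sum]
          exact mul_le_mul_of_nonneg_left (sum_inv_sq_le' _) (by positivity)
      _ = _ := by ring
  linarith

lemma exists_red (f : V ℤ) (h1 : 0 < hA f) (h2 : hD f < 0) :
    ∃ x s y w : ℤ, x * w - s * y = 1 ∧ redC (act x s y w f) := by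
  have hex : ∃ n : ℕ, ∃ x s y w : ℤ, x * w - s * y = 1 ∧ hA (act x s y w f) = n ∧ 0 < n := by
    refine ⟨(hA f).toNat, 1, 0, 0, 1, by ring, ?_, by omega⟩
    rw [act_one]; omega
  obtain ⟨x, s, y, w, hdet, hn, hn0⟩ := Nat.find_spec hex
  have hmin := fun m hm => Nat.find_min hex (m := m) hm
  set n := Nat.find hex with hnd
  set k := round (-((hB (act x s y w f) : ℤ) : ℚ) / (2 * n)) with hk
  have hact : act (1:ℤ) k 0 1 (act x s y w f) = act x (x * k + s) y (y * k + w) f := by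
    rw [act_act]; congr 1 <;> ring
  refine ⟨x, x * k + s, y, y * k + w, by linear_combination hdet, ?_⟩
  rw [← hact]
  set g := act x s y w f with hg
  have hA' : hA (act 1 k 0 1 g) = n := by rw [hA_act, hn]; ring
  have hB' : hB (act 1 k 0 1 g) = hB g + 2 * n * k := by rw [hB_act, hn]; ring
  have hD' : hD (act 1 k 0 1 g) < 0 := by rw [hD_act, hg, hD_act, hdet]; simpa using h2
  have hC0 : 0 < hC (act 1 k 0 1 g) := by
    by_contra h
    have : 0 ≤ hD (act 1 k 0 1 g) := by
      rw [hD, hA']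
      nlinarith [sq_nonneg (hB (act 1 k 0 1 g))]
    omega
  refine ⟨by omega, ?_, ?_⟩
  · rw [hA', hB']
    have hr := abs_sub_round (-((hB g : ℤ) : ℚ) / (2 * n))
    rw [← hk] at hr
    have hnQ : (0:ℚ) < n := by exact_mod_cast hn0
    have : |((hB g : ℤ) : ℚ) + 2 * n * k| ≤ n := by
      have e : ((hB g : ℤ) : ℚ) + 2 * n * k = -(2 * n) * (-((hB g : ℤ) : ℚ) / (2 * n) - k) := by field_simp; ring
      rw [e, abs_mul, abs_neg, abs_of_pos (by positivity)]
      nlinarith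
    exact_mod_cast this
  · by_contra h
    push Not at h
    refine hmin (hC (act 1 k 0 1 g)).toNat (by omega) ⟨(x * k + s), -x, y * k + w, -y, by linear_combination hdet, ?_, by omega⟩
    have : act (x * k + s) (-x) (y * k + w) (-y) f = act 0 (-1) 1 0 (act 1 k 0 1 g) := by
      rw [hact, act_act]; congr 1 <;> ring
    rw [this, hA_act]
    simp; omega

lemma redO_lt {f : V ℤ} (h : redO f) (x y : ℤ) (hy : y ≠ 0) : hA f < hA f * x ^ 2 + hB f * x * y + hC f * y ^ 2 := by
  obtain ⟨h1, h2, h3⟩ := h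
  have hy1 : 1 ≤ |y| := Int.one_le_abs hy
  have hxy : -(|hB f| * (|x| * |y|)) ≤ hB f * x * y := by
    rw [← abs_mul, ← abs_mul]
    have := neg_abs_le (hB f * (x * y)); linarith
  have hx0 := abs_nonneg x
  rw [← sq_abs x, ← sq_abs y]
  rcases hx0.eq_or_lt with hx | hx
  · have hx' : x = 0 := abs_eq_zero.1 hx.symm
    have hy2 : 1 ≤ y ^ 2 := by rw [← sq_abs]; nlinarith
    rw [hx', abs_zero, sq_abs]; nlinarith
  · have h5 : hA f * (|x| ^ 2 - |x| * |y| + |y| ^ 2) < hA f * |x| ^ 2 - |hB f| * (|x| * |y|) + hC f * |y| ^ 2 := by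
      have : 0 < |x| * |y| := by positivity
      nlinarith [mul_lt_mul_of_pos_right h2 this, mul_lt_mul_of_pos_right h3 (pow_pos (lt_of_lt_of_le one_pos hy1) 2)]
    have h6 : 1 ≤ |x| ^ 2 - |x| * |y| + |y| ^ 2 := by
      nlinarith [sq_nonneg (|x| - |y|)]
    nlinarith

lemma redO_unique {f1 f2 : V ℤ} (h1 : redO f1) (h2 : redO f2) {x s y w : ℤ} (hdet : x * w - s * y = 1)
    (h : f2 = act x s y w f1) : f2 = f1 ∨ f2 = -f1 := by
  have hA2 : hA f2 = hA f1 * x ^ 2 + hB f1 * x * y + hC f1 * y ^ 2 := by rw [h, hA_act, hdet]; ring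
  have hinv : f1 = act w (-s) (-y) x f2 := by
    rw [h, act_act]
    conv_lhs => rw [← act_one f1]
    congr 1 <;> first | ring1 | linear_combination -hdet
  have hA1 : hA f1 = hA f2 * w ^ 2 + hB f2 * w * (-y) + hC f2 * (-y) ^ 2 := by
    conv_lhs => rw [hinv, hA_act]
    rw [show w * x - -s * -y = 1 by linear_combination hdet]; ring
  have hy : y = 0 := by
    by_contra hy
    have k1 := redO_lt h1 x y hy
    have k2 := redO_lt h2 w (-y) (neg_ne_zero.2 hy)
    omega
  subst hy
  have hxw : x * w = 1 := by linarith
  have hs : s = 0 := by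
    have hB2 : hB f2 = 2 * hA f1 * x * s + hB f1 := by rw [h, hB_act, hdet]; linear_combination hB f1 * hxw
    have hx2 : x ^ 2 = 1 := by
      rcases Int.isUnit_iff.1 (IsUnit.of_mul_eq_one _ hxw) with h | h <;> rw [h] <;> norm_num
    have e : hA f2 = hA f1 := by rw [hA2, hx2]; ring
    have k1 := abs_lt.1 h1.2.1
    have k2 := abs_lt.1 h2.2.1
    rw [e, hB2] at k2
    have := h1.1
    have k3 : |x * s| < 1 := by rw [abs_lt]; constructor <;> nlinarith
    have k4 : x * s = 0 := by rw [Int.abs_lt_one_iff] at k3; exact k3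
    rcases mul_eq_zero.1 k4 with h | h
    · rw [h] at hxw; simp at hxw
    · exact h
  subst hs
  rcases Int.isUnit_iff.1 (IsUnit.of_mul_eq_one _ hxw) with hx | hx
  · left
    have : w = 1 := by rw [hx] at hxw; linarith
    rw [h, hx, this, act_one]
  · right
    have : w = -1 := by rw [hx] at hxw; linarith
    rw [h, hx, this]
    funext i; fin_cases i <;> simp [act]

/-! labels -/
noncomputable def lab (q : ℕ) (s w : ℤ) : Option (ZMod q) := if (w : ZMod q) = 0 then none else some ((s : ZMod q) * (w : ZMod q)⁻¹)

lemma lab_eq (q : ℕ) [Fact q.Prime] {s w s' w' : ℤ} (h : lab q s w = lab q s' w') :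
    (s : ZMod q) * w' = s' * w := by
  unfold lab at h
  split_ifs at h with h1 h2 h2
  · rw [h1, h2]; simp
  · have := Option.some.inj h
    field_simp at this
    linear_combination this

def Rel1 (q : ℕ) (f g : V ℤ) (l : Option (ZMod q)) : Prop :=
  ∃ x s y w s1 w1 u v : ℤ, x * w - s * y = q ∧ act x s y w g = (q : ℤ) • f ∧
    (q : ℤ) ∣ x - u * s1 ∧ (q : ℤ) ∣ y - u * w1 ∧ (q : ℤ) ∣ s - v * s1 ∧ (q : ℤ) ∣ w - v * w1 ∧
    ¬ ((q : ℤ) ∣ s1 ∧ (q : ℤ) ∣ w1) ∧ (q : ℤ) ∣ act 0 s1 0 w1 g 3 ∧ l = lab q s1 w1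

lemma act_smul (x s y w k : ℤ) (f : V ℤ) : act x s y w (k • f) = k • act x s y w f := by
  funext i; fin_cases i <;> simp [act] <;> ring

lemma Rel1_unique (q : ℕ) [hq : Fact q.Prime] {f1 f2 g : V ℤ} {l : Option (ZMod q)} (h1 : redO f1) (h2 : redO f2)
    (r1 : Rel1 q f1 g l) (r2 : Rel1 q f2 g l) : f2 = f1 ∨ f2 = -f1 := by
  obtain ⟨x, s, y, w, s1, w1, u, v, e1, e2, e3, e4, e5, e6, -, -, e9⟩ := r1
  obtain ⟨x', s', y', w', s1', w1', u', v', k1, k2, k3, k4, k5, k6, -, -, k9⟩ := r2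
  have hl := lab_eq q (e9.symm.trans k9)
  have hq0 : (q : ℤ) ≠ 0 := by exact_mod_cast hq.1.ne_zero
  simp only [← ZMod.intCast_zmod_eq_zero_iff_dvd] at e3 e4 e5 e6 k3 k4 k5 k6
  push_cast at e3 e4 e5 e6 k3 k4 k5 k6
  rw [sub_eq_zero] at e3 e4 e5 e6 k3 k4 k5 k6
  have d1 : (q : ℤ) ∣ w * x' - s * y' := by
    rw [← ZMod.intCast_zmod_eq_zero_iff_dvd]; push_cast; rw [e5, e6, k3, k4]; linear_combination -(v * u' : ZMod q) * hl
  have d2 : (q : ℤ) ∣ w * s' - s * w' := by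
    rw [← ZMod.intCast_zmod_eq_zero_iff_dvd]; push_cast; rw [e5, e6, k5, k6]; linear_combination -(v * v' : ZMod q) * hl
  have d3 : (q : ℤ) ∣ x * y' - y * x' := by
    rw [← ZMod.intCast_zmod_eq_zero_iff_dvd]; push_cast; rw [e3, e4, k3, k4]; linear_combination (u * u' : ZMod q) * hl
  have d4 : (q : ℤ) ∣ x * w' - y * s' := by
    rw [← ZMod.intCast_zmod_eq_zero_iff_dvd]; push_cast; rw [e3, e4, k5, k6]; linear_combination (u * v' : ZMod q) * hl
  obtain ⟨a, ha⟩ := d1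
  obtain ⟨b, hb⟩ := d2
  obtain ⟨c, hc⟩ := d3
  obtain ⟨d, hd⟩ := d4
  have hx' : x' = x * a + s * c := mul_left_cancel₀ hq0 (by linear_combination -x' * e1 + x * ha + s * hc)
  have hs' : s' = x * b + s * d := mul_left_cancel₀ hq0 (by linear_combination -s' * e1 + x * hb + s * hd)
  have hy' : y' = y * a + w * c := mul_left_cancel₀ hq0 (by linear_combination -y' * e1 + y * ha + w * hc)
  have hw' : w' = y * b + w * d := mul_left_cancel₀ hq0 (by linear_combination -w' * e1 + y * hb + w * hd)
  have hdet : a * d - b * c = 1 := by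
    apply mul_left_cancel₀ hq0
    have : (x * w - s * y) * (a * d - b * c) = x' * w' - s' * y' := by rw [hx', hs', hy', hw']; ring
    rw [e1, k1] at this; linarith
  refine redO_unique h1 h2 hdet ?_
  have : (q : ℤ) • f2 = (q : ℤ) • act a b c d f1 := by
    rw [← act_smul, ← e2, act_act, ← k2]
    congr 1
  exact smul_right_injective _ hq0 this

lemma Rel1_exists (q : ℕ) [hq : Fact q.Prime] (hq2 : q ≠ 2) {f : V ℤ} (h1 : 0 < hA f) (hneg : hD f < 0) (hd : (q : ℤ) ^ 2 ∣ hD f)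
    (hH : ¬ ((q : ℤ) ∣ hA f ∧ (q : ℤ) ∣ hB f ∧ (q : ℤ) ∣ hC f)) :
    ∃ g l, redC g ∧ hD f = q ^ 2 * hD g ∧ ¬ ((q : ℤ) ∣ hA g ∧ (q : ℤ) ∣ hB g ∧ (q : ℤ) ∣ hC g) ∧ Rel1 q f g l := by
  have hqp : Prime (q : ℤ) := Nat.prime_iff_prime_int.1 hq.1
  have hq0 : (q : ℤ) ≠ 0 := hqp.ne_zero
  have hqpos : (0:ℤ) < q := by have := hq.1.pos; exact_mod_cast this
  have h2 : (2 : ZMod q) ≠ 0 := by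
    have := Ring.two_ne_zero (R := ZMod q) (by rw [ZMod.ringChar_zmod_n]; exact hq2)
    exact this
  -- move the double root to infinity
  obtain ⟨x, s, y, w, hdet, hqA, hqB⟩ : ∃ x s y w : ℤ, x * w - s * y = 1 ∧ (q : ℤ) ∣ hA (act x s y w f) ∧ (q : ℤ) ∣ hB (act x s y w f) := by
    have hD0 : ((hB f : ℤ) : ZMod q) ^ 2 - 4 * (hA f : ℤ) * (hC f : ℤ) = 0 := by
      have := (dvd_pow_self (q : ℤ) two_ne_zero).trans hd
      rw [← ZMod.intCast_zmod_eq_zero_iff_dvd] at this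
      simpa [hD] using this
    by_cases hA0 : (q : ℤ) ∣ hA f
    · refine ⟨1, 0, 0, 1, by ring, by rwa [act_one], ?_⟩
      rw [act_one]
      rw [← ZMod.intCast_zmod_eq_zero_iff_dvd] at hA0 ⊢
      rw [hA0] at hD0
      simpa using hD0
    · rw [← ZMod.intCast_zmod_eq_zero_iff_dvd] at hA0
      refine ⟨(-((hB f : ℤ) : ZMod q) * (2 * ((hA f : ℤ) : ZMod q))⁻¹).val, -1, 1, 0, by ring, ?_, ?_⟩ <;>
        rw [← ZMod.intCast_zmod_eq_zero_iff_dvd]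
      · rw [hA_act]; push_cast; rw [ZMod.natCast_zmod_val]; field_simp; ring_nf
        linear_combination -4 * ((hA f : ℤ) : ZMod q) ^ 2 * hD0
      · rw [hB_act]; push_cast; rw [ZMod.natCast_zmod_val]; field_simp; ring
  set f' := act x s y w f with hf'
  have hinv : f = act w (-s) (-y) x f' := by
    rw [hf', act_act]
    conv_lhs => rw [← act_one f]
    congr 1 <;> first | ring1 | linear_combination -hdet
  have hdet' : w * x - -s * -y = 1 := by linear_combination hdet
  have hDf' : hD f' = hD f := by rw [hf', hD_act, hdet]; ring
  have hqC : ¬ (q : ℤ) ∣ hC f' := by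
    intro hqC
    apply hH
    have eA := hA_act w (-s) (-y) x f'
    have eB := hB_act w (-s) (-y) x f'
    have eC := hC_act w (-s) (-y) x f'
    rw [← hinv] at eA eB eC
    rw [eA, eB, eC]
    refine ⟨Dvd.dvd.mul_left ?_ _, Dvd.dvd.mul_left ?_ _, Dvd.dvd.mul_left ?_ _⟩
    · exact dvd_add (dvd_add (hqA.mul_right _) ((hqB.mul_right _).mul_right _)) (hqC.mul_right _)
    · exact dvd_add (dvd_add (((hqA.mul_left _).mul_right _).mul_right _) (hqB.mul_right _)) (((hqC.mul_left _).mul_right _).mul_right _)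
    · exact dvd_add (dvd_add (hqA.mul_right _) ((hqB.mul_right _).mul_right _)) (hqC.mul_right _)
  have hq4 : IsCoprime ((q : ℤ) ^ 2) 4 := by
    apply IsCoprime.pow_left
    rw [show (4:ℤ) = 2 ^ 2 by norm_num]
    apply IsCoprime.pow_right
    rw [Int.isCoprime_iff_gcd_eq_one]
    exact_mod_cast (Nat.coprime_primes hq.1 Nat.prime_two).2 hq2
  have hqA2 : (q : ℤ) ^ 2 ∣ hA f' := by
    have e : 4 * (hA f' * hC f') = hB f' ^ 2 - hD f' := by simp only [hD]; ring
    have h3 : (q : ℤ) ^ 2 ∣ 4 * (hA f' * hC f') := by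
      rw [e, hDf']; exact dvd_sub (pow_dvd_pow_of_dvd hqB 2) hd
    have h4 := hq4.dvd_of_dvd_mul_left h3
    refine IsCoprime.dvd_of_dvd_mul_right ?_ h4
    exact ((Prime.coprime_iff_not_dvd hqp).2 hqC).pow_left
  have hq_0 : (q : ℤ) ∣ f' 0 := by
    have h5 : f' 0 * hC f' = f' 1 * hB f' - f' 2 * hA f' := by linear_combination syz1 f'
    have h6 : (q : ℤ) ∣ f' 0 * hC f' := by rw [h5]; exact dvd_sub (hqB.mul_left _) (hqA.mul_left _)
    exact (hqp.dvd_or_dvd h6).resolve_right hqC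
  have hq_1 : (q : ℤ) ∣ f' 1 := by
    apply hqp.dvd_of_dvd_pow (n := 2)
    have : f' 1 ^ 2 = hA f' + f' 0 * f' 2 := by simp only [hA]; ring
    rw [this]; exact dvd_add hqA (hq_0.mul_right _)
  have hq_2 : ¬ (q : ℤ) ∣ f' 2 := by
    intro h
    apply hqC
    simp only [hC]
    exact dvd_sub (dvd_pow h two_ne_zero) (hq_1.mul_right _)
  have hq_0' : (q : ℤ) ^ 2 ∣ f' 0 := by
    have h5 : (q : ℤ) ^ 2 ∣ f' 0 * f' 2 := by
      have : f' 0 * f' 2 = f' 1 ^ 2 - hA f' := by simp only [hA]; ring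
      rw [this]; exact dvd_sub (pow_dvd_pow_of_dvd hq_1 2) hqA2
    exact IsCoprime.dvd_of_dvd_mul_right (((Prime.coprime_iff_not_dvd hqp).2 hq_2).pow_left) h5
  obtain ⟨a, ha⟩ := hq_0'
  obtain ⟨b, hb⟩ := hq_1
  set f'' : V ℤ := ![a, b, f' 2, q * f' 3] with hf''
  have hAA : hA f' = q ^ 2 * hA f'' := by simp [hA, hf'', ha, hb]; ring
  have hBB : hB f' = q * hB f'' := by simp [hB, hf'', ha, hb]; ring
  have hCC : hC f' = hC f'' := by simp [hC, hf'', hb]; ring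
  have hDD : hD f' = q ^ 2 * hD f'' := by simp only [hD, hAA, hBB, hCC]; ring
  have hact : act (q : ℤ) 0 0 1 f'' = (q : ℤ) • f' := by
    funext i; fin_cases i <;> simp [act, hf'', ha, hb] <;> ring
  have hDn : hD f'' < 0 := by
    by_contra h
    have : 0 ≤ hD f' := by rw [hDD]; push Not at h; positivity
    omega
  have hApos : 0 < hA f'' := by
    by_contra h
    have hle : hA f' ≤ 0 := by rw [hAA]; push Not at h; exact mul_nonpos_of_nonneg_of_nonpos (by positivity) h
    have e1 : hA f' = hA f * x ^ 2 + hB f * x * y + hC f * y ^ 2 := by rw [hf', hA_act, hdet]; ring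
    have e2 : 4 * hA f * hA f' = (2 * hA f * x + hB f * y) ^ 2 - hD f * y ^ 2 := by rw [e1]; simp only [hD]; ring
    have e3 : 4 * hA f * hA f' ≤ 0 := mul_nonpos_of_nonneg_of_nonpos (by positivity) hle
    have hy : y = 0 := by
      by_contra hy
      have : 0 < y ^ 2 := by positivity
      nlinarith [sq_nonneg (2 * hA f * x + hB f * y)]
    rw [hy] at e2 hdet
    have hx : x ≠ 0 := by rintro rfl; simp at hdet
    have : 0 < x ^ 2 := by positivity
    nlinarith [mul_pos (mul_pos h1 h1) this]
  obtain ⟨x1, s1, y1, w1, hdet1, hred⟩ := exists_red f'' hApos hDn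
  set g := act x1 s1 y1 w1 f'' with hg
  have hinv1 : f'' = act w1 (-s1) (-y1) x1 g := by
    rw [hg, act_act]
    conv_lhs => rw [← act_one f'']
    congr 1 <;> first | ring1 | linear_combination -hdet1
  have hdet1' : w1 * x1 - -s1 * -y1 = 1 := by linear_combination hdet1
  refine ⟨g, lab q (-s1) x1, hred, ?_, ?_, q * w1 * w + -s1 * -y, q * w1 * -s + -s1 * x, q * -y1 * w + x1 * -y, q * -y1 * -s + x1 * x,
    -s1, x1, -y, x, ?_, ?_, ⟨w1 * w, by ring⟩, ⟨-y1 * w, by ring⟩, ⟨w1 * -s, by ring⟩, ⟨-y1 * -s, by ring⟩, ?_, ?_, rfl⟩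
  · rw [hg, hD_act, hdet1, ← hDf', hDD]; ring
  · rintro ⟨k1, k2, k3⟩
    apply hqC
    rw [hCC, hinv1, hC_act]
    exact Dvd.dvd.mul_left (dvd_add (dvd_add (k1.mul_right _) ((k2.mul_right _).mul_right _)) (k3.mul_right _)) _
  · have e : q * ((w1 * x1 - -s1 * -y1) * (w * x - -s * -y)) = q := by rw [hdet1', hdet']; ring
    linear_combination e
  · have e1 : (q : ℤ) • f = act w (-s) (-y) x (act (q : ℤ) 0 0 1 (act w1 (-s1) (-y1) x1 g)) := by
      rw [← hinv1, hact, act_smul, ← hinv]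
    rw [e1]
    clear_value g
    rw [act_act, act_act]
    congr 1 <;> ring
  · rintro ⟨k1, k2⟩
    apply hqp.not_unit
    rw [isUnit_iff_dvd_one, ← hdet1']
    exact dvd_sub (k2.mul_left _) (k1.mul_right _)
  · have : act 0 (-s1) 0 x1 g 3 = f'' 3 := by
      conv_rhs => rw [hinv1]
      simp [act]
    rw [this]; simp [hf'']


open Polynomial in
/-- dehomogenised cubic modulo `q` -/
noncomputable def gpoly (q : ℕ) (g : V ℤ) : (ZMod q)[X] :=
  C (g 0 : ZMod q) * X ^ 3 + C (3 * (g 1 : ZMod q)) * X ^ 2 + C (3 * (g 2 : ZMod q)) * X + C (g 3 : ZMod q)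

/-- possible labels -/
noncomputable def labs (q : ℕ) [Fact q.Prime] (g : V ℤ) : Finset (Option (ZMod q)) :=
  insert none ((gpoly q g).roots.toFinset.image some)

lemma card_labs (q : ℕ) [Fact q.Prime] (g : V ℤ) : (labs q g).card ≤ 4 := by
  unfold labs
  refine (Finset.card_insert_le _ _).trans ?_
  have h1 : ((gpoly q g).roots.toFinset.image some).card ≤ 3 := by
    refine Finset.card_image_le.trans ((Multiset.toFinset_card_le _).trans ((Polynomial.card_roots' _).trans ?_))
    unfold gpoly
    exact Polynomial.natDegree_cubic_le
  omega

lemma Rel1_labs (q : ℕ) [hq : Fact q.Prime] (hq3 : 3 < q) {f g : V ℤ} {l : Option (ZMod q)}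
    (hH : ¬ ((q : ℤ) ∣ hA g ∧ (q : ℤ) ∣ hB g ∧ (q : ℤ) ∣ hC g)) (h : Rel1 q f g l) : l ∈ labs q g := by
  obtain ⟨-, -, -, -, s, w, -, -, -, -, -, -, -, -, hsw, hr, rfl⟩ := h
  unfold lab labs
  split_ifs with hw
  · simp
  · rw [Finset.mem_insert]; right
    rw [Finset.mem_image]
    refine ⟨_, ?_, rfl⟩
    rw [Multiset.mem_toFinset, Polynomial.mem_roots']
    have h3 : (3 : ZMod q) ≠ 0 := by
      intro h
      have : ((3:ℕ) : ZMod q) = 0 := by exact_mod_cast h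
      rw [ZMod.natCast_eq_zero_iff] at this
      exact absurd (Nat.le_of_dvd (by norm_num) this) (by omega)
    constructor
    · intro h0
      set Q : Cubic (ZMod q) := ⟨(g 0 : ZMod q), 3 * (g 1 : ZMod q), 3 * (g 2 : ZMod q), (g 3 : ZMod q)⟩ with hQd
      have hQ : Q.toPoly = 0 := h0
      have c3 := (Cubic.coeff_eq_a (P := Q)).symm.trans ((congrArg (fun p => Polynomial.coeff p _) hQ).trans (Polynomial.coeff_zero _))
      have c2 := (Cubic.coeff_eq_b (P := Q)).symm.trans ((congrArg (fun p => Polynomial.coeff p _) hQ).trans (Polynomial.coeff_zero _))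
      have c1 := (Cubic.coeff_eq_c (P := Q)).symm.trans ((congrArg (fun p => Polynomial.coeff p _) hQ).trans (Polynomial.coeff_zero _))
      have c0 := (Cubic.coeff_eq_d (P := Q)).symm.trans ((congrArg (fun p => Polynomial.coeff p _) hQ).trans (Polynomial.coeff_zero _))
      simp [hQd, h3] at c0 c1 c2 c3
      apply hH
      simp only [← ZMod.intCast_zmod_eq_zero_iff_dvd, hA, hB, hC]
      push_cast
      rw [c0, c1, c2, c3]; simp
    · rw [← ZMod.intCast_zmod_eq_zero_iff_dvd] at hr
      simp [act] at hr
      simp only [Polynomial.IsRoot.def, gpoly]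
      simp
      field_simp
      linear_combination hr

def EQ (X : ℝ) (q : ℕ) : Set (V ℤ) := {f ∈ FO X | (q : ℤ) ^ 2 ∣ hD f ∧ ¬ ((q : ℤ) ∣ hA f ∧ (q : ℤ) ∣ hB f ∧ (q : ℤ) ∣ hC f)}

lemma FO_finite (X : ℝ) : (FO X).Finite := by
  rcases le_or_gt 0 X with h | h
  · exact (FC_bound X h).1.subset (by intro f hf; exact ⟨hf.1.redC, hf.2⟩)
  · convert Set.finite_empty (α := V ℤ)
    rw [Set.eq_empty_iff_forall_notMem]
    intro f hf
    have := hf.1.redC.hD_neg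
    have h2 : ((hD f : ℤ) : ℝ) < 0 := by exact_mod_cast this
    have h3 := hf.2.2
    linarith

lemma EQ_bound : ∃ C : ℝ, 0 < C ∧ ∀ (X : ℝ) (_ : 0 ≤ X) (q : ℕ) (_ : q.Prime) (_ : 3 < q),
    ((EQ X q).ncard : ℝ) ≤ C * X * ((q:ℝ) ^ 2)⁻¹ := by
  obtain ⟨C, hC0, hC⟩ := RC_bound
  refine ⟨8 * C, by positivity, fun X hX q hq hq3 => ?_⟩
  have : Fact q.Prime := ⟨hq⟩
  have hqR : (0:ℝ) < q := by exact_mod_cast hq.pos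
  have hfin : (EQ X q).Finite := (FO_finite X).subset (by intro f hf; exact hf.1)
  have hex : ∀ f : V ℤ, f ∈ EQ X q → ∃ gl : V ℤ × Option (ZMod q), gl.1 ∈ RC (X / q ^ 2) ∧ gl.2 ∈ labs q gl.1 ∧ Rel1 q f gl.1 gl.2 := by
    rintro f ⟨⟨h1, -, h2⟩, h3, h4⟩
    obtain ⟨g, l, k1, k2, k3, k4⟩ := Rel1_exists q (by omega) h1.1 h1.redC.hD_neg h3 h4
    refine ⟨(g, l), ⟨k1, ?_⟩, Rel1_labs q hq3 k3 k4, k4⟩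
    rw [k2] at h2
    push_cast at h2
    rw [← neg_div, div_lt_iff₀ (by positivity)]; linarith
  choose! Ψ hΨ using hex
  obtain ⟨hRf, hRc⟩ := hC (X / q ^ 2) (by positivity)
  have h1 : hfin.toFinset.card ≤ 2 * (hfin.toFinset.image Ψ).card := by
    refine Finset.card_le_mul_card_image _ _ ?_
    intro b hb
    obtain ⟨f, hf, rfl⟩ := Finset.mem_image.1 hb
    rw [Set.Finite.mem_toFinset] at hf
    refine (Finset.card_le_card (t := {f, -f}) ?_).trans Finset.card_le_two
    intro f2 hf2
    rw [Finset.mem_filter, Set.Finite.mem_toFinset] at hf2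
    have r2 := (hΨ f2 hf2.1).2.2
    rw [hf2.2] at r2
    have := Rel1_unique q hf.1.1 hf2.1.1.1 (hΨ f hf).2.2 r2
    simpa using this
  have h2 : (hfin.toFinset.image Ψ).card ≤ hRf.toFinset.card * 4 := by
    have : hfin.toFinset.image Ψ ⊆ (hRf.toFinset.sigma fun g => labs q g).image (fun z => (z.1, z.2)) := by
      intro b hb
      obtain ⟨f, hf, rfl⟩ := Finset.mem_image.1 hb
      rw [Set.Finite.mem_toFinset] at hf
      refine Finset.mem_image.2 ⟨⟨(Ψ f).1, (Ψ f).2⟩, Finset.mem_sigma.2 ⟨?_, (hΨ f hf).2.1⟩, rfl⟩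
      rw [Set.Finite.mem_toFinset]; exact (hΨ f hf).1
    refine (Finset.card_le_card this).trans (Finset.card_image_le.trans ?_)
    rw [Finset.card_sigma]
    exact Finset.sum_le_card_nsmul _ _ _ fun g _ => card_labs q g
  rw [← Set.ncard_eq_toFinset_card _ hfin] at h1
  rw [← Set.ncard_eq_toFinset_card _ hRf] at h2
  have h3 : ((EQ X q).ncard : ℝ) ≤ 8 * (RC (X / q ^ 2)).ncard := by
    have : (EQ X q).ncard ≤ 8 * (RC (X / q ^ 2)).ncard := by omega
    exact_mod_cast this
  calc _ ≤ 8 * (C * (X / q ^ 2)) := h3.trans (by gcongr)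
    _ = _ := by ring

lemma tail : ∃ C : ℝ, 0 < C ∧ ∀ Z : ℕ, 3 ≤ Z → ∀ᶠ X : ℝ in atTop,
    ({f ∈ FO X | ∃ q : ℕ, q.Prime ∧ Z < q ∧ (q : ℤ) ^ 2 ∣ hD f}.ncard : ℝ) ≤ C * X / Z := by
  obtain ⟨C1, hC1, h1⟩ := tail2
  obtain ⟨C2, hC2, h2⟩ := EQ_bound
  refine ⟨C1 + C2, by positivity, fun Z hZ => ?_⟩
  have hZR : (0:ℝ) < Z := by exact_mod_cast (by omega : 0 < Z)
  filter_upwards [h1 Z (by omega), eventually_gt_atTop 0] with X hX hX0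
  set S2 := {f ∈ FC X | ∃ q : ℕ, q.Prime ∧ Z < q ∧ (q : ℤ) ∣ hA f ∧ (q : ℤ) ∣ hB f ∧ (q : ℤ) ∣ hC f} with hS2
  set P := (Finset.Ioc Z ⌊X⌋₊).filter Nat.Prime with hP
  have hsub : {f ∈ FO X | ∃ q : ℕ, q.Prime ∧ Z < q ∧ (q : ℤ) ^ 2 ∣ hD f} ⊆ S2 ∪ ⋃ q ∈ P, EQ X q := by
    rintro f ⟨hf, q, hq, hZq, hd⟩
    by_cases h : (q : ℤ) ∣ hA f ∧ (q : ℤ) ∣ hB f ∧ (q : ℤ) ∣ hC f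
    · left; exact ⟨⟨hf.1.redC, hf.2⟩, q, hq, hZq, h⟩
    · right
      simp only [mem_iUnion]
      refine ⟨q, Finset.mem_filter.2 ⟨Finset.mem_Ioc.2 ⟨hZq, Nat.le_floor ?_⟩, hq⟩, hf, hd, h⟩
      have hn := hf.1.redC.hD_neg
      have k1 : (q : ℤ) ^ 2 ≤ - hD f := Int.le_of_dvd (by omega) ((dvd_neg).2 hd)
      have k2 : (q : ℤ) ≤ - hD f := by
        have : (1:ℤ) ≤ q := by exact_mod_cast hq.one_lt.le
        nlinarith
      have k3 : ((q : ℤ) : ℝ) ≤ - ((hD f : ℤ) : ℝ) := by exact_mod_cast k2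
      have := hf.2.2
      push_cast at k3
      linarith
  have hf1 : S2.Finite := (FC_bound X hX0.le).1.subset (by intro f hf; exact hf.1)
  have hf2 : (⋃ q ∈ P, EQ X q).Finite := Set.Finite.biUnion (Finset.finite_toSet _) fun q hq =>
    (FO_finite X).subset (by intro f hf; exact hf.1)
  have k1 : ((⋃ q ∈ P, EQ X q).ncard : ℝ) ≤ C2 * X / Z :=
    calc _ ≤ ∑ q ∈ P, ((EQ X q).ncard : ℝ) := by exact_mod_cast Finset.set_ncard_biUnion_le _ _
      _ ≤ ∑ q ∈ P, C2 * X * ((q:ℝ) ^ 2)⁻¹ := Finset.sum_le_sum fun q hq => by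
          rw [hP, Finset.mem_filter, Finset.mem_Ioc] at hq
          exact h2 X hX0.le q hq.2 (by omega)
      _ ≤ C2 * X * (Z:ℝ)⁻¹ := by
          rw [← Finset.mul_sum]
          gcongr
          refine le_trans ?_ (sum_inv_sq_le Z ⌊X⌋₊ (by omega))
          exact Finset.sum_le_sum_of_subset_of_nonneg (Finset.filter_subset _ _) fun _ _ _ => by positivity
      _ = _ := by ring
  have k2 : ({f ∈ FO X | ∃ q : ℕ, q.Prime ∧ Z < q ∧ (q : ℤ) ^ 2 ∣ hD f}.ncard : ℝ) ≤ S2.ncard + (⋃ q ∈ P, EQ X q).ncard := by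
    exact_mod_cast (Set.ncard_le_ncard hsub (hf1.union hf2)).trans (Set.ncard_union_le _ _)
  have e : (C1 + C2) * X / Z = C1 * X / Z + C2 * X / Z := by ring
  rw [e]; linarith

end PTM


/-! ### The sieve -/
namespace PTM
open Set Filter

theorem sieve {ι : Type} [Fintype ι] (L U : ℝ → Set (ι → ℤ)) (c : ℝ) (hL : Equi L c) (hU : Equi U c)
    (k : ℕ → ℕ) (hk0 : k 0 = 0) (T : ∀ q, Finset (ι → ZMod (q ^ k q))) (Bad : ℕ → (ι → ℤ) → Prop) (Z0 : ℕ)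
    (hBad : ∀ q : ℕ, q.Prime → Z0 < q → ∀ f, rd (q ^ k q) f ∉ T q → Bad q f) (C : ℝ)
    (htail : ∀ Z : ℕ, Z0 ≤ Z → ∀ᶠ X : ℝ in atTop, ({f ∈ L X | ∃ q : ℕ, q.Prime ∧ Z < q ∧ Bad q f}.ncard : ℝ) ≤ C * X / Z)
    (t : ℝ) (ht : Tendsto (fun n => ∏ q ∈ Nat.primesBelow n, ((T q).card : ℝ) / ((q ^ k q : ℕ) : ℝ) ^ Fintype.card ι) atTop (nhds t))
    (N : ℝ → ℝ) (E : ℝ) (hlo : ∀ᶠ X in atTop, ({f ∈ L X | ∀ q : ℕ, q.Prime → rd (q ^ k q) f ∈ T q}.ncard : ℝ) ≤ N X + E)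
    (hhi : ∀ᶠ X in atTop, N X ≤ ({f ∈ U X | ∀ q : ℕ, q.Prime → rd (q ^ k q) f ∈ T q}.ncard : ℝ) + E) :
    Tendsto (fun X => N X / X) atTop (nhds (c * t)) := by
  have hm : ∀ q, q ^ k q ≠ 0 := by
    intro q
    rcases Nat.eq_zero_or_pos q with rfl | h
    · simp [hk0]
    · positivity
  have hco : ∀ n, ((Nat.primesBelow n : Finset ℕ) : Set ℕ).Pairwise (fun q q' => (q ^ k q).Coprime (q' ^ k q')) := by
    intro n q hq q' hq' hne
    exact ((Nat.coprime_primes (Nat.prime_of_mem_primesBelow hq) (Nat.prime_of_mem_primesBelow hq')).2 hne).pow _ _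
  have pL := fun n => hL.prod' (fun q => q ^ k q) hm T (Nat.primesBelow n) (hco n)
  have pU := fun n => hU.prod' (fun q => q ^ k q) hm T (Nat.primesBelow n) (hco n)
  have hct := ht.const_mul c
  have hE : ∀ ε > 0, ∀ᶠ X : ℝ in atTop, E ≤ ε * X := by
    intro ε hε
    filter_upwards [eventually_ge_atTop (E / ε)] with X hX
    rw [div_le_iff₀ hε] at hX; linarith
  apply tendsto_div_of_eps
  · intro ε hε
    obtain ⟨n, hn⟩ := (hct.eventually (gt_mem_nhds (show c * t < c * t + ε / 3 by linarith))).exists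
    filter_upwards [(pU n).eventually (gt_mem_nhds (lt_add_of_pos_right _ (by positivity : 0 < ε / 3))), hE (ε / 3) (by positivity), hhi, eventually_gt_atTop 0]
      with X h1 h2 h3 h4
    rw [div_lt_iff₀ h4] at h1
    have h5 : ({f ∈ U X | ∀ q : ℕ, q.Prime → rd (q ^ k q) f ∈ T q}.ncard : ℝ) ≤ ({f ∈ U X | ∀ q ∈ Nat.primesBelow n, rd (q ^ k q) f ∈ T q}.ncard : ℝ) := by
      have hfin : {f ∈ U X | ∀ q ∈ Nat.primesBelow n, rd (q ^ k q) f ∈ T q}.Finite := (hU.1 X h4).subset (by intro f hf; exact hf.1)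
      exact_mod_cast Set.ncard_le_ncard (by
        intro f hf; exact ⟨hf.1, fun q hq => hf.2 q (Nat.prime_of_mem_primesBelow hq)⟩) hfin
    have h8 := mul_lt_mul_of_pos_right hn h4
    have h9 := h5
    clear h5
    linarith [h1, h2, h3, h8, h9]
  · intro ε hε
    have hC : Tendsto (fun n : ℕ => C / (n : ℝ)) atTop (nhds 0) := tendsto_const_div_atTop_nhds_zero_nat C
    obtain ⟨n, hn, hn1, hn2⟩ := (((hct.comp (tendsto_add_atTop_nat 1)).eventually (lt_mem_nhds (show c * t - ε / 4 < c * t by linarith))).and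
      ((hC.eventually (gt_mem_nhds (show 0 < ε / 4 by linarith))).and (eventually_ge_atTop Z0))).exists
    simp only [Function.comp] at hn
    filter_upwards [(pL (n + 1)).eventually (lt_mem_nhds (sub_lt_self _ (by positivity : 0 < ε / 4))), hE (ε / 4) (by positivity), hlo, htail n hn2, eventually_gt_atTop 0]
      with X h1 h2 h3 h6 h4
    rw [lt_div_iff₀ h4] at h1
    have h5 : ({f ∈ L X | ∀ q ∈ Nat.primesBelow (n + 1), rd (q ^ k q) f ∈ T q}.ncard : ℝ) ≤ ({f ∈ L X | ∀ q : ℕ, q.Prime → rd (q ^ k q) f ∈ T q}.ncard : ℝ)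
        + ({f ∈ L X | ∃ q : ℕ, q.Prime ∧ n < q ∧ Bad q f}.ncard : ℝ) := by
      have hfin : ({f ∈ L X | ∀ q : ℕ, q.Prime → rd (q ^ k q) f ∈ T q} ∪ {f ∈ L X | ∃ q : ℕ, q.Prime ∧ n < q ∧ Bad q f}).Finite :=
        (hL.1 X h4).subset (by rintro f (hf | hf) <;> exact hf.1)
      have hsub : {f ∈ L X | ∀ q ∈ Nat.primesBelow (n + 1), rd (q ^ k q) f ∈ T q} ⊆
        ({f ∈ L X | ∀ q : ℕ, q.Prime → rd (q ^ k q) f ∈ T q} ∪ {f ∈ L X | ∃ q : ℕ, q.Prime ∧ n < q ∧ Bad q f}) := by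
        rintro f ⟨hf, hf2⟩
        by_cases h : ∃ q : ℕ, q.Prime ∧ n < q ∧ Bad q f
        · right; exact ⟨hf, h⟩
        · left
          refine ⟨hf, fun q hq => ?_⟩
          by_contra hb
          rcases lt_or_ge n q with hlt | hge
          · exact h ⟨q, hq, hlt, hBad q hq (by omega) f hb⟩
          · exact hb (hf2 q (Nat.mem_primesBelow.2 ⟨by omega, hq⟩))
      exact_mod_cast (Set.ncard_le_ncard hsub hfin).trans (Set.ncard_union_le _ _)
    have h7 : C * X / n ≤ ε / 4 * X := by
      rw [mul_div_right_comm]; exact mul_le_mul_of_nonneg_right hn1.le h4.le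
    have h8 := mul_lt_mul_of_pos_right hn h4
    linarith

lemma euler_lim : Tendsto (fun n : ℕ => ∏ q ∈ Nat.primesBelow n, (1 - 1 / (q:ℝ) ^ 2)) atTop (nhds (6 / Real.pi ^ 2)) := by
  have h := riemannZeta_eulerProduct (s := 2) (by norm_num)
  rw [riemannZeta_two] at h
  have h2 : Tendsto (fun n : ℕ => ∏ q ∈ Nat.primesBelow n, (1 - 1 / (q:ℝ) ^ 2)⁻¹) atTop (nhds (Real.pi ^ 2 / 6)) := by
    rw [← Filter.tendsto_ofReal_iff]
    convert h using 1
    · funext n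
      push_cast
      refine Finset.prod_congr rfl fun q _ => ?_
      rw [Complex.cpow_neg]
      norm_num
    · push_cast; rfl
  have h3 := h2.inv₀ (by positivity)
  simp only [← Finset.prod_inv_distrib, inv_inv] at h3
  convert h3 using 2
  rw [inv_div]

lemma one_sub_pos {q : ℕ} (hq : q.Prime) : (0:ℝ) < 1 - 1 / (q:ℝ) ^ 2 := by
  have : (2:ℝ) ≤ q := by exact_mod_cast hq.two_le
  rw [sub_pos, div_lt_one (by positivity)]
  nlinarith

lemma prod_lim (S : Finset ℕ) (hS : ∀ q ∈ S, q.Prime) (τ σ : ℕ → ℝ) (h : ∀ q, q.Prime → q ∉ S → τ q = σ q) (hσ : ∀ q, q.Prime → σ q ≠ 0)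
    (s : ℝ) (hs : Tendsto (fun n : ℕ => ∏ q ∈ Nat.primesBelow n, σ q) atTop (nhds s)) :
    Tendsto (fun n : ℕ => ∏ q ∈ Nat.primesBelow n, τ q) atTop (nhds ((∏ q ∈ S, τ q / σ q) * s)) := by
  refine (hs.const_mul (∏ q ∈ S, τ q / σ q)).congr' ?_
  filter_upwards [eventually_gt_atTop (S.sup id)] with n hn
  have hsub : S ⊆ Nat.primesBelow n := by
    intro q hq
    have : q ≤ S.sup id := Finset.le_sup (f := id) hq
    exact Nat.mem_primesBelow.2 ⟨by omega, hS q hq⟩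
  rw [← Finset.prod_sdiff hsub, ← Finset.prod_sdiff hsub (f := τ)]
  have e : ∏ x ∈ Nat.primesBelow n \ S, τ x = ∏ x ∈ Nat.primesBelow n \ S, σ x :=
    Finset.prod_congr rfl fun q hq => h q (Nat.prime_of_mem_primesBelow (Finset.mem_sdiff.1 hq).1) (Finset.mem_sdiff.1 hq).2
  rw [e, Finset.prod_div_distrib]
  have : ∏ q ∈ S, σ q ≠ 0 := Finset.prod_ne_zero_iff.2 fun q hq => hσ q (hS q hq)
  field_simp

end PTM


/-! ### Local data: squares, tails -/
namespace PTM
open Set Filter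

/-- `z` is a unit and a square in the `p`-adic integers. -/
def sqp (p : ℕ) (z : ℤ) : Prop := if p = 2 then z % 8 = 1 else ¬ (p : ℤ) ∣ z ∧ ∃ r : ℤ, (p : ℤ) ∣ z - r ^ 2

lemma sqp.not_dvd {p : ℕ} {z : ℤ} (h : sqp p z) : ¬ (p : ℤ) ∣ z := by
  unfold sqp at h
  split_ifs at h with h2
  · subst h2; push_cast; omega
  · exact h.1

lemma sqp_of_sq {p : ℕ} (hp : p.Prime) (z a g : ℤ) (hz : ¬ (p : ℤ) ∣ z) (ha : ¬ (p : ℤ) ∣ a)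
    (h : ((4 * p : ℕ) : ℤ) ∣ g ^ 2 - z * a ^ 2) : sqp p z := by
  unfold sqp
  split_ifs with h2
  · subst h2
    push_cast at *
    have ha2 : a ^ 2 % 8 = 1 := by
      have : a % 8 = 1 ∨ a % 8 = 3 ∨ a % 8 = 5 ∨ a % 8 = 7 := by omega
      rcases this with h | h | h | h <;> simp [pow_two, Int.mul_emod, h]
    have hza : z * a ^ 2 % 8 = z % 8 := by rw [Int.mul_emod, ha2]; simp
    have hg2 : g ^ 2 % 8 = 0 ∨ g ^ 2 % 8 = 1 ∨ g ^ 2 % 8 = 4 := by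
      have : g % 8 = 0 ∨ g % 8 = 1 ∨ g % 8 = 2 ∨ g % 8 = 3 ∨ g % 8 = 4 ∨ g % 8 = 5 ∨ g % 8 = 6 ∨ g % 8 = 7 := by omega
      rcases this with h | h | h | h | h | h | h | h <;> simp [pow_two, Int.mul_emod, h]
    omega
  · refine ⟨hz, ?_⟩
    have : Fact p.Prime := ⟨hp⟩
    have hc : IsCoprime (a : ℤ) (p : ℤ) := by
      rw [Int.isCoprime_iff_gcd_eq_one, Int.gcd_comm]
      have := (Nat.Prime.coprime_iff_not_dvd hp (n := a.natAbs)).2 (fun h => ha (Int.natCast_dvd.2 h))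
      simpa [Int.gcd] using this
    obtain ⟨u, v, huv⟩ := hc
    refine ⟨u * g, ?_⟩
    have h1 : (p : ℤ) ∣ g ^ 2 - z * a ^ 2 := dvd_trans ⟨4, by push_cast; ring⟩ h
    obtain ⟨t, ht⟩ := h1
    have e : u * a = 1 - v * p := by linarith
    refine ⟨z * (2 * v - v ^ 2 * p) - u ^ 2 * t, ?_⟩
    have : z * (u * a) ^ 2 = z * (1 - v * p) ^ 2 := by rw [e]
    linear_combination -this - u ^ 2 * ht

lemma cov0 (f : V ℤ) : (f 0 ^ 2 * f 3 - 3 * f 0 * f 1 * f 2 + 2 * f 1 ^ 3) ^ 2 = 4 * hA f ^ 3 + hD f * f 0 ^ 2 := by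
  simp only [hD, hA, hB, hC]; ring
lemma cov3 (f : V ℤ) : (f 3 ^ 2 * f 0 - 3 * f 3 * f 2 * f 1 + 2 * f 2 ^ 3) ^ 2 = 4 * hC f ^ 3 + hD f * f 3 ^ 2 := by
  simp only [hD, hA, hB, hC]; ring

lemma sqp_aux {p : ℕ} (hp : p.Prime) (g A D' a : ℤ) (hD : ¬ (p : ℤ) ∣ D') (ha : ¬ (p : ℤ) ∣ a)
    (h : g ^ 2 = 4 * (p * A) ^ 3 + p ^ 2 * D' * a ^ 2) : sqp p D' := by
  have hp0 : (p : ℤ) ≠ 0 := by exact_mod_cast hp.ne_zero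
  have : (p : ℤ) ∣ g := by
    have : (p : ℤ) ∣ g ^ 2 := ⟨4 * p ^ 2 * A ^ 3 + p * D' * a ^ 2, by rw [h]; ring⟩
    exact (Nat.prime_iff_prime_int.1 hp).dvd_of_dvd_pow this
  obtain ⟨g', rfl⟩ := this
  refine sqp_of_sq hp D' a g' hD ha ⟨A ^ 3, ?_⟩
  have : (p : ℤ) ^ 2 * (g' ^ 2 - D' * a ^ 2 - 4 * p * A ^ 3) = 0 := by linear_combination h
  have := (mul_eq_zero.1 this).resolve_left (by positivity)
  push_cast; linarith

/-- forms with Hessian content `p` -/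
lemma TpD {p : ℕ} (hp : p.Prime) (f : V ℤ) (h1 : (p : ℤ) ∣ hA f) (h2 : (p : ℤ) ∣ hB f) (h3 : (p : ℤ) ∣ hC f)
    (h4 : ¬ (p : ℤ) ^ 3 ∣ hD f) : ∃ D', hD f = p ^ 2 * D' ∧ sqp p D' := by
  obtain ⟨A, hA'⟩ := h1
  obtain ⟨B, hB'⟩ := h2
  obtain ⟨C, hC'⟩ := h3
  have hP := Nat.prime_iff_prime_int.1 hp
  have e : hD f = p ^ 2 * (B ^ 2 - 4 * A * C) := by rw [hD, hA', hB', hC']; ring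
  have hD' : ¬ (p : ℤ) ∣ B ^ 2 - 4 * A * C := by
    rintro ⟨t, ht⟩; exact h4 ⟨t, by rw [e, ht]; ring⟩
  refine ⟨_, e, ?_⟩
  by_cases ha : (p : ℤ) ∣ f 0
  · by_cases hd : (p : ℤ) ∣ f 3
    · exfalso
      obtain ⟨a, ha⟩ := ha
      obtain ⟨d, hd⟩ := hd
      have hb : (p : ℤ) ∣ f 1 := by
        refine hP.dvd_of_dvd_pow (n := 2) ⟨A + a * f 2, ?_⟩
        unfold hA at hA'; rw [ha] at hA'; linarith
      have hc : (p : ℤ) ∣ f 2 := by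
        refine hP.dvd_of_dvd_pow (n := 2) ⟨C + d * f 1, ?_⟩
        unfold hC at hC'; rw [hd] at hC'; linarith
      obtain ⟨b, hb⟩ := hb
      obtain ⟨c, hc⟩ := hc
      refine h4 ⟨p * ((b * c - a * d) ^ 2 - 4 * (b ^ 2 - a * c) * (c ^ 2 - b * d)), ?_⟩
      simp only [hD, hA, hB, hC, ha, hb, hc, hd]; ring
    · exact sqp_aux hp _ C _ (f 3) hD' hd (by rw [cov3, hC', e])
  · exact sqp_aux hp _ A _ (f 0) hD' ha (by rw [cov0, hA', e])

/-- fibres of reduction -/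
lemma card_fiber (m n : ℕ) [NeZero m] [NeZero n] (h : m ∣ n) (T : Finset (ZMod m)) :
    Nat.card {z : ZMod n // ZMod.castHom h (ZMod m) z ∈ T} * m = T.card * n := by
  have hsurj := ZMod.ringHom_surjective (ZMod.castHom h (ZMod m))
  have key : ∀ x, Nat.card {z : ZMod n // ZMod.castHom h (ZMod m) z = x} = Nat.card (RingHom.ker (ZMod.castHom h (ZMod m))) := by
    intro x
    obtain ⟨y, hy⟩ := hsurj x
    refine Nat.card_congr ⟨fun z => ⟨z.1 - y, by rw [RingHom.mem_ker, map_sub, z.2, hy, sub_self]⟩,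
      fun z => ⟨z.1 + y, by rw [map_add, (RingHom.mem_ker.1 z.2), hy, zero_add]⟩, fun z => Subtype.ext (sub_add_cancel _ _), fun z => Subtype.ext (add_sub_cancel_right _ _)⟩
  have sum : ∀ T : Finset (ZMod m), Nat.card {z : ZMod n // ZMod.castHom h (ZMod m) z ∈ T} = T.card * Nat.card (RingHom.ker (ZMod.castHom h (ZMod m))) := by
    intro T
    rw [← smul_eq_mul, ← Finset.sum_const, ← Finset.sum_congr rfl (fun x _ => key x)]
    rw [Nat.card_eq_fintype_card, Fintype.card_subtype, Finset.card_eq_sum_card_fiberwise (f := fun z => ZMod.castHom h (ZMod m) z) (t := T)]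
    · refine Finset.sum_congr rfl fun x hx => ?_
      rw [Nat.card_eq_fintype_card, Fintype.card_subtype]
      congr 1
      ext z
      simp only [Finset.mem_filter, Finset.mem_univ, true_and]
      exact ⟨fun h => h.2, fun h => ⟨by rw [h]; exact hx, h⟩⟩
    · intro z hz; exact (Finset.mem_filter.1 hz).2
  have h2 := sum Finset.univ
  rw [sum T]
  have h3 : Nat.card {z : ZMod n // ZMod.castHom h (ZMod m) z ∈ (Finset.univ : Finset (ZMod m))} = n := by
    simp [Nat.card_eq_fintype_card, ZMod.card]
  rw [h3, Finset.card_univ, ZMod.card] at h2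
  calc _ = T.card * (m * Nat.card (RingHom.ker (ZMod.castHom h (ZMod m)))) := by ring
    _ = _ := by rw [← h2]

lemma card_sq_odd (p : ℕ) [hp : Fact p.Prime] (h2 : p ≠ 2) :
    2 * (Finset.univ.filter (fun x : ZMod p => x ≠ 0 ∧ IsSquare x)).card = p - 1 := by
  have hc : ringChar (ZMod p) ≠ 2 := by rw [ZMod.ringChar_zmod_n]; exact h2
  have h := quadraticChar_sum_zero hc
  have e : ∀ x : ZMod p, quadraticChar (ZMod p) x = 2 * (if x ≠ 0 ∧ IsSquare x then 1 else 0) - (if x ≠ 0 then 1 else 0) := by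
    intro x
    by_cases hx : x = 0
    · simp [hx]
    · by_cases hs : IsSquare x
      · rw [(quadraticChar_one_iff_isSquare hx).2 hs]; simp [hx, hs]
      · rw [quadraticChar_neg_one_iff_not_isSquare.2 hs]; simp [hx, hs]
  rw [Finset.sum_congr rfl (fun x _ => e x), Finset.sum_sub_distrib, ← Finset.mul_sum, Finset.sum_boole, Finset.sum_boole] at h
  have h3 : (Finset.univ.filter (fun x : ZMod p => x ≠ 0)).card = p - 1 := by
    rw [Finset.filter_ne', Finset.card_erase_of_mem (Finset.mem_univ _), Finset.card_univ, ZMod.card]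
  rw [h3] at h
  have : ((2 * (Finset.univ.filter (fun x : ZMod p => x ≠ 0 ∧ IsSquare x)).card : ℕ) : ℤ) = ((p - 1 : ℕ) : ℤ) := by
    push_cast at h ⊢; linarith
  exact_mod_cast this

lemma card_sqp (p k : ℕ) [hp : Fact p.Prime] (hk : 1 ≤ k) (hk2 : p = 2 → 3 ≤ k) (A : Finset (ZMod (p ^ k)))
    (hA : ∀ z : ℤ, (z : ZMod (p ^ k)) ∈ A ↔ sqp p z) :
    (A.card : ℝ) / (p ^ k : ℕ) * cq p = (1 - 1 / p) / 2 := by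
  have hp0 : (p : ℝ) ≠ 0 := by exact_mod_cast hp.1.ne_zero
  have : NeZero (p ^ k) := ⟨pow_ne_zero _ hp.1.ne_zero⟩
  have hpk : ((p ^ k : ℕ) : ℝ) ≠ 0 := by exact_mod_cast pow_ne_zero _ hp.1.ne_zero
  have conv : ∀ (m : ℕ) [NeZero m] (h : m ∣ p ^ k) (T : Finset (ZMod m)), (∀ z : ℤ, (z : ZMod m) ∈ T ↔ sqp p z) →
      A.card * m = T.card * p ^ k := by
    intro m _ h T hT
    rw [← card_fiber m (p ^ k) h T]
    congr 1
    rw [Nat.card_eq_fintype_card, Fintype.card_subtype]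
    congr 1
    ext z
    obtain ⟨z, rfl⟩ := ZMod.intCast_surjective z
    rw [hA]
    simp only [Finset.mem_filter, Finset.mem_univ, true_and, map_intCast]
    exact (hT z).symm
  by_cases h2 : p = 2
  · subst h2
    have := conv 8 (show 2 ^ 3 ∣ 2 ^ k from pow_dvd_pow 2 (hk2 rfl)) {1} (by
      intro z
      rw [Finset.mem_singleton]
      have : ((z : ZMod 8) = 1) ↔ ((z : ZMod 8) = ((1:ℤ) : ZMod 8)) := by simp
      rw [this, ZMod.intCast_eq_intCast_iff_dvd_sub, sqp, if_pos rfl]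
      push_cast
      omega)
    have h' : (A.card : ℝ) * 8 = (2 ^ k : ℕ) := by exact_mod_cast (by simpa using this)
    rw [← h']
    have : (A.card : ℝ) ≠ 0 := by intro h0; rw [h0] at h'; exact hpk (by rw [← h']; simp)
    simp [cq]; field_simp; norm_num
  · have := conv p (dvd_pow_self p (by omega)) (Finset.univ.filter (fun x : ZMod p => x ≠ 0 ∧ IsSquare x)) (by
      intro z
      simp only [Finset.mem_filter, Finset.mem_univ, true_and, sqp, if_neg h2]
      rw [Ne, ZMod.intCast_zmod_eq_zero_iff_dvd]
      refine and_congr_right fun _ => ⟨?_, ?_⟩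
      · rintro ⟨r, hr⟩
        obtain ⟨r, rfl⟩ := ZMod.intCast_surjective r
        refine ⟨r, ?_⟩
        rw [← ZMod.intCast_zmod_eq_zero_iff_dvd]
        push_cast; rw [hr]; ring
      · rintro ⟨r, hr⟩
        rw [← ZMod.intCast_zmod_eq_zero_iff_dvd] at hr
        push_cast at hr
        exact ⟨r, by rw [← pow_two]; exact sub_eq_zero.1 hr⟩)
    have h3 := card_sq_odd p h2
    set T := (Finset.univ.filter (fun x : ZMod p => x ≠ 0 ∧ IsSquare x)).card
    have h3' : (2:ℝ) * T = p - 1 := by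
      have : ((2 * T : ℕ) : ℝ) = ((p - 1 : ℕ) : ℝ) := by rw [h3]
      rw [Nat.cast_sub hp.1.one_le] at this
      push_cast at this; exact this
    have h4 : (A.card : ℝ) * p = T * (p ^ k : ℕ) := by exact_mod_cast this
    have h5 : (A.card : ℝ) / (p ^ k : ℕ) = T / p := by rw [div_eq_div_iff hpk hp0]; exact h4
    rw [h5]
    simp only [cq, if_neg h2, Nat.cast_one, mul_one]
    field_simp
    linarith

lemma tail_SD (Z : ℕ) (hZ : 1 ≤ Z) (X : ℝ) (hX : 0 < X) :
    ({D ∈ SD X | ∃ q : ℕ, q.Prime ∧ Z < q ∧ (q : ℤ) ^ 2 ∣ D ()}.ncard : ℝ) ≤ 1 * X / Z := by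
  set M := ⌈X⌉₊
  have hfin := equi_SD.1 X hX
  have hsub : {D ∈ SD X | ∃ q : ℕ, q.Prime ∧ Z < q ∧ (q : ℤ) ^ 2 ∣ D ()} ⊆
      ⋃ q ∈ Finset.Ioc Z M, {D ∈ SD X | (q : ℤ) ^ 2 ∣ D ()} := by
    rintro D ⟨hD, q, hq, hZq, hd⟩
    rw [Set.mem_iUnion₂]
    refine ⟨q, Finset.mem_Ioc.2 ⟨hZq, ?_⟩, hD, hd⟩
    have h1 : (q : ℤ) ^ 2 ≤ - D () := Int.le_of_dvd (by have := hD.1; omega) ((dvd_neg).2 hd)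
    have h2 : ((q : ℤ) : ℝ) ^ 2 ≤ - (D () : ℝ) := by exact_mod_cast h1
    have h3 := hD.2
    have h4 : (1:ℝ) ≤ q := by exact_mod_cast hq.one_le
    have h5 := Nat.le_ceil X
    have : (q : ℝ) ≤ M := by push_cast at h2; nlinarith
    exact_mod_cast this
  have hb : ∀ q ∈ Finset.Ioc Z M, ({D ∈ SD X | (q : ℤ) ^ 2 ∣ D ()}.ncard : ℝ) ≤ X * ((q : ℝ) ^ 2)⁻¹ := by
    intro q hq
    have hq0 : 0 < q := by have := (Finset.mem_Ioc.1 hq).1; omega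
    have hqr : (0:ℝ) < (q:ℝ) ^ 2 := by positivity
    have himg : {D ∈ SD X | (q : ℤ) ^ 2 ∣ D ()} ⊆ (fun (j : ℕ) (_ : Unit) => -((q : ℤ) ^ 2 * j)) '' (Finset.Ioc 0 ⌊X * ((q : ℝ) ^ 2)⁻¹⌋₊ : Finset ℕ) := by
      rintro D ⟨hD, t, ht⟩
      have hD1 := hD.1
      have ht0 : t < 0 := by
        rw [ht] at hD1
        by_contra h
        push Not at h
        have : (0:ℤ) ≤ (q:ℤ) ^ 2 * t := by positivity
        omega
      refine ⟨t.natAbs, ?_, ?_⟩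
      · simp only [Finset.coe_Ioc, Set.mem_Ioc]
        refine ⟨by omega, Nat.le_floor ?_⟩
        rw [← div_eq_mul_inv, le_div_iff₀ hqr]
        have h3 := hD.2
        rw [ht] at h3
        have : ((t.natAbs : ℕ) : ℝ) = -(t : ℝ) := by
          have h : ((t.natAbs : ℕ) : ℤ) = -t := by omega
          calc ((t.natAbs : ℕ) : ℝ) = (((t.natAbs : ℕ) : ℤ) : ℝ) := (Int.cast_natCast _).symm
            _ = _ := by rw [h]; push_cast; ring
        rw [this]
        push_cast at h3
        nlinarith
      · funext i
        have : ((t.natAbs : ℕ) : ℤ) = -t := by omega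
        show -((q : ℤ) ^ 2 * ((t.natAbs : ℕ) : ℤ)) = D ()
        rw [this, ht]; ring
    have := Set.ncard_le_ncard himg ((Finset.finite_toSet _).image _)
    have h2 := this.trans (Set.ncard_image_le (Finset.finite_toSet _))
    rw [Set.ncard_coe_finset, Nat.card_Ioc, Nat.sub_zero] at h2
    have h3 : (({D ∈ SD X | (q : ℤ) ^ 2 ∣ D ()}.ncard : ℕ) : ℝ) ≤ ((⌊X * ((q : ℝ) ^ 2)⁻¹⌋₊ : ℕ) : ℝ) := by exact_mod_cast h2
    exact h3.trans (Nat.floor_le (by positivity))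
  have hfu : (⋃ q ∈ Finset.Ioc Z M, {D ∈ SD X | (q : ℤ) ^ 2 ∣ D ()}).Finite :=
    hfin.subset (by intro D hD; rw [Set.mem_iUnion₂] at hD; obtain ⟨q, _, h⟩ := hD; exact h.1)
  have h1 := (Set.ncard_le_ncard hsub hfu).trans (Finset.set_ncard_biUnion_le _ _)
  have h2 : (({D ∈ SD X | ∃ q : ℕ, q.Prime ∧ Z < q ∧ (q : ℤ) ^ 2 ∣ D ()}.ncard : ℕ) : ℝ) ≤ ∑ q ∈ Finset.Ioc Z M, X * ((q : ℝ) ^ 2)⁻¹ := by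
    refine le_trans (Nat.cast_le.2 h1) ?_
    rw [Nat.cast_sum]
    exact Finset.sum_le_sum hb
  refine h2.trans ?_
  rw [← Finset.mul_sum, one_mul, div_eq_mul_inv]
  exact mul_le_mul_of_nonneg_left (sum_inv_sq_le Z M (by omega)) hX.le

end PTM


/-! ### The three limits -/
namespace PTM
open Set Filter

/-- Local conditions on discriminants at all primes. -/
structure LocData (p : ℕ) where
  k : ℕ → ℕ
  k0 : k 0 = 0
  hk2 : ∀ q, q.Prime → 2 ≤ k q
  hk4 : 4 ≤ k 2
  A : ∀ q, Finset (ZMod (q ^ k q))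
  S : Finset ℕ
  hS : ∀ q ∈ S, q.Prime
  h2S : 2 ∈ S
  hpS : p ∈ S
  hout : ∀ q, q.Prime → q ∉ S → k q = 2 ∧ ∀ z : ℤ, (z : ZMod (q ^ k q)) ∈ A q ↔ ¬ (q : ℤ) ^ 2 ∣ z
  hgood : ∀ q, q.Prime → ∀ z : ℤ, (z : ZMod (q ^ k q)) ∈ A q → good q z
  hne : ∀ q, q.Prime → (A q).Nonempty
  hp : ∀ z : ℤ, (z : ZMod (p ^ k p)) ∈ A p ↔ sqp p z

namespace LocData
variable {p : ℕ} (L : LocData p)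

/-- the discriminant satisfies all local conditions -/
def ok (D : ℤ) : Prop := ∀ q : ℕ, q.Prime → (D : ZMod (q ^ L.k q)) ∈ L.A q

lemma ne0 (q : ℕ) : q ^ L.k q ≠ 0 := by
  rcases Nat.eq_zero_or_pos q with rfl | h
  · simp [L.k0]
  · positivity

noncomputable def al (q : ℕ) : ℝ := ((L.A q).card : ℝ) / ((q ^ L.k q : ℕ) : ℝ)

noncomputable def alpha : ℝ := (∏ q ∈ L.S, L.al q / (1 - 1 / (q:ℝ) ^ 2)) * (6 / Real.pi ^ 2)

lemma al_pos (q : ℕ) (hq : q.Prime) : 0 < L.al q := by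
  unfold al
  have h1 := Finset.card_pos.2 (L.hne q hq)
  have h2 := Nat.pos_of_ne_zero (L.ne0 q)
  positivity

lemma alpha_pos : 0 < L.alpha := by
  unfold alpha
  refine mul_pos (Finset.prod_pos fun q hq => div_pos (L.al_pos q (L.hS q hq)) (one_sub_pos (L.hS q hq))) (by positivity)

lemma al_out (q : ℕ) (hq : q.Prime) (hS : q ∉ L.S) : L.al q = 1 - 1 / (q:ℝ) ^ 2 := by
  obtain ⟨h1, h2⟩ := L.hout q hq hS
  have : NeZero (q ^ L.k q) := ⟨L.ne0 q⟩
  have e : L.A q = Finset.univ.erase 0 := by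
    ext z
    obtain ⟨z, rfl⟩ := ZMod.intCast_surjective z
    rw [h2 z, Finset.mem_erase, Ne, ZMod.intCast_zmod_eq_zero_iff_dvd]
    have e : ((q ^ L.k q : ℕ) : ℤ) = (q : ℤ) ^ 2 := by rw [h1]; push_cast; rfl
    rw [e]
    simp
  have hq0 : (q:ℝ) ≠ 0 := by exact_mod_cast hq.ne_zero
  rw [al, e, Finset.card_erase_of_mem (Finset.mem_univ _), Finset.card_univ, ZMod.card, h1,
    Nat.cast_sub (Nat.one_le_iff_ne_zero.2 (by positivity [hq.pos]))]
  push_cast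
  field_simp

lemma al_p [hp : Fact p.Prime] : L.al p * cq p = (1 - 1 / p) / 2 := by
  refine card_sqp p (L.k p) ?_ ?_ (L.A p) L.hp
  · have := L.hk2 p hp.1; omega
  · rintro rfl; have := L.hk4; omega

theorem limD : Tendsto (fun X : ℝ => ({D : Unit → ℤ | D ∈ SD X ∧ L.ok (D ())}.ncard : ℝ) / X) atTop (nhds L.alpha) := by
  have hT : ∀ q (f : Unit → ℤ), rd (q ^ L.k q) f ∈ (L.A q).map (Equiv.funUnique Unit (ZMod (q ^ L.k q))).symm.toEmbedding ↔ ((f () : ℤ) : ZMod (q ^ L.k q)) ∈ L.A q := by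
    intro q f
    rw [Finset.mem_map_equiv]; rfl
  have h := sieve SD SD 1 equi_SD equi_SD L.k L.k0 (fun q => (L.A q).map (Equiv.funUnique Unit (ZMod (q ^ L.k q))).symm.toEmbedding)
    (fun q D => (q : ℤ) ^ 2 ∣ D ()) (L.S.sup id + 1) (by
      intro q hq hZ f hf
      rw [hT] at hf
      have hqS : q ∉ L.S := fun h => by
        have : q ≤ L.S.sup id := Finset.le_sup (f := id) h
        omega
      by_contra hc
      exact hf (((L.hout q hq hqS).2 _).2 hc)) 1 (by
      intro Z hZ
      filter_upwards [eventually_gt_atTop 0] with X hX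
      exact tail_SD Z (by omega) X hX) L.alpha (by
      have := prod_lim L.S L.hS L.al (fun q => 1 - 1 / (q:ℝ) ^ 2) L.al_out (fun q hq => (one_sub_pos hq).ne') _ euler_lim
      refine this.congr fun n => Finset.prod_congr rfl fun q _ => ?_
      simp [al]) (fun X => ({D : Unit → ℤ | D ∈ SD X ∧ L.ok (D ())}.ncard : ℝ)) 0
      (by
        refine Eventually.of_forall fun X => ?_
        rw [add_zero]
        refine le_of_eq ?_
        congr 2
        ext f
        simp only [hT, ok]) (by
        refine Eventually.of_forall fun X => ?_
        rw [add_zero]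
        refine le_of_eq ?_
        congr 2
        ext f
        simp only [hT, ok])
  rwa [one_mul] at h

lemma hD_rd (N : ℕ) (f : V ℤ) : hD (rd N f) = ((hD f : ℤ) : ZMod N) := by
  have : rd N f = fmap (Int.castRingHom (ZMod N)) f := rfl
  rw [this, hD_fmap]; rfl
lemma hA_rd (N : ℕ) (f : V ℤ) : hA (rd N f) = ((hA f : ℤ) : ZMod N) := by
  have : rd N f = fmap (Int.castRingHom (ZMod N)) f := rfl
  rw [this, hA_fmap]; rfl
lemma hB_rd (N : ℕ) (f : V ℤ) : hB (rd N f) = ((hB f : ℤ) : ZMod N) := by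
  have : rd N f = fmap (Int.castRingHom (ZMod N)) f := rfl
  rw [this, hB_fmap]; rfl
lemma hC_rd (N : ℕ) (f : V ℤ) : hC (rd N f) = ((hC f : ℤ) : ZMod N) := by
  have : rd N f = fmap (Int.castRingHom (ZMod N)) f := rfl
  rw [this, hC_fmap]; rfl

/-- density of cubic forms with discriminant in a set of good residues -/
lemma dens (q k : ℕ) [hq : Fact q.Prime] (hk : 2 ≤ k) (hk2 : q = 2 → 4 ≤ k) (A : Finset (ZMod (q ^ k)))
    (hA : ∀ z : ℤ, (z : ZMod (q ^ k)) ∈ A → good q z) :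
    (Nat.card {f : V (ZMod (q ^ k)) // hD f ∈ A} : ℝ) / ((q ^ k : ℕ) : ℝ) ^ 4 = (A.card : ℝ) / ((q ^ k : ℕ) : ℝ) * cq q * (1 - 1 / (q:ℝ) ^ 2) := by
  have : NeZero (q ^ k) := ⟨pow_ne_zero _ hq.1.ne_zero⟩
  have hpk : ((q ^ k : ℕ) : ℝ) ≠ 0 := by exact_mod_cast pow_ne_zero _ hq.1.ne_zero
  have h1 : Nat.card {f : V (ZMod (q ^ k)) // hD f ∈ A} = A.card * (cq q * Nat.card (SL (ZMod (q ^ k)))) := by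
    rw [← smul_eq_mul, ← Finset.sum_const]
    rw [Nat.card_eq_fintype_card, Fintype.card_subtype, Finset.card_eq_sum_card_fiberwise (f := fun f => hD f) (t := A)]
    · refine Finset.sum_congr rfl fun x hx => ?_
      obtain ⟨z, rfl⟩ := ZMod.intCast_surjective x
      rw [← card_good q k hk hk2 z (hA z hx), Nat.card_eq_fintype_card, Fintype.card_subtype]
      congr 1
      ext f
      simp only [Finset.mem_filter, Finset.mem_univ, true_and]
      exact ⟨fun h => h.2, fun h => ⟨by rw [h]; exact hx, h⟩⟩
    · intro z hz; exact (Finset.mem_filter.1 hz).2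
  rw [h1]
  push_cast
  rw [card_SL_pow q k (by omega)]
  push_cast at hpk ⊢
  generalize (1 - 1 / (q:ℝ) ^ 2) = u
  field_simp

lemma prod_cq : (∏ q ∈ L.S, (cq q : ℝ)) = 2 := by
  rw [Finset.prod_eq_single_of_mem 2 L.h2S]
  · simp [cq]
  · intro q _ h; simp [cq, h]

lemma euler_lim2 : Tendsto (fun n : ℕ => ∏ q ∈ Nat.primesBelow n, ((1 - 1 / (q:ℝ) ^ 2) ^ 2)) atTop (nhds ((6 / Real.pi ^ 2) ^ 2)) := by
  simp only [Finset.prod_pow]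
  exact euler_lim.pow 2

lemma lim_const (τ : ℕ → ℝ) (c : ℝ) (hτ : (∏ q ∈ L.S, τ q) = c * ∏ q ∈ L.S, L.al q * cq q * (1 - 1 / (q:ℝ) ^ 2)) :
    Real.pi ^ 2 / 6 * ((∏ q ∈ L.S, τ q / (1 - 1 / (q:ℝ) ^ 2) ^ 2) * (6 / Real.pi ^ 2) ^ 2) = 2 * c * L.alpha := by
  rw [Finset.prod_div_distrib, hτ, alpha, Finset.prod_div_distrib, Finset.prod_mul_distrib, Finset.prod_mul_distrib, L.prod_cq, Finset.prod_pow]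
  have : ∏ q ∈ L.S, (1 - 1 / (q:ℝ) ^ 2) ≠ 0 := Finset.prod_ne_zero_iff.2 fun q hq => (one_sub_pos (L.hS q hq)).ne'
  generalize ∏ q ∈ L.S, (1 - 1 / (q:ℝ) ^ 2) = u at *
  generalize ∏ q ∈ L.S, L.al q = v
  have hpi := Real.pi_ne_zero
  field_simp

theorem lim1 (N : ℝ → ℝ) (E : ℝ) (hlo : ∀ᶠ X in atTop, ({f ∈ FO X | L.ok (hD f)}.ncard : ℝ) ≤ N X + E)
    (hhi : ∀ᶠ X in atTop, N X ≤ ({f ∈ FC X | L.ok (hD f)}.ncard : ℝ) + E) :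
    Tendsto (fun X => N X / X) atTop (nhds (2 * L.alpha)) := by
  have hfin : ∀ q, NeZero (q ^ L.k q) := fun q => ⟨L.ne0 q⟩
  have hTm : ∀ q (f : V ℤ), rd (q ^ L.k q) f ∈ (Set.toFinite {f : V (ZMod (q ^ L.k q)) | hD f ∈ L.A q}).toFinset ↔ ((hD f : ℤ) : ZMod (q ^ L.k q)) ∈ L.A q := by
    intro q f
    rw [Set.Finite.mem_toFinset, ← hD_rd]; rfl
  obtain ⟨C, hC, htail⟩ := tail
  have hq' : ∀ q, q.Prime → ((Set.toFinite {f : V (ZMod (q ^ L.k q)) | hD f ∈ L.A q}).toFinset.card : ℝ) / ((q ^ L.k q : ℕ) : ℝ) ^ 4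
      = L.al q * cq q * (1 - 1 / (q:ℝ) ^ 2) := by
    intro q hq
    have : Fact q.Prime := ⟨hq⟩
    rw [al, ← dens q (L.k q) (L.hk2 q hq) (by rintro rfl; exact L.hk4) (L.A q) (L.hgood q hq), ← Set.ncard_eq_toFinset_card]
    rfl
  have h := sieve FO FC (Real.pi ^ 2 / 6) equi_FO equi_FC L.k L.k0 (fun q => (Set.toFinite {f : V (ZMod (q ^ L.k q)) | hD f ∈ L.A q}).toFinset)
    (fun q f => (q : ℤ) ^ 2 ∣ hD f) (L.S.sup id + 3) (by
      intro q hq hZ f hf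
      rw [hTm] at hf
      have hqS : q ∉ L.S := fun h => by
        have : q ≤ L.S.sup id := Finset.le_sup (f := id) h
        omega
      by_contra hc
      exact hf (((L.hout q hq hqS).2 _).2 hc)) C (by
      intro Z hZ
      exact htail Z (by omega)) _ (by
      have := prod_lim L.S L.hS (fun q => L.al q * cq q * (1 - 1 / (q:ℝ) ^ 2)) (fun q => (1 - 1 / (q:ℝ) ^ 2) ^ 2) (by
        intro q hq hqS
        have h2 : q ≠ 2 := fun h => hqS (h ▸ L.h2S)
        rw [L.al_out q hq hqS]; simp [cq, h2]; ring) (fun q hq => (pow_pos (one_sub_pos hq) 2).ne') _ euler_lim2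
      refine this.congr fun n => Finset.prod_congr rfl fun q hq => ?_
      rw [← hq' q (Nat.prime_of_mem_primesBelow hq)]; simp) N E
      (by simp only [hTm]; exact hlo) (by simp only [hTm]; exact hhi)
  rw [L.lim_const _ 1 (by rw [one_mul])] at h
  rwa [mul_one] at h

lemma good_mul {p q : ℕ} (hp : p.Prime) (hq : q.Prime) (h : q ≠ p) (z : ℤ) (hz : good q z) : good q (p ^ 2 * z) := by
  unfold good at *
  split_ifs at * with h2
  · subst h2
    have : p % 2 = 1 := hp.eq_two_or_odd.resolve_left (fun h' => h h'.symm)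
    have : (p : ℤ) % 8 = 1 ∨ (p : ℤ) % 8 = 3 ∨ (p : ℤ) % 8 = 5 ∨ (p : ℤ) % 8 = 7 := by omega
    have h8 : (p : ℤ) ^ 2 % 8 = 1 := by
      rcases this with h | h | h | h <;> simp [pow_two, Int.mul_emod, h]
    generalize (p : ℤ) ^ 2 = P at *
    obtain ⟨m, rfl⟩ : ∃ m, P = 8 * m + 1 := ⟨P / 8, by omega⟩
    have e : (8 * m + 1) * z = 8 * (m * z) + z := by ring
    rw [e]
    rcases hz with h | h | h
    · left; omega
    · obtain ⟨j, rfl⟩ : ∃ j, z = 2 * j := ⟨z / 2, by omega⟩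
      have : m * (2 * j) = 2 * (m * j) := by ring
      rw [this]; omega
    · obtain ⟨j, rfl⟩ : ∃ j, z = 2 * j := ⟨z / 2, by omega⟩
      have : m * (2 * j) = 2 * (m * j) := by ring
      rw [this]; omega
  · intro hd
    apply hz
    have hc : IsCoprime ((q : ℤ) ^ 2) ((p : ℤ) ^ 2) := by
      apply IsCoprime.pow
      rw [Nat.isCoprime_iff_coprime]
      exact (Nat.coprime_primes hq hp).2 h
    exact hc.dvd_of_dvd_mul_left hd

/-- integral forms with Hessian content `p` and admissible discriminant -/
def okp (f : V ℤ) : Prop := (p : ℤ) ∣ hA f ∧ (p : ℤ) ∣ hB f ∧ (p : ℤ) ∣ hC f ∧ ∃ D', hD f = p ^ 2 * D' ∧ L.ok D'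

noncomputable def k' : ℕ → ℕ := fun q => if q = p then 3 else L.k q

def Tp (q : ℕ) : Set (V (ZMod (q ^ L.k' q))) :=
  {g | (q = p → (p : ZMod (q ^ L.k' q)) ∣ hA g ∧ (p : ZMod (q ^ L.k' q)) ∣ hB g ∧ (p : ZMod (q ^ L.k' q)) ∣ hC g ∧ hD g ≠ 0) ∧
    (q ≠ p → ∃ z : ℤ, (z : ZMod (q ^ L.k q)) ∈ L.A q ∧ hD g = ((p ^ 2 * z : ℤ) : ZMod (q ^ L.k' q)))}

lemma Tp_p [hp : Fact p.Prime] (f : V ℤ) : rd (p ^ L.k' p) f ∈ L.Tp p ↔ ((p : ℤ) ∣ hA f ∧ (p : ℤ) ∣ hB f ∧ (p : ℤ) ∣ hC f ∧ ¬ (p : ℤ) ^ 3 ∣ hD f) := by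
  have e : L.k' p = 3 := by simp [k']
  have d := fun x => dvd_zmod p 1 (by norm_num) x
  simp only [pow_one] at d
  have : ((p : ZMod (p ^ 3)) ∣ hA (rd (p ^ 3) f) ∧ (p : ZMod (p ^ 3)) ∣ hB (rd (p ^ 3) f) ∧ (p : ZMod (p ^ 3)) ∣ hC (rd (p ^ 3) f) ∧ hD (rd (p ^ 3) f) ≠ 0) ↔
      ((p : ℤ) ∣ hA f ∧ (p : ℤ) ∣ hB f ∧ (p : ℤ) ∣ hC f ∧ ¬ (p : ℤ) ^ 3 ∣ hD f) := by
    rw [hA_rd, hB_rd, hC_rd, hD_rd, d, d, d, Ne, ZMod.intCast_zmod_eq_zero_iff_dvd]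
    push_cast; rfl
  rw [← this, ← e]
  constructor
  · intro h; exact h.1 rfl
  · intro h; exact ⟨fun _ => h, fun h => absurd rfl h⟩

lemma Tp_q (q : ℕ) (hq : q ≠ p) (f : V ℤ) : rd (q ^ L.k' q) f ∈ L.Tp q ↔
    ∃ z : ℤ, (z : ZMod (q ^ L.k q)) ∈ L.A q ∧ ((hD f : ℤ) : ZMod (q ^ L.k q)) = ((p ^ 2 * z : ℤ) : ZMod (q ^ L.k q)) := by
  have e : L.k' q = L.k q := by simp [k', hq]
  have e' : rd (q ^ L.k' q) f ∈ L.Tp q ↔ ∃ z : ℤ, (z : ZMod (q ^ L.k q)) ∈ L.A q ∧ hD (rd (q ^ L.k' q) f) = ((p ^ 2 * z : ℤ) : ZMod (q ^ L.k' q)) := by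
    constructor
    · intro h; exact h.2 hq
    · intro h; exact ⟨fun h' => absurd h' hq, fun _ => h⟩
  rw [e']
  have aux : ∀ k, k = L.k q → ((∃ z : ℤ, (z : ZMod (q ^ L.k q)) ∈ L.A q ∧ hD (rd (q ^ k) f) = ((p ^ 2 * z : ℤ) : ZMod (q ^ k))) ↔
      ∃ z : ℤ, (z : ZMod (q ^ L.k q)) ∈ L.A q ∧ ((hD f : ℤ) : ZMod (q ^ L.k q)) = ((p ^ 2 * z : ℤ) : ZMod (q ^ L.k q))) := by
    rintro _ rfl
    simp only [hD_rd]
  exact aux _ e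

lemma p_unit [hp : Fact p.Prime] (q : ℕ) (hq : q.Prime) (h : q ≠ p) : IsUnit ((p : ZMod (q ^ L.k q)) ^ 2) := by
  apply IsUnit.pow
  have : Fact q.Prime := ⟨hq⟩
  have := (isUnit_zmod q (L.k q) (by have := L.hk2 q hq; omega) p).2 (by
    intro hd
    have : q ∣ p := by exact_mod_cast hd
    exact h ((Nat.prime_dvd_prime_iff_eq hq hp.1).1 this))
  simpa using this

lemma okp_iff [hp : Fact p.Prime] (f : V ℤ) : (∀ q : ℕ, q.Prime → rd (q ^ L.k' q) f ∈ L.Tp q) ↔ L.okp f := by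
  constructor
  · intro h
    obtain ⟨h1, h2, h3, h4⟩ := (L.Tp_p f).1 (h p hp.1)
    obtain ⟨D', hD', hs⟩ := TpD hp.1 f h1 h2 h3 h4
    refine ⟨h1, h2, h3, D', hD', fun q hq => ?_⟩
    by_cases hqp : q = p
    · subst hqp; exact (L.hp D').2 hs
    · obtain ⟨z, hz, hz2⟩ := (L.Tp_q q hqp f).1 (h q hq)
      rw [hD'] at hz2
      push_cast at hz2
      rw [(L.p_unit q hq hqp).mul_right_inj] at hz2
      rw [hz2]; exact hz
  · rintro ⟨h1, h2, h3, D', hD', hok⟩ q hq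
    by_cases hqp : q = p
    · subst hqp
      refine (L.Tp_p f).2 ⟨h1, h2, h3, ?_⟩
      have := ((L.hp D').1 (hok q hq)).not_dvd
      rw [hD', pow_succ]
      intro hd
      exact this ((mul_dvd_mul_iff_left (pow_ne_zero 2 (by exact_mod_cast hq.ne_zero))).1 hd)
    · exact (L.Tp_q q hqp f).2 ⟨D', hok q hq, by rw [hD']⟩

lemma dens_q [hp : Fact p.Prime] (q : ℕ) (hq : q.Prime) (h : q ≠ p) (k : ℕ) (hk : k = L.k q) :
    (Nat.card {g : V (ZMod (q ^ k)) // ∃ z : ℤ, (z : ZMod (q ^ L.k q)) ∈ L.A q ∧ hD g = ((p ^ 2 * z : ℤ) : ZMod (q ^ k))} : ℝ)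
      / ((q ^ k : ℕ) : ℝ) ^ 4 = L.al q * cq q * (1 - 1 / (q:ℝ) ^ 2) := by
  subst hk
  have : Fact q.Prime := ⟨hq⟩
  have hu := L.p_unit q hq h
  have := dens q (L.k q) (L.hk2 q hq) (by rintro rfl; exact L.hk4) ((L.A q).image (fun z => (p : ZMod (q ^ L.k q)) ^ 2 * z)) (by
    intro z hz
    obtain ⟨w, hw, e⟩ := Finset.mem_image.1 hz
    obtain ⟨w, rfl⟩ := ZMod.intCast_surjective w
    have hg := good_mul hp.1 hq h w (L.hgood q hq w hw)
    have e2 : ((z - p ^ 2 * w : ℤ) : ZMod (q ^ L.k q)) = 0 := by push_cast; rw [← e]; ring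
    rw [ZMod.intCast_zmod_eq_zero_iff_dvd] at e2
    push_cast at e2
    have hk := L.hk2 q hq
    unfold good at *
    split_ifs at * with h2
    · subst h2
      have : (16 : ℤ) ∣ z - p ^ 2 * w := dvd_trans (by exact_mod_cast pow_dvd_pow (2:ℤ) L.hk4) e2
      omega
    · intro hd
      apply hg
      have := (dvd_trans (pow_dvd_pow (q:ℤ) hk) e2)
      have := dvd_sub hd this
      simpa using this)
  rw [Finset.card_image_of_injective _ (fun x y hxy => (hu.mul_right_inj).1 hxy)] at this
  rw [al, ← this]
  congr 2
  refine Nat.card_congr (Equiv.subtypeEquivRight fun g => ?_)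
  rw [Finset.mem_image]
  constructor
  · rintro ⟨z, hz, e⟩; exact ⟨z, hz, by rw [e]; push_cast; ring⟩
  · rintro ⟨z, hz, e⟩
    obtain ⟨z, rfl⟩ := ZMod.intCast_surjective z
    exact ⟨z, hz, by rw [← e]; push_cast; ring⟩

lemma dens_p [hp : Fact p.Prime] (k : ℕ) (hk : k = 3) :
    (Nat.card {g : V (ZMod (p ^ k)) // (p : ZMod (p ^ k)) ∣ hA g ∧ (p : ZMod (p ^ k)) ∣ hB g ∧ (p : ZMod (p ^ k)) ∣ hC g ∧ hD g ≠ 0} : ℝ)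
      / ((p ^ k : ℕ) : ℝ) ^ 4 = L.al p * cq p * (1 - 1 / (p:ℝ) ^ 2) * (2 / p ^ 2) := by
  subst hk
  rw [L.al_p]
  have := card_condP p
  unfold condP at this
  rw [this]
  have hp0 : (p : ℝ) ≠ 0 := by exact_mod_cast hp.1.ne_zero
  push_cast
  field_simp

theorem limp [hp : Fact p.Prime] (N : ℝ → ℝ) (E : ℝ) (hlo : ∀ᶠ X in atTop, ({f ∈ FO X | L.okp f}.ncard : ℝ) ≤ N X + E)
    (hhi : ∀ᶠ X in atTop, N X ≤ ({f ∈ FC X | L.okp f}.ncard : ℝ) + E) :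
    Tendsto (fun X => N X / X) atTop (nhds (4 * L.alpha / p ^ 2)) := by
  have hk'0 : L.k' 0 = 0 := by simp [k', hp.1.ne_zero.symm, L.k0]
  have hfin : ∀ q, NeZero (q ^ L.k' q) := fun q => ⟨by
    rcases Nat.eq_zero_or_pos q with rfl | h
    · simp [hk'0]
    · positivity⟩
  have hTm : ∀ q (f : V ℤ), rd (q ^ L.k' q) f ∈ (Set.toFinite (L.Tp q)).toFinset ↔ rd (q ^ L.k' q) f ∈ L.Tp q := by
    intro q f
    rw [Set.Finite.mem_toFinset]
  obtain ⟨C, hC, htail⟩ := tail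
  set τ : ℕ → ℝ := fun q => L.al q * cq q * (1 - 1 / (q:ℝ) ^ 2) * (if q = p then 2 / (p:ℝ) ^ 2 else 1) with hτ
  have hq' : ∀ q, q.Prime → ((Set.toFinite (L.Tp q)).toFinset.card : ℝ) / ((q ^ L.k' q : ℕ) : ℝ) ^ 4 = τ q := by
    intro q hq
    rw [← Set.ncard_eq_toFinset_card]
    by_cases hqp : q = p
    · subst hqp
      simp only [hτ, if_true]
      rw [← L.dens_p (L.k' q) (by simp [k'])]
      congr 2
      refine Nat.card_congr (Equiv.subtypeEquivRight fun g => ?_)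
      constructor
      · intro h; exact h.1 rfl
      · intro h; exact ⟨fun _ => h, fun h => absurd rfl h⟩
    · simp only [hτ, if_neg hqp, mul_one]
      rw [← L.dens_q q hq hqp (L.k' q) (by simp [k', hqp])]
      congr 2
      refine Nat.card_congr (Equiv.subtypeEquivRight fun g => ?_)
      constructor
      · intro h; exact h.2 hqp
      · intro h; exact ⟨fun h' => absurd h' hqp, fun _ => h⟩
  have h := sieve FO FC (Real.pi ^ 2 / 6) equi_FO equi_FC L.k' hk'0 (fun q => (Set.toFinite (L.Tp q)).toFinset)
    (fun q f => (q : ℤ) ^ 2 ∣ hD f) (L.S.sup id + 3) (by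
      intro q hq hZ f hf
      rw [hTm] at hf
      have hqS : q ∉ L.S := fun h => by
        have : q ≤ L.S.sup id := Finset.le_sup (f := id) h
        omega
      by_contra hc
      have hqp : q ≠ p := fun h => hqS (h ▸ L.hpS)
      apply hf
      rw [L.Tp_q q hqp]
      obtain ⟨u, hu⟩ := L.p_unit q hq hqp
      obtain ⟨z, hz⟩ := ZMod.intCast_surjective (((u⁻¹ : (ZMod (q ^ L.k q))ˣ) : ZMod (q ^ L.k q)) * ((hD f : ℤ) : ZMod (q ^ L.k q)))
      have e : ((hD f : ℤ) : ZMod (q ^ L.k q)) = ((p ^ 2 * z : ℤ) : ZMod (q ^ L.k q)) := by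
        push_cast; rw [hz, ← hu, ← mul_assoc, Units.mul_inv, one_mul]
      refine ⟨z, ?_, e⟩
      rw [(L.hout q hq hqS).2]
      intro hd
      apply hc
      rw [ZMod.intCast_eq_intCast_iff_dvd_sub, (L.hout q hq hqS).1] at e
      push_cast at e
      have := dvd_sub (dvd_mul_of_dvd_right hd ((p:ℤ) ^ 2)) e
      simpa using this) C (by
      intro Z hZ
      exact htail Z (by omega)) _ (by
      have := prod_lim L.S L.hS τ (fun q => (1 - 1 / (q:ℝ) ^ 2) ^ 2) (by
        intro q hq hqS
        have h2 : q ≠ 2 := fun h => hqS (h ▸ L.h2S)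
        have hqp : q ≠ p := fun h => hqS (h ▸ L.hpS)
        simp only [hτ]
        rw [L.al_out q hq hqS]; simp [cq, h2, hqp]; ring) (fun q hq => (pow_pos (one_sub_pos hq) 2).ne') _ euler_lim2
      refine this.congr fun n => Finset.prod_congr rfl fun q hq => ?_
      rw [← hq' q (Nat.prime_of_mem_primesBelow hq)]; simp) N E
      (by simp only [hTm, L.okp_iff]; exact hlo) (by simp only [hTm, L.okp_iff]; exact hhi)
  rw [L.lim_const τ (2 / p ^ 2) (by
    simp only [hτ]
    rw [Finset.prod_mul_distrib, Finset.prod_ite_eq' L.S p, if_pos L.hpS, mul_comm])] at h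
  convert h using 2
  ring

end LocData
end PTM


/-! ### Imaginary quadratic orders, abstractly -/
namespace PTM
open Set Filter

/-- `R` is the maximal order of discriminant `D < 0`. -/
structure QR (R : Type*) [CommRing R] (D : ℤ) where
  ω : R
  σ : R ≃+* R
  hσ : σ ω = D - ω
  hω : 4 * ω * (D - ω) = (D : R) ^ 2 - D
  span : ∀ r : R, ∃ m n : ℤ, r = m + n * ω
  indep : ∀ m n : ℤ, (m : R) + n * ω = 0 → m = 0 ∧ n = 0
  hD : D < 0
  hgood : ∀ q : ℕ, q.Prime → good q D

namespace QR
variable {R : Type*} [CommRing R] {D : ℤ}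

lemma int_inj (Q : QR R D) {m : ℤ} (h : (m : R) = 0) : m = 0 := (Q.indep m 0 (by simp [h])).1

lemma charZero (Q : QR R D) : CharZero R := by
  refine ⟨fun a b h => ?_⟩
  have : ((a - b : ℤ) : R) = 0 := by push_cast; rw [h]; ring
  have := Q.int_inj this
  omega

lemma int_eq (Q : QR R D) {m n : ℤ} (h : (m : R) = n) : m = n := by
  have := Q.int_inj (m := m - n) (by push_cast; rw [h]; ring)
  omega

/-- `(B + √D)/2` -/
def th (Q : QR R D) (B : ℤ) : R := Q.ω + ((B - D) / 2 : ℤ)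

lemma par (Q : QR R D) {A B C : ℤ} (h : B ^ 2 - 4 * A * C = D) : ∃ t, B = D + 2 * t := by
  have h1 : B ^ 2 % 4 = D % 4 := by
    rw [← h]
    have : 4 * A * C = 4 * (A * C) := by ring
    rw [this]; omega
  have hg := Q.hgood 2 Nat.prime_two
  rw [good, if_pos rfl] at hg
  refine ⟨(B - D) / 2, ?_⟩
  have : B % 4 = 0 ∨ B % 4 = 1 ∨ B % 4 = 2 ∨ B % 4 = 3 := by omega
  rcases this with h | h | h | h <;> simp [pow_two, Int.mul_emod, h] at h1 <;> omega

lemma th_eq (Q : QR R D) (t : ℤ) : Q.th (D + 2 * t) = Q.ω + t := by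
  unfold th
  congr 2
  omega

lemma mul4 (Q : QR R D) (x : R) (h : 4 * x = 0) : x = 0 := by
  obtain ⟨m, n, rfl⟩ := Q.span x
  have := Q.indep (4 * m) (4 * n) (by push_cast; linear_combination h)
  have h1 : m = 0 := by omega
  have h2 : n = 0 := by omega
  simp [h1, h2]

lemma σ_th (Q : QR R D) {A B C : ℤ} (h : B ^ 2 - 4 * A * C = D) : Q.σ (Q.th B) = B - Q.th B := by
  obtain ⟨t, rfl⟩ := Q.par h
  rw [th_eq, map_add, Q.hσ, map_intCast]; push_cast; ring

lemma th_mul (Q : QR R D) {A B C : ℤ} (h : B ^ 2 - 4 * A * C = D) : Q.th B * (B - Q.th B) = A * C := by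
  obtain ⟨t, rfl⟩ := Q.par h
  rw [th_eq]
  have h' : (((D + 2 * t) ^ 2 - 4 * A * C : ℤ) : R) = D := by rw [h]
  push_cast at h'
  refine sub_eq_zero.1 (Q.mul4 _ ?_)
  push_cast
  linear_combination Q.hω + h'

lemma th_rep (Q : QR R D) {A B C : ℤ} (h : B ^ 2 - 4 * A * C = D) (r : R) : ∃ m n : ℤ, r = m + n * Q.th B := by
  obtain ⟨t, rfl⟩ := Q.par h
  obtain ⟨m, n, rfl⟩ := Q.span r
  exact ⟨m - n * t, n, by rw [th_eq]; push_cast; ring⟩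

lemma th_inj (Q : QR R D) {A B C : ℤ} (h : B ^ 2 - 4 * A * C = D) {m n m' n' : ℤ}
    (e : (m : R) + n * Q.th B = m' + n' * Q.th B) : m = m' ∧ n = n' := by
  obtain ⟨t, rfl⟩ := Q.par h
  rw [th_eq] at e
  have := Q.indep (m - m' + (n - n') * t) (n - n') (by push_cast; linear_combination e)
  have h2 : n = n' := by omega
  subst h2
  simp at this
  omega

/-- integrality and positivity of the norm -/
lemma norm_pos (Q : QR R D) {r : R} (hr : r ≠ 0) : ∃ N : ℤ, 0 < N ∧ r * Q.σ r = N := by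
  obtain ⟨m, n, rfl⟩ := Q.span r
  have hg := Q.hgood 2 Nat.prime_two
  rw [good, if_pos rfl] at hg
  have h4 : (4 : ℤ) ∣ D ^ 2 - D := by
    have : D % 4 = 0 ∨ D % 4 = 1 := by omega
    apply Int.dvd_of_emod_eq_zero
    rcases this with h | h <;> simp [pow_two, Int.sub_emod, Int.mul_emod, h]
  obtain ⟨e, he⟩ := h4
  have he' : Q.ω * (D - Q.ω) = e := by
    refine sub_eq_zero.1 (Q.mul4 _ ?_)
    have : ((D ^ 2 - D : ℤ) : R) = ((4 * e : ℤ) : R) := by rw [he]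
    push_cast at this
    linear_combination Q.hω + this
  refine ⟨m ^ 2 + m * n * D + n ^ 2 * e, ?_, ?_⟩
  · have hD := Q.hD
    have h0 : 4 * (m ^ 2 + m * n * D + n ^ 2 * e) = (2 * m + n * D) ^ 2 + (-D) * n ^ 2 := by linear_combination -n ^ 2 * he
    by_cases hn : n = 0
    · have hm : m ≠ 0 := by rintro rfl; apply hr; simp [hn]
      subst hn
      have : 0 < m ^ 2 := by positivity
      simpa using this
    · have : 0 < n ^ 2 := by positivity
      nlinarith [sq_nonneg (2 * m + n * D)]
  · simp only [map_add, map_mul, map_intCast, Q.hσ]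
    push_cast
    linear_combination (n:R) ^ 2 * he'

lemma σσ (Q : QR R D) (r : R) : Q.σ (Q.σ r) = r := by
  obtain ⟨m, n, rfl⟩ := Q.span r
  simp [Q.hσ]

lemma unit_eq (Q : QR R D) (hD : D < -4) (u : R) (hu : IsUnit u) : u = 1 ∨ u = -1 := by
  have hc := Q.charZero
  have hnt : Nontrivial R := ⟨⟨0, 1, fun h => by
    have := Q.int_inj (m := 1) (by push_cast; exact h.symm)
    omega⟩⟩
  obtain ⟨v, hv⟩ := hu.exists_right_inv
  obtain ⟨N, hN, eN⟩ := Q.norm_pos hu.ne_zero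
  obtain ⟨M, hM, eM⟩ := Q.norm_pos (r := v) (fun h0 => by rw [h0, mul_zero] at hv; exact zero_ne_one hv)
  have h1 : N * M = 1 := by
    apply Q.int_eq
    push_cast
    rw [← eN, ← eM]
    have := congrArg Q.σ hv
    rw [map_mul, map_one] at this
    calc _ = (u * v) * (Q.σ u * Q.σ v) := by ring
      _ = 1 := by rw [hv, this, mul_one]
  have hN1 : N = 1 := by nlinarith
  obtain ⟨m, n, rfl⟩ := Q.span u
  have e4 : (2 * m + n * D) ^ 2 + (-D) * n ^ 2 = 4 := by
    apply Q.int_eq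
    push_cast
    rw [hN1] at eN
    simp only [map_add, map_mul, map_intCast, Q.hσ] at eN
    push_cast at eN
    linear_combination 4 * eN - (n:R)^2 * Q.hω
  have hn : n = 0 := by
    by_contra hn
    have : 0 < n ^ 2 := by positivity
    nlinarith [sq_nonneg (2 * m + n * D)]
  subst hn
  have : (m - 1) * (m + 1) = 0 := by linarith
  rcases mul_eq_zero.1 this with h | h
  · left; have : m = 1 := by omega
    simp [this]
  · right; have : m = -1 := by omega
    simp [this]

/-- principal ideals generated by positive integers -/
lemma span_int (Q : QR R D) {a b : ℤ} (ha : 0 < a) (hb : 0 < b) (h : Ideal.span {(a : R)} = Ideal.span {(b : R)}) : a = b := by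
  have aux : ∀ {a b : ℤ}, 0 < a → 0 < b → Ideal.span {(a : R)} = Ideal.span {(b : R)} → b ≤ a := by
    intro a b ha hb h
    have : (a : R) ∈ Ideal.span {(b : R)} := h ▸ Ideal.mem_span_singleton_self _
    obtain ⟨r, hr⟩ := Ideal.mem_span_singleton'.1 this
    obtain ⟨m, n, rfl⟩ := Q.span r
    have := Q.indep (m * b - a) (n * b) (by push_cast; linear_combination hr)
    have h1 : m * b = a := by omega
    exact Int.le_of_dvd ha ⟨m, by rw [← h1]; ring⟩
  exact le_antisymm (aux hb ha h.symm) (aux ha hb h)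

/-- the ideal attached to a form -/
def I (Q : QR R D) (A B : ℤ) : Ideal R := Ideal.span {(A : R), Q.th B}

lemma mem_I (Q : QR R D) {A B C : ℤ} (h : B ^ 2 - 4 * A * C = D) (r : R) : r ∈ Q.I A B ↔ ∃ X Y : ℤ, r = X * A + Y * Q.th B := by
  rw [I, Ideal.mem_span_pair]
  have hm := Q.th_mul h
  constructor
  · rintro ⟨a, b, rfl⟩
    obtain ⟨m, n, rfl⟩ := Q.th_rep h a
    obtain ⟨m', n', rfl⟩ := Q.th_rep h b
    refine ⟨m - n' * C, n * A + m' + n' * B, ?_⟩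
    push_cast
    linear_combination -(n' : R) * hm
  · rintro ⟨X, Y, rfl⟩; exact ⟨X, Y, rfl⟩

lemma prim (Q : QR R D) {A B C : ℤ} (h : B ^ 2 - 4 * A * C = D) (J : Ideal R) (hA : (A : R) ∈ J) (hB : (B : R) ∈ J) (hC : (C : R) ∈ J) : J = ⊤ := by
  set g := Int.gcd A (Int.gcd B C)
  have hg1 : g = 1 := by
    by_contra hne
    obtain ⟨q, hq, hd⟩ := Nat.exists_prime_and_dvd hne
    have : Fact q.Prime := ⟨hq⟩
    have hd' : (q : ℤ) ∣ g := by exact_mod_cast hd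
    have hbc : (g : ℤ) ∣ (Int.gcd B C : ℤ) := Int.gcd_dvd_right ..
    have hA := hd'.trans (Int.gcd_dvd_left A (Int.gcd B C) : (g : ℤ) ∣ A)
    have hB := (hd'.trans hbc).trans (Int.gcd_dvd_left B C)
    have hC := (hd'.trans hbc).trans (Int.gcd_dvd_right B C)
    have := good_prim q A B C (by rw [h]; exact Q.hgood q hq)
    tauto
  have e1 := Int.gcd_eq_gcd_ab A (Int.gcd B C)
  have e2 := Int.gcd_eq_gcd_ab B C
  rw [Ideal.eq_top_iff_one]
  have : (1 : R) = ((g : ℤ) : R) := by rw [hg1]; simp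
  rw [this, e1, e2]
  push_cast
  exact Ideal.add_mem _ (Ideal.mul_mem_right _ _ hA) (Ideal.mul_mem_right _ _ (Ideal.add_mem _ (Ideal.mul_mem_right _ _ hB) (Ideal.mul_mem_right _ _ hC)))

lemma I_conj (Q : QR R D) {A B C : ℤ} (h : B ^ 2 - 4 * A * C = D) :
    Q.I A B * (Q.I A B).map Q.σ = Ideal.span {(A : R)} := by
  have hm := Q.th_mul h
  have : (Q.I A B).map Q.σ = Ideal.span {(A : R), B - Q.th B} := by
    rw [I, Ideal.map_span]; simp [Set.image_pair, Q.σ_th h]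
  rw [this, I, Ideal.span_pair_mul_span_pair]
  have : Ideal.span {(A : R) * A, A * (B - Q.th B), Q.th B * A, Q.th B * (B - Q.th B)} = Ideal.span {(A : R)} * Ideal.span {(A : R), B - Q.th B, Q.th B, (C : R)} := by
    rw [Ideal.span_mul_span', Set.singleton_mul, Set.image_insert_eq, Set.image_insert_eq, Set.image_insert_eq, Set.image_singleton, hm, mul_comm (Q.th B)]
  rw [this, Q.prim h (Ideal.span {(A : R), B - Q.th B, Q.th B, (C : R)}), Ideal.mul_top]
  · exact Ideal.subset_span (by simp)
  · have h1 : (B - Q.th B : R) ∈ Ideal.span {(A : R), B - Q.th B, Q.th B, (C : R)} := Ideal.subset_span (by simp)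
    have h2 : (Q.th B : R) ∈ Ideal.span {(A : R), B - Q.th B, Q.th B, (C : R)} := Ideal.subset_span (by simp)
    have := Ideal.add_mem _ h1 h2
    rwa [sub_add_cancel] at this
  · exact Ideal.subset_span (by simp)

lemma span_cube (x y : R) : Ideal.span {x, y} ^ 3 = Ideal.span {x ^ 3, x ^ 2 * y, x * y ^ 2, y ^ 3} := by
  rw [pow_three, Ideal.span_pair_mul_span_pair, Ideal.span_mul_span']
  congr 1
  ext r
  simp only [Set.mem_mul, Set.mem_insert_iff, Set.mem_singleton_iff]
  constructor
  · rintro ⟨a, ha, b, hb, rfl⟩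
    rcases ha with rfl | rfl <;> rcases hb with rfl | rfl | rfl | rfl <;> ring_nf <;> simp
  · rintro (rfl | rfl | rfl | rfl)
    · exact ⟨x, by simp, x * x, by simp, by ring⟩
    · exact ⟨x, by simp, x * y, by simp, by ring⟩
    · exact ⟨x, by simp, y * y, by simp, by ring⟩
    · exact ⟨y, by simp, y * y, by simp, by ring⟩

/-- the ideal `W` attached to a cubic form -/
def W (Q : QR R D) (A B C : ℤ) (f : V ℤ) : Ideal R :=
  Ideal.span {f 1 * (A : R) - f 0 * (B - Q.th B), f 1 * Q.th B - f 0 * C, f 2 * Q.th B - f 1 * C, f 3 * Q.th B - f 2 * C}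

/-- the element `e₀` attached to a cubic form -/
def e0 (Q : QR R D) (A B : ℤ) (f : V ℤ) : R := f 1 * (A : R) - f 0 * (B - Q.th B)

lemma W_eq (Q : QR R D) {A B C : ℤ} (h : B ^ 2 - 4 * A * C = D) (f : V ℤ)
    (s1 : f 0 * C - f 1 * B + f 2 * A = 0) (s2 : f 1 * C - f 2 * B + f 3 * A = 0) :
    Ideal.span {Q.e0 A B f} * Q.I A B ^ 3 = Ideal.span {(A : R) ^ 3} * Q.W A B C f := by
  have hm := Q.th_mul h
  have s1' : (f 0 * C - f 1 * B + f 2 * A : R) = 0 := by exact_mod_cast congrArg (Int.cast : ℤ → R) s1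
  have s2' : (f 1 * C - f 2 * B + f 3 * A : R) = 0 := by exact_mod_cast congrArg (Int.cast : ℤ → R) s2
  rw [I, span_cube, W, Ideal.span_mul_span', Ideal.span_mul_span', Set.singleton_mul, Set.singleton_mul]
  simp only [Set.image_insert_eq, Set.image_singleton]
  unfold e0
  set θ := Q.th B
  have k1 : (f 1 * (A : R) - f 0 * (B - θ)) * θ = A * (f 1 * θ - f 0 * C) := by linear_combination -(f 0 : R) * hm
  have k2 : (f 1 * θ - f 0 * C) * θ = A * (f 2 * θ - f 1 * C) := by linear_combination -(f 1 : R) * hm - θ * s1'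
  have k3 : (f 2 * θ - f 1 * C) * θ = A * (f 3 * θ - f 2 * C) := by linear_combination -(f 2 : R) * hm - θ * s2'
  congr 2
  · ring
  congr 1
  · linear_combination (A:R) ^ 2 * k1
  congr 1
  · linear_combination (A : R) * θ * k1 + (A : R) ^ 2 * k2
  · congr 1
    linear_combination θ ^ 2 * k1 + A * θ * k2 + (A : R) ^ 2 * k3

end QR
end PTM


/-! ### Class groups and reduced forms -/
namespace PTM
open Set Filter

section
variable {R : Type*} [CommRing R] [IsDomain R] [IsDedekindDomain R]

/-- class of an ideal (with junk value `1` at zero) -/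
noncomputable def cl (J : Ideal R) : ClassGroup R :=
  if h : J ≠ ⊥ then ClassGroup.mk0 ⟨J, mem_nonZeroDivisors_of_ne_zero h⟩ else 1

lemma cl_of_ne {J : Ideal R} (h : J ≠ ⊥) : cl J = ClassGroup.mk0 ⟨J, mem_nonZeroDivisors_of_ne_zero h⟩ := dif_pos h

lemma cl_mk0 (J : (Ideal R)⁰) : cl (J : Ideal R) = ClassGroup.mk0 J :=
  cl_of_ne (nonZeroDivisors.coe_ne_zero J)

lemma cl_surj (g : ClassGroup R) : ∃ J : Ideal R, J ≠ ⊥ ∧ cl J = g := by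
  obtain ⟨J, rfl⟩ := ClassGroup.mk0_surjective g
  exact ⟨J, nonZeroDivisors.coe_ne_zero J, cl_mk0 J⟩

lemma cl_mul {J J' : Ideal R} (h : J ≠ ⊥) (h' : J' ≠ ⊥) : cl (J * J') = cl J * cl J' := by
  rw [cl_of_ne h, cl_of_ne h', cl_of_ne (mul_ne_zero h h'), ← map_mul]
  rfl

lemma cl_pow {J : Ideal R} (h : J ≠ ⊥) : cl (J ^ 3) = cl J ^ 3 := by
  rw [pow_three, cl_mul h (mul_ne_zero h h), cl_mul h h, pow_three]

lemma cl_eq_iff {J J' : Ideal R} (h : J ≠ ⊥) (h' : J' ≠ ⊥) :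
    cl J = cl J' ↔ ∃ x y : R, x ≠ 0 ∧ y ≠ 0 ∧ Ideal.span {x} * J = Ideal.span {y} * J' := by
  rw [cl_of_ne h, cl_of_ne h', ClassGroup.mk0_eq_mk0_iff]
  constructor
  · rintro ⟨x, y, hx, hy, e⟩; exact ⟨x, y, hx, hy, e⟩
  · rintro ⟨x, y, hx, hy, e⟩; exact ⟨x, y, hx, hy, e⟩

lemma cl_span {x : R} (hx : x ≠ 0) : cl (Ideal.span {x}) = 1 := by
  rw [cl_of_ne (by simpa using hx), ClassGroup.mk0_eq_one_iff]
  exact ⟨x, rfl⟩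

lemma cl_top : cl (⊤ : Ideal R) = 1 := by
  rw [← cl_span (one_ne_zero (α := R)), Ideal.span_singleton_one]

lemma cl_eq_one {J : Ideal R} (h : J ≠ ⊥) (e : cl J = 1) : ∃ x : R, x ≠ 0 ∧ J = Ideal.span {x} := by
  rw [cl_of_ne h, ClassGroup.mk0_eq_one_iff] at e
  obtain ⟨x, hx⟩ := e
  refine ⟨x, ?_, hx⟩
  rintro rfl
  apply h
  rw [hx]; simp

lemma span_ne {x : R} (hx : x ≠ 0) : Ideal.span {x} ≠ (⊥ : Ideal R) := by simpa using hx

lemma cancel_span {x : R} (hx : x ≠ 0) {J J' : Ideal R} (h : Ideal.span {x} * J = Ideal.span {x} * J') : J = J' :=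
  mul_left_cancel₀ (span_ne hx) h

end

namespace QR
variable {R : Type*} [CommRing R] [IsDomain R] [IsDedekindDomain R] {D : ℤ}

lemma int_ne (Q : QR R D) {m : ℤ} (h : m ≠ 0) : (m : R) ≠ 0 := fun h' => h (Q.int_inj h')

lemma I_ne (Q : QR R D) {A : ℤ} (B : ℤ) (hA : A ≠ 0) : Q.I A B ≠ ⊥ := by
  intro h
  have : (A : R) ∈ Q.I A B := Ideal.subset_span (by simp)
  rw [h] at this
  exact Q.int_ne hA (by simpa using this)

lemma e0_norm (Q : QR R D) {A B C : ℤ} (h : B ^ 2 - 4 * A * C = D) (f : V ℤ)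
    (s1 : f 0 * C - f 1 * B + f 2 * A = 0) :
    Q.e0 A B f * Q.σ (Q.e0 A B f) = ((A ^ 2 * hA f : ℤ) : R) := by
  have hm := Q.th_mul h
  have s1' : (f 0 * C - f 1 * B + f 2 * A : R) = 0 := by exact_mod_cast congrArg (Int.cast : ℤ → R) s1
  simp only [e0, map_sub, map_mul, map_intCast, Q.σ_th h, hA]
  push_cast
  linear_combination (f 0 : R) ^ 2 * hm + A * f 0 * s1'

lemma map_span1 (Q : QR R D) (x : R) : (Ideal.span {x}).map Q.σ = Ideal.span {Q.σ x} := by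
  rw [Ideal.map_span]; simp

/-- norms in `(x) I³ = (A³) W` -/
lemma W_norm (Q : QR R D) {A B C : ℤ} (h : B ^ 2 - 4 * A * C = D) {x : R} {W : Ideal R}
    (e : Ideal.span {x} * Q.I A B ^ 3 = Ideal.span {(A : R) ^ 3} * W) :
    Ideal.span {x * Q.σ x} * Ideal.span {(A : R) ^ 3} = Ideal.span {(A : R) ^ 6} * (W * W.map Q.σ) := by
  have e' := congrArg (Ideal.map Q.σ) e
  rw [Ideal.map_mul, Ideal.map_mul, Ideal.map_pow, map_span1, map_span1, map_pow, map_intCast] at e'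
  have := congrArg₂ (· * ·) e e'
  calc _ = Ideal.span {x} * Ideal.span {Q.σ x} * (Q.I A B * (Q.I A B).map Q.σ) ^ 3 := by
        rw [Q.I_conj h, Ideal.span_singleton_pow, Ideal.span_singleton_mul_span_singleton x]
    _ = (Ideal.span {x} * Q.I A B ^ 3) * (Ideal.span {Q.σ x} * (Q.I A B).map Q.σ ^ 3) := by ring
    _ = _ := by
      rw [this]
      have : Ideal.span {(A : R) ^ 6} = Ideal.span {(A : R) ^ 3} * Ideal.span {(A : R) ^ 3} := by
        rw [Ideal.span_singleton_mul_span_singleton]; congr 2; ring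
      rw [this]; ring

lemma σ_ne (Q : QR R D) {x : R} (hx : x ≠ 0) : Q.σ x ≠ 0 := by simpa using hx

lemma W_conj (Q : QR R D) {A B C c : ℤ} (h : B ^ 2 - 4 * A * C = D) (hA0 : 0 < A) (f : V ℤ)
    (s1 : f 0 * C - f 1 * B + f 2 * A = 0) (s2 : f 1 * C - f 2 * B + f 3 * A = 0) (hc : hA f = c * A) :
    Q.W A B C f * (Q.W A B C f).map Q.σ = Ideal.span {(c : R)} := by
  have := Q.W_norm h (Q.W_eq h f s1 s2)
  rw [Q.e0_norm h f s1, hc, Ideal.span_singleton_mul_span_singleton] at this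
  have hA' : (A : R) ^ 6 ≠ 0 := pow_ne_zero _ (Q.int_ne hA0.ne')
  apply cancel_span hA'
  rw [← this, Ideal.span_singleton_mul_span_singleton]
  congr 2
  push_cast; ring

lemma sum_sq (Q : QR R D) {A B C : ℤ} (h : B ^ 2 - 4 * A * C = D) (hA0 : 0 < A) : 0 < C := by
  have := Q.hD
  by_contra hC
  nlinarith [sq_nonneg B, mul_nonneg hA0.le (by omega : 0 ≤ -C)]

/-- every class is represented by a form -/
lemma rep1 (Q : QR R D) (g : ClassGroup R) : ∃ A B C : ℤ, 0 < A ∧ B ^ 2 - 4 * A * C = D ∧ cl (Q.I A B) = g := by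
  obtain ⟨J, hJ, rfl⟩ := cl_surj g
  obtain ⟨r, hr, hr0⟩ := Submodule.exists_mem_ne_zero_of_ne_bot hJ
  obtain ⟨N, hN, eN⟩ := Q.norm_pos hr0
  have hNJ : (N : R) ∈ J := by rw [← eN]; exact Ideal.mul_mem_right _ _ hr
  obtain ⟨e, he⟩ : ∃ e : ℤ, Q.ω * (D - Q.ω) = e := by
    by_cases h0 : Q.ω = 0
    · exact ⟨0, by simp [h0]⟩
    · obtain ⟨N, _, h⟩ := Q.norm_pos h0
      exact ⟨N, by rw [← h, Q.hσ]⟩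
  -- ideal of ω-coefficients
  let L : Ideal ℤ :=
    { carrier := {n | ∃ m : ℤ, (m + n * Q.ω : R) ∈ J}
      add_mem' := by
        rintro a b ⟨m, hm⟩ ⟨m', hm'⟩
        exact ⟨m + m', by have := J.add_mem hm hm'; push_cast; convert this using 1; ring⟩
      zero_mem' := ⟨0, by simp⟩
      smul_mem' := by
        rintro c a ⟨m, hm⟩
        exact ⟨c * m, by have := J.mul_mem_left (c : R) hm; push_cast; convert this using 1; simp; ring⟩ }
  let M : Ideal ℤ := J.comap (Int.castRingHom R)
  obtain ⟨d, hd⟩ := (IsPrincipalIdealRing.principal L).principal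
  obtain ⟨a0, ha0⟩ := (IsPrincipalIdealRing.principal M).principal
  have hM : ∀ m : ℤ, (m : R) ∈ J ↔ a0 ∣ m := by
    intro m
    have : (m : R) ∈ J ↔ m ∈ M := by simp [M]
    rw [this, ha0]; exact Ideal.mem_span_singleton
  have hL : ∀ n : ℤ, (∃ m : ℤ, (m + n * Q.ω : R) ∈ J) ↔ d ∣ n := by
    intro n
    have : (∃ m : ℤ, (m + n * Q.ω : R) ∈ J) ↔ n ∈ L := Iff.rfl
    rw [this, hd]; exact Ideal.mem_span_singleton
  have ha00 : a0 ≠ 0 := by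
    rintro rfl
    have := (hM N).1 hNJ
    simp at this; omega
  have hda : d ∣ a0 := (hL a0).1 ⟨0, by
    have := J.mul_mem_left Q.ω ((hM a0).2 dvd_rfl)
    convert this using 1; push_cast; ring⟩
  have hd0 : d ≠ 0 := by rintro rfl; simp at hda; exact ha00 hda
  obtain ⟨m, hm⟩ := (hL d).2 dvd_rfl
  have hdm : d ∣ m := by
    have : d ∣ m + d * D := (hL _).1 ⟨-(d * e), by
      have := J.mul_mem_left Q.ω hm
      convert this using 1; push_cast
      linear_combination (d : R) * he⟩
    exact (dvd_add_left (Dvd.intro _ rfl)).1 this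
  obtain ⟨A', rfl⟩ := hda
  obtain ⟨m', rfl⟩ := hdm
  -- θ = ω + m'
  set B := D + 2 * m' with hB
  have hθ : Q.th B = Q.ω + m' := Q.th_eq m'
  have hθJ : (d : R) * Q.th B ∈ J := by rw [hθ]; convert hm using 1; push_cast; ring
  obtain ⟨n0, hn0⟩ : ∃ n0 : ℤ, Q.th B * (B - Q.th B) = n0 := ⟨m' ^ 2 + m' * D + e, by
    rw [hθ, hB]; push_cast; linear_combination he⟩
  have hA'n : A' ∣ n0 := by
    have : ((d * n0 : ℤ) : R) ∈ J := by
      have := J.mul_mem_right (B - Q.th B) hθJ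
      convert this using 1; push_cast; linear_combination -(d : R) * hn0
    have := (hM _).1 this
    exact (mul_dvd_mul_iff_left hd0).1 this
  have hdisc : B ^ 2 - 4 * n0 = D := by
    apply Q.int_eq
    push_cast
    rw [← hn0, hθ, hB]
    push_cast
    linear_combination - Q.hω
  have key : ∀ A : ℤ, A ≠ 0 → A ∣ n0 → (A = A' ∨ A = -A') → Ideal.span {(d : R)} * Q.I A B = J := by
    intro A hA0 hAn hAA
    obtain ⟨C, hC⟩ := hAn
    have hA'A : A' ∣ A ∧ A ∣ A' := by rcases hAA with rfl | rfl <;> simp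
    have hdAJ : (d * A : R) ∈ J := by
      have := (hM (d * A)).2 (mul_dvd_mul_left d hA'A.1)
      push_cast at this; exact this
    apply le_antisymm
    · rw [I, Ideal.span_mul_span', Ideal.span_le]
      rintro x hx
      rw [Set.singleton_mul, Set.image_pair] at hx
      rcases hx with rfl | rfl
      · exact hdAJ
      · exact hθJ
    · intro x hx
      obtain ⟨s, t, rfl⟩ := Q.span x
      obtain ⟨k, rfl⟩ := (hL t).1 ⟨s, hx⟩
      have h2 : ((s - k * (d * m') : ℤ) : R) ∈ J := by
        have := J.sub_mem hx (J.mul_mem_left (k : R) hm)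
        convert this using 1; push_cast; ring
      obtain ⟨l, hl⟩ := (hM _).1 h2
      obtain ⟨u, hu⟩ := hA'A.2
      have : (s + (d * k : ℤ) * Q.ω : R) = d * (A * (u * l) + Q.th B * k) := by
        rw [hθ]
        have hs : s = k * (d * m') + d * (A * u) * l := by rw [← hu]; linarith
        rw [hs]; push_cast; ring
      rw [this]
      refine Ideal.mul_mem_mul (Ideal.mem_span_singleton_self _) (Ideal.add_mem _ (Ideal.mul_mem_right _ _ (Ideal.subset_span (by simp))) (Ideal.mul_mem_right _ _ (Ideal.subset_span (by simp))))
  have hA'0 : A' ≠ 0 := by rintro rfl; simp at ha00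
  obtain ⟨A, hApos, hAA, hAn⟩ : ∃ A : ℤ, 0 < A ∧ (A = A' ∨ A = -A') ∧ A ∣ n0 := by
    rcases lt_or_gt_of_ne hA'0 with h | h
    · exact ⟨-A', by omega, Or.inr rfl, by simpa using hA'n⟩
    · exact ⟨A', h, Or.inl rfl, hA'n⟩
  obtain ⟨C, hC⟩ := id hAn
  refine ⟨A, B, C, hApos, by rw [hC] at hdisc; linarith, ?_⟩
  rw [← key A hApos.ne' hAn hAA, cl_mul (span_ne (Q.int_ne hd0)) (Q.I_ne B hApos.ne'), cl_span (Q.int_ne hd0), one_mul]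

lemma th_add (Q : QR R D) {A B C : ℤ} (h : B ^ 2 - 4 * A * C = D) (k : ℤ) : Q.th (B + 2 * k) = Q.th B + k := by
  obtain ⟨t, rfl⟩ := Q.par h
  rw [show D + 2 * t + 2 * k = D + 2 * (t + k) by ring, th_eq, th_eq]; push_cast; ring

lemma I_shift (Q : QR R D) {A B C : ℤ} (h : B ^ 2 - 4 * A * C = D) (k : ℤ) : Q.I A (B + 2 * (A * k)) = Q.I A B := by
  rw [I, I, Q.th_add h]
  push_cast
  rw [Ideal.span_pair_comm, mul_comm, Ideal.span_pair_add_mul_right, Ideal.span_pair_comm]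

lemma cl_swap (Q : QR R D) {A B C : ℤ} (h : B ^ 2 - 4 * A * C = D) (hA0 : 0 < A) : cl (Q.I C (-B)) = cl (Q.I A B) := by
  have hC := Q.sum_sq h hA0
  have hm := Q.th_mul h
  have hθ : Q.th B ≠ 0 := by
    intro h0
    rw [h0, zero_mul] at hm
    exact Q.int_ne (mul_pos hA0 hC).ne' (by push_cast; exact hm.symm)
  rw [cl_eq_iff (Q.I_ne _ hC.ne') (Q.I_ne _ hA0.ne')]
  refine ⟨Q.th B, C, hθ, Q.int_ne hC.ne', ?_⟩
  have : Q.th (-B) = -(B - Q.th B) := by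
    have := Q.th_add h (-B)
    rw [show B + 2 * -B = -B by ring] at this
    rw [this]; push_cast; ring
  rw [I, I, this, Ideal.span_mul_span', Ideal.span_mul_span', Set.singleton_mul, Set.singleton_mul, Set.image_pair, Set.image_pair, mul_neg, hm]
  rw [mul_comm (A : R), Ideal.span_pair_comm, mul_comm (Q.th B), Ideal.span_insert, Ideal.span_insert, Ideal.span_singleton_neg]

/-- every class is represented by a reduced form -/
lemma rep2 (Q : QR R D) (g : ClassGroup R) : ∃ A B C : ℤ, 0 < A ∧ B ^ 2 - 4 * A * C = D ∧ |B| ≤ A ∧ A ≤ C ∧ cl (Q.I A B) = g := by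
  have hex : ∃ n : ℕ, 0 < n ∧ ∃ B C : ℤ, B ^ 2 - 4 * (n : ℤ) * C = D ∧ cl (Q.I n B) = g := by
    obtain ⟨A, B, C, h0, h1, h2⟩ := Q.rep1 g
    have : ((A.toNat : ℕ) : ℤ) = A := by omega
    exact ⟨A.toNat, by omega, B, C, by rw [this]; exact h1, by rw [this]; exact h2⟩
  obtain ⟨hn, B, C, h1, h2⟩ := Nat.find_spec hex
  have hmin := fun m => Nat.find_min' hex (m := m)
  set A : ℤ := (Nat.find hex : ℤ) with hAdef
  have hA0 : 0 < A := by omega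
  obtain ⟨k, hk⟩ : ∃ k : ℤ, |B + 2 * (A * k)| ≤ A := by
    refine ⟨-((B + A) / (2 * A)), ?_⟩
    have e := Int.emod_add_mul_ediv (B + A) (2 * A)
    have e1 := Int.emod_nonneg (B + A) (by omega : 2 * A ≠ 0)
    have e2 := Int.emod_lt_of_pos (B + A) (by omega : 0 < 2 * A)
    rw [abs_le]; constructor <;> nlinarith
  have h1' : (B + 2 * (A * k)) ^ 2 - 4 * A * (C + B * k + A * k ^ 2) = D := by rw [← h1]; ring
  have h2' : cl (Q.I A (B + 2 * (A * k))) = g := by rw [Q.I_shift h1, h2]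
  refine ⟨A, _, _, hA0, h1', hk, ?_, h2'⟩
  set C' := C + B * k + A * k ^ 2
  have hC := Q.sum_sq h1' hA0
  have e : ((C'.toNat : ℕ) : ℤ) = C' := by omega
  have := hmin C'.toNat ⟨by omega, -(B + 2 * (A * k)), A, by rw [e, ← h1']; ring, by rw [e, Q.cl_swap h1' hA0, h2']⟩
  omega

/-- the pairs (class, ideal) parametrised by cubic forms -/
def Zs (Q : QR R D) (c : ℤ) : Set (ClassGroup R × Ideal R) :=
  {s | s.2 * s.2.map Q.σ = Ideal.span {(c : R)} ∧ s.1 ^ 3 = cl s.2}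

lemma Zs_ne (Q : QR R D) {c : ℤ} (hc : 0 < c) {W : Ideal R} (h : W * W.map Q.σ = Ideal.span {(c : R)}) : W ≠ ⊥ := by
  rintro rfl
  rw [Ideal.bot_mul] at h
  exact span_ne (Q.int_ne hc.ne') h.symm

/-- the data attached to a cubic form -/
structure Dat (Q : QR R D) (c : ℤ) (f : V ℤ) (A B C : ℤ) : Prop where
  hA : hA f = c * A
  hB : hB f = c * B
  hC : hC f = c * C
  h : B ^ 2 - 4 * A * C = D
  A0 : 0 < A
  s1 : f 0 * C - f 1 * B + f 2 * A = 0
  s2 : f 1 * C - f 2 * B + f 3 * A = 0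

lemma dat (Q : QR R D) {c : ℤ} (hc : 0 < c) {f : V ℤ} (h0 : 0 < hA f) (h1 : c ∣ hA f) (h2 : c ∣ hB f) (h3 : c ∣ hC f)
    (h4 : PTM.hD f = c ^ 2 * D) : Q.Dat c f (hA f / c) (hB f / c) (hC f / c) := by
  obtain ⟨A, eA⟩ := h1
  obtain ⟨B, eB⟩ := h2
  obtain ⟨C, eC⟩ := h3
  have q1 : hA f / c = A := by rw [eA]; exact Int.mul_ediv_cancel_left _ hc.ne'
  have q2 : hB f / c = B := by rw [eB]; exact Int.mul_ediv_cancel_left _ hc.ne'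
  have q3 : hC f / c = C := by rw [eC]; exact Int.mul_ediv_cancel_left _ hc.ne'
  rw [q1, q2, q3]
  have t1 := syz1 f
  have t2 := syz2 f
  rw [eA, eB, eC] at t1 t2
  refine ⟨eA, eB, eC, ?_, ?_, ?_, ?_⟩
  · have : c ^ 2 ≠ 0 := pow_ne_zero _ hc.ne'
    apply mul_left_cancel₀ this
    rw [← h4, PTM.hD, eA, eB, eC]; ring
  · rw [eA] at h0; exact (mul_pos_iff_of_pos_left hc).1 h0
  · apply mul_left_cancel₀ hc.ne'; linear_combination t1
  · apply mul_left_cancel₀ hc.ne'; linear_combination t2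

lemma Dat.mem (Q : QR R D) {c : ℤ} (hc : 0 < c) {f : V ℤ} {A B C : ℤ} (d : Q.Dat c f A B C) :
    (cl (Q.I A B), Q.W A B C f) ∈ Q.Zs c := by
  have hW := Q.W_conj d.h d.A0 f d.s1 d.s2 d.hA
  refine ⟨hW, ?_⟩
  have hI := Q.I_ne B d.A0.ne'
  have hW0 := Q.Zs_ne hc hW
  have he : Q.e0 A B f ≠ 0 := by
    intro h0
    have := Q.e0_norm d.h f d.s1
    rw [h0, zero_mul, d.hA] at this
    exact Q.int_ne (by have := d.A0; positivity) this.symm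
  have hA' : (A : R) ^ 3 ≠ 0 := pow_ne_zero _ (Q.int_ne d.A0.ne')
  have := congrArg cl (Q.W_eq d.h f d.s1 d.s2)
  rw [cl_mul (span_ne he) (pow_ne_zero _ hI), cl_span he, cl_mul (span_ne hA') hW0, cl_span hA', cl_pow hI, one_mul, one_mul] at this
  exact this

/-- surjectivity -/
lemma surj (Q : QR R D) {c : ℤ} (hc : 0 < c) {s : ClassGroup R × Ideal R} (hs : s ∈ Q.Zs c) :
    ∃ (f : V ℤ) (A B C : ℤ), Q.Dat c f A B C ∧ |B| ≤ A ∧ A ≤ C ∧ s = (cl (Q.I A B), Q.W A B C f) := by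
  obtain ⟨g, W⟩ := s
  obtain ⟨hW, hg⟩ := hs
  simp only at hW hg
  obtain ⟨A, B, C, hA0, h, r1, r2, rfl⟩ := Q.rep2 g
  have hI := Q.I_ne B hA0.ne'
  have hW0 := Q.Zs_ne hc hW
  have hm := Q.th_mul h
  rw [← cl_pow hI, cl_eq_iff (pow_ne_zero _ hI) hW0] at hg
  obtain ⟨x, y, hx, hy, e⟩ := hg
  have hmem : ∀ z ∈ Q.I A B ^ 3, ∃ w, x * z = y * w := by
    intro z hz
    have : x * z ∈ Ideal.span {y} * W := by rw [← e]; exact Ideal.mul_mem_mul (Ideal.mem_span_singleton_self _) hz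
    obtain ⟨w, _, hw⟩ := Ideal.mem_span_singleton_mul.1 this
    exact ⟨w, hw.symm⟩
  rw [I, span_cube] at hmem
  obtain ⟨w0, e0'⟩ := hmem _ (Ideal.subset_span (by simp : (A : R) ^ 3 ∈ _))
  obtain ⟨w1, e1'⟩ := hmem _ (Ideal.subset_span (by simp : (A : R) ^ 2 * Q.th B ∈ _))
  obtain ⟨w2, e2'⟩ := hmem _ (Ideal.subset_span (by simp : (A : R) * Q.th B ^ 2 ∈ _))
  obtain ⟨w3, e3'⟩ := hmem _ (Ideal.subset_span (by simp : Q.th B ^ 3 ∈ _))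
  have k1 : w0 * Q.th B = A * w1 := mul_left_cancel₀ hy (by linear_combination -Q.th B * e0' + A * e1')
  have k2 : w1 * Q.th B = A * w2 := mul_left_cancel₀ hy (by linear_combination -Q.th B * e1' + A * e2')
  have k3 : w2 * Q.th B = A * w3 := mul_left_cancel₀ hy (by linear_combination -Q.th B * e2' + A * e3')
  obtain ⟨m0, f0, rfl⟩ := Q.th_rep h w0
  obtain ⟨m1, f1, rfl⟩ := Q.th_rep h w1
  obtain ⟨m2, f2, rfl⟩ := Q.th_rep h w2
  obtain ⟨m3, f3, rfl⟩ := Q.th_rep h w3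
  have step : ∀ m f m' f' : ℤ, (m + f * Q.th B) * Q.th B = A * ((m' : R) + f' * Q.th B) → m' = -(f * C) ∧ A * f' = m + f * B := by
    intro m f m' f' hk
    obtain ⟨q1, q2⟩ := Q.th_inj h (m := -(f * (A * C))) (n := m + f * B) (m' := A * m') (n' := A * f') (by
      push_cast; linear_combination hk + (f : R) * hm)
    exact ⟨mul_left_cancel₀ hA0.ne' (by linear_combination -q1), q2.symm⟩
  obtain ⟨_, g1⟩ := step _ _ _ _ k1
  obtain ⟨g2, g3⟩ := step _ _ _ _ k2
  obtain ⟨g4, g5⟩ := step _ _ _ _ k3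
  obtain ⟨p1, _⟩ := step _ _ _ _ k1
  set f : V ℤ := ![f0, f1, f2, f3] with hf
  have t0 : f 0 = f0 := rfl
  have t1 : f 1 = f1 := rfl
  have t2 : f 2 = f2 := rfl
  have t3 : f 3 = f3 := rfl
  have s1 : f 0 * C - f 1 * B + f 2 * A = 0 := by rw [t0, t1, t2]; linear_combination g3 + p1
  have s2 : f 1 * C - f 2 * B + f 3 * A = 0 := by rw [t1, t2, t3]; linear_combination g5 + g2
  have he0 : (m0 + f0 * Q.th B : R) = Q.e0 A B f := by
    have : m0 = A * f1 - f0 * B := by linarith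
    rw [e0, t0, t1, this]; push_cast; ring
  rw [he0] at e0'
  have hA' : (A : R) ^ 3 ≠ 0 := pow_ne_zero _ (Q.int_ne hA0.ne')
  have hWW : Ideal.span {Q.e0 A B f} * Q.I A B ^ 3 = Ideal.span {(A : R) ^ 3} * W := by
    apply cancel_span hy
    rw [← mul_assoc, Ideal.span_singleton_mul_span_singleton, ← e0', mul_left_comm, ← e, mul_comm x, ← Ideal.span_singleton_mul_span_singleton, mul_assoc]
  have hWeq : Q.W A B C f = W := by
    apply cancel_span hA'
    rw [← hWW, Q.W_eq h f s1 s2]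
  have hne : Q.e0 A B f ≠ 0 := by
    intro h0; rw [h0, mul_zero] at e0'
    exact mul_ne_zero hx hA' e0'
  obtain ⟨N, hN, eN⟩ := Q.norm_pos hne
  have hn := Q.W_norm h hWW
  have hNA : N = A ^ 2 * hA f := by
    apply Q.int_eq; rw [← eN, Q.e0_norm h f s1]
  rw [eN, hW] at hn
  have hn' : N * A ^ 3 = A ^ 6 * c := by
    apply Q.span_int (by positivity) (by positivity)
    push_cast
    rw [← Ideal.span_singleton_mul_span_singleton, hn, Ideal.span_singleton_mul_span_singleton]
  have hAc : hA f = c * A := by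
    have : A ^ 5 ≠ 0 := by positivity
    apply mul_left_cancel₀ this
    rw [hNA] at hn'; linear_combination hn'
  have hBc : hB f = c * B := by
    apply mul_left_cancel₀ hA0.ne'
    have : A * hB f = B * hA f := by simp only [hA, hB]; linear_combination f 1 * s1 - f 0 * s2
    rw [this, hAc]; ring
  have hCc : hC f = c * C := by
    apply mul_left_cancel₀ hA0.ne'
    have : A * hC f = C * hA f := by simp only [hA, hC]; linear_combination f 2 * s1 - f 1 * s2
    rw [this, hAc]; ring
  exact ⟨f, A, B, C, ⟨hAc, hBc, hCc, h, hA0, s1, s2⟩, r1, r2, by rw [hWeq]⟩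

end QR
end PTM


/-! ### The correspondence: fibres and counts -/
namespace PTM
open Set Filter

namespace QR
variable {R : Type*} [CommRing R] [IsDomain R] [IsDedekindDomain R] {D : ℤ}

lemma norm_XY (Q : QR R D) {A B C : ℤ} (h : B ^ 2 - 4 * A * C = D) (X Y : ℤ) :
    (X * A + Y * Q.th B) * Q.σ (X * A + Y * Q.th B) = ((A * (A * X ^ 2 + B * X * Y + C * Y ^ 2) : ℤ) : R) := by
  simp only [map_add, map_mul, map_intCast, Q.σ_th h]
  push_cast
  linear_combination (Y : R) ^ 2 * Q.th_mul h

lemma q_ge {A B C X Y : ℤ} (h1 : |B| ≤ A) (h2 : A ≤ C) (h0 : 0 < A) (hXY : X ≠ 0 ∨ Y ≠ 0) :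
    A ≤ A * X ^ 2 + B * X * Y + C * Y ^ 2 := by
  have hB := abs_le.1 h1
  have key : ∀ x y : ℤ, 0 ≤ x → 0 ≤ y → (x ≠ 0 ∨ y ≠ 0) → A ≤ A * x ^ 2 - A * (x * y) + A * y ^ 2 := by
    intro x y hx hy hxy
    have : 1 ≤ x ^ 2 - x * y + y ^ 2 := by
      rcases hxy with h | h
      · have : 0 < x := by omega
        nlinarith [sq_nonneg (x - 2 * y)]
      · have : 0 < y := by omega
        nlinarith [sq_nonneg (y - 2 * x)]
    nlinarith
  have := key |X| |Y| (abs_nonneg _) (abs_nonneg _) (by simpa using hXY)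
  rw [sq_abs, sq_abs] at this
  have h3 : -(A * (|X| * |Y|)) ≤ B * X * Y := by
    have : |B * X * Y| ≤ A * (|X| * |Y|) := by
      rw [abs_mul, abs_mul, mul_assoc]
      exact mul_le_mul_of_nonneg_right h1 (by positivity)
    have := neg_abs_le (B * X * Y)
    linarith
  nlinarith [sq_nonneg Y, mul_nonneg (sub_nonneg.2 h2) (sq_nonneg Y)]

lemma q_eq {A B C X Y : ℤ} (h1 : |B| < A) (h2 : A < C) (h0 : 0 < A)
    (e : A * X ^ 2 + B * X * Y + C * Y ^ 2 = A) : Y = 0 ∧ (X = 1 ∨ X = -1) := by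
  have hY : Y = 0 := by
    by_contra hY
    have := q_ge (A := A) (B := B) (C := A) (X := X) (Y := Y) h1.le le_rfl h0 (Or.inr hY)
    have hY2 : 0 < Y ^ 2 := by positivity
    nlinarith
  subst hY
  refine ⟨rfl, ?_⟩
  have : A * ((X - 1) * (X + 1)) = 0 := by linear_combination e
  rcases mul_eq_zero.1 this with h | h
  · omega
  · rcases mul_eq_zero.1 h with h | h
    · left; omega
    · right; omega

/-- uniqueness of strictly reduced forms in a class -/
lemma red_unique (Q : QR R D) {A B C A' B' C' : ℤ} (h : B ^ 2 - 4 * A * C = D) (h' : B' ^ 2 - 4 * A' * C' = D)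
    (A0 : 0 < A) (A0' : 0 < A') (r1 : |B| < A) (r2 : A < C) (r1' : |B'| < A') (r2' : A' < C')
    (e : cl (Q.I A B) = cl (Q.I A' B')) : A = A' ∧ B = B' ∧ C = C' := by
  have main : ∀ {A B C A' B' C' : ℤ}, B ^ 2 - 4 * A * C = D → B' ^ 2 - 4 * A' * C' = D → 0 < A → 0 < A' →
      |B'| < A' → A' < C' → ∀ x y : R, x ≠ 0 → y ≠ 0 → Ideal.span {x} * Q.I A B = Ideal.span {y} * Q.I A' B' →
      ∃ X Y : ℤ, (X ≠ 0 ∨ Y ≠ 0) ∧ x * A = y * (X * A' + Y * Q.th B') ∧ A = A' * X ^ 2 + B' * X * Y + C' * Y ^ 2 := by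
    intro A B C A' B' C' h h' A0 A0' r1 r2 x y hx hy e
    have m1 : x * A ∈ Ideal.span {y} * Q.I A' B' := by
      rw [← e]; exact Ideal.mul_mem_mul (Ideal.mem_span_singleton_self _) (Ideal.subset_span (by simp))
    obtain ⟨z, hz, hxy⟩ := Ideal.mem_span_singleton_mul.1 m1
    obtain ⟨X, Y, rfl⟩ := (Q.mem_I h' z).1 hz
    obtain ⟨N, hN, eN⟩ := Q.norm_pos hx
    obtain ⟨M, hM, eM⟩ := Q.norm_pos hy
    have hn : N * A = M * A' := by
      apply Q.span_int (by positivity) (by positivity)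
      have e' := congrArg (Ideal.map Q.σ) e
      rw [Ideal.map_mul, Ideal.map_mul, map_span1, map_span1] at e'
      have e2 := congrArg₂ (· * ·) e e'
      push_cast
      rw [← Ideal.span_singleton_mul_span_singleton, ← Ideal.span_singleton_mul_span_singleton, ← Q.I_conj h, ← Q.I_conj h', ← eN, ← eM, ← Ideal.span_singleton_mul_span_singleton, ← Ideal.span_singleton_mul_span_singleton]
      calc _ = (Ideal.span {x} * Q.I A B) * (Ideal.span {Q.σ x} * (Q.I A B).map Q.σ) := by ring
        _ = _ := e2
        _ = _ := by ring
    refine ⟨X, Y, ?_, hxy.symm, ?_⟩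
    · by_contra hcon
      push Not at hcon
      rw [hcon.1, hcon.2] at hxy
      simp at hxy
      rcases hxy with h | h
      · exact hx h
      · exact Q.int_ne A0.ne' h
    · have e1 : N * A * A = M * (A' * (A' * X ^ 2 + B' * X * Y + C' * Y ^ 2)) := by
        apply Q.int_eq
        have hc := congrArg Q.σ hxy
        rw [map_mul, map_mul, map_intCast] at hc
        have := Q.norm_XY h' X Y
        rw [Int.cast_mul M, ← this, ← eM]
        push_cast
        rw [← eN]
        linear_combination -(x * A) * hc - Q.σ y * Q.σ (X * A' + Y * Q.th B') * hxy
      rw [hn] at e1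
      have : M * A' ≠ 0 := by positivity
      apply mul_left_cancel₀ this
      linear_combination e1
  rw [cl_eq_iff (Q.I_ne _ A0.ne') (Q.I_ne _ A0'.ne')] at e
  obtain ⟨x, y, hx, hy, e⟩ := e
  obtain ⟨X, Y, hXY, k1, k2⟩ := main h h' A0 A0' r1' r2' x y hx hy e
  obtain ⟨X', Y', hXY', _, k4⟩ := main h' h A0' A0 r1 r2 y x hy hx e.symm
  have l1 := q_ge r1'.le r2'.le A0' hXY
  have l2 := q_ge r1.le r2.le A0 hXY'
  have hAA : A = A' := by omega
  subst hAA
  obtain ⟨rfl, hX⟩ := q_eq r1' r2' A0 k2.symm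
  have hA' := Q.int_ne A0.ne'
  have hI : Q.I A B = Q.I A B' := by
    have hxy : x = y ∨ x = -y := by
      rcases hX with rfl | rfl
      · left; apply mul_right_cancel₀ hA'; rw [k1]; simp
      · right; apply mul_right_cancel₀ hA'; rw [k1]; simp
    have : Ideal.span {x} = Ideal.span {y} := by
      rcases hxy with rfl | rfl
      · rfl
      · exact Ideal.span_singleton_neg y
    rw [this] at e
    exact cancel_span hy e
  have : Q.th B ∈ Q.I A B' := by rw [← hI]; exact Ideal.subset_span (by simp)
  obtain ⟨U, Z, hUZ⟩ := (Q.mem_I h' _).1 this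
  obtain ⟨t, ht⟩ := Q.par h
  obtain ⟨t', ht'⟩ := Q.par h'
  have : Q.th B = Q.th B' + (t - t' : ℤ) := by rw [ht, ht', th_eq, th_eq]; push_cast; ring
  rw [this] at hUZ
  obtain ⟨c1, c2⟩ := Q.th_inj h' (m := t - t') (n := 1) (m' := U * A) (n' := Z) (by push_cast; push_cast at hUZ; linear_combination hUZ)
  have hBB : B = B' := by
    have hd : B - B' = 2 * (U * A) := by rw [← c1]; omega
    have b1 := abs_lt.1 r1
    have b2 := abs_lt.1 r1'
    have : U = 0 := by
      by_contra hU
      rcases lt_or_gt_of_ne hU with h | h <;> nlinarith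
    rw [this] at hd; omega
  subst hBB
  refine ⟨rfl, rfl, ?_⟩
  have : 4 * A ≠ 0 := by positivity
  apply mul_left_cancel₀ this
  linear_combination h' - h

/-- the fibres of the correspondence -/
lemma fibre (Q : QR R D) (hD4 : D < -4) {c : ℤ} {f f' : V ℤ} {A B C A' B' C' : ℤ} (d : Q.Dat c f A B C) (d' : Q.Dat c f' A' B' C') (hc : 0 < c)
    (r1 : |B| < A) (r2 : A < C) (r1' : |B'| < A') (r2' : A' < C')
    (e : cl (Q.I A B) = cl (Q.I A' B')) (e' : Q.W A B C f = Q.W A' B' C' f') : f' = f ∨ f' = -f := by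
  obtain ⟨rfl, rfl, rfl⟩ := Q.red_unique d.h d'.h d.A0 d'.A0 r1 r2 r1' r2' e
  have w := Q.W_eq d.h f d.s1 d.s2
  have w' := Q.W_eq d.h f' d'.s1 d'.s2
  rw [e', ← w'] at w
  have hI : Q.I A B ^ 3 ≠ ⊥ := pow_ne_zero _ (Q.I_ne _ d.A0.ne')
  have w2 := mul_right_cancel₀ hI w
  rw [Ideal.span_singleton_eq_span_singleton] at w2
  obtain ⟨u, hu⟩ := w2
  have aux : ∀ g : V ℤ, Q.Dat c g A B C → Q.e0 A B f' = Q.e0 A B g → f' = g := by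
    intro g dg he
    unfold e0 at he
    obtain ⟨a1, a2⟩ := Q.th_inj d.h (m := f' 1 * A - f' 0 * B) (n := f' 0) (m' := g 1 * A - g 0 * B) (n' := g 0) (by push_cast; linear_combination he)
    have hA := d.A0.ne'
    have a3 : f' 1 = g 1 := by
      apply mul_right_cancel₀ hA; rw [a2] at a1; linarith
    have a4 : f' 2 = g 2 := by
      apply mul_right_cancel₀ hA
      have := d'.s1
      rw [a2, a3] at this
      linarith [dg.s1]
    have a5 : f' 3 = g 3 := by
      apply mul_right_cancel₀ hA
      have := d'.s2
      rw [a3, a4] at this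
      linarith [dg.s2]
    funext i
    fin_cases i <;> assumption
  rcases Q.unit_eq hD4 u u.isUnit with h1 | h1
  · left
    exact aux f d (by rw [← hu, h1, mul_one])
  · right
    refine aux (-f) ⟨?_, ?_, ?_, d.h, d.A0, ?_, ?_⟩ ?_
    · rw [← d.hA]; simp [hA]
    · rw [← d.hB]; simp [hB]
    · rw [← d.hC]; simp [hC]
    · simp only [Pi.neg_apply]; linear_combination -d.s1
    · simp only [Pi.neg_apply]; linear_combination -d.s2
    · rw [← hu, h1]; simp only [e0, Pi.neg_apply]; push_cast; ring

/-- forms belonging to `D` and content `c` -/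
def FF (D c : ℤ) : Set (V ℤ) := {f | f 0 ≠ 0 ∧ (c ∣ hA f ∧ c ∣ hB f ∧ c ∣ hC f) ∧ PTM.hD f = c ^ 2 * D}

noncomputable def Φ (Q : QR R D) (c : ℤ) (f : V ℤ) : ClassGroup R × Ideal R :=
  (cl (Q.I (hA f / c) (hB f / c)), Q.W (hA f / c) (hB f / c) (hC f / c) f)

lemma FFfin (c D : ℤ) : {f : V ℤ | redC f ∧ f ∈ FF D c}.Finite := by
  have := (FC_bound (|c ^ 2 * D| + 1 : ℤ) (by push_cast; positivity)).1
  refine this.subset ?_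
  rintro f ⟨h1, h2, h3, h4⟩
  refine ⟨h1, h2, ?_⟩
  rw [h4]
  have := neg_abs_le (c ^ 2 * D)
  exact_mod_cast (by linarith : -(|c ^ 2 * D| + 1) < c ^ 2 * D)

lemma count_lo (Q : QR R D) (hD4 : D < -4) {c : ℤ} (hc : 0 < c) (Z : Set (ClassGroup R × Ideal R)) (hZ : Z.Finite)
    (hsub : ∀ f, redO f → f ∈ FF D c → Q.Φ c f ∈ Z) :
    {f : V ℤ | redO f ∧ f ∈ FF D c}.ncard ≤ 2 * Z.ncard := by
  have hfin : {f : V ℤ | redO f ∧ f ∈ FF D c}.Finite :=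
    (FFfin c D).subset (by rintro f ⟨h1, h2⟩; exact ⟨h1.redC, h2⟩)
  have hdat : ∀ f, redO f → f ∈ FF D c → Q.Dat c f (hA f / c) (hB f / c) (hC f / c) ∧ |hB f / c| < hA f / c ∧ hA f / c < hC f / c := by
    intro f h1 h2
    have d := Q.dat hc h1.1 h2.2.1.1 h2.2.1.2.1 h2.2.1.2.2 h2.2.2
    refine ⟨d, ?_, ?_⟩
    · have := h1.2.1
      rw [d.hA, d.hB, abs_mul, abs_of_pos hc] at this
      exact lt_of_mul_lt_mul_left this hc.le
    · have := h1.2.2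
      rw [d.hA, d.hC] at this
      exact lt_of_mul_lt_mul_left this hc.le
  rw [Set.ncard_eq_toFinset_card _ hfin, Set.ncard_eq_toFinset_card _ hZ]
  have h1 : hfin.toFinset.card ≤ 2 * (hfin.toFinset.image (Q.Φ c)).card := by
    refine Finset.card_le_mul_card_image _ _ ?_
    intro s hs
    obtain ⟨f, hf, rfl⟩ := Finset.mem_image.1 hs
    rw [Set.Finite.mem_toFinset] at hf
    calc _ ≤ ({f, -f} : Finset (V ℤ)).card := by
          apply Finset.card_le_card
          intro f' hf'
          rw [Finset.mem_filter, Set.Finite.mem_toFinset] at hf'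
          obtain ⟨⟨g1, g2⟩, g3⟩ := hf'
          obtain ⟨d, r1, r2⟩ := hdat f hf.1 hf.2
          obtain ⟨d', r1', r2'⟩ := hdat f' g1 g2
          have := Q.fibre hD4 d d' hc r1 r2 r1' r2' (congrArg Prod.fst g3).symm (congrArg Prod.snd g3).symm
          simpa using this
      _ ≤ 2 := Finset.card_le_two
  refine h1.trans (Nat.mul_le_mul_left 2 (Finset.card_le_card ?_))
  intro s hs
  obtain ⟨f, hf, rfl⟩ := Finset.mem_image.1 hs
  rw [Set.Finite.mem_toFinset] at hf ⊢
  exact hsub f hf.1 hf.2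

lemma count_hi (Q : QR R D) {c : ℤ} (hc : 0 < c) (Z : Set (ClassGroup R × Ideal R)) (hZ : Z.Finite)
    (hsub : Z ⊆ Q.Zs c) (hne : ∀ f A B C, Q.Dat c f A B C → (cl (Q.I A B), Q.W A B C f) ∈ Z → f 0 ≠ 0) :
    2 * Z.ncard ≤ {f : V ℤ | redC f ∧ f ∈ FF D c}.ncard := by
  have hfin := FFfin c D
  have hex : ∀ s : Z, ∃ f : V ℤ, redC f ∧ f ∈ FF D c ∧ Q.Φ c f = s ∧ Q.Φ c (-f) = s := by
    rintro ⟨s, hs⟩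
    obtain ⟨f, A, B, C, d, r1, r2, e⟩ := Q.surj hc (hsub hs)
    have q1 : hA f / c = A := by rw [d.hA]; exact Int.mul_ediv_cancel_left _ hc.ne'
    have q2 : hB f / c = B := by rw [d.hB]; exact Int.mul_ediv_cancel_left _ hc.ne'
    have q3 : hC f / c = C := by rw [d.hC]; exact Int.mul_ediv_cancel_left _ hc.ne'
    refine ⟨f, ⟨?_, ?_, ?_⟩, ⟨hne f A B C d (e ▸ hs), ⟨⟨A, d.hA⟩, ⟨B, d.hB⟩, ⟨C, d.hC⟩⟩, ?_⟩, ?_, ?_⟩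
    · rw [d.hA]; have := d.A0; positivity
    · rw [d.hA, d.hB, abs_mul, abs_of_pos hc]; exact mul_le_mul_of_nonneg_left r1 hc.le
    · rw [d.hA, d.hC]; exact mul_le_mul_of_nonneg_left r2 hc.le
    · rw [PTM.hD, d.hA, d.hB, d.hC, ← d.h]; ring
    · simp only [Φ, q1, q2, q3, e]
    · have w1 : hA (-f) = hA f := by simp [hA]
      have w2 : hB (-f) = hB f := by simp [hB]
      have w3 : hC (-f) = hC f := by simp [hC]
      simp only [Φ, w1, w2, w3, q1, q2, q3, e]
      congr 1
      unfold W
      simp only [Pi.neg_apply, Int.cast_neg, neg_mul]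
      simp only [show ∀ a b : R, -a - -b = -(a - b) from fun a b => by ring]
      simp only [Ideal.span_insert, Ideal.span_singleton_neg]
  choose F hF using hex
  have hcard : 2 * Z.ncard = Nat.card (Bool × Z) := by
    rw [Nat.card_prod, Nat.card_eq_fintype_card, Fintype.card_bool]; rfl
  rw [hcard]
  have hfin' : Finite {f : V ℤ | redC f ∧ f ∈ FF D c} := hfin
  refine Nat.card_le_card_of_injective (β := {f : V ℤ | redC f ∧ f ∈ FF D c}) (fun x => ⟨if x.1 then F x.2 else -F x.2, ?_⟩) ?_
  · obtain ⟨h1, h2, _⟩ := hF x.2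
    have w1 : hA (-F x.2) = hA (F x.2) := by simp [hA]
    have w2 : hB (-F x.2) = hB (F x.2) := by simp [hB]
    have w3 : hC (-F x.2) = hC (F x.2) := by simp [hC]
    split_ifs
    · exact ⟨h1, h2⟩
    · refine ⟨?_, ?_, ?_, ?_⟩
      · simpa only [redC, w1, w2, w3] using h1
      · simpa using h2.1
      · simpa only [w1, w2, w3] using h2.2.1
      · have := h2.2.2
        simpa only [PTM.hD, w1, w2, w3] using this
  · rintro ⟨b, s⟩ ⟨b', s'⟩ hxy
    have hxy' : (if b then F s else -F s) = (if b' then F s' else -F s') := congrArg Subtype.val hxy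
    have hs : s = s' := by
      have k := congrArg (Q.Φ c) hxy'
      have e1 : Q.Φ c (if b then F s else -F s) = s := by
        split_ifs
        · exact (hF s).2.2.1
        · exact (hF s).2.2.2
      have e2 : Q.Φ c (if b' then F s' else -F s') = s' := by
        split_ifs
        · exact (hF s').2.2.1
        · exact (hF s').2.2.2
      rw [e1, e2] at k
      exact Subtype.ext k
    subst hs
    have h0 := (hF s).2.1.1
    have k := congrFun hxy' 0
    have : b = b' := by
      cases b <;> cases b' <;> simp at k ⊢ <;> omega
    rw [this]

end QR
end PTM


/-! ### Characters of order three -/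
namespace PTM
open Set Filter

section
variable {G : Type*} [CommGroup G] [Finite G]

/-- number of cube roots -/
noncomputable def rt (w : G) : ℕ := {g : G | g ^ 3 = w}.ncard

abbrev N3 (G : Type*) [CommGroup G] : Subgroup G := (powMonoidHom 3 : G →* G).range
abbrev V3 (G : Type*) [CommGroup G] := Additive (G ⧸ N3 G)

lemma V3_smul (x : V3 G) : 3 • x = 0 := by
  obtain ⟨g, hg⟩ := QuotientGroup.mk_surjective (Additive.toMul x)
  have : Additive.toMul (3 • x) = 1 := by
    rw [toMul_nsmul, ← hg, ← QuotientGroup.mk_pow, QuotientGroup.eq_one_iff]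
    exact ⟨g, rfl⟩
  exact this

noncomputable instance instModV3 : Module (ZMod 3) (V3 G) := AddCommGroup.zmodModule V3_smul

instance instFinV3 : Finite (V3 G) := inferInstanceAs (Finite (G ⧸ N3 G))

lemma mul3_trivial (φ : G →* Multiplicative (ZMod 3)) (x : G) (hx : x ∈ N3 G) : φ x = 1 := by
  obtain ⟨g, rfl⟩ := hx
  have : ∀ y : Multiplicative (ZMod 3), y ^ 3 = 1 := by decide
  simp [this]

noncomputable def homEquiv : (G →* Multiplicative (ZMod 3)) ≃ Module.Dual (ZMod 3) (V3 G) where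
  toFun φ := AddMonoidHom.toZModLinearMap 3 (MonoidHom.toAdditiveLeft (QuotientGroup.lift (N3 G) φ (mul3_trivial φ)))
  invFun L := (MonoidHom.toAdditiveLeft.symm L.toAddMonoidHom).comp (QuotientGroup.mk' (N3 G))
  left_inv φ := by ext g; rfl
  right_inv L := by
    ext x
    obtain ⟨g, hg⟩ := QuotientGroup.mk_surjective (Additive.toMul x)
    obtain rfl : x = Additive.ofMul (g : G ⧸ N3 G) := by rw [hg]; rfl
    rfl

lemma homEquiv_apply (φ : G →* Multiplicative (ZMod 3)) (g : G) :
    homEquiv φ (Additive.ofMul (g : G ⧸ N3 G)) = Multiplicative.toAdd (φ g) := rfl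

instance instFinHom : Finite (G →* Multiplicative (ZMod 3)) := Finite.of_injective (fun φ => (φ : G → _)) DFunLike.coe_injective

lemma card_hom : Nat.card (G →* Multiplicative (ZMod 3)) = rt (1 : G) := by
  have h1 : Nat.card (G →* Multiplicative (ZMod 3)) = Nat.card (V3 G) := by
    rw [Nat.card_congr homEquiv, Module.natCard_eq_pow_finrank (K := ZMod 3), Subspace.dual_finrank_eq, ← Module.natCard_eq_pow_finrank]
  have h2 : Nat.card (V3 G) = Nat.card (G ⧸ N3 G) := rfl
  rw [h1, h2]
  have h3 := Subgroup.card_eq_card_quotient_mul_card_subgroup (N3 G)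
  have h4 := Subgroup.card_eq_card_quotient_mul_card_subgroup (powMonoidHom 3 : G →* G).ker
  have h5 : Nat.card (G ⧸ (powMonoidHom 3 : G →* G).ker) = Nat.card (N3 G) :=
    Nat.card_congr (QuotientGroup.quotientKerEquivRange _).toEquiv
  have h6 : Nat.card (powMonoidHom 3 : G →* G).ker = rt (1 : G) := by
    rw [rt, ← Nat.card_coe_set_eq]; rfl
  rw [h5, h6, h3, mul_comm] at h4
  have : 0 < Nat.card (N3 G) := Nat.card_pos
  exact Nat.eq_of_mul_eq_mul_left this h4

noncomputable def nhom (w : G) (b : ZMod 3) : ℕ := {φ : G →* Multiplicative (ZMod 3) | φ w = Multiplicative.ofAdd b}.ncard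

lemma rt_of_mem {w : G} (hw : w ∈ N3 G) : rt w = rt (1 : G) := by
  obtain ⟨v, rfl⟩ := hw
  rw [rt, rt, ← Set.ncard_image_of_injective {g : G | g ^ 3 = 1} (mul_right_injective v)]
  congr 1
  ext g
  constructor
  · intro hg
    have hg' : g ^ 3 = v ^ 3 := hg
    refine ⟨v⁻¹ * g, ?_, by simp⟩
    show (v⁻¹ * g) ^ 3 = 1
    rw [mul_pow, hg', inv_pow]; simp
  · rintro ⟨x, hx, rfl⟩
    have hx' : x ^ 3 = 1 := hx
    show (v * x) ^ 3 = v ^ 3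
    rw [mul_pow, hx', mul_one]

lemma rt_of_not_mem {w : G} (hw : w ∉ N3 G) : rt w = 0 := by
  rw [rt, Set.ncard_eq_zero]
  ext g
  simp only [mem_empty_iff_false, iff_false]
  intro hg
  exact hw ⟨g, hg⟩

lemma nhom_mem {w : G} (hw : w ∈ N3 G) (b : ZMod 3) : nhom w b = if b = 0 then rt (1 : G) else 0 := by
  have h1 : ∀ φ : G →* Multiplicative (ZMod 3), φ w = 1 := fun φ => mul3_trivial φ w hw
  split_ifs with hb
  · rw [← card_hom, nhom, ← Set.ncard_univ]
    congr 1
    ext φ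
    simp only [mem_univ, iff_true]
    show φ w = _
    rw [h1, hb]; rfl
  · rw [nhom, Set.ncard_eq_zero]
    ext φ
    simp only [mem_empty_iff_false, iff_false]
    intro hφ
    have hφ' : φ w = Multiplicative.ofAdd b := hφ
    rw [h1] at hφ'
    apply hb
    exact (Multiplicative.ofAdd.injective hφ').symm

lemma nhom_not_mem {w : G} (hw : w ∉ N3 G) (b : ZMod 3) : 3 * nhom w b = rt (1 : G) := by
  obtain ⟨φ₀, h0⟩ : ∃ φ : G →* Multiplicative (ZMod 3), φ w ≠ 1 := by
    by_contra hcon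
    push Not at hcon
    apply hw
    have : (Additive.ofMul (w : G ⧸ N3 G) : V3 G) = 0 := by
      rw [← Module.forall_dual_apply_eq_zero_iff (ZMod 3)]
      intro L
      obtain ⟨φ, rfl⟩ := homEquiv.surjective L
      rw [homEquiv_apply, hcon]; rfl
    have h2 : (w : G ⧸ N3 G) = 1 := this
    exact (QuotientGroup.eq_one_iff w).1 h2
  have hgen : ∀ y : Multiplicative (ZMod 3), y ≠ 1 → ∀ z, ∃ k : ℕ, y ^ k = z := by
    intro y hy z
    revert y z
    have : ∀ y : Multiplicative (ZMod 3), y ≠ 1 → ∀ z, ∃ k : Fin 3, y ^ (k : ℕ) = z := by decide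
    intro y hy z
    obtain ⟨k, hk⟩ := this y hy z
    exact ⟨k, hk⟩
  have heq : ∀ b b' : ZMod 3, nhom w b = nhom w b' := by
    intro b b'
    obtain ⟨k, hk⟩ := hgen _ h0 (Multiplicative.ofAdd (b - b'))
    rw [nhom, nhom, ← Set.ncard_image_of_injective {φ : G →* Multiplicative (ZMod 3) | φ w = Multiplicative.ofAdd b'} (mul_right_injective (φ₀ ^ k))]
    congr 1
    ext φ
    constructor
    · intro hφ
      have hφ' : φ w = Multiplicative.ofAdd b := hφ
      refine ⟨(φ₀ ^ k)⁻¹ * φ, ?_, by simp⟩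
      show ((φ₀ ^ k)⁻¹ * φ) w = _
      rw [MonoidHom.mul_apply, MonoidHom.inv_apply, MonoidHom.pow_apply, hk, hφ', ← ofAdd_neg, ← ofAdd_add]
      congr 1; ring
    · rintro ⟨x, hx, rfl⟩
      have hx' : x w = Multiplicative.ofAdd b' := hx
      show (φ₀ ^ k * x) w = _
      rw [MonoidHom.mul_apply, MonoidHom.pow_apply, hk, hx', ← ofAdd_add]
      congr 1; ring
  have hsum : nhom w 0 + nhom w 1 + nhom w 2 = rt (1 : G) := by
    rw [← card_hom, nhom, nhom, nhom, ← Set.ncard_union_eq, ← Set.ncard_union_eq, ← Set.ncard_univ]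
    · congr 1
      ext φ
      simp only [mem_univ, iff_true]
      have : ∀ y : Multiplicative (ZMod 3), (y = Multiplicative.ofAdd 0 ∨ y = Multiplicative.ofAdd 1) ∨ y = Multiplicative.ofAdd 2 := by decide
      exact this (φ w)
    · rw [Set.disjoint_left]
      rintro φ (h1 | h1) h2
      · have : Multiplicative.ofAdd (0 : ZMod 3) = Multiplicative.ofAdd 2 := Eq.trans (Eq.symm h1) h2
        exact absurd this (by decide)
      · have : Multiplicative.ofAdd (1 : ZMod 3) = Multiplicative.ofAdd 2 := Eq.trans (Eq.symm h1) h2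
        exact absurd this (by decide)
    · rw [Set.disjoint_left]
      intro φ h1 h2
      have : Multiplicative.ofAdd (0 : ZMod 3) = Multiplicative.ofAdd 1 := Eq.trans (Eq.symm h1) h2
      exact absurd this (by decide)
  have e0 := heq 0 b
  have e1 := heq 1 b
  have e2 := heq 2 b
  omega

/-- the count of characters with prescribed value -/
lemma nhom_eq (w : G) (b : ZMod 3) : 3 * (nhom w b : ℤ) = if b = 0 then (rt (1 : G) + 2 * rt w : ℤ) else rt (1 : G) - rt w := by
  by_cases hw : w ∈ N3 G
  · rw [nhom_mem hw, rt_of_mem hw]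
    split_ifs <;> push_cast <;> ring
  · have := nhom_not_mem hw b
    rw [rt_of_not_mem hw]
    split_ifs <;> push_cast <;> omega

lemma surj_iff (φ : G →* Multiplicative (ZMod 3)) : Function.Surjective φ ↔ φ ≠ 1 := by
  constructor
  · rintro h rfl
    obtain ⟨g, hg⟩ := h (Multiplicative.ofAdd 1)
    exact absurd hg (by simp; decide)
  · intro h y
    obtain ⟨g, hg⟩ : ∃ g, φ g ≠ 1 := by
      by_contra hcon
      push Not at hcon
      exact h (MonoidHom.ext hcon)
    have : ∀ y : Multiplicative (ZMod 3), y ≠ 1 → ∀ z, ∃ k : Fin 3, y ^ (k : ℕ) = z := by decide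
    obtain ⟨k, hk⟩ := this _ hg y
    exact ⟨g ^ (k : ℕ), by rw [map_pow, hk]⟩

lemma nsur_eq (w : G) (b : ZMod 3) :
    3 * ({φ : G →* Multiplicative (ZMod 3) | Function.Surjective φ ∧ φ w = Multiplicative.ofAdd b}.ncard : ℤ) =
      if b = 0 then (rt (1 : G) + 2 * rt w - 3 : ℤ) else rt (1 : G) - rt w := by
  have h := nhom_eq w b
  by_cases hb : b = 0
  · rw [if_pos hb] at h ⊢
    have e : {φ : G →* Multiplicative (ZMod 3) | Function.Surjective φ ∧ φ w = Multiplicative.ofAdd b} = {φ : G →* Multiplicative (ZMod 3) | φ w = Multiplicative.ofAdd b} \ {1} := by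
      ext φ
      show (Function.Surjective φ ∧ _) ↔ _ ∧ φ ≠ 1
      rw [surj_iff, and_comm]; rfl
    have m : (1 : G →* Multiplicative (ZMod 3)) ∈ {φ : G →* Multiplicative (ZMod 3) | φ w = Multiplicative.ofAdd b} := by
      show (1 : G →* Multiplicative (ZMod 3)) w = _
      rw [hb]; rfl
    have := Set.ncard_diff_singleton_add_one m
    rw [e]
    unfold nhom at h
    omega
  · rw [if_neg hb] at h ⊢
    rw [← h, nhom]
    congr 3
    ext φ
    show (Function.Surjective φ ∧ _) ↔ _
    refine ⟨fun h => h.2, fun h => ⟨?_, h⟩⟩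
    rw [surj_iff]
    rintro rfl
    apply hb
    exact (Multiplicative.ofAdd.injective (show Multiplicative.ofAdd (0 : ZMod 3) = Multiplicative.ofAdd b from h)).symm

lemma rt_inv (w : G) : rt w⁻¹ = rt w := by
  rw [rt, rt, ← Set.ncard_image_of_injective {g : G | g ^ 3 = w} inv_injective]
  congr 1
  ext g
  constructor
  · intro hg
    exact ⟨g⁻¹, by show g⁻¹ ^ 3 = w; rw [inv_pow, show g ^ 3 = w⁻¹ from hg, inv_inv], inv_inv g⟩
  · rintro ⟨x, hx, rfl⟩
    show x⁻¹ ^ 3 = w⁻¹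
    rw [inv_pow, show x ^ 3 = w from hx]

end
end PTM


/-! ### The correspondence for content one and content `p` -/
namespace PTM
open Set Filter

namespace QR
variable {R : Type*} [CommRing R] [IsDomain R] [IsDedekindDomain R] {D : ℤ}

/-- the nontrivial three-torsion -/
def Z1 (R : Type*) [CommRing R] [IsDomain R] : Set (ClassGroup R × Ideal R) :=
  (fun g => (g, (⊤ : Ideal R))) '' {g : ClassGroup R | g ^ 3 = 1 ∧ g ≠ 1}

lemma Z1_card [Finite (ClassGroup R)] : (Z1 R).ncard + 1 = rt (1 : ClassGroup R) := by
  rw [Z1, Set.ncard_image_of_injective _ (fun a b h => congrArg Prod.fst h)]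
  have e : {g : ClassGroup R | g ^ 3 = 1 ∧ g ≠ 1} = {g : ClassGroup R | g ^ 3 = 1} \ {1} := by
    ext g; rfl
  have m : (1 : ClassGroup R) ∈ {g : ClassGroup R | g ^ 3 = 1} := by show (1 : ClassGroup R) ^ 3 = 1; simp
  rw [e, rt, Set.ncard_sdiff_singleton_add_one m]

lemma top_of_one (Q : QR R D) {W : Ideal R} (h : W * W.map Q.σ = Ideal.span {((1 : ℤ) : R)}) : W = ⊤ := by
  rw [Int.cast_one, Ideal.span_singleton_one] at h
  exact top_le_iff.1 (h ▸ Ideal.mul_le_left)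

lemma count1_lo [Finite (ClassGroup R)] (Q : QR R D) (hD4 : D < -4) :
    {f : V ℤ | redO f ∧ f ∈ FF D 1}.ncard + 2 ≤ 2 * rt (1 : ClassGroup R) := by
  have := Q.count_lo hD4 one_pos (Z1 R) (Set.Finite.image _ (Set.toFinite _)) ?_
  · have := Z1_card (R := R)
    omega
  intro f h1 h2
  have d := Q.dat one_pos h1.1 h2.2.1.1 h2.2.1.2.1 h2.2.1.2.2 h2.2.2
  obtain ⟨hW, hg⟩ := d.mem Q one_pos
  have hWt : Q.W (hA f / 1) (hB f / 1) (hC f / 1) f = ⊤ := Q.top_of_one hW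
  simp only [hWt, cl_top] at hg
  refine ⟨cl (Q.I (hA f / 1) (hB f / 1)), ⟨hg, ?_⟩, Prod.ext rfl hWt.symm⟩
  intro hone
  have r1 : |hB f / 1| < hA f / 1 := by simpa using h1.2.1
  have r2 : hA f / 1 < hC f / 1 := by simpa using h1.2.2
  set A := hA f / 1
  set B := hB f / 1
  set C := hC f / 1
  obtain ⟨x, hx, hI⟩ := cl_eq_one (Q.I_ne B d.A0.ne') hone
  have hxI : x ∈ Q.I A B := by rw [hI]; exact Ideal.mem_span_singleton_self _
  obtain ⟨X, Y, hXY⟩ := (Q.mem_I d.h x).1 hxI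
  have hn := Q.norm_XY d.h X Y
  rw [← hXY] at hn
  have hne : X ≠ 0 ∨ Y ≠ 0 := by
    by_contra hcon
    push Not at hcon
    apply hx; rw [hXY, hcon.1, hcon.2]; simp
  have hge := q_ge r1.le r2.le d.A0 hne
  set q := A * X ^ 2 + B * X * Y + C * Y ^ 2
  have hA0 := d.A0
  have hq : A * q = A := by
    apply Q.span_int (mul_pos hA0 (by omega)) hA0
    rw [← hn, ← Q.I_conj d.h, hI, map_span1, Ideal.span_singleton_mul_span_singleton]
  have hA1 : A = 1 := by nlinarith
  have hB0 : B = 0 := by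
    rw [hA1] at r1
    have := abs_lt.1 r1; omega
  have w := Q.W_eq d.h f d.s1 d.s2
  rw [hWt, hA1, hB0] at w
  have hIt : Q.I 1 0 = ⊤ := by
    rw [Ideal.eq_top_iff_one]; exact Ideal.subset_span (by simp)
  rw [hIt] at w
  simp only [Int.cast_one, one_pow, Ideal.span_singleton_one, Ideal.mul_top, ← Ideal.one_eq_top, mul_one] at w
  rw [Ideal.one_eq_top, Ideal.span_singleton_eq_top] at w
  have hd := d.h
  rw [hA1, hB0] at hd
  have fin : ∀ e : ℤ, Q.e0 1 0 f = e → False := by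
    intro e he
    have := (Q.th_inj hd (m := f 1) (n := f 0) (m' := e) (n' := 0) (by rw [← he, e0]; push_cast; ring)).2
    exact h2.1 this
  rcases Q.unit_eq hD4 _ w with h | h
  · exact fin 1 (by rw [h]; simp)
  · exact fin (-1) (by rw [h]; simp)

lemma count1_hi [Finite (ClassGroup R)] (Q : QR R D) :
    2 * rt (1 : ClassGroup R) ≤ {f : V ℤ | redC f ∧ f ∈ FF D 1}.ncard + 2 := by
  have := Q.count_hi one_pos (Z1 R) (Set.Finite.image _ (Set.toFinite _)) ?_ ?_
  · have := Z1_card (R := R)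
    omega
  · rintro s ⟨g, ⟨hg, _⟩, rfl⟩
    refine ⟨?_, ?_⟩
    · simp [Ideal.map_top, Ideal.span_singleton_one]
    · show g ^ 3 = cl ⊤
      rw [cl_top, hg]
  · rintro f A B C d ⟨g, ⟨_, hg⟩, e⟩ h0
    have eI : g = cl (Q.I A B) := congrArg Prod.fst e
    have eW : ⊤ = Q.W A B C f := congrArg Prod.snd e
    apply hg
    rw [eI]
    have w := Q.W_eq d.h f d.s1 d.s2
    have hA1 : A = f 1 ^ 2 := by
      have := d.hA
      rw [hA, h0] at this; linarith
    have hf1 : f 1 ≠ 0 := by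
      intro h; have := d.A0; rw [hA1, h] at this; simp at this
    have hf1' := Q.int_ne hf1
    have he : Q.e0 A B f = (f 1 : R) ^ 3 := by rw [e0, h0, hA1]; push_cast; ring
    rw [← eW, Ideal.mul_top, he, hA1] at w
    have w2 : Q.I A B ^ 3 = Ideal.span {(f 1 : R)} ^ 3 := by
      apply cancel_span (pow_ne_zero 3 hf1')
      rw [hA1, w, Ideal.span_singleton_pow, Ideal.span_singleton_mul_span_singleton]
      congr 2; push_cast; ring
    have w3 : Q.I A B = Ideal.span {(f 1 : R)} := by
      apply dvd_antisymm
      · exact (UniqueFactorizationMonoid.pow_dvd_pow_iff_dvd three_ne_zero).1 w2.dvd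
      · exact (UniqueFactorizationMonoid.pow_dvd_pow_iff_dvd three_ne_zero).1 w2.symm.dvd
    rw [w3, cl_span hf1']

lemma exists_B (Q : QR R D) {p : ℕ} (hp : p.Prime) (hs : sqp p D) : ∃ B C : ℤ, B ^ 2 - 4 * p * C = D ∧ ¬ (p : ℤ) ∣ B := by
  have hnd := hs.not_dvd
  have hg := Q.hgood 2 Nat.prime_two
  rw [good, if_pos rfl] at hg
  have fin : ∀ B C : ℤ, B ^ 2 - 4 * p * C = D → ∃ B C : ℤ, B ^ 2 - 4 * p * C = D ∧ ¬ (p : ℤ) ∣ B := by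
    intro B C h
    refine ⟨B, C, h, fun hd => hnd ?_⟩
    rw [← h]
    exact dvd_sub (dvd_pow hd two_ne_zero) (by rw [mul_comm 4, mul_assoc]; exact Dvd.intro _ rfl)
  by_cases h2 : p = 2
  · subst h2
    rw [sqp, if_pos rfl] at hs
    exact fin 1 ((1 - D) / 8) (by push_cast; omega)
  · rw [sqp, if_neg h2] at hs
    obtain ⟨_, r, hr⟩ := hs
    have hodd : (p : ℤ) % 2 = 1 := by
      have := hp.eq_two_or_odd; omega
    obtain ⟨B, hB2, hBp⟩ : ∃ B : ℤ, B % 2 = D % 2 ∧ (p : ℤ) ∣ B ^ 2 - D := by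
      by_cases hpar : r % 2 = D % 2
      · exact ⟨r, hpar, by rw [← neg_sub]; exact hr.neg_right⟩
      · refine ⟨r + p, by omega, ?_⟩
        have : (r + p) ^ 2 - D = p * (2 * r + p) - (D - r ^ 2) := by ring
        rw [this]; exact dvd_sub (Dvd.intro _ rfl) hr
    have h4 : (4 : ℤ) ∣ B ^ 2 - D := by
      have : B % 4 = 0 ∨ B % 4 = 1 ∨ B % 4 = 2 ∨ B % 4 = 3 := by omega
      have : B ^ 2 % 4 = D % 4 := by
        rcases this with h | h | h | h <;> simp [pow_two, Int.mul_emod, h] <;> omega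
      omega
    have hcop : IsCoprime (4 : ℤ) (p : ℤ) := by
      have : Nat.Coprime 4 p := by
        have : Nat.Coprime (2 ^ 2) p := Nat.Coprime.pow_left 2 ((Nat.coprime_primes Nat.prime_two hp).2 (Ne.symm h2))
        exact this
      exact_mod_cast Nat.isCoprime_iff_coprime.2 this
    obtain ⟨C, hC⟩ := hcop.mul_dvd h4 hBp
    exact fin B C (by linarith)

/-- a prime of norm `p` -/
lemma w_facts (Q : QR R D) {p : ℕ} (hp : p.Prime) {B C : ℤ} (h : B ^ 2 - 4 * p * C = D) (hB : ¬ (p : ℤ) ∣ B) :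
    (Q.I p B).IsPrime ∧ ((Q.I p B).map Q.σ).IsPrime ∧ Q.I p B ≠ (Q.I p B).map Q.σ ∧
    (∀ m : ℤ, (m : R) ∈ Q.I p B ↔ (p : ℤ) ∣ m) ∧ (∀ m : ℤ, (m : R) ∈ (Q.I p B).map Q.σ ↔ (p : ℤ) ∣ m) := by
  have hp' : Prime (p : ℤ) := Nat.prime_iff_prime_int.1 hp
  have hpI : ((p : ℤ) : R) ∈ Q.I p B := Ideal.subset_span (by simp)
  have hθI : Q.th B ∈ Q.I p B := Ideal.subset_span (by simp)
  have hmem : ∀ m : ℤ, (m : R) ∈ Q.I p B ↔ (p : ℤ) ∣ m := by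
    intro m
    constructor
    · intro hm
      obtain ⟨X, Y, e⟩ := (Q.mem_I h _).1 hm
      obtain ⟨e1, e2⟩ := Q.th_inj h (m := m) (n := 0) (m' := X * p) (n' := Y) (by rw [e]; push_cast; ring)
      exact ⟨X, by rw [e1]; ring⟩
    · rintro ⟨k, rfl⟩
      push_cast
      exact Ideal.mul_mem_right _ _ (by simpa using hpI)
  have hpr : (Q.I p B).IsPrime := by
    refine ⟨?_, ?_⟩
    · intro ht
      have : ((1 : ℤ) : R) ∈ Q.I p B := by rw [ht]; trivial
      exact hp'.not_dvd_one ((hmem 1).1 this)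
    · intro x y hxy
      obtain ⟨m, n, rfl⟩ := Q.th_rep h x
      obtain ⟨m', n', rfl⟩ := Q.th_rep h y
      have : ((m * m' : ℤ) : R) ∈ Q.I p B := by
        have := (Q.I p B).sub_mem hxy ((Q.I p B).mul_mem_left (n * m' + m * n' + n * n' * Q.th B : R) hθI)
        convert this using 1; push_cast; ring
      rcases hp'.dvd_or_dvd ((hmem _).1 this) with hd | hd
      · left; exact Ideal.add_mem _ ((hmem m).2 hd) (Ideal.mul_mem_left _ _ hθI)
      · right; exact Ideal.add_mem _ ((hmem m').2 hd) (Ideal.mul_mem_left _ _ hθI)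
  have hσ : ∀ x, Q.σ x ∈ (Q.I p B).map Q.σ ↔ x ∈ Q.I p B := by
    intro x
    constructor
    · intro hx
      obtain ⟨y, hy, e⟩ := (Ideal.mem_map_iff_of_surjective _ Q.σ.surjective).1 hx
      rwa [← Q.σ.injective e]
    · exact Ideal.mem_map_of_mem _
  refine ⟨hpr, Ideal.map_isPrime_of_equiv Q.σ, ?_, hmem, ?_⟩
  · intro e
    have h1 : (B - Q.th B : R) ∈ Q.I p B := by
      rw [e, ← Q.σ_th h, hσ]; exact hθI
    have := (Q.I p B).add_mem h1 hθI
    rw [sub_add_cancel] at this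
    exact hB ((hmem B).1 this)
  · intro m
    rw [← hmem m, ← hσ m, map_intCast]

lemma prime_max {P J : Ideal R} (hP : P.IsPrime) (h0 : P ≠ ⊥) (hJ : J.IsPrime) (h : P ≤ J) : P = J :=
  (hP.isMaximal h0).eq_of_le hJ.ne_top h

lemma map_σσ (Q : QR R D) (J : Ideal R) : (J.map Q.σ).map Q.σ = J := by
  apply le_antisymm
  · rw [Ideal.map_le_iff_le_comap, Ideal.map_le_iff_le_comap]
    intro x hx
    rw [Ideal.mem_comap, Ideal.mem_comap, Q.σσ]; exact hx
  · intro x hx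
    rw [← Q.σσ x]
    exact Ideal.mem_map_of_mem _ (Ideal.mem_map_of_mem _ hx)

/-- the two primes above `p`, and the ideals of norm `p` -/
lemma Zp_eq (Q : QR R D) {p : ℕ} (hp : p.Prime) {B C : ℤ} (h : B ^ 2 - 4 * p * C = D) (hB : ¬ (p : ℤ) ∣ B) (W : Ideal R) :
    W * W.map Q.σ = Ideal.span {((p : ℤ) : R)} ↔ W = Q.I p B ∨ W = (Q.I p B).map Q.σ := by
  obtain ⟨p1, p2, hne, m1, m2⟩ := Q.w_facts hp h hB
  have hc := Q.I_conj h
  set w1 := Q.I p B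
  set w2 := w1.map Q.σ
  have hw1 : w1 ≠ ⊥ := Q.I_ne B (by exact_mod_cast hp.ne_zero)
  have hσσ : w2.map Q.σ = w1 := by
    exact Q.map_σσ w1
  have hw2 : w2 ≠ ⊥ := by
    intro h0; rw [h0, Ideal.mul_bot] at hc
    exact span_ne (Q.int_ne (by exact_mod_cast hp.ne_zero : ((p : ℕ) : ℤ) ≠ 0)) hc.symm
  constructor
  · intro hW
    have hWt : W ≠ ⊤ := by
      rintro rfl
      rw [Ideal.map_top, Ideal.mul_top] at hW
      have : ((1 : ℤ) : R) ∈ w1 := by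
        have : (⊤ : Ideal R) ≤ w1 := by rw [hW, ← hc]; exact Ideal.mul_le_left
        exact this trivial
      have := (m1 1).1 this
      exact (Nat.prime_iff_prime_int.1 hp).not_dvd_one this
    obtain ⟨M, hM, hWM⟩ := Ideal.exists_le_maximal W hWt
    have hWM1 : w1 * w2 ≤ M := by rw [hc, ← hW]; exact Ideal.mul_le_left.trans hWM
    -- one of the wi equals M, so it divides W
    have key : ∀ v : Ideal R, v.IsPrime → v ≠ ⊥ → v * v.map Q.σ = Ideal.span {((p : ℤ) : R)} → (v.map Q.σ).IsPrime → v ≤ M → W = v := by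
      intro v hv hv0 hvc hvp hvM
      have := prime_max hv hv0 hM.isPrime hvM
      rw [← this] at hWM
      obtain ⟨U, hU⟩ := Ideal.dvd_iff_le.2 hWM
      have e : v * (U * W.map Q.σ) = v * v.map Q.σ := by rw [← mul_assoc, ← hU, hW, hvc]
      have e2 := mul_left_cancel₀ hv0 e
      have hmapW : W.map Q.σ = v.map Q.σ * U.map Q.σ := by rw [hU, Ideal.map_mul]
      rw [hmapW, mul_left_comm] at e2
      have hv' : v.map Q.σ ≠ ⊥ := by
        intro h0; rw [h0, Ideal.mul_bot] at hvc
        exact span_ne (Q.int_ne (by exact_mod_cast hp.ne_zero : ((p : ℕ) : ℤ) ≠ 0)) hvc.symm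
      have e3 : U * U.map Q.σ = ⊤ := by
        apply mul_left_cancel₀ hv'; rw [e2, Ideal.mul_top]
      have hUt : U = ⊤ := top_le_iff.1 (e3 ▸ Ideal.mul_le_left)
      rw [hU, hUt, Ideal.mul_top]
    rcases (hM.isPrime.mul_le).1 hWM1 with h1 | h1
    · left; exact key w1 p1 hw1 hc p2 h1
    · right; exact key w2 p2 hw2 (by rw [hσσ, mul_comm]; exact hc) (by rw [hσσ]; exact p1) h1
  · rintro (rfl | rfl)
    · exact hc
    · rw [hσσ, mul_comm]; exact hc

lemma cl_conj (Q : QR R D) {p : ℕ} (hp : p.Prime) {B C : ℤ} (h : B ^ 2 - 4 * p * C = D) : cl ((Q.I p B).map Q.σ) = (cl (Q.I p B))⁻¹ := by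
  have hp0 : ((p : ℕ) : ℤ) ≠ 0 := by exact_mod_cast hp.ne_zero
  have hc := Q.I_conj h
  have hw2 : (Q.I p B).map Q.σ ≠ ⊥ := by
    intro h0; rw [h0, Ideal.mul_bot] at hc
    exact span_ne (Q.int_ne hp0) hc.symm
  have := congrArg cl hc
  rw [cl_mul (Q.I_ne B hp0) hw2, cl_span (Q.int_ne hp0)] at this
  exact (inv_eq_of_mul_eq_one_right this).symm

lemma Zp_card [Finite (ClassGroup R)] (Q : QR R D) {p : ℕ} (hp : p.Prime) {B C : ℤ} (h : B ^ 2 - 4 * p * C = D) (hB : ¬ (p : ℤ) ∣ B) :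
    (Q.Zs p).Finite ∧ (Q.Zs p).ncard = 2 * rt (cl (Q.I p B)) := by
  obtain ⟨p1, p2, hne, m1, m2⟩ := Q.w_facts hp h hB
  have e : Q.Zs p = (fun g => (g, Q.I p B)) '' {g : ClassGroup R | g ^ 3 = cl (Q.I p B)} ∪
      (fun g => (g, (Q.I p B).map Q.σ)) '' {g : ClassGroup R | g ^ 3 = cl ((Q.I p B).map Q.σ)} := by
    ext ⟨g, W⟩
    constructor
    · rintro ⟨h1, h2⟩
      rcases (Q.Zp_eq hp h hB W).1 h1 with rfl | rfl
      · left; exact ⟨g, h2, rfl⟩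
      · right; exact ⟨g, h2, rfl⟩
    · rintro (⟨g', h2, e⟩ | ⟨g', h2, e⟩)
      · obtain ⟨rfl, rfl⟩ := Prod.mk.inj e
        exact ⟨(Q.Zp_eq hp h hB _).2 (Or.inl rfl), h2⟩
      · obtain ⟨rfl, rfl⟩ := Prod.mk.inj e
        exact ⟨(Q.Zp_eq hp h hB _).2 (Or.inr rfl), h2⟩
  have f1 := (Set.toFinite {g : ClassGroup R | g ^ 3 = cl (Q.I p B)}).image (fun g => (g, Q.I p B))
  have f2 := (Set.toFinite {g : ClassGroup R | g ^ 3 = cl ((Q.I p B).map Q.σ)}).image (fun g => (g, (Q.I p B).map Q.σ))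
  rw [e]
  refine ⟨f1.union f2, ?_⟩
  rw [Set.ncard_union_eq _ f1 f2, Set.ncard_image_of_injective _ (fun a b h => congrArg Prod.fst h), Set.ncard_image_of_injective _ (fun a b h => congrArg Prod.fst h)]
  · have : rt (cl ((Q.I p B).map Q.σ)) = rt (cl (Q.I p B)) := by rw [Q.cl_conj hp h, rt_inv]
    unfold rt at this ⊢
    omega
  · rw [Set.disjoint_left]
    rintro s ⟨g, _, rfl⟩ ⟨g', _, e'⟩
    exact hne (congrArg Prod.snd e').symm

lemma countp [Finite (ClassGroup R)] (Q : QR R D) {p : ℕ} (hp : p.Prime) {B C : ℤ} (h : B ^ 2 - 4 * p * C = D) (hB : ¬ (p : ℤ) ∣ B) :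
    (D < -4 → {f : V ℤ | redO f ∧ f ∈ FF D p}.ncard ≤ 4 * rt (cl (Q.I p B))) ∧
    4 * rt (cl (Q.I p B)) ≤ {f : V ℤ | redC f ∧ f ∈ FF D p}.ncard := by
  have hp0 : (0 : ℤ) < p := by exact_mod_cast hp.pos
  have hp' : Prime (p : ℤ) := Nat.prime_iff_prime_int.1 hp
  obtain ⟨hfin, hcard⟩ := Q.Zp_card hp h hB
  have hpD : ¬ (p : ℤ) ∣ D := by
    intro hd
    apply hB
    have : (p : ℤ) ∣ B ^ 2 := by
      have e : B ^ 2 = D + p * (4 * C) := by linarith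
      rw [e]; exact dvd_add hd (Dvd.intro _ rfl)
    exact hp'.dvd_of_dvd_pow this
  constructor
  · intro hD4
    have := Q.count_lo hD4 hp0 (Q.Zs p) hfin ?_
    · rw [hcard] at this; omega
    intro f h1 h2
    exact (Q.dat hp0 h1.1 h2.2.1.1 h2.2.1.2.1 h2.2.1.2.2 h2.2.2).mem Q hp0
  · have := Q.count_hi hp0 (Q.Zs p) hfin le_rfl ?_
    · rw [hcard] at this; omega
    intro f A B C d _ h0
    have a1 := d.hA
    have a2 := d.hB
    have a3 := d.hC
    rw [hA, h0] at a1
    rw [PTM.hB, h0] at a2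
    rw [hC] at a3
    have d1 : (p : ℤ) ∣ f 1 := hp'.dvd_of_dvd_pow (n := 2) ⟨A, by linarith⟩
    obtain ⟨u, hu⟩ := d1
    have d2 : (p : ℤ) ∣ f 2 := hp'.dvd_of_dvd_pow (n := 2) ⟨C + u * f 3, by rw [hu] at a3; linarith⟩
    obtain ⟨v, hv⟩ := d2
    rw [hu] at a1
    rw [hu, hv] at a2 a3
    have q1 : A = p * u ^ 2 := mul_left_cancel₀ hp0.ne' (by linear_combination -a1)
    have q2 : B = p * (u * v) := mul_left_cancel₀ hp0.ne' (by linear_combination -a2)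
    apply hpD
    rw [← d.h, q1, q2]
    exact ⟨p * (u * v) ^ 2 - 4 * u ^ 2 * C, by ring⟩

/-- generic version of `pointedSurCount` -/
noncomputable def psc (R : Type*) [CommRing R] [IsDomain R] (v : ℕ) (a : ZMod 3) : ℝ :=
  (Nat.card {x : (Ideal R)⁰ × (Ideal R)⁰ × (ClassGroup R →* Multiplicative (ZMod 3)) //
      (x.1 : Ideal R).IsPrime ∧ (x.2.1 : Ideal R).IsPrime ∧
      (x.1 : Ideal R) ≠ (x.2.1 : Ideal _) ∧
      Ideal.comap (algebraMap ℤ R) x.1 = Ideal.span {(v : ℤ)} ∧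
      Ideal.comap (algebraMap ℤ R) x.2.1 = Ideal.span {(v : ℤ)} ∧
      Function.Surjective x.2.2 ∧
      x.2.2 (idealClass _ x.1 * (idealClass _ x.2.1)⁻¹) = Multiplicative.ofAdd a} : ℝ) / 2

end QR
end PTM


/-! ### The pointed count -/
namespace PTM
open Set Filter

namespace QR
variable {R : Type*} [CommRing R] [IsDomain R] [IsDedekindDomain R] {D : ℤ}

lemma idealClass_eq (J : (Ideal R)⁰) : idealClass R J = cl (J : Ideal R) := by
  have h : IsDedekindDomain R := inferInstance
  rw [idealClass, dif_pos h, cl_mk0]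

lemma psc_eq [Finite (ClassGroup R)] (Q : QR R D) {p : ℕ} (hp : p.Prime) {B C : ℤ} (h : B ^ 2 - 4 * p * C = D) (hB : ¬ (p : ℤ) ∣ B) (a : ZMod 3) :
    3 * psc R p a = if a = 0 then (rt (1 : ClassGroup R) + 2 * rt (cl (Q.I p B)) - 3 : ℝ) else rt (1 : ClassGroup R) - rt (cl (Q.I p B)) := by
  obtain ⟨p1, p2, hne, m1, m2⟩ := Q.w_facts hp h hB
  have hc := Q.I_conj h
  have hcl := Q.cl_conj hp h
  have hp0 : ((p : ℕ) : ℤ) ≠ 0 := by exact_mod_cast hp.ne_zero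
  have hw1 : Q.I p B ≠ ⊥ := Q.I_ne B hp0
  have hw2 : (Q.I p B).map Q.σ ≠ ⊥ := by
    intro h0; rw [h0, Ideal.mul_bot] at hc
    exact span_ne (Q.int_ne hp0) hc.symm
  set w1 := Q.I p B
  set w2 := w1.map Q.σ
  have comap_eq : ∀ v : Ideal R, (∀ m : ℤ, (m : R) ∈ v ↔ (p : ℤ) ∣ m) → Ideal.comap (algebraMap ℤ R) v = Ideal.span {(p : ℤ)} := by
    intro v hv
    ext m
    rw [Ideal.mem_comap, Ideal.mem_span_singleton, ← hv m]
    simp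
  have above : ∀ v : Ideal R, v.IsPrime → Ideal.comap (algebraMap ℤ R) v = Ideal.span {(p : ℤ)} → v = w1 ∨ v = w2 := by
    intro v hv he
    have hpv : ((p : ℤ) : R) ∈ v := by
      have : (p : ℤ) ∈ Ideal.comap (algebraMap ℤ R) v := by rw [he]; exact Ideal.mem_span_singleton_self _
      rw [Ideal.mem_comap] at this
      simpa using this
    have : w1 * w2 ≤ v := by rw [hc, Ideal.span_singleton_le_iff_mem]; exact hpv
    rcases hv.mul_le.1 this with h1 | h1
    · left; exact (prime_max p1 hw1 hv h1).symm
    · right; exact (prime_max p2 hw2 hv h1).symm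
  set u := cl w1
  let S : ClassGroup R → Set (ClassGroup R →* Multiplicative (ZMod 3)) := fun g =>
    {φ | Function.Surjective φ ∧ φ g = Multiplicative.ofAdd a}
  let W1 : (Ideal R)⁰ := ⟨w1, mem_nonZeroDivisors_of_ne_zero hw1⟩
  let W2 : (Ideal R)⁰ := ⟨w2, mem_nonZeroDivisors_of_ne_zero hw2⟩
  have cube : ∀ (φ : ClassGroup R →* Multiplicative (ZMod 3)) (g : ClassGroup R), φ (g * g) = φ g⁻¹ := by
    intro φ g
    have : φ (g ^ 3) = 1 := mul3_trivial φ _ ⟨g, rfl⟩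
    have e : g * g = g ^ 3 * g⁻¹ := eq_mul_inv_of_mul_eq (by rw [pow_three, mul_assoc])
    rw [e, map_mul, this, one_mul]
  have e1 : idealClass R W1 * (idealClass R W2)⁻¹ = u * u := by
    rw [idealClass_eq, idealClass_eq]
    show cl w1 * (cl w2)⁻¹ = _
    rw [hcl, inv_inv]
  have e2 : idealClass R W2 * (idealClass R W1)⁻¹ = u⁻¹ * u⁻¹ := by
    rw [idealClass_eq, idealClass_eq]
    show cl w2 * (cl w1)⁻¹ = _
    rw [hcl]
  have hset : {x : (Ideal R)⁰ × (Ideal R)⁰ × (ClassGroup R →* Multiplicative (ZMod 3)) |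
      (x.1 : Ideal R).IsPrime ∧ (x.2.1 : Ideal R).IsPrime ∧
      (x.1 : Ideal R) ≠ (x.2.1 : Ideal _) ∧
      Ideal.comap (algebraMap ℤ R) x.1 = Ideal.span {(p : ℤ)} ∧
      Ideal.comap (algebraMap ℤ R) x.2.1 = Ideal.span {(p : ℤ)} ∧
      Function.Surjective x.2.2 ∧
      x.2.2 (idealClass _ x.1 * (idealClass _ x.2.1)⁻¹) = Multiplicative.ofAdd a} =
      (fun φ => (W1, W2, φ)) '' S u⁻¹ ∪ (fun φ => (W2, W1, φ)) '' S u := by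
    ext ⟨v1, v2, φ⟩
    constructor
    · rintro ⟨q1, q2, q3, q4, q5, q6, q7⟩
      simp only at q1 q2 q3 q4 q5 q6 q7
      rcases above _ q1 q4 with r1 | r1 <;> rcases above _ q2 q5 with r2 | r2
      · exact absurd (r1.trans r2.symm) q3
      · left
        obtain rfl : v1 = W1 := Subtype.ext r1
        obtain rfl : v2 = W2 := Subtype.ext r2
        refine ⟨φ, ⟨q6, ?_⟩, rfl⟩
        rw [e1, cube] at q7; exact q7
      · right
        obtain rfl : v1 = W2 := Subtype.ext r1
        obtain rfl : v2 = W1 := Subtype.ext r2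
        refine ⟨φ, ⟨q6, ?_⟩, rfl⟩
        rw [e2, cube, inv_inv] at q7; exact q7
      · exact absurd (r1.trans r2.symm) q3
    · rintro (⟨ψ, ⟨q6, q7⟩, e⟩ | ⟨ψ, ⟨q6, q7⟩, e⟩)
      · rw [← e]
        refine ⟨p1, p2, hne, comap_eq _ m1, comap_eq _ m2, q6, ?_⟩
        simp only
        rw [e1, cube]; exact q7
      · rw [← e]
        refine ⟨p2, p1, hne.symm, comap_eq _ m2, comap_eq _ m1, q6, ?_⟩
        simp only
        rw [e2, cube, inv_inv]; exact q7
  have inj1 : ∀ x y : (Ideal R)⁰, Function.Injective (fun φ : ClassGroup R →* Multiplicative (ZMod 3) => (x, y, φ)) :=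
    fun x y a b h => congrArg (fun t => t.2.2) h
  have hcard : ∀ T, {x : (Ideal R)⁰ × (Ideal R)⁰ × (ClassGroup R →* Multiplicative (ZMod 3)) |
      (x.1 : Ideal R).IsPrime ∧ (x.2.1 : Ideal R).IsPrime ∧
      (x.1 : Ideal R) ≠ (x.2.1 : Ideal _) ∧
      Ideal.comap (algebraMap ℤ R) x.1 = Ideal.span {(p : ℤ)} ∧
      Ideal.comap (algebraMap ℤ R) x.2.1 = Ideal.span {(p : ℤ)} ∧
      Function.Surjective x.2.2 ∧
      x.2.2 (idealClass _ x.1 * (idealClass _ x.2.1)⁻¹) = Multiplicative.ofAdd a} = T → psc R p a = (T.ncard : ℝ) / 2 := by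
    rintro T rfl
    rfl
  rw [hcard _ hset, Set.ncard_union_eq, Set.ncard_image_of_injective _ (inj1 _ _), Set.ncard_image_of_injective _ (inj1 _ _)]
  · have k1 := nsur_eq u⁻¹ a
    have k2 := nsur_eq u a
    rw [rt_inv] at k1
    have k1' : 3 * ((S u⁻¹).ncard : ℤ) = _ := k1
    have k2' : 3 * ((S u).ncard : ℤ) = _ := k2
    have k3 : (3 * ((S u⁻¹).ncard : ℤ) + 3 * ((S u).ncard : ℤ) : ℤ) = 2 * (if a = 0 then (rt (1 : ClassGroup R) + 2 * rt u - 3 : ℤ) else rt (1 : ClassGroup R) - rt u) := by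
      rw [k1', k2']; ring
    have k4 := congrArg (Int.cast : ℤ → ℝ) k3
    push_cast at k4
    push_cast
    linarith
  · rw [Set.disjoint_left]
    rintro s ⟨g, _, rfl⟩ ⟨g', _, e'⟩
    exact hne (congrArg (fun t => (t.1 : Ideal R)) e').symm

end QR
end PTM


/-! ### Averages over discriminants -/
namespace PTM
open Set Filter

lemma ncard_cover {α : Type*} (P : Set α) (hP : P.Finite) (T : Finset ℤ) (Z : ℤ → Set α)
    (hZ : ∀ D ∈ T, (Z D).Finite)
    (hcov : ∀ f ∈ P, ∃ D ∈ T, f ∈ Z D) : (P.ncard : ℝ) ≤ ∑ D ∈ T, ((Z D).ncard : ℝ) := by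
  have h1 : P ⊆ ⋃ D ∈ T, Z D := by
    intro f hf
    obtain ⟨D, h, h'⟩ := hcov f hf
    exact Set.mem_biUnion h h'
  have hfin : (⋃ D ∈ T, Z D).Finite := Set.Finite.biUnion T.finite_toSet hZ
  have h2 : P.ncard ≤ ∑ D ∈ T, (Z D).ncard := by
    refine (Set.ncard_le_ncard h1 hfin).trans ?_
    clear h1 hcov hfin hZ
    induction T using Finset.induction_on with
    | empty => simp
    | insert a s ha ih =>
      rw [Finset.set_biUnion_insert, Finset.sum_insert ha]
      exact (Set.ncard_union_le _ _).trans (by omega)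
  exact_mod_cast h2

lemma ncard_cover' {α : Type*} (P : Set α) (hP : P.Finite) (T : Finset ℤ) (Z : ℤ → Set α)
    (hsub : ∀ D ∈ T, Z D ⊆ P) (hdis : ∀ D D' f, f ∈ Z D → f ∈ Z D' → D = D') :
    ∑ D ∈ T, ((Z D).ncard : ℝ) ≤ (P.ncard : ℝ) := by
  have h1 : ∀ T : Finset ℤ, (∀ D ∈ T, Z D ⊆ P) → (∑ D ∈ T, (Z D).ncard) ≤ (⋃ D ∈ T, Z D).ncard := by
    intro T
    induction T using Finset.induction_on with
    | empty => simp
    | insert a s ha ih =>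
      intro hs
      rw [Finset.set_biUnion_insert, Finset.sum_insert ha, Set.ncard_union_eq ?_ (hP.subset (hs a (Finset.mem_insert_self _ _))) (hP.subset (Set.iUnion₂_subset fun D hD => hs D (Finset.mem_insert_of_mem hD)))]
      · have := ih (fun D hD => hs D (Finset.mem_insert_of_mem hD)); omega
      · rw [Set.disjoint_left]
        intro f hf hf'
        simp only [Set.mem_iUnion] at hf'
        obtain ⟨D, hD, hf'⟩ := hf'
        exact ha (hdis _ _ _ hf hf' ▸ hD)
  have h2 : (⋃ D ∈ T, Z D).ncard ≤ P.ncard := Set.ncard_le_ncard (Set.iUnion₂_subset hsub) hP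
  exact_mod_cast (h1 T hsub).trans h2

namespace LocData
variable {p : ℕ} (L : LocData p)

lemma DSfin (X : ℝ) : {D : ℤ | D < 0 ∧ -X < (D : ℝ) ∧ L.ok D}.Finite := by
  refine (Set.finite_Icc ⌊-X⌋ 0).subset ?_
  rintro D ⟨h1, h2, -⟩
  exact ⟨by exact_mod_cast (Int.floor_le (-X)).trans h2.le, h1.le⟩

/-- the admissible discriminants up to `X` -/
noncomputable def DS (X : ℝ) : Finset ℤ := (L.DSfin X).toFinset

lemma mem_DS {X : ℝ} {D : ℤ} : D ∈ L.DS X ↔ D < 0 ∧ -X < (D : ℝ) ∧ L.ok D := by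
  rw [DS, Set.Finite.mem_toFinset]; rfl

lemma lim0 : Tendsto (fun X : ℝ => ((L.DS X).card : ℝ) / X) atTop (nhds L.alpha) := by
  refine L.limD.congr fun X => ?_
  congr 2
  rw [DS, ← Set.ncard_eq_toFinset_card _ (L.DSfin X)]
  refine Set.ncard_congr (fun D _ => D ()) ?_ ?_ ?_
  · rintro D ⟨⟨h1, h2⟩, h3⟩; exact ⟨h1, h2, h3⟩
  · intro D D' _ _ h; funext x; exact h
  · rintro D ⟨h1, h2, h3⟩; exact ⟨fun _ => D, ⟨⟨h1, h2⟩, h3⟩, rfl⟩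

def okc (c : ℤ) (f : V ℤ) : Prop := c ∣ hA f ∧ c ∣ hB f ∧ c ∣ hC f ∧ ∃ D', hD f = c ^ 2 * D' ∧ L.ok D'

lemma FOfib (c : ℤ) (hc : 0 < c) (u : ℤ → ℝ) (hu : ∀ D, D < 0 → L.ok D → -2 ≤ u D)
    (h : ∀ D, D < -4 → L.ok D → ({f | redO f ∧ f ∈ QR.FF D c}.ncard : ℝ) ≤ u D) :
    ∃ E : ℝ, 0 ≤ E ∧ ∀ X, ({f ∈ FO X | L.okc c f}.ncard : ℝ) ≤ ∑ D ∈ L.DS (X / c ^ 2), u D + E := by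
  have hfin : ∀ D, {f | redO f ∧ f ∈ QR.FF D c}.Finite := fun D =>
    (QR.FFfin c D).subset (by rintro f ⟨h1, h2⟩; exact ⟨h1.redC, h2⟩)
  have hc' : (0 : ℝ) < c := by exact_mod_cast hc
  refine ⟨∑ D ∈ Finset.Ico (-4 : ℤ) 0, (({f | redO f ∧ f ∈ QR.FF D c}.ncard : ℝ) + 2), by positivity, fun X => ?_⟩
  have h1 := ncard_cover {f ∈ FO X | L.okc c f} ((FO_finite X).subset (by rintro f ⟨h, -⟩; exact h)) (L.DS (X / c ^ 2))
    (fun D => {f | redO f ∧ f ∈ QR.FF D c}) (fun D _ => hfin D) (by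
      rintro f ⟨⟨r1, r2, r3⟩, r4, r5, r6, D', r7, r8⟩
      refine ⟨D', L.mem_DS.2 ⟨?_, ?_, r8⟩, r1, r2, ⟨r4, r5, r6⟩, r7⟩
      · have := r1.redC.hD_neg
        rw [r7] at this
        exact neg_of_mul_neg_right this (by positivity)
      · rw [r7] at r3
        push_cast at r3
        rw [← neg_div, div_lt_iff₀ (by positivity)]
        linarith)
  refine h1.trans ?_
  have h2 : ∑ D ∈ L.DS (X / c ^ 2), (({f | redO f ∧ f ∈ QR.FF D c}.ncard : ℝ) - u D) ≤
      ∑ D ∈ L.DS (X / c ^ 2), if D ∈ Finset.Ico (-4 : ℤ) 0 then (({f | redO f ∧ f ∈ QR.FF D c}.ncard : ℝ) + 2) else 0 := by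
    refine Finset.sum_le_sum fun D hD => ?_
    obtain ⟨d1, d2, d3⟩ := L.mem_DS.1 hD
    split_ifs with hm
    · have := hu D d1 d3; linarith
    · rw [Finset.mem_Ico] at hm
      have := h D (by omega) d3; linarith
  rw [← Finset.sum_filter, Finset.sum_sub_distrib] at h2
  have h3 : ∑ D ∈ (L.DS (X / c ^ 2)).filter (fun D => D ∈ Finset.Ico (-4 : ℤ) 0), (({f | redO f ∧ f ∈ QR.FF D c}.ncard : ℝ) + 2) ≤
     ∑ D ∈ Finset.Ico (-4 : ℤ) 0, (({f | redO f ∧ f ∈ QR.FF D c}.ncard : ℝ) + 2) := by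
    refine Finset.sum_le_sum_of_subset_of_nonneg ?_ (fun _ _ _ => by positivity)
    intro D hD; exact (Finset.mem_filter.1 hD).2
  linarith

lemma FCfib (c : ℤ) (hc : 0 < c) (u : ℤ → ℝ)
    (h : ∀ D, D < 0 → L.ok D → u D ≤ ({f | redC f ∧ f ∈ QR.FF D c}.ncard : ℝ)) (X : ℝ) (hX : 0 ≤ X) :
    ∑ D ∈ L.DS (X / c ^ 2), u D ≤ ({f ∈ FC X | L.okc c f}.ncard : ℝ) := by
  have hc' : (0 : ℝ) < c := by exact_mod_cast hc
  refine (Finset.sum_le_sum fun D hD => ?_).trans (ncard_cover' {f ∈ FC X | L.okc c f} ((FC_bound X hX).1.subset (by rintro f ⟨h, -⟩; exact h)) (L.DS (X / c ^ 2))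
    (fun D => {f | redC f ∧ f ∈ QR.FF D c}) ?_ ?_)
  · obtain ⟨d1, d2, d3⟩ := L.mem_DS.1 hD
    exact h D d1 d3
  · rintro D hD f ⟨r1, r2, ⟨r4, r5, r6⟩, r7⟩
    obtain ⟨d1, d2, d3⟩ := L.mem_DS.1 hD
    refine ⟨⟨r1, r2, ?_⟩, r4, r5, r6, D, r7, d3⟩
    rw [r7]; push_cast
    rw [← neg_div, div_lt_iff₀ (by positivity)] at d2
    linarith
  · rintro D D' f ⟨-, -, -, r⟩ ⟨-, -, -, r'⟩
    exact mul_left_cancel₀ (pow_ne_zero 2 hc.ne') (r.symm.trans r')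

theorem avg [hp : Fact p.Prime] (t s : ℤ → ℕ)
    (h1 : ∀ D, D < -4 → L.ok D → {f | redO f ∧ f ∈ QR.FF D 1}.ncard + 2 ≤ 2 * t D)
    (h2 : ∀ D, D < 0 → L.ok D → 2 * t D ≤ {f | redC f ∧ f ∈ QR.FF D 1}.ncard + 2)
    (h3 : ∀ D, D < -4 → L.ok D → {f | redO f ∧ f ∈ QR.FF D p}.ncard ≤ 4 * s D)
    (h4 : ∀ D, D < 0 → L.ok D → 4 * s D ≤ {f | redC f ∧ f ∈ QR.FF D p}.ncard) :
    Tendsto (fun X : ℝ => (∑ D ∈ L.DS X, (t D : ℝ)) / X) atTop (nhds (2 * L.alpha)) ∧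
    Tendsto (fun X : ℝ => (∑ D ∈ L.DS X, (s D : ℝ)) / X) atTop (nhds L.alpha) := by
  constructor
  · have okc1 : ∀ f, L.okc 1 f ↔ L.ok (hD f) := by
      intro f
      constructor
      · rintro ⟨-, -, -, D', h, h'⟩; rw [h]; simpa using h'
      · intro h; exact ⟨one_dvd _, one_dvd _, one_dvd _, hD f, by ring, h⟩
    obtain ⟨E, hE, h5⟩ := L.FOfib 1 one_pos (fun D => 2 * (t D : ℝ) - 2) (fun D _ _ => by
      have : (0:ℝ) ≤ t D := by positivity
      linarith) (fun D hD ho => by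
        have := h1 D hD ho
        have : (({f | redO f ∧ f ∈ QR.FF D 1}.ncard + 2 : ℕ) : ℝ) ≤ (2 * t D : ℕ) := by exact_mod_cast this
        push_cast at this; linarith)
    have h6 := L.FCfib 1 one_pos (fun D => 2 * (t D : ℝ) - 2) (fun D hD ho => by
        have := h2 D hD ho
        have : ((2 * t D : ℕ) : ℝ) ≤ ({f | redC f ∧ f ∈ QR.FF D 1}.ncard + 2 : ℕ) := by exact_mod_cast this
        push_cast at this; linarith)
    simp only [okc1, Int.cast_one, one_pow, div_one] at h5 h6
    have h7 := L.lim1 (fun X => ∑ D ∈ L.DS X, (2 * (t D : ℝ) - 2)) E (Eventually.of_forall h5)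
      (by filter_upwards [eventually_ge_atTop 0] with X hX; have := h6 X hX; linarith)
    have h8 := (h7.const_mul (1 / 2)).add L.lim0
    rw [show 1 / 2 * (2 * L.alpha) + L.alpha = 2 * L.alpha by ring] at h8
    refine h8.congr fun X => ?_
    rw [Finset.sum_sub_distrib, ← Finset.mul_sum]
    simp only [Finset.sum_const, nsmul_eq_mul]
    ring
  · have hp0 : (0 : ℤ) < p := by exact_mod_cast hp.1.pos
    obtain ⟨E, hE, h5⟩ := L.FOfib p hp0 (fun D => 4 * (s D : ℝ)) (fun D _ _ => by
      have : (0:ℝ) ≤ s D := by positivity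
      linarith) (fun D hD ho => by exact_mod_cast h3 D hD ho)
    have h6 := L.FCfib p hp0 (fun D => 4 * (s D : ℝ)) (fun D hD ho => by exact_mod_cast h4 D hD ho)
    have h7 := L.limp (fun X => ∑ D ∈ L.DS (X / p ^ 2), (4 * (s D : ℝ))) E (Eventually.of_forall (by simp only [Int.cast_natCast] at h5; exact h5))
      (by filter_upwards [eventually_ge_atTop 0] with X hX
          have := h6 X hX
          simp only [Int.cast_natCast] at this
          refine this.trans (le_add_of_le_of_nonneg le_rfl hE))
    have hpR : (0 : ℝ) < p := by exact_mod_cast hp.1.pos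
    have h8 := (h7.comp (tendsto_id.const_mul_atTop (show (0:ℝ) < (p:ℝ) ^ 2 by positivity))).const_mul ((p:ℝ) ^ 2 / 4)
    rw [show (p:ℝ) ^ 2 / 4 * (4 * L.alpha / p ^ 2) = L.alpha by field_simp] at h8
    refine h8.congr fun X => ?_
    simp only [Function.comp, id]
    rw [mul_div_cancel_left₀ _ (by positivity), ← Finset.mul_sum]
    rcases eq_or_ne X 0 with rfl | hX
    · simp
    · field_simp

/-- the ratio limit -/
theorem ratio [hp : Fact p.Prime] (a : ZMod 3) (Ps : ℤ → ℝ)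
    (R : ∀ D : ℤ, Type) [∀ D, CommRing (R D)] [∀ D, IsDomain (R D)] [∀ D, IsDedekindDomain (R D)] [∀ D, Finite (ClassGroup (R D))]
    (Q : ∀ D, D < 0 → L.ok D → Nonempty (QR (R D) D)) (hPs : ∀ D, D < 0 → L.ok D → Ps D = QR.psc (R D) p a) :
    Tendsto (fun X : ℝ => (∑ D ∈ L.DS X, Ps D) / ((L.DS X).card : ℝ)) atTop (nhds (1 / 3)) := by
  have key : ∀ D, ∃ t s : ℕ, (D < 0 → L.ok D → (D < -4 → {f | redO f ∧ f ∈ QR.FF D 1}.ncard + 2 ≤ 2 * t) ∧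
      2 * t ≤ {f | redC f ∧ f ∈ QR.FF D 1}.ncard + 2 ∧ (D < -4 → {f | redO f ∧ f ∈ QR.FF D p}.ncard ≤ 4 * s) ∧
      4 * s ≤ {f | redC f ∧ f ∈ QR.FF D p}.ncard ∧ 3 * Ps D = if a = 0 then (t + 2 * s - 3 : ℝ) else t - s) := by
    intro D
    by_cases h : D < 0 ∧ L.ok D
    · obtain ⟨q⟩ := Q D h.1 h.2
      obtain ⟨B, C, hBC, hB⟩ := q.exists_B hp.1 ((L.hp D).1 (h.2 p hp.1))
      have hc := q.countp hp.1 hBC hB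
      refine ⟨rt (1 : ClassGroup (R D)), rt (cl (q.I p B)), fun _ _ => ⟨q.count1_lo, q.count1_hi, hc.1, hc.2, ?_⟩⟩
      rw [hPs D h.1 h.2, q.psc_eq hp.1 hBC hB]
    · exact ⟨0, 0, fun h1 h2 => absurd ⟨h1, h2⟩ h⟩
  choose t s hts using key
  obtain ⟨g1, g2⟩ := L.avg t s (fun D hD ho => (hts D (by omega) ho).1 hD) (fun D hD ho => (hts D hD ho).2.1)
    (fun D hD ho => (hts D (by omega) ho).2.2.1 hD) (fun D hD ho => (hts D hD ho).2.2.2.1)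
  have hα := L.alpha_pos
  have hPs' : Tendsto (fun X : ℝ => (∑ D ∈ L.DS X, Ps D) / X) atTop (nhds (L.alpha / 3)) := by
    have e : ∀ X, ∑ D ∈ L.DS X, Ps D = ∑ D ∈ L.DS X, (if a = 0 then (t D + 2 * s D - 3 : ℝ) else t D - s D) / 3 := by
      intro X
      refine Finset.sum_congr rfl fun D hD => ?_
      obtain ⟨d1, d2, d3⟩ := L.mem_DS.1 hD
      rw [← (hts D d1 d3).2.2.2.2]; ring
    simp only [e]
    by_cases ha : a = 0
    · simp only [if_pos ha]
      have := ((g1.add (g2.const_mul 2)).sub (L.lim0.const_mul 3)).div_const 3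
      rw [show (2 * L.alpha + 2 * L.alpha - 3 * L.alpha) / 3 = L.alpha / 3 by ring] at this
      refine this.congr fun X => ?_
      rw [← Finset.sum_div, Finset.sum_sub_distrib, Finset.sum_add_distrib, ← Finset.mul_sum]
      simp only [Finset.sum_const, nsmul_eq_mul]
      ring
    · simp only [if_neg ha]
      have := (g1.sub g2).div_const 3
      rw [show (2 * L.alpha - L.alpha) / 3 = L.alpha / 3 by ring] at this
      refine this.congr fun X => ?_
      rw [← Finset.sum_div, Finset.sum_sub_distrib]
      ring
  have := hPs'.div L.lim0 hα.ne'
  rw [show L.alpha / 3 / L.alpha = 1 / 3 by field_simp] at this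
  refine this.congr' ?_
  filter_upwards [eventually_gt_atTop 0] with X hX
  simp only [Pi.div_apply]
  rw [div_div_div_cancel_right₀ hX.ne']

end LocData
end PTM


/-! ### Imaginary quadratic fields and discriminants -/
namespace PTM
open Set Filter

lemma good_of_sqf {m : ℤ} (hm : Squarefree m) :
    ∃ D : ℤ, (∀ q : ℕ, q.Prime → good q D) ∧ (D = m ∨ D = 4 * m) := by
  have hq : ∀ q : ℕ, q.Prime → ¬ (q : ℤ) ^ 2 ∣ m := by
    intro q hq h
    rw [pow_two] at h
    have h1 := Int.isUnit_iff.1 (hm _ h)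
    have h2 := hq.one_lt
    omega
  have h2 := hq 2 Nat.prime_two
  push_cast at h2
  by_cases h4 : m % 4 = 1
  · refine ⟨m, fun q hq' => ?_, Or.inl rfl⟩
    unfold good
    split_ifs with h
    · exact Or.inl h4
    · exact hq q hq'
  · refine ⟨4 * m, fun q hq' => ?_, Or.inr rfl⟩
    unfold good
    split_ifs with h
    · omega
    · intro hd
      refine hq q hq' (IsCoprime.dvd_of_dvd_mul_left ?_ hd)
      have : Nat.Coprime (q ^ 2) 4 := Nat.Coprime.pow_left 2 ((Nat.coprime_primes hq' Nat.prime_two).2 h |>.pow_right 2 : Nat.Coprime q (2 ^ 2))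
      have := Nat.isCoprime_iff_coprime.2 this
      exact_mod_cast this

/-- every nonzero integer is a fundamental one times a square, up to a factor 4 -/
lemma fund {z : ℤ} (hz : z ≠ 0) :
    ∃ D k : ℤ, k ≠ 0 ∧ (∀ q : ℕ, q.Prime → good q D) ∧ 4 * z = D * k ^ 2 := by
  obtain ⟨a, b, hab, ha⟩ := Nat.sq_mul_squarefree z.natAbs
  have hb : b ≠ 0 := by
    rintro rfl; simp at hab; exact hz (Int.natAbs_eq_zero.1 hab.symm)
  obtain ⟨m, hm, hmz⟩ : ∃ m : ℤ, Squarefree m ∧ z = b ^ 2 * m := by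
    rcases Int.natAbs_eq z with h | h
    · refine ⟨a, Int.squarefree_natCast.2 ha, ?_⟩
      rw [h, ← hab]; push_cast; ring
    · refine ⟨-a, ?_, ?_⟩
      · rw [← Int.squarefree_natAbs]; simpa using ha
      · rw [h, ← hab]; push_cast; ring
  have hb' : (b : ℤ) ≠ 0 := by exact_mod_cast hb
  obtain ⟨D, hD, h | h⟩ := good_of_sqf hm
  · exact ⟨D, 2 * b, by simpa using hb, hD, by rw [hmz, h]; ring⟩
  · exact ⟨D, b, hb', hD, by rw [hmz, h]; ring⟩

noncomputable def dl (D : ℤ) : ℂ := Complex.I * (Real.sqrt (-(D : ℝ)) : ℝ)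

lemma dl_sq {D : ℤ} (hD : D < 0) : dl D ^ 2 = D := by
  have h : (0:ℝ) ≤ -(D : ℝ) := by have : (D:ℝ) < 0 := by exact_mod_cast hD
                                  linarith
  rw [dl, mul_pow, Complex.I_sq, ← Complex.ofReal_pow, Real.sq_sqrt h]; push_cast; ring

lemma dl_conj (D : ℤ) : (starRingEnd ℂ) (dl D) = - dl D := by
  rw [dl, map_mul, Complex.conj_I, Complex.conj_ofReal]; ring

lemma dl_im {D : ℤ} (hD : D < 0) : (dl D).im ≠ 0 := by
  have : (0:ℝ) < -(D : ℝ) := by have : (D:ℝ) < 0 := by exact_mod_cast hD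
                                linarith
  simp [dl, Real.sqrt_ne_zero'.2 this]

lemma dl_re (D : ℤ) : (dl D).re = 0 := by simp [dl]

/-- the quadratic field of discriminant `D` -/
noncomputable def KD (D : ℤ) : IntermediateField ℚ ℂ := IntermediateField.adjoin ℚ {dl D}

lemma dl_mem (D : ℤ) : dl D ∈ KD D := IntermediateField.mem_adjoin_simple_self ℚ _

lemma dl_int (D : ℤ) : IsIntegral ℤ (dl D) := by
  rcases lt_or_ge D 0 with h | h
  · refine IsIntegral.of_pow two_pos ?_
    rw [dl_sq h]
    exact isIntegral_algebraMap (R := ℤ) (A := ℂ) (x := D)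
  · have : (0:ℝ) ≤ D := by exact_mod_cast h
    have : dl D = 0 := by rw [dl, Real.sqrt_eq_zero_of_nonpos (by linarith)]; simp
    rw [this]; exact isIntegral_zero

instance (D : ℤ) : FiniteDimensional ℚ (KD D) :=
  IntermediateField.adjoin.finiteDimensional ((dl_int D).tower_top)

instance (D : ℤ) : NumberField (KD D) := ⟨⟩

lemma dl_not_rat {D : ℤ} (hD : D < 0) (u : ℚ) : (u : ℂ) ≠ dl D := by
  intro h
  have := congrArg Complex.im h
  simp at this
  exact dl_im hD this.symm

lemma mem_KD {D : ℤ} (hD : D < 0) {x : ℂ} (hx : x ∈ KD D) : ∃ u v : ℚ, x = u + v * dl D := by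
  let A : Subalgebra ℚ ℂ := 
    { carrier := {x | ∃ u v : ℚ, x = u + v * dl D}
      mul_mem' := by
        rintro _ _ ⟨u, v, rfl⟩ ⟨u', v', rfl⟩
        refine ⟨u * u' + D * (v * v'), u * v' + v * u', ?_⟩
        push_cast
        linear_combination (v * v' : ℂ) * dl_sq hD
      add_mem' := by
        rintro _ _ ⟨u, v, rfl⟩ ⟨u', v', rfl⟩
        exact ⟨u + u', v + v', by push_cast; ring⟩
      algebraMap_mem' := fun r => ⟨r, 0, by simp⟩ }
  have h1 : (KD D).toSubalgebra ≤ A := by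
    rw [KD, IntermediateField.adjoin_simple_toSubalgebra_of_isAlgebraic (IsIntegral.isAlgebraic ((dl_int D).tower_top)), Algebra.adjoin_le_iff]
    rintro _ rfl
    exact ⟨0, 1, by simp⟩
  exact h1 hx

lemma finrank_KD {D : ℤ} (hD : D < 0) : Module.finrank ℚ (KD D) = 2 := by
  have hli : LinearIndependent ℚ ![(1 : KD D), ⟨dl D, dl_mem D⟩] := by
    rw [LinearIndependent.pair_iff]
    intro s t h
    have h := congrArg (fun x : KD D => (x : ℂ)) h
    simp only [IntermediateField.coe_add, IntermediateField.coe_smul, IntermediateField.coe_one, IntermediateField.coe_zero, Algebra.smul_def, mul_one] at h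
    have h1 := congrArg Complex.im h
    have h2 := congrArg Complex.re h
    simp [dl_re] at h1 h2
    have := dl_im hD
    exact ⟨h2, by tauto⟩
  have hsp : ⊤ ≤ Submodule.span ℚ (Set.range ![(1 : KD D), ⟨dl D, dl_mem D⟩]) := by
    rintro ⟨x, hx⟩ -
    obtain ⟨u, v, h⟩ := mem_KD hD hx
    have : (⟨x, hx⟩ : KD D) = u • 1 + v • ⟨dl D, dl_mem D⟩ := by
      apply Subtype.ext
      simp only [IntermediateField.coe_add, IntermediateField.coe_smul, IntermediateField.coe_one, Algebra.smul_def, mul_one]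
      exact h
    rw [this]
    refine Submodule.add_mem _ (Submodule.smul_mem _ _ (Submodule.subset_span ⟨0, rfl⟩)) (Submodule.smul_mem _ _ (Submodule.subset_span ⟨1, rfl⟩))
  rw [Module.finrank_eq_card_basis (Module.Basis.mk hli hsp)]; rfl

/-- every imaginary quadratic field is a `KD` -/
lemma exists_KD (K : IntermediateField ℚ ℂ) (h2 : Module.finrank ℚ K = 2) (hz : ∃ z : ℂ, z ∈ K ∧ z.im ≠ 0) :
    ∃ D : ℤ, D < 0 ∧ (∀ q : ℕ, q.Prime → good q D) ∧ K = KD D := by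
  obtain ⟨z, hzK, hzi⟩ := hz
  haveI : FiniteDimensional ℚ K := FiniteDimensional.of_finrank_pos (by omega)
  obtain ⟨y, hyK, hyi, r, hr⟩ : ∃ y ∈ K, y.im ≠ 0 ∧ ∃ r : ℚ, y ^ 2 = r := by
    have hint : IsIntegral ℚ (⟨z, hzK⟩ : K) := IsIntegral.of_finite ℚ _
    have hdeg : (minpoly ℚ (⟨z, hzK⟩ : K)).natDegree ≤ 2 := h2 ▸ minpoly.natDegree_le _
    have hne := minpoly.ne_zero hint
    have hev := minpoly.aeval ℚ (⟨z, hzK⟩ : K)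
    set P := minpoly ℚ (⟨z, hzK⟩ : K)
    rw [Polynomial.aeval_eq_sum_range' (n := 3) (by omega)] at hev
    simp only [Finset.sum_range_succ, Finset.sum_range_zero, zero_add, pow_zero, pow_one] at hev
    have hev : (P.coeff 0 : ℂ) + P.coeff 1 * z + P.coeff 2 * z ^ 2 = 0 := by
      have h3 := congrArg (fun x : K => (x : ℂ)) hev
      simp only [IntermediateField.coe_add, IntermediateField.coe_smul, IntermediateField.coe_zero, IntermediateField.coe_pow, IntermediateField.coe_one] at h3
      simpa only [Algebra.smul_def, eq_ratCast, mul_one] using h3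
    have ha : P.coeff 2 ≠ 0 := by
      intro ha
      rw [ha] at hev
      have i1 := congrArg Complex.im hev
      have i2 := congrArg Complex.re hev
      simp at i1 i2
      have i3 : P.coeff 1 = 0 := by tauto
      rw [i3] at i2
      simp at i2
      apply hne
      ext n
      rcases n with _ | _ | _ | n
      · simpa using i2
      · simpa using i3
      · simpa using ha
      · rw [Polynomial.coeff_eq_zero_of_natDegree_lt (by omega)]; simp
    refine ⟨2 * P.coeff 2 * z + P.coeff 1, ?_, ?_, P.coeff 1 ^ 2 - 4 * P.coeff 2 * P.coeff 0, ?_⟩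
    · refine K.add_mem (K.mul_mem ?_ hzK) ?_
      · have := K.algebraMap_mem (2 * P.coeff 2); simpa using this
      · have := K.algebraMap_mem (P.coeff 1); simpa using this
    · have : (2 * (P.coeff 2 : ℂ) * z + P.coeff 1).im = 2 * P.coeff 2 * z.im := by
        rw [show (2 * (P.coeff 2 : ℂ)) = ((2 * P.coeff 2 : ℚ) : ℝ) by push_cast; rfl]
        simp [Complex.im_ofReal_mul]
      rw [this]
      have : (P.coeff 2 : ℝ) ≠ 0 := by exact_mod_cast ha
      positivity
    · push_cast
      linear_combination 4 * (P.coeff 2 : ℂ) * hev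
  -- normalise
  have hz0 : r.num * r.den ≠ 0 := by
    have : r ≠ 0 := by
      rintro rfl
      have : y = 0 := by simpa using hr
      simp [this] at hyi
    have := Rat.num_ne_zero.2 this
    positivity
  obtain ⟨D, k, hk, hg, hDk⟩ := fund hz0
  have hkC : (k : ℂ) ≠ 0 := by exact_mod_cast hk
  have hdC : (r.den : ℂ) ≠ 0 := by exact_mod_cast r.den_ne_zero
  set w : ℂ := 2 * r.den * y / k with hw
  have hwK : w ∈ K := by
    have h1 : (2 * r.den / k : ℂ) ∈ K := by have := K.algebraMap_mem (2 * r.den / k); simpa using this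
    have := K.mul_mem h1 hyK
    rwa [show (2 * r.den / k : ℂ) * y = w by rw [hw]; ring] at this
  have hw2 : w ^ 2 = D := by
    have e1 : (r : ℂ) * r.den = r.num := by exact_mod_cast Rat.mul_den_eq_num r
    have e2 : (4 * (r.num * r.den) : ℂ) = D * k ^ 2 := by exact_mod_cast hDk
    rw [hw, div_pow, div_eq_iff (pow_ne_zero 2 hkC), ← e2, ← e1, mul_pow, hr]; ring
  have hwi : w.im ≠ 0 := by
    have e : w = ((2 * r.den / k : ℚ) : ℝ) * y := by rw [hw]; push_cast; ring
    rw [e, Complex.im_ofReal_mul]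
    refine mul_ne_zero ?_ hyi
    have : (2 * r.den / k : ℚ) ≠ 0 := div_ne_zero (mul_ne_zero two_ne_zero (by exact_mod_cast r.den_ne_zero)) (by exact_mod_cast hk)
    exact_mod_cast this
  have hD : D < 0 := by
    have i1 := congrArg Complex.im hw2
    have i2 := congrArg Complex.re hw2
    simp [pow_two] at i1 i2
    have i3 : w.re = 0 := by
      have : w.re * w.im = 0 := by linarith
      exact (mul_eq_zero.1 this).resolve_right hwi
    rw [i3] at i2
    have : (0:ℝ) < w.im * w.im := mul_self_pos.2 hwi
    have : (D : ℝ) < 0 := by linarith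
    exact_mod_cast this
  refine ⟨D, hD, hg, ?_⟩
  have hle : KD D ≤ K := by
    rw [KD, IntermediateField.adjoin_simple_le_iff]
    rcases sq_eq_sq_iff_eq_or_eq_neg.1 (hw2.trans (dl_sq hD).symm) with h | h
    · exact h ▸ hwK
    · rw [show dl D = -w by rw [h]; ring]; exact K.neg_mem hwK
  exact (IntermediateField.eq_of_le_of_finrank_eq hle (by rw [h2, finrank_KD hD])).symm

end PTM


/-! ### Rings of integers -/
namespace PTM
open Set Filter

lemma sq_mod4 (a : ℤ) : a ^ 2 % 4 = 0 ∨ a ^ 2 % 4 = 1 := by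
  rcases Int.even_or_odd a with ⟨b, rfl⟩ | ⟨b, rfl⟩
  · left; ring_nf; omega
  · right; ring_nf; omega

lemma int_of_good {D : ℤ} (hg : ∀ q : ℕ, q.Prime → good q D) (a N : ℤ) (v : ℚ) (h : (D : ℚ) * v ^ 2 = a ^ 2 - 4 * N) :
    ∃ b : ℤ, v = b := by
  have hv := Rat.num_div_den v
  have hd0 : (v.den : ℚ) ≠ 0 := by exact_mod_cast v.den_ne_zero
  have key : D * v.num ^ 2 = (a ^ 2 - 4 * N) * (v.den : ℤ) ^ 2 := by
    have e1 : v * v.den = v.num := Rat.mul_den_eq_num v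
    have : (D : ℚ) * (v.num : ℚ) ^ 2 = (a ^ 2 - 4 * N) * (v.den : ℚ) ^ 2 := by rw [← h, ← e1]; ring
    exact_mod_cast this
  have hcop : IsCoprime ((v.den : ℤ)) v.num := by
    rw [Int.isCoprime_iff_nat_coprime]; simpa using v.reduced.symm
  have hdD : (v.den : ℤ) ^ 2 ∣ D := by
    refine IsCoprime.dvd_of_dvd_mul_right (z := v.num ^ 2) hcop.pow ?_
    exact ⟨_, key.trans (mul_comm _ _)⟩
  by_cases h1 : v.den = 1
  · exact ⟨v.num, by rw [← hv, h1]; simp⟩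
  · exfalso
    obtain ⟨q, hq, hqd⟩ := Nat.exists_prime_and_dvd h1
    have hqD : (q : ℤ) ^ 2 ∣ D := (pow_dvd_pow_of_dvd (by exact_mod_cast hqd) 2).trans hdD
    have := hg q hq
    unfold good at this
    split_ifs at this with h2
    · subst h2
      push_cast at hqD
      obtain ⟨m, hm⟩ := hqD
      obtain ⟨e, he⟩ := hqd
      rw [he] at key hcop
      push_cast at key hcop
      have hnodd : v.num % 2 = 1 := by
        have : ¬ (2 : ℤ) ∣ v.num := by
          intro h2
          have := hcop.isUnit_of_dvd' (Dvd.intro _ rfl) h2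
          rw [Int.isUnit_iff] at this; omega
        omega
      have key2 : m * v.num ^ 2 = (a ^ 2 - 4 * N) * (e : ℤ) ^ 2 := by
        rw [hm] at key
        linarith
      have hm4 : m % 4 = 2 ∨ m % 4 = 3 := by omega
      have k1 : v.num ^ 2 % 4 = 1 := by
        rcases sq_mod4 v.num with h | h
        · obtain ⟨c, hc⟩ : ∃ c, v.num = 2 * c + 1 := ⟨v.num / 2, by omega⟩
          rw [hc] at h ⊢; ring_nf at h ⊢; omega
        · exact h
      have k2 : m * v.num ^ 2 % 4 = (a ^ 2 - 4 * N) * (e : ℤ) ^ 2 % 4 := by rw [key2]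
      rw [Int.mul_emod m, Int.mul_emod (a ^ 2 - 4 * N)] at k2
      rw [k1] at k2
      have k3 : (a ^ 2 - 4 * N) % 4 = a ^ 2 % 4 := by omega
      rw [k3] at k2
      rcases sq_mod4 a with h | h <;> rcases sq_mod4 (e : ℤ) with h' | h' <;> rcases hm4 with h'' | h'' <;>
        rw [h, h', h''] at k2 <;> omega
    · exact this hqD

lemma good2 {D : ℤ} (hg : ∀ q : ℕ, q.Prime → good q D) : D % 4 = 0 ∨ D % 4 = 1 := by
  have := hg 2 Nat.prime_two
  unfold good at this
  rw [if_pos rfl] at this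
  omega

lemma rat_int_of_integral {r : ℚ} (h : IsIntegral ℤ (r : ℂ)) : ∃ m : ℤ, r = m := by
  have h' : IsIntegral ℤ r := by
    refine (isIntegral_algHom_iff ((algebraMap ℚ ℂ).toIntAlgHom) (algebraMap ℚ ℂ).injective).1 ?_
    exact h
  obtain ⟨m, hm⟩ := IsIntegrallyClosed.isIntegral_iff.1 h'
  exact ⟨m, by simpa using hm.symm⟩

lemma conj_mem {D : ℤ} (hD : D < 0) {x : ℂ} (hx : x ∈ KD D) : (starRingEnd ℂ) x ∈ KD D := by
  obtain ⟨u, v, rfl⟩ := mem_KD hD hx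
  rw [map_add, map_mul, map_ratCast, map_ratCast, dl_conj]
  have h1 := (KD D).algebraMap_mem u
  have h2 := (KD D).algebraMap_mem v
  simp only [eq_ratCast] at h1 h2
  exact (KD D).add_mem h1 ((KD D).mul_mem h2 ((KD D).neg_mem (dl_mem D)))

noncomputable def cj {D : ℤ} (hD : D < 0) : KD D ≃+* KD D where
  toFun x := ⟨(starRingEnd ℂ) x, conj_mem hD x.2⟩
  invFun x := ⟨(starRingEnd ℂ) x, conj_mem hD x.2⟩
  left_inv x := by apply Subtype.ext; simp
  right_inv x := by apply Subtype.ext; simp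
  map_mul' x y := by apply Subtype.ext; simp
  map_add' x y := by apply Subtype.ext; simp

open NumberField in
noncomputable def iota (D : ℤ) : 𝓞 (KD D) →+* ℂ := (KD D).val.toRingHom.comp (algebraMap (𝓞 (KD D)) (KD D))

lemma OK_ext {D : ℤ} {x y : NumberField.RingOfIntegers (KD D)} (h : iota D x = iota D y) : x = y :=
  NumberField.RingOfIntegers.ext (Subtype.ext h)

open NumberField in
theorem exists_QR {D : ℤ} (hD : D < 0) (hg : ∀ q : ℕ, q.Prime → good q D) : Nonempty (QR (𝓞 (KD D)) D) := by
  have h4 := good2 hg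
  obtain ⟨N, hN⟩ : ∃ N, D ^ 2 - D = 4 * N := by
    rcases h4 with h | h
    · obtain ⟨m, hm⟩ : ∃ m, D = 4 * m := ⟨D / 4, by omega⟩
      exact ⟨4 * m ^ 2 - m, by rw [hm]; ring⟩
    · obtain ⟨m, hm⟩ : ∃ m, D = 4 * m + 1 := ⟨D / 4, by omega⟩
      exact ⟨m * (4 * m + 1), by rw [hm]; ring⟩
  have hNC : (D : ℂ) ^ 2 - D = 4 * N := by exact_mod_cast hN
  have hmem : (D + dl D) / 2 ∈ KD D := by
    refine (KD D).div_mem ((KD D).add_mem ?_ (dl_mem D)) ?_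
    · exact intCast_mem _ D
    · exact ofNat_mem _ 2
  have hint : IsIntegral ℤ (⟨(D + dl D) / 2, hmem⟩ : KD D) := by
    refine ⟨Polynomial.X ^ 2 - Polynomial.C D * Polynomial.X + Polynomial.C N, ?_, ?_⟩
    · monicity!
    · rw [Polynomial.eval₂_add, Polynomial.eval₂_sub, Polynomial.eval₂_mul, Polynomial.eval₂_pow, Polynomial.eval₂_X, Polynomial.eval₂_C, Polynomial.eval₂_C, eq_intCast, eq_intCast]
      apply Subtype.ext
      have e1 : ∀ m : ℤ, ((m : KD D) : ℂ) = m := fun m => by simp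
      simp only [IntermediateField.coe_add, AddSubgroupClass.coe_sub, IntermediateField.coe_mul, IntermediateField.coe_pow, IntermediateField.coe_zero, e1]
      linear_combination (1/4 : ℂ) * dl_sq hD - (1/4 : ℂ) * hNC
  let ω : 𝓞 (KD D) := ⟨⟨(D + dl D) / 2, hmem⟩, hint⟩
  have hωC : iota D ω = (D + dl D) / 2 := rfl
  refine ⟨{ ω := ω, σ := RingOfIntegers.mapRingEquiv (cj hD), hσ := ?_, hω := ?_, span := ?_, indep := ?_, hD := hD, hgood := hg }⟩
  · apply OK_ext
    have : iota D (RingOfIntegers.mapRingEquiv (cj hD) ω) = (starRingEnd ℂ) (iota D ω) := rfl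
    rw [this, map_sub, map_intCast, hωC, map_div₀, map_add, map_intCast, dl_conj, map_ofNat]
    ring
  · apply OK_ext
    simp only [map_sub, map_mul, map_intCast, map_ofNat, map_pow, hωC]
    linear_combination - dl_sq hD
  · intro r
    obtain ⟨u, v, huv⟩ : ∃ u v : ℚ, iota D r = u + v * dl D := mem_KD hD (r : KD D).2
    have hr : IsIntegral ℤ (iota D r) := (RingOfIntegers.isIntegral r).map (iota D).toIntAlgHom
    have hr' : IsIntegral ℤ ((starRingEnd ℂ) (iota D r)) := hr.map ((starRingEnd ℂ).toIntAlgHom)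
    rw [huv] at hr hr'
    have hs := hr.add hr'
    have hm := hr.mul hr'
    obtain ⟨a, ha⟩ := rat_int_of_integral (r := 2 * u) (by
      have e : ((2 * u : ℚ) : ℂ) = u + v * dl D + (starRingEnd ℂ) (u + v * dl D) := by
        simp only [map_add, map_mul, map_ratCast, dl_conj]; push_cast; ring
      rw [e]; exact hs)
    obtain ⟨M, hM⟩ := rat_int_of_integral (r := u ^ 2 - D * v ^ 2) (by
      have e : ((u ^ 2 - D * v ^ 2 : ℚ) : ℂ) = (u + v * dl D) * (starRingEnd ℂ) (u + v * dl D) := by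
        simp only [map_add, map_mul, map_ratCast, dl_conj]; push_cast
        linear_combination (v : ℂ) ^ 2 * dl_sq hD
      rw [e]; exact hm)
    obtain ⟨b, hb⟩ := int_of_good hg a M (2 * v) (by
      rw [← ha, ← hM]; ring)
    have hab : D * b ^ 2 = a ^ 2 - 4 * M := by
      have : (D : ℚ) * b ^ 2 = a ^ 2 - 4 * M := by rw [← ha, ← hM, ← hb]; ring
      exact_mod_cast this
    obtain ⟨m, hm⟩ : ∃ m, a = 2 * m + b * D := by
      have : (a - b * D) % 2 = 0 := by
        have h1 : (a ^ 2 - D * b ^ 2) % 2 = 0 := by omega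
        rcases Int.emod_two_eq_zero_or_one a with h | h <;> rcases Int.emod_two_eq_zero_or_one b with h' | h' <;> rcases Int.emod_two_eq_zero_or_one D with h'' | h'' <;>
          simp [Int.sub_emod, Int.mul_emod, pow_two, h, h', h''] at h1 ⊢
      exact ⟨(a - b * D) / 2, by omega⟩
    refine ⟨m, b, OK_ext ?_⟩
    rw [huv]
    simp only [map_add, map_mul, map_intCast, hωC]
    have ha' : (2 * u : ℂ) = 2 * m + b * D := by
      have : (2 * u : ℚ) = 2 * m + b * D := by rw [ha, hm]; push_cast; ring
      exact_mod_cast this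
    have hb' : (2 * v : ℂ) = b := by exact_mod_cast hb
    linear_combination (1 / 2 : ℂ) * ha' + (dl D / 2) * hb'
  · intro m n h
    have h := congrArg (iota D) h
    simp only [map_add, map_mul, map_intCast, hωC, map_zero] at h
    have i1 := congrArg Complex.im h
    have i2 := congrArg Complex.re h
    simp [dl_re] at i1 i2
    have hn : n = 0 := by
      have := dl_im hD
      tauto
    subst hn
    simpa using i2

end PTM


/-! ### The discriminant -/
namespace PTM
open Set Filter

lemma QR.exists_basis {R : Type*} [CommRing R] {D : ℤ} (Q : QR R D) :
    ∃ b : Module.Basis (Fin 2) ℤ R, Algebra.discr ℤ b = D := by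
  have hli : LinearIndependent ℤ ![(1 : R), Q.ω] := by
    rw [LinearIndependent.pair_iff]
    intro s t h
    exact Q.indep s t (by simpa using h)
  have hsp : ⊤ ≤ Submodule.span ℤ (Set.range ![(1 : R), Q.ω]) := by
    rintro r -
    obtain ⟨m, n, h⟩ := Q.span r
    have : r = m • (1 : R) + n • Q.ω := by rw [h]; simp
    rw [this]
    exact Submodule.add_mem _ (Submodule.smul_mem _ _ (Submodule.subset_span ⟨0, rfl⟩)) (Submodule.smul_mem _ _ (Submodule.subset_span ⟨1, rfl⟩))
  let b := Module.Basis.mk hli hsp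
  have b0 : b 0 = 1 := by simp [b]
  have b1 : b 1 = Q.ω := by simp [b]
  refine ⟨b, ?_⟩
  obtain ⟨m, n, hmn⟩ := Q.span (Q.ω * Q.ω)
  have hmn2 : 4 * m = -(D ^ 2 - D) ∧ n = D := by
    have h := Q.hω
    have := Q.indep (D ^ 2 - D + 4 * m) (4 * n - 4 * D) (by push_cast; linear_combination -h - 4 * hmn)
    constructor <;> [linarith [this.1]; linarith [this.2]]
  have rep : ∀ (u v : ℤ) (i : Fin 2), b.repr (u + v * Q.ω) i = ![u, v] i := by
    intro u v i
    have : (u + v * Q.ω : R) = u • b 0 + v • b 1 := by rw [b0, b1]; simp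
    rw [this, map_add, map_smul, map_smul, b.repr_self, b.repr_self]
    fin_cases i <;> simp
  have tr : ∀ u v : ℤ, Algebra.trace ℤ R (u + v * Q.ω) = 2 * u + D * v := by
    intro u v
    rw [Algebra.trace_eq_matrix_trace b, Matrix.trace_fin_two, Algebra.leftMulMatrix_eq_repr_mul, Algebra.leftMulMatrix_eq_repr_mul, b0, b1]
    have e1 : (u + v * Q.ω : R) * Q.ω = ((v * m : ℤ) : R) + ((u + v * D : ℤ) : R) * Q.ω := by
      have : (n : R) = D := by rw [hmn2.2]
      push_cast; linear_combination (v : R) * hmn + (v : R) * Q.ω * this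
    rw [mul_one, rep, e1, rep]
    simp; ring
  rw [Algebra.discr_def, Matrix.det_fin_two]
  simp only [Algebra.traceMatrix_apply, Algebra.traceForm_apply, b0, b1, mul_one, one_mul]
  have t0 := tr 1 0
  have t1 := tr 0 1
  have t2 := tr m n
  rw [← hmn] at t2
  simp only [Int.cast_one, Int.cast_zero, zero_mul, add_zero, zero_add, one_mul] at t0 t1
  rw [t0, t1, t2, hmn2.2]
  linarith [hmn2.1]

lemma absDisc_KD {D : ℤ} (hD : D < 0) (hg : ∀ q : ℕ, q.Prime → good q D) : absDisc (KD D) = D := by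
  have hfd : FiniteDimensional ℚ (KD D) := inferInstance
  rw [absDisc, dif_pos hfd]
  obtain ⟨Q⟩ := exists_QR hD hg
  obtain ⟨b, hb⟩ := Q.exists_basis
  exact (NumberField.discr_eq_discr _ b).symm.trans hb

end PTM


/-! ### Local algebras -/
namespace PTM
open Set Filter

section
variable {p : ℕ} [hp : Fact p.Prime]

lemma sq_close {x y : ℚ_[p]} (hy : y ≠ 0) (h : ‖x - y‖ < ‖4 * y‖) : ∃ u : ℚ_[p], u ≠ 0 ∧ x = y * u ^ 2 := by
  have hy' : 0 < ‖y‖ := norm_pos_iff.2 hy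
  have h4 : ‖(4 : ℚ_[p])‖ ≤ 1 := by exact_mod_cast Padic.norm_int_le_one (p := p) 4
  have hx : x ≠ 0 := by
    rintro rfl
    rw [zero_sub, norm_neg, norm_mul] at h
    nlinarith
  have hc1 : ‖x / y - 1‖ < ‖(4 : ℚ_[p])‖ := by
    rw [show x / y - 1 = (x - y) / y by field_simp, norm_div, div_lt_iff₀ hy', ← norm_mul]; exact h
  have hc : ‖x / y‖ ≤ 1 := by
    have : x / y = (x / y - 1) + 1 := by ring
    rw [this]
    refine (Padic.nonarchimedean _ _).trans (max_le (hc1.le.trans h4) (by simp))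
  let c : ℤ_[p] := ⟨x / y, hc⟩
  have H := hensels_lemma (p := p) (R := ℤ_[p]) (F := Polynomial.X ^ 2 - Polynomial.C c) (a := 1) (by
    simp only [map_sub, map_pow, Polynomial.aeval_X, Polynomial.aeval_C, one_pow, Polynomial.derivative_sub, Polynomial.derivative_X_pow, Polynomial.derivative_C, sub_zero]
    have e1 : ‖(1 : ℤ_[p]) - c‖ = ‖x / y - 1‖ := by
      rw [norm_sub_rev]; rfl
    simp
    rw [e1, ← norm_pow]
    refine hc1.trans_le (le_of_eq ?_)
    rw [show ((2 : ℤ_[p]) ^ 2) = 4 by norm_num]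
    rfl)
  obtain ⟨z, hz, -⟩ := H
  simp at hz
  have hz2 : (z : ℚ_[p]) ^ 2 = x / y := by
    have : z ^ 2 = c := sub_eq_zero.1 hz
    have := congrArg (fun t : ℤ_[p] => (t : ℚ_[p])) this
    simpa using this
  refine ⟨z, ?_, by rw [hz2]; field_simp⟩
  intro h0
  rw [h0] at hz2
  have : x / y ≠ 0 := div_ne_zero hx hy
  exact this (by rw [← hz2]; simp)

/-- `F` is generated by a square root of `d` -/
def gen (F : Type*) [CommRing F] [Algebra ℚ_[p] F] (d : ℚ_[p]) : Prop :=
  ∃ y : F, y * y = algebraMap ℚ_[p] F d ∧ LinearIndependent ℚ_[p] ![(1 : F), y]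

variable {F : Type*} [CommRing F] [Algebra ℚ_[p] F] {F' : Type*} [CommRing F'] [Algebra ℚ_[p] F']

lemma gen.mul {d u : ℚ_[p]} (h : gen F d) (hu : u ≠ 0) : gen F (d * u ^ 2) := by
  obtain ⟨y, h1, h2⟩ := h
  refine ⟨u • y, ?_, ?_⟩
  · rw [smul_mul_smul_comm, h1, ← pow_two, Algebra.smul_def, ← map_mul, mul_comm]
  · rw [LinearIndependent.pair_iff] at h2 ⊢
    intro s t h
    rw [smul_smul] at h
    obtain ⟨a, b⟩ := h2 _ _ h
    exact ⟨a, (mul_eq_zero.1 b).resolve_right hu⟩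

lemma gen.map {d : ℚ_[p]} (e : F ≃ₐ[ℚ_[p]] F') (h : gen F d) : gen F' d := by
  obtain ⟨y, h1, h2⟩ := h
  refine ⟨e y, by rw [← map_mul, h1, AlgEquiv.commutes], ?_⟩
  have := h2.map' e.toLinearMap (LinearMap.ker_eq_bot.2 e.injective)
  have e2 : (⇑e.toLinearMap ∘ ![1, y]) = ![(1 : F'), e y] := by
    funext i; fin_cases i <;> simp
  rwa [e2] at this

lemma gen.equiv {d : ℚ_[p]} (h : gen F d) (hF : Module.finrank ℚ_[p] F = 2) :
    Nonempty (QuadraticAlgebra ℚ_[p] d 0 ≃ₐ[ℚ_[p]] F) := by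
  obtain ⟨y, h1, h2⟩ := h
  let φ := QuadraticAlgebra.lift (a := d) (b := (0 : ℚ_[p])) ⟨y, by rw [h1, zero_smul, add_zero, Algebra.algebraMap_eq_smul_one]⟩
  have hφ : ∀ z, φ z = z.re • (1 : F) + z.im • y := fun z => rfl
  haveI : FiniteDimensional ℚ_[p] F := FiniteDimensional.of_finrank_pos (by omega)
  have hinj : Function.Injective φ := by
    rw [injective_iff_map_eq_zero]
    intro z hz
    rw [hφ] at hz
    rw [LinearIndependent.pair_iff] at h2
    obtain ⟨a, b⟩ := h2 _ _ hz
    exact QuadraticAlgebra.ext a b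
  have hsur : Function.Surjective φ :=
    (LinearMap.injective_iff_surjective_of_finrank_eq_finrank (f := φ.toLinearMap)
      (by rw [QuadraticAlgebra.finrank_eq_two, hF])).1 hinj
  exact ⟨AlgEquiv.ofBijective φ ⟨hinj, hsur⟩⟩

/-- scaling to a fundamental integer -/
lemma gen.exists_good {d : ℚ_[p]} (hd : d ≠ 0) (h : gen F d) : ∃ z : ℤ, (∀ q : ℕ, q.Prime → good q z) ∧ gen F (z : ℚ_[p]) := by
  have h4 : (4 : ℚ_[p]) ≠ 0 := by norm_num
  obtain ⟨r, hr⟩ := Padic.rat_dense p d (ε := ‖4 * d‖) (norm_pos_iff.2 (mul_ne_zero h4 hd))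
  rw [norm_sub_rev] at hr
  obtain ⟨u, hu, hru⟩ := sq_close hd hr
  have hr0 : r ≠ 0 := by
    rintro rfl
    have : d * u ^ 2 ≠ 0 := mul_ne_zero hd (pow_ne_zero 2 hu)
    rw [← hru] at this; simp at this
  have hz0 : r.num * r.den ≠ 0 := mul_ne_zero (Rat.num_ne_zero.2 hr0) (by exact_mod_cast r.den_ne_zero)
  obtain ⟨D, k, hk, hg, hDk⟩ := fund hz0
  refine ⟨D, hg, ?_⟩
  have hkQ : (k : ℚ_[p]) ≠ 0 := by exact_mod_cast hk
  have hdQ : (r.den : ℚ_[p]) ≠ 0 := by exact_mod_cast r.den_ne_zero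
  have e : (D : ℚ_[p]) = d * (u * (2 * r.den / k)) ^ 2 := by
    have e1 : (r : ℚ_[p]) * r.den = r.num := by exact_mod_cast Rat.mul_den_eq_num r
    have e2 : (4 * (r.num * r.den) : ℚ_[p]) = D * k ^ 2 := by exact_mod_cast hDk
    rw [mul_pow, ← mul_assoc, ← hru, div_pow, ← mul_div_assoc, eq_div_iff (pow_ne_zero 2 hkQ), ← e2, ← e1]; ring
  rw [e]
  exact h.mul (mul_ne_zero hu (div_ne_zero (mul_ne_zero two_ne_zero hdQ) hkQ))

lemma gen_prod {d : ℚ_[p]} (hd : d ≠ 0) : gen (ℚ_[p] × ℚ_[p]) d ↔ ∃ r, d = r ^ 2 := by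
  constructor
  · rintro ⟨y, h, -⟩
    exact ⟨y.1, by have := congrArg Prod.fst h; rw [pow_two]; exact this.symm⟩
  · rintro ⟨r, rfl⟩
    have hr : r ≠ 0 := by rintro rfl; simp at hd
    refine ⟨(r, -r), by ext <;> simp [pow_two], ?_⟩
    rw [LinearIndependent.pair_iff]
    intro s t h
    have h1 := congrArg Prod.fst h
    have h2 := congrArg Prod.snd h
    simp at h1 h2
    have h3 : s = 0 := by
      have : 2 * s = 0 := by linear_combination h1 + h2
      simpa using this
    refine ⟨h3, ?_⟩
    rw [h3] at h1
    simp [hr] at h1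
    exact h1

lemma gen_field (hF : IsField F) (h2 : Module.finrank ℚ_[p] F = 2) : ∃ d : ℚ_[p], d ≠ 0 ∧ gen F d := by
  haveI := hF.isDomain
  haveI : FiniteDimensional ℚ_[p] F := FiniteDimensional.of_finrank_pos (by omega)
  obtain ⟨x, hx⟩ : ∃ x : F, ∀ r : ℚ_[p], algebraMap _ F r ≠ x := by
    by_contra hc
    push Not at hc
    have := finrank_le_one (R := ℚ_[p]) (1 : F) (fun x => by
      obtain ⟨r, hr⟩ := hc x
      exact ⟨r, by rw [← hr, Algebra.algebraMap_eq_smul_one]⟩)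
    omega
  have hli : LinearIndependent ℚ_[p] ![(1 : F), x] := by
    rw [LinearIndependent.pair_iff]
    intro s t h
    have ht : t = 0 := by
      by_contra ht
      apply hx (-s / t)
      have h3 : t • x = algebraMap _ F (-s) := by
        rw [Algebra.algebraMap_eq_smul_one, neg_smul]; exact eq_neg_of_add_eq_zero_right h
      rw [Algebra.smul_def] at h3
      have h4 : algebraMap ℚ_[p] F t ≠ 0 := by simpa using ht
      apply mul_left_cancel₀ h4
      rw [h3, ← map_mul]; congr 1; field_simp
    subst ht
    rw [zero_smul, add_zero, ← Algebra.algebraMap_eq_smul_one] at h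
    exact ⟨by simpa using h, rfl⟩
  have hsp := hli.span_eq_top_of_card_eq_finrank (by simp [h2])
  have hxx : x * x ∈ Submodule.span ℚ_[p] (Set.range ![(1 : F), x]) := by rw [hsp]; trivial
  simp only [Matrix.range_cons, Matrix.range_empty, Set.union_empty, Set.singleton_union, Submodule.mem_span_pair] at hxx
  obtain ⟨s, t, hst⟩ := hxx
  rw [Algebra.smul_def, Algebra.smul_def, mul_one] at hst
  have hy : (2 * x - algebraMap _ F t) * (2 * x - algebraMap _ F t) = algebraMap _ F (4 * s + t ^ 2) := by
    simp only [map_add, map_mul, map_pow, map_ofNat]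
    linear_combination -4 * hst
  refine ⟨4 * s + t ^ 2, ?_, 2 * x - algebraMap _ F t, hy, ?_⟩
  · intro h0
    rw [h0, map_zero, mul_self_eq_zero] at hy
    apply hx (t / 2)
    have h2 : algebraMap ℚ_[p] F 2 ≠ 0 := by simp
    apply mul_left_cancel₀ h2
    rw [← map_mul, mul_div_cancel₀ t two_ne_zero, map_ofNat]
    exact (sub_eq_zero.1 hy).symm
  · rw [LinearIndependent.pair_iff] at hli ⊢
    intro a b h
    have h' := hli (a - b * t) (2 * b) (by
      rw [← h]
      simp only [Algebra.smul_def, map_sub, map_mul, map_ofNat]; ring)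
    have hb : b = 0 := by simpa using h'.2
    refine ⟨?_, hb⟩
    have := h'.1
    rw [hb] at this; simpa using this

end
end PTM


/-! ### Local conditions in terms of the discriminant -/
namespace PTM
open Set Filter

section
variable {p : ℕ} [hp : Fact p.Prime] {F : Type*} [CommRing F] [Algebra ℚ_[p] F]

lemma tensor_gen {D : ℤ} (hD : D < 0) : gen (ℚ_[p] ⊗[ℚ] KD D) (D : ℚ_[p]) := by
  have hli : LinearIndependent ℚ ![(1 : KD D), ⟨dl D, dl_mem D⟩] := by
    rw [LinearIndependent.pair_iff]
    intro s t h
    have h := congrArg (fun x : KD D => (x : ℂ)) h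
    simp only [IntermediateField.coe_add, IntermediateField.coe_smul, IntermediateField.coe_one, IntermediateField.coe_zero, Algebra.smul_def, mul_one] at h
    have h1 := congrArg Complex.im h
    have h2 := congrArg Complex.re h
    simp [dl_re] at h1 h2
    have := dl_im hD
    exact ⟨h2, by tauto⟩
  let b := basisOfLinearIndependentOfCardEqFinrank hli (by rw [finrank_KD hD]; rfl)
  have b0 : b 0 = 1 := by simp [b]
  have b1 : b 1 = ⟨dl D, dl_mem D⟩ := by simp [b]
  refine ⟨1 ⊗ₜ ⟨dl D, dl_mem D⟩, ?_, ?_⟩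
  · rw [Algebra.TensorProduct.tmul_mul_tmul, one_mul]
    have : (⟨dl D, dl_mem D⟩ * ⟨dl D, dl_mem D⟩ : KD D) = (D : KD D) := by
      apply Subtype.ext
      have := dl_sq hD
      rw [pow_two] at this
      simpa using this
    rw [this, map_intCast]
    exact map_intCast (Algebra.TensorProduct.includeRight : KD D →ₐ[ℚ] ℚ_[p] ⊗[ℚ] KD D) D
  · have := (Algebra.TensorProduct.basis ℚ_[p] b).linearIndependent
    have e2 : ⇑(Algebra.TensorProduct.basis ℚ_[p] b) = ![(1 : ℚ_[p] ⊗[ℚ] KD D), 1 ⊗ₜ ⟨dl D, dl_mem D⟩] := by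
      funext i; fin_cases i <;> simp [b0, b1, Algebra.TensorProduct.one_def]
    rwa [e2] at this

lemma tensor_iff {D : ℤ} (hD : D < 0) (hF : Module.finrank ℚ_[p] F = 2) :
    Nonempty ((ℚ_[p] ⊗[ℚ] KD D) ≃ₐ[ℚ_[p]] F) ↔ gen F (D : ℚ_[p]) := by
  constructor
  · rintro ⟨e⟩; exact (tensor_gen hD).map e
  · intro h
    obtain ⟨e⟩ := h.equiv hF
    obtain ⟨e'⟩ := (tensor_gen (p := p) hD).equiv (by rw [Module.finrank_baseChange, finrank_KD hD])
    exact ⟨e'.symm.trans e⟩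

lemma finrank_of_et (h : Nonempty (F ≃ₐ[ℚ_[p]] (ℚ_[p] × ℚ_[p])) ∨ (IsField F ∧ Module.finrank ℚ_[p] F = 2)) :
    Module.finrank ℚ_[p] F = 2 := by
  rcases h with ⟨⟨e⟩⟩ | h
  · rw [e.toLinearEquiv.finrank_eq]; simp
  · exact h.2

lemma exists_good_of_et (h : Nonempty (F ≃ₐ[ℚ_[p]] (ℚ_[p] × ℚ_[p])) ∨ (IsField F ∧ Module.finrank ℚ_[p] F = 2)) :
    ∃ z : ℤ, (∀ q : ℕ, q.Prime → good q z) ∧ gen F (z : ℚ_[p]) := by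
  rcases h with ⟨⟨e⟩⟩ | h
  · exact gen.exists_good one_ne_zero (((gen_prod one_ne_zero).2 ⟨1, by simp⟩).map e.symm)
  · obtain ⟨d, hd, hg⟩ := gen_field h.1 h.2
    exact hg.exists_good hd

end

noncomputable def kk (q : ℕ) : ℕ := if q = 0 then 0 else if q = 2 then 6 else 2

lemma good_congr {q : ℕ} {z z' : ℤ} (hq : q.Prime) (h : good q z) (hc : ((q ^ kk q : ℕ) : ℤ) ∣ z' - z) : good q z' := by
  unfold good at h ⊢
  unfold kk at hc
  rw [if_neg hq.ne_zero] at hc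
  split_ifs at h hc ⊢ with h2
  · subst h2; norm_num at hc; omega
  · intro hd
    push_cast at hc
    exact h ((dvd_sub_right hd).1 hc |> fun h => h)

lemma not_dvd_four {q : ℕ} {z : ℤ} (hq : q.Prime) (h : good q z) : ¬ ((q ^ kk q : ℕ) : ℤ) ∣ 4 * z := by
  unfold good at h
  unfold kk
  rw [if_neg hq.ne_zero]
  split_ifs at h ⊢ with h2
  · subst h2; norm_num; omega
  · intro hd
    push_cast at hd
    refine h (IsCoprime.dvd_of_dvd_mul_left ?_ hd)
    have : Nat.Coprime (q ^ 2) 4 := Nat.Coprime.pow_left 2 ((Nat.coprime_primes hq Nat.prime_two).2 h2 |>.pow_right 2 : Nat.Coprime q (2 ^ 2))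
    have := Nat.isCoprime_iff_coprime.2 this
    exact_mod_cast this

lemma gen_congr {p : ℕ} [hp : Fact p.Prime] {F : Type*} [CommRing F] [Algebra ℚ_[p] F] {z z' : ℤ} (h : good p z)
    (hc : ((p ^ kk p : ℕ) : ℤ) ∣ z' - z) (hF : gen F (z : ℚ_[p])) : gen F (z' : ℚ_[p]) := by
  have hn := not_dvd_four hp.1 h
  have hz : (z : ℚ_[p]) ≠ 0 := by
    intro h0
    have : z = 0 := by exact_mod_cast h0
    rw [this] at hn; simp at hn
  obtain ⟨u, hu, e⟩ := sq_close (x := (z' : ℚ_[p])) (y := z) hz (by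
    by_contra hc'
    push Not at hc'
    apply hn
    push_cast at hc ⊢
    rw [← Padic.norm_int_le_pow_iff_dvd] at hc ⊢
    push_cast at hc ⊢
    exact hc'.trans hc)
  rw [e]; exact hF.mul hu

lemma sqp.good {p : ℕ} {z : ℤ} (h : sqp p z) : PTM.good p z := by
  have h' := h.not_dvd
  unfold sqp at h
  unfold PTM.good
  split_ifs at h ⊢ with h2
  · left; omega
  · intro hd; exact h' ((dvd_pow_self _ two_ne_zero).trans hd)

lemma sq_iff_sqp {p : ℕ} [hp : Fact p.Prime] {z : ℤ} (h : good p z) : (∃ r : ℚ_[p], (z : ℚ_[p]) = r ^ 2) ↔ sqp p z := by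
  constructor
  · rintro ⟨r, hr⟩
    have hr1 : ‖r‖ ≤ 1 := by
      have h1 := Padic.norm_int_le_one (p := p) z
      rw [hr, norm_pow] at h1
      exact (pow_le_one_iff_of_nonneg (norm_nonneg _) two_ne_zero).1 h1
    obtain ⟨R, hR⟩ : ∃ R : ℤ_[p], (R : ℚ_[p]) = r := ⟨⟨r, hr1⟩, rfl⟩
    obtain ⟨r0, hr0⟩ := Metric.denseRange_iff.1 (PadicInt.denseRange_intCast (p := p)) R ((p : ℝ) ^ (-(4 : ℕ) : ℤ)) (by have := hp.1.pos; positivity)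
    have h2 : ‖r - r0‖ < (p : ℝ) ^ (-(4 : ℕ) : ℤ) := by
      rw [dist_eq_norm, PadicInt.norm_def] at hr0
      rw [PadicInt.coe_sub, PadicInt.coe_intCast, hR] at hr0
      exact hr0
    have hdvd : ((p ^ 4 : ℕ) : ℤ) ∣ z - r0 ^ 2 := by
      push_cast
      rw [← Padic.norm_int_le_pow_iff_dvd]
      push_cast
      rw [hr, show r ^ 2 - (r0 : ℚ_[p]) ^ 2 = (r - r0) * (r + r0) by ring, norm_mul]
      have h3 : ‖r + r0‖ ≤ 1 := (Padic.nonarchimedean _ _).trans (max_le hr1 (Padic.norm_int_le_one _))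
      refine (mul_le_of_le_one_right (norm_nonneg _) h3).trans h2.le
    unfold sqp
    unfold good at h
    split_ifs at h ⊢ with h2
    · subst h2
      norm_num at hdvd
      have h16 : z % 16 = r0 ^ 2 % 16 := by omega
      have h17 : r0 ^ 2 % 16 = 0 ∨ r0 ^ 2 % 16 = 1 ∨ r0 ^ 2 % 16 = 4 ∨ r0 ^ 2 % 16 = 9 := by
        have : r0 ^ 2 % 16 = (r0 % 16) ^ 2 % 16 := by rw [pow_two, Int.mul_emod, pow_two]
        have h18 : 0 ≤ r0 % 16 := by omega
        have h19 : r0 % 16 < 16 := by omega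
        rw [this]
        generalize r0 % 16 = x at h18 h19
        interval_cases x <;> decide
      omega
    · have hd2 : (p : ℤ) ^ 2 ∣ z - r0 ^ 2 := (pow_dvd_pow (p : ℤ) (show 2 ≤ 4 by norm_num)).trans (by push_cast at hdvd; exact hdvd)
      have hd1 : (p : ℤ) ∣ z - r0 ^ 2 := (dvd_pow_self _ two_ne_zero).trans hd2
      refine ⟨fun hz => h ?_, r0, hd1⟩
      have h5 : (p : ℤ) ∣ r0 ^ 2 := (dvd_sub_right hz).1 hd1
      have h6 : (p : ℤ) ^ 2 ∣ r0 ^ 2 := pow_dvd_pow_of_dvd ((Nat.prime_iff_prime_int.1 hp.1).dvd_of_dvd_pow h5) 2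
      have := dvd_add hd2 h6
      rwa [sub_add_cancel] at this
  · intro hs
    have hnd := hs.not_dvd
    unfold sqp at hs
    split_ifs at hs with h2
    · subst h2
      obtain ⟨u, -, e⟩ := sq_close (p := 2) (x := (z : ℚ_[2])) (y := 1) one_ne_zero (by
        by_contra hc'
        push Not at hc'
        have h8 : ((2 : ℕ) : ℤ) ^ 3 ∣ z - 1 := by norm_num; omega
        rw [← Padic.norm_int_le_pow_iff_dvd] at h8
        push_cast at h8
        have h9 := hc'.trans h8
        have : ‖((4 : ℤ) : ℚ_[2])‖ ≤ ((2 : ℕ) : ℝ) ^ (-(3 : ℕ) : ℤ) := by push_cast; simpa using h9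
        rw [Padic.norm_int_le_pow_iff_dvd] at this
        norm_num at this)
      exact ⟨u, by rw [e]; ring⟩
    · obtain ⟨-, r, hr⟩ := hs
      have hpr : ¬ (p : ℤ) ∣ r := fun hd => hnd (by
        have := dvd_add hr (dvd_pow hd two_ne_zero)
        rwa [sub_add_cancel] at this)
      have hr0 : (r : ℚ_[p]) ≠ 0 := by
        intro h0
        have : r = 0 := by exact_mod_cast h0
        rw [this] at hpr; simp at hpr
      have hpI := Nat.prime_iff_prime_int.1 hp.1
      obtain ⟨u, -, e⟩ := sq_close (p := p) (x := (z : ℚ_[p])) (y := r ^ 2) (pow_ne_zero 2 hr0) (by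
        by_contra hc'
        push Not at hc'
        have hr' : (p : ℤ) ^ 1 ∣ z - r ^ 2 := by rwa [pow_one]
        rw [← Padic.norm_int_le_pow_iff_dvd] at hr'
        push_cast at hr'
        have h9 := hc'.trans hr'
        have : ‖((4 * r ^ 2 : ℤ) : ℚ_[p])‖ ≤ (p : ℝ) ^ (-(1 : ℕ) : ℤ) := by
          have e : ((4 * r ^ 2 : ℤ) : ℚ_[p]) = 4 * (r : ℚ_[p]) ^ 2 := by push_cast; ring
          rw [e]; exact h9
        rw [Padic.norm_int_le_pow_iff_dvd, pow_one] at this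
        rcases hpI.dvd_or_dvd this with h | h
        · have h' : (p : ℤ) ∣ 2 ^ 2 := by norm_num; exact h
          have h' := hpI.dvd_of_dvd_pow h'
          have h' : p ∣ 2 := by exact_mod_cast h'
          exact h2 ((Nat.prime_dvd_prime_iff_eq hp.1 Nat.prime_two).1 h')
        · exact hpr (hpI.dvd_of_dvd_pow h))
      exact ⟨r * u, by rw [e]; ring⟩

end PTM


/-! ### The local data attached to the algebras `F i`, and the final bookkeeping -/
namespace PTM
open Set Filter

section
variable {n : ℕ} (p : Fin (n + 1) → ℕ) [∀ i, Fact (p i).Prime]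
    (F : Fin (n + 1) → Type) [∀ i, CommRing (F i)] [∀ i, Algebra ℚ_[p i] (F i)]

/-- the local condition at `q` -/
def lc (q : ℕ) (z : ℤ) : Prop := good q z ∧ ∀ i, p i = q → gen (F i) (z : ℚ_[p i])

lemma kk_ne0 (q : ℕ) : q ^ kk q ≠ 0 := by
  rcases Nat.eq_zero_or_pos q with rfl | h
  · simp [kk]
  · positivity

/-- the residue classes satisfying the local condition at `q` -/
noncomputable def lA (q : ℕ) : Finset (ZMod (q ^ kk q)) :=
  haveI : NeZero (q ^ kk q) := ⟨kk_ne0 q⟩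
  (Set.toFinite {x : ZMod (q ^ kk q) | ∃ z : ℤ, (z : ZMod (q ^ kk q)) = x ∧ lc p F q z}).toFinset

lemma mem_lA {q : ℕ} (hq : q.Prime) (z : ℤ) : (z : ZMod (q ^ kk q)) ∈ lA p F q ↔ lc p F q z := by
  unfold lA
  rw [Set.Finite.mem_toFinset]
  constructor
  · rintro ⟨z', h, hg, hF⟩
    have hc : ((q ^ kk q : ℕ) : ℤ) ∣ z - z' := (ZMod.intCast_eq_intCast_iff_dvd_sub _ _ _).1 h
    refine ⟨good_congr hq hg hc, fun i hi => ?_⟩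
    subst hi
    exact gen_congr hg hc (hF i rfl)
  · exact fun h => ⟨z, rfl, h⟩

lemma good_one (q : ℕ) (hq : q.Prime) : good q 1 := by
  unfold good
  split_ifs with h
  · left; norm_num
  · intro hd
    have h1 : (q : ℤ) ∣ 1 := (dvd_pow_self _ two_ne_zero).trans hd
    have h2 : q ∣ 1 := by exact_mod_cast h1
    exact hq.one_lt.ne' (Nat.dvd_one.1 h2)

lemma good.ne_zero {q : ℕ} {z : ℤ} (h : good q z) : z ≠ 0 := by
  rintro rfl
  unfold good at h
  split_ifs at h with h2
  · omega
  · exact h (dvd_zero _)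

variable (hinj : Function.Injective p)
    (hFet : ∀ i, Nonempty (F i ≃ₐ[ℚ_[p i]] (ℚ_[p i] × ℚ_[p i])) ∨
      (IsField (F i) ∧ Module.finrank ℚ_[p i] (F i) = 2))
    (hF1 : Nonempty (F 0 ≃ₐ[ℚ_[p 0]] (ℚ_[p 0] × ℚ_[p 0])))

lemma lc_p0 (hinj : Function.Injective p) (hF1 : Nonempty (F 0 ≃ₐ[ℚ_[p 0]] (ℚ_[p 0] × ℚ_[p 0]))) (z : ℤ) : lc p F (p 0) z ↔ sqp (p 0) z := by
  obtain ⟨e⟩ := hF1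
  have key : good (p 0) z → (gen (F 0) (z : ℚ_[p 0]) ↔ sqp (p 0) z) := by
    intro hg
    rw [← sq_iff_sqp hg, ← gen_prod (by exact_mod_cast hg.ne_zero)]
    exact ⟨fun h => h.map e, fun h => h.map e.symm⟩
  constructor
  · rintro ⟨hg, h⟩
    exact (key hg).1 (h 0 rfl)
  · intro h
    refine ⟨h.good, fun i hi => ?_⟩
    have := hinj hi
    subst this
    exact (key h.good).2 h

/-- the local data attached to the problem -/
noncomputable def locData : LocData (p 0) where
  k := kk
  k0 := by simp [kk]
  hk2 q hq := by
    unfold kk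
    rw [if_neg hq.ne_zero]
    split_ifs <;> norm_num
  hk4 := by simp [kk]
  A := lA p F
  S := insert 2 (Finset.univ.image p)
  hS q hq := by
    rw [Finset.mem_insert, Finset.mem_image] at hq
    rcases hq with rfl | ⟨i, -, rfl⟩
    · exact Nat.prime_two
    · exact Fact.out
  h2S := Finset.mem_insert_self _ _
  hpS := Finset.mem_insert_of_mem (Finset.mem_image_of_mem _ (Finset.mem_univ _))
  hout q hq hS := by
    rw [Finset.mem_insert, Finset.mem_image, not_or] at hS
    refine ⟨by unfold kk; rw [if_neg hq.ne_zero, if_neg hS.1], fun z => ?_⟩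
    rw [mem_lA p F hq]
    unfold lc good
    rw [if_neg hS.1]
    exact ⟨fun h => h.1, fun h => ⟨h, fun i hi => (hS.2 ⟨i, Finset.mem_univ _, hi⟩).elim⟩⟩
  hgood q hq z h := ((mem_lA p F hq z).1 h).1
  hne q hq := by
    by_cases h : ∃ i, p i = q
    · obtain ⟨i, rfl⟩ := h
      obtain ⟨z, hz, hg⟩ := exists_good_of_et (hFet i)
      refine ⟨_, (mem_lA p F hq z).2 ⟨hz _ hq, fun j hj => ?_⟩⟩
      have := hinj hj
      subst this
      exact hg
    · exact ⟨_, (mem_lA p F hq 1).2 ⟨good_one q hq, fun i hi => (h ⟨i, hi⟩).elim⟩⟩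
  hp z := (mem_lA p F Fact.out z).trans (lc_p0 p F hinj hF1 z)

lemma locData_ok (D : ℤ) : (locData p F hinj hFet hF1).ok D ↔
    (∀ q : ℕ, q.Prime → good q D) ∧ ∀ i, gen (F i) (D : ℚ_[p i]) := by
  constructor
  · intro h
    exact ⟨fun q hq => ((mem_lA p F hq D).1 (h q hq)).1,
      fun i => ((mem_lA p F Fact.out D).1 (h (p i) Fact.out)).2 i rfl⟩
  · rintro ⟨h1, h2⟩ q hq
    exact (mem_lA p F hq D).2 ⟨h1 q hq, fun i _ => h2 i⟩

lemma inSPlus_KD (hFet : ∀ i, Nonempty (F i ≃ₐ[ℚ_[p i]] (ℚ_[p i] × ℚ_[p i])) ∨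
      (IsField (F i) ∧ Module.finrank ℚ_[p i] (F i) = 2)) {D : ℤ} (hD : D < 0) : InSPlus n p F (KD D) ↔ ∀ i, gen (F i) (D : ℚ_[p i]) := by
  constructor
  · rintro ⟨-, -, h⟩ i
    exact (tensor_iff hD (finrank_of_et (hFet i))).1 (h i)
  · intro h
    exact ⟨finrank_KD hD, ⟨_, dl_mem D, dl_im hD⟩, fun i => (tensor_iff hD (finrank_of_et (hFet i))).2 (h i)⟩

lemma abs_lt_of_neg {D : ℤ} (hD : D < 0) (X : ℝ) : ((|D| : ℤ) : ℝ) < X ↔ -X < (D : ℝ) := by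
  rw [abs_of_neg hD]; push_cast; constructor <;> intro h <;> linarith

/-- the fields counted correspond to their discriminants -/
lemma exists_equiv (X : ℝ) : ∃ e : ↥((locData p F hinj hFet hF1).DS X) ≃
    {K : IntermediateField ℚ ℂ // InSPlus n p F K ∧ (|absDisc K| : ℝ) < X},
    ∀ D, ((e D : IntermediateField ℚ ℂ)) = KD D := by
  have hm : ∀ D : ↥((locData p F hinj hFet hF1).DS X),
      (D : ℤ) < 0 ∧ -X < ((D : ℤ) : ℝ) ∧ (∀ q : ℕ, q.Prime → good q D) ∧ ∀ i, gen (F i) ((D : ℤ) : ℚ_[p i]) := by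
    intro D
    obtain ⟨h1, h2, h3⟩ := (LocData.mem_DS _).1 D.2
    exact ⟨h1, h2, (locData_ok p F hinj hFet hF1 _).1 h3⟩
  let f : ↥((locData p F hinj hFet hF1).DS X) →
      {K : IntermediateField ℚ ℂ // InSPlus n p F K ∧ (|absDisc K| : ℝ) < X} := fun D =>
    ⟨KD D, (inSPlus_KD p F hFet (hm D).1).2 (hm D).2.2.2, by
      rw [absDisc_KD (hm D).1 (hm D).2.2.1]
      have := (abs_lt_of_neg (hm D).1 X).2 (hm D).2.1
      push_cast at this
      exact this⟩
  have hf : Function.Bijective f := by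
    constructor
    · intro D D' h
      have h1 : KD (D : ℤ) = KD D' := congrArg Subtype.val h
      have h2 := congrArg absDisc h1
      rw [absDisc_KD (hm D).1 (hm D).2.2.1, absDisc_KD (hm D').1 (hm D').2.2.1] at h2
      exact Subtype.ext h2
    · rintro ⟨K, hK, hX⟩
      obtain ⟨D, hD, hg, rfl⟩ := exists_KD K hK.1 hK.2.1
      rw [absDisc_KD hD hg] at hX
      refine ⟨⟨D, (LocData.mem_DS _).2 ⟨hD, (abs_lt_of_neg hD X).1 (by push_cast; exact hX),
        (locData_ok p F hinj hFet hF1 _).2 ⟨hg, (inSPlus_KD p F hFet hD).1 hK⟩⟩⟩, rfl⟩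
  exact ⟨Equiv.ofBijective f hf, fun D => rfl⟩

end
end PTM

theorem pointed_three_moment_imaginary
    (n : ℕ) (p : Fin (n + 1) → ℕ) [∀ i, Fact (p i).Prime] (hinj : Function.Injective p)
    (F : Fin (n + 1) → Type) [∀ i, CommRing (F i)] [∀ i, Algebra ℚ_[p i] (F i)]
    (hFet : ∀ i, Nonempty (F i ≃ₐ[ℚ_[p i]] (ℚ_[p i] × ℚ_[p i])) ∨
      (IsField (F i) ∧ Module.finrank ℚ_[p i] (F i) = 2))
    (hF1 : Nonempty (F 0 ≃ₐ[ℚ_[p 0]] (ℚ_[p 0] × ℚ_[p 0])))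
    (a : ZMod 3) :
    Filter.Tendsto (fun X : ℝ =>
        (∑' K : {K : IntermediateField ℚ ℂ // InSPlus n p F K ∧ (|absDisc K| : ℝ) < X},
          pointedSurCount K (p 0) a) /
        (Nat.card {K : IntermediateField ℚ ℂ // InSPlus n p F K ∧ (|absDisc K| : ℝ) < X} : ℝ))
      Filter.atTop (nhds (1 / 3)) := by
  have hfun : (fun X : ℝ =>
        (∑' K : {K : IntermediateField ℚ ℂ // InSPlus n p F K ∧ (|absDisc K| : ℝ) < X},
          pointedSurCount K (p 0) a) /
        (Nat.card {K : IntermediateField ℚ ℂ // InSPlus n p F K ∧ (|absDisc K| : ℝ) < X} : ℝ)) =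
      fun X : ℝ => (∑ D ∈ (PTM.locData p F hinj hFet hF1).DS X, pointedSurCount (PTM.KD D) (p 0) a) /
        (((PTM.locData p F hinj hFet hF1).DS X).card : ℝ) := by
    funext X
    obtain ⟨e, he⟩ := PTM.exists_equiv p F hinj hFet hF1 X
    congr 1
    · rw [← e.tsum_eq, tsum_fintype,
        ← Finset.sum_coe_sort ((PTM.locData p F hinj hFet hF1).DS X) fun D => pointedSurCount (PTM.KD D) (p 0) a]
      refine Finset.sum_congr rfl fun D _ => ?_
      rw [he]
    · rw [← Nat.card_congr e, Nat.card_eq_fintype_card, Fintype.card_coe]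
  rw [hfun]
  exact (PTM.locData p F hinj hFet hF1).ratio a (fun D => pointedSurCount (PTM.KD D) (p 0) a)
    (fun D => NumberField.RingOfIntegers (PTM.KD D))
    (fun D hD h => PTM.exists_QR hD ((PTM.locData_ok p F hinj hFet hF1 D).1 h).1)
    (fun D _ _ => rfl)
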